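/- Let 𝒜 be a homogeneous constant-coefficient differential operator of order k on ℝ^n and let 1 ≤ j ≤ min{k, n−1}. Then the following are equivalent: (i) for every u ∈ BV^𝒜_loc(ℝ^n), D^{k−j}u ∈ t^{j, n/(n−j)}(x) for ℒ^n-almost every x ∈ ℝ^n; (ii) 𝒜 is elliptic and canceling. -/

import Mathlib

open MeasureTheory Metric Filter
open scoped ENNReal RealInnerProductSpace Topology

noncomputable section

/-- Euclidean space `ℝ^n`. -/
abbrev Euc (n : ℕ) : Type := EuclideanSpace ℝ (Fin n)

/-- The `i`-th standard basis vector of `ℝ^n`. -/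
def stdVec (n : ℕ) (i : Fin n) : Euc n := EuclideanSpace.single i (1 : ℝ)

/-- Coefficients `A_I : V →ₗ W` (indexed by `I : Fin k → Fin n`) of a homogeneous linear
constant-coefficient differential operator `𝒜 u = ∑_I A_I ∂_I u` of order `k` on `ℝ^n`. -/
abbrev CoeffOp (n k : ℕ) (V W : Type*) [NormedAddCommGroup V] [InnerProductSpace ℝ V]
    [NormedAddCommGroup W] [InnerProductSpace ℝ W] : Type _ :=
  (Fin k → Fin n) → (V →ₗ[ℝ] W)

variable {V W F : Type*}
  [NormedAddCommGroup V] [InnerProductSpace ℝ V] [FiniteDimensional ℝ V]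
  [NormedAddCommGroup W] [InnerProductSpace ℝ W] [FiniteDimensional ℝ W]

/-- The coefficients represent a linear map on symmetric tensors `V ⊙^k ℝ^n`. -/
def IsSymmetricOp (n k : ℕ) (A : CoeffOp n k V W) : Prop :=
  ∀ (I : Fin k → Fin n) (σ : Equiv.Perm (Fin k)), A (I ∘ σ) = A I

/-- The symbol `𝒜[ξ] v = A (v ⊗^k ξ) = ∑_I (∏ i, ξ_{I i}) A_I v`. -/
def symbolMap (n k : ℕ) (A : CoeffOp n k V W) (ξ : Euc n) : V →ₗ[ℝ] W :=
  ∑ I : Fin k → Fin n, (∏ i, ξ (I i)) • A I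

/-- Ellipticity: the symbol is injective for all `ξ ≠ 0`. -/
def IsElliptic (n k : ℕ) (A : CoeffOp n k V W) : Prop :=
  ∀ ξ : Euc n, ξ ≠ 0 → Function.Injective (symbolMap n k A ξ)

/-- Van Schaftingen's cancellation condition: `⋂_{ξ ∈ 𝕊^{n-1}} im 𝒜[ξ] = {0}`. -/
def IsCanceling (n k : ℕ) (A : CoeffOp n k V W) : Prop :=
  (⋂ ξ ∈ sphere (0 : Euc n) 1, (LinearMap.range (symbolMap n k A ξ) : Set W)) = {0}

/-- Inverse of an endomorphism (junk value when not invertible), via matrix inversion. -/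
def linInv (f : V →ₗ[ℝ] V) : V →ₗ[ℝ] V :=
  letI b := Module.finBasis ℝ V
  Matrix.toLin b b ((LinearMap.toMatrix b b f)⁻¹)

/-- `𝒜†[ξ] = (𝒜*[ξ] 𝒜[ξ])⁻¹ 𝒜*[ξ]`. -/
def Adagger (n k : ℕ) (A : CoeffOp n k V W) (ξ : Euc n) : W →ₗ[ℝ] V :=
  linInv (LinearMap.adjoint (symbolMap n k A ξ) ∘ₗ symbolMap n k A ξ) ∘ₗ
    LinearMap.adjoint (symbolMap n k A ξ)

/-- Condition (WC): for every `w ∈ ⋂_{ξ ∈ 𝕊^{n-1}} im 𝒜[ξ]`,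
`∫_{𝕊^{n-1}} 𝒜†[ξ] w ⊗^{k-n} ξ dℋ^{n-1}(ξ) = 0`, written componentwise in the
tensor coordinates indexed by `J : Fin (k-n) → Fin n`. -/
def IsWeaklyCanceling (n k : ℕ) (A : CoeffOp n k V W) : Prop :=
  ∀ w : W, (∀ ξ ∈ sphere (0 : Euc n) 1, w ∈ LinearMap.range (symbolMap n k A ξ)) →
    ∀ J : Fin (k - n) → Fin n,
      (∫ ξ in sphere (0 : Euc n) 1,
        (∏ i, ξ (J i)) • (Adagger n k A ξ w) ∂(μH[(n : ℝ) - 1])) = 0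

section TestFun

variable [NormedAddCommGroup F] [NormedSpace ℝ F]

/-- Compactly supported smooth test function. -/
def IsTestFun (n : ℕ) (φ : Euc n → F) : Prop :=
  ContDiff ℝ (⊤ : ℕ∞) φ ∧ HasCompactSupport φ

/-- Iterated directional derivative `∂_{I 0} ⋯ ∂_{I (m-1)} φ (x)`. -/
def dirDeriv (n m : ℕ) (I : Fin m → Fin n) (φ : Euc n → F) (x : Euc n) : F :=
  iteratedFDeriv ℝ m φ x (fun i => stdVec n (I i))

/-- Smooth functions of degree-`≤ j` polynomial type. -/
def IsPolyDeg (n : ℕ) (j : ℕ) (P : Euc n → F) : Prop :=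
  ContDiff ℝ (⊤ : ℕ∞) P ∧ ∀ x, iteratedFDeriv ℝ (j + 1) P x = 0

end TestFun

/-- Pointwise application of the operator `𝒜` to a smooth map. -/
def Aapply (n k : ℕ) (A : CoeffOp n k V W) (u : Euc n → V) (x : Euc n) : W :=
  ∑ I : Fin k → Fin n, A I (dirDeriv n k I u x)

/-- `𝒜 u = f σ` (a `W`-valued measure with total-variation measure `σ` and polar density `f`)
in the sense of distributions. -/
def HasDistribA (n k : ℕ) (A : CoeffOp n k V W) (u : Euc n → V) (σ : Measure (Euc n))
    (f : Euc n → W) : Prop :=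
  ∀ φ : Euc n → W, IsTestFun n φ →
    ((-1 : ℝ) ^ k) * (∑ I : Fin k → Fin n,
        ∫ x, ⟪u x, LinearMap.adjoint (A I) (dirDeriv n k I φ x)⟫) =
      ∫ x, ⟪f x, φ x⟫ ∂σ

/-- `u ∈ BV^𝒜_loc(ℝ^n)`: `u` is locally integrable and `𝒜 u` is a `W`-valued Radon measure,
given by its polar decomposition `f σ` with `σ` locally finite and `‖f‖ = 1` σ-a.e. -/
def MemBVAloc (n k : ℕ) (A : CoeffOp n k V W) (u : Euc n → V) : Prop :=
  LocallyIntegrable u volume ∧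
    ∃ (σ : Measure (Euc n)) (f : Euc n → W), IsLocallyFiniteMeasure σ ∧
      LocallyIntegrable f σ ∧ (∀ᵐ x ∂σ, ‖f x‖ = 1) ∧ HasDistribA n k A u σ f

/-- `v` is the family of weak derivatives of order `m` of `u` (componentwise, indexed by
`I : Fin m → Fin n`). -/
def IsWeakDerivFamily (n m : ℕ) (u : Euc n → V) (v : (Fin m → Fin n) → Euc n → V) : Prop :=
  (∀ I, LocallyIntegrable (v I) volume) ∧
    ∀ (I : Fin m → Fin n) (φ : Euc n → ℝ), IsTestFun n φ →
      ∫ x, (dirDeriv n m I φ x) • u x = ((-1 : ℝ) ^ m) • ∫ x, φ x • v I x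

/-- `Q r = o(r^a)` as `r ↓ 0`. -/
def SmallO (Q : ℝ → ℝ≥0∞) (a : ℝ) : Prop :=
  Tendsto (fun r => Q r / ENNReal.ofReal (r ^ a)) (𝓝[>] (0 : ℝ)) (𝓝 0)

section Spaces

variable [NormedAddCommGroup F] [NormedSpace ℝ F]

/-- `f ∈ t^{j,p}(x)`: there is a polynomial `P` of degree at most `j` with
`(⨍_{B_r(x)} |f - P|^p)^{1/p} = o(r^j)` as `r ↓ 0`. -/
def MemT (n : ℕ) (j : ℕ) (p : ℝ) (f : Euc n → F) (x : Euc n) : Prop :=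
  ∃ P : Euc n → F, IsPolyDeg n j P ∧
    SmallO (fun r => ((volume (ball x r))⁻¹ *
      ∫⁻ y in ball x r, (‖f y - P y‖₊ : ℝ≥0∞) ^ p) ^ (1 / p)) (j : ℝ)

/-- `f ∈ t^{j,∞}(x)`: there is a polynomial `P` of degree at most `j` with
`‖f - P‖_{L^∞(B_r(x))} = o(r^j)` as `r ↓ 0`. -/
def MemTInf (n : ℕ) (j : ℕ) (f : Euc n → F) (x : Euc n) : Prop :=
  ∃ P : Euc n → F, IsPolyDeg n j P ∧
    SmallO (fun r => essSup (fun y => (‖f y - P y‖₊ : ℝ≥0∞))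
      (volume.restrict (ball x r))) (j : ℝ)

/-- The Lorentz `L^{p,q}` quasi-norm (for `p, q < ∞`). -/
def lorentzNorm {α : Type*} [MeasurableSpace α] (p q : ℝ) (μ : Measure α) (f : α → F) : ℝ≥0∞ :=
  ENNReal.ofReal p ^ (1 / q) *
    (∫⁻ t in Set.Ioi (0 : ℝ),
      (ENNReal.ofReal t * (μ {x | t < ‖f x‖}) ^ (1 / p)) ^ q * (ENNReal.ofReal t)⁻¹) ^ (1 / q)

/-- `f` is `L^{p,q}`-differentiable of order `j` at `x`:
`‖f - P‖_{L^{p,q}(B_r(x))} = o(r^{j + n/p})` for a polynomial `P` of degree at most `j`. -/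
def MemTLorentz (n : ℕ) (j : ℕ) (p q : ℝ) (f : Euc n → F) (x : Euc n) : Prop :=
  ∃ P : Euc n → F, IsPolyDeg n j P ∧
    SmallO (fun r => lorentzNorm p q (volume.restrict (ball x r)) (fun y => f y - P y))
      ((j : ℝ) + n / p)

/-- `f ∈ L^p_loc`. -/
def LocLp (n : ℕ) (p : ℝ) (f : Euc n → F) : Prop :=
  ∀ K : Set (Euc n), IsCompact K → ∫⁻ x in K, (‖f x‖₊ : ℝ≥0∞) ^ p < ⊤

end Spaces

end

noncomputable section

/-- The algebra of smooth real functions on `ℝ^n`. -/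
def Sm (n : ℕ) : Subalgebra ℝ (Euc n → ℝ) where
  carrier := {f | ContDiff ℝ (⊤ : ℕ∞) f}
  mul_mem' := fun {f g} (hf : ContDiff ℝ (⊤ : ℕ∞) f) (hg : ContDiff ℝ (⊤ : ℕ∞) g) => (hf.mul hg : ContDiff ℝ (⊤ : ℕ∞) fun x => f x * g x)
  add_mem' := fun {f g} (hf : ContDiff ℝ (⊤ : ℕ∞) f) (hg : ContDiff ℝ (⊤ : ℕ∞) g) => (hf.add hg : ContDiff ℝ (⊤ : ℕ∞) fun x => f x + g x)
  algebraMap_mem' := fun c => (contDiff_const : ContDiff ℝ (⊤ : ℕ∞) fun _ : Euc n => c)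

variable {n : ℕ}

instance : CoeFun (Sm n) (fun _ => Euc n → ℝ) := ⟨fun f => f.1⟩

theorem Sm.smooth (f : Sm n) : ContDiff ℝ (⊤ : ℕ∞) (f : Euc n → ℝ) := f.2

theorem Sm.differentiable (f : Sm n) : Differentiable ℝ (f : Euc n → ℝ) :=
  (Sm.smooth f).differentiable (by simp)

theorem Sm.continuous (f : Sm n) : Continuous (f : Euc n → ℝ) := (Sm.smooth f).continuous

@[simp] theorem Sm.add_apply (f g : Sm n) (x : Euc n) : (f + g) x = f x + g x := rfl
@[simp] theorem Sm.sub_apply (f g : Sm n) (x : Euc n) : (f - g) x = f x - g x := rfl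
@[simp] theorem Sm.neg_apply (f : Sm n) (x : Euc n) : (-f) x = - f x := rfl
@[simp] theorem Sm.mul_apply (f g : Sm n) (x : Euc n) : (f * g) x = f x * g x := rfl
@[simp] theorem Sm.smul_apply (c : ℝ) (f : Sm n) (x : Euc n) : (c • f) x = c * f x := rfl
@[simp] theorem Sm.zero_apply (x : Euc n) : (0 : Sm n) x = 0 := rfl
@[simp] theorem Sm.one_apply (x : Euc n) : (1 : Sm n) x = 1 := rfl
@[simp] theorem Sm.sum_apply {ι : Type*} (s : Finset ι) (f : ι → Sm n) (x : Euc n) :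
    (∑ i ∈ s, f i) x = ∑ i ∈ s, f i x := by
  have : ((∑ i ∈ s, f i : Sm n) : Euc n → ℝ) = ∑ i ∈ s, (f i : Euc n → ℝ) := by
    simp
  rw [this, Finset.sum_apply]

theorem Sm.ext {f g : Sm n} (h : ∀ x, f x = g x) : f = g := Subtype.ext (funext h)

/-- The partial derivative `∂_i` acting on smooth functions. -/
def pd (i : Fin n) : Module.End ℝ (Sm n) where
  toFun f := ⟨fun x => fderiv ℝ f x (stdVec n i),
    ((Sm.smooth f).fderiv_right (m := (⊤ : ℕ∞)) (by simp)).clm_apply contDiff_const⟩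
  map_add' f g := Sm.ext fun x => by
    change fderiv ℝ (fun y => f y + g y) x _ = _
    rw [fderiv_fun_add ((Sm.differentiable f) x) ((Sm.differentiable g) x)]
    rfl
  map_smul' c f := Sm.ext fun x => by
    change fderiv ℝ (fun y => c * f y) x _ = c * _
    rw [fderiv_const_mul ((Sm.differentiable f) x)]
    rfl

theorem pd_apply (i : Fin n) (f : Sm n) (x : Euc n) :
    pd i f x = fderiv ℝ f x (stdVec n i) := rfl

theorem pd_comm (i j : Fin n) : pd (n := n) i * pd j = pd j * pd i := by
  ext1 f
  refine Sm.ext fun x => ?_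
  have key : ∀ a b : Fin n, pd a (pd b f) x
      = fderiv ℝ (fderiv ℝ f) x (stdVec n a) (stdVec n b) := by
    intro a b
    have h1 : DifferentiableAt ℝ (fderiv ℝ f) x :=
      (((Sm.smooth f).fderiv_right (m := (⊤ : ℕ∞)) (by simp)).differentiable (by simp)) x
    change fderiv ℝ (fun y => fderiv ℝ f y (stdVec n b)) x (stdVec n a) = _
    rw [fderiv_clm_apply h1 (differentiableAt_const _)]
    simp
  change pd i (pd j f) x = pd j (pd i f) x
  rw [key, key]
  have hs : IsSymmSndFDerivAt ℝ f x :=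
    ((Sm.smooth f).contDiffAt).isSymmSndFDerivAt (by simpa using (by exact_mod_cast le_top : ((2 : ℕ∞) : WithTop ℕ∞) ≤ ((⊤ : ℕ∞) : WithTop ℕ∞)))
  exact hs (stdVec n i) (stdVec n j)

theorem pd_mul (i : Fin n) (f g : Sm n) : pd i (f * g) = pd i f * g + f * pd i g := by
  refine Sm.ext fun x => ?_
  change fderiv ℝ (fun y => f y * g y) x _ = _
  rw [fderiv_fun_mul ((Sm.differentiable f) x) ((Sm.differentiable g) x)]
  simp [pd_apply]
  ring

/-- The commutative subalgebra generated by the partial derivatives. -/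
abbrev PdAlg (n : ℕ) : Subalgebra ℝ (Module.End ℝ (Sm n)) :=
  Algebra.adjoin ℝ (Set.range (pd (n := n)))

instance pdAlg_comm (n : ℕ) : IsMulCommutative (PdAlg n) :=
  Algebra.isMulCommutative_adjoin ℝ <| by
    rintro _ ⟨i, rfl⟩ _ ⟨j, rfl⟩
    exact pd_comm i j

open scoped IsMulCommutative in
/-- The constant-coefficient operator `p(D)`, multiplicative in `p`. -/
def op (n : ℕ) : MvPolynomial (Fin n) ℝ →ₐ[ℝ] Module.End ℝ (Sm n) :=
  (PdAlg n).val.comp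
    (MvPolynomial.aeval (R := ℝ) (S₁ := PdAlg n)
      (fun i => (⟨pd i, Algebra.subset_adjoin ⟨i, rfl⟩⟩ : PdAlg n)))

open scoped IsMulCommutative in
@[simp] theorem op_X (i : Fin n) : op n (MvPolynomial.X i) = pd i := by
  change ((MvPolynomial.aeval (R := ℝ) (S₁ := PdAlg n) _ (MvPolynomial.X i) : PdAlg n) :
    Module.End ℝ (Sm n)) = _
  rw [MvPolynomial.aeval_X]

theorem op_C (c : ℝ) (f : Sm n) : op n (MvPolynomial.C c) f = c • f := by
  have : (MvPolynomial.C c : MvPolynomial (Fin n) ℝ) = algebraMap ℝ _ c := rfl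
  rw [this, AlgHom.commutes]; rfl

theorem op_mul (p q : MvPolynomial (Fin n) ℝ) (f : Sm n) :
    op n (p * q) f = op n p (op n q f) := by
  rw [map_mul]; rfl

theorem op_X_mul (i : Fin n) (p : MvPolynomial (Fin n) ℝ) (f : Sm n) :
    op n (MvPolynomial.X i * p) f = pd i (op n p f) := by
  rw [op_mul, op_X]

theorem op_mul_X (i : Fin n) (p : MvPolynomial (Fin n) ℝ) (f : Sm n) :
    op n (p * MvPolynomial.X i) f = op n p (pd i f) := by
  rw [op_mul, op_X]

theorem op_add (p q : MvPolynomial (Fin n) ℝ) (f : Sm n) :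
    op n (p + q) f = op n p f + op n q f := by
  rw [map_add]; rfl

theorem op_sum {ι : Type*} (s : Finset ι) (p : ι → MvPolynomial (Fin n) ℝ) (f : Sm n) :
    op n (∑ i ∈ s, p i) f = ∑ i ∈ s, op n (p i) f := by
  rw [map_sum]; simp

/-- The monomial `∏ X_{I i}`. -/
def monoI {m : ℕ} (I : Fin m → Fin n) : MvPolynomial (Fin n) ℝ :=
  ∏ i, MvPolynomial.X (I i)

theorem op_monoI {m : ℕ} (I : Fin m → Fin n) (f : Sm n) (x : Euc n) :
    op n (monoI I) f x = dirDeriv n m I f x := by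
  induction m generalizing x with
  | zero => simp [monoI, dirDeriv]
  | succ m ih =>
    have h1 : monoI I = MvPolynomial.X (I 0) * monoI (Fin.tail I) := by
      simp [monoI, Fin.prod_univ_succ, Fin.tail]
    rw [h1, op_X_mul, pd_apply]
    have h2 : ((op n (monoI (Fin.tail I)) f : Sm n) : Euc n → ℝ)
        = dirDeriv n m (Fin.tail I) f := funext fun y => ih _ y
    rw [h2]
    unfold dirDeriv
    rw [iteratedFDeriv_succ_apply_left]
    have h3 : DifferentiableAt ℝ (iteratedFDeriv ℝ m f) x :=
      ((Sm.smooth f).differentiable_iteratedFDeriv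
        (by exact_mod_cast (WithTop.coe_lt_top (m : ℕ)))) x
    rw [fderiv_continuousMultilinear_apply_const h3]
    rfl

theorem monoI_homog {m : ℕ} (I : Fin m → Fin n) : (monoI I).IsHomogeneous m := by
  have := MvPolynomial.IsHomogeneous.prod (R := ℝ) Finset.univ
    (fun i : Fin m => MvPolynomial.X (I i)) (fun _ => 1)
    (fun i _ => MvPolynomial.isHomogeneous_X ℝ (I i))
  simpa [monoI] using this

theorem eval_monoI {m : ℕ} (I : Fin m → Fin n) (ξ : Fin n → ℝ) :
    MvPolynomial.eval ξ (monoI I) = ∏ i, ξ (I i) := by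
  simp [monoI]

theorem dirDeriv_smooth {m : ℕ} (I : Fin m → Fin n) (f : Sm n) :
    ContDiff ℝ (⊤ : ℕ∞) (dirDeriv n m I f) := by
  have : dirDeriv n m I f = op n (monoI I) f := funext fun x => (op_monoI I f x).symm
  rw [this]
  exact Sm.smooth _

end

noncomputable section

variable {n : ℕ}

theorem homog_induction {motive : ℕ → MvPolynomial (Fin n) ℝ → Prop} {l : ℕ}
    {p : MvPolynomial (Fin n) ℝ} (hp : p.IsHomogeneous l)
    (hC : ∀ a, motive 0 (MvPolynomial.C a)) (h0 : ∀ l, motive l 0)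
    (hadd : ∀ l p q, motive l p → motive l q → motive l (p + q))
    (hX : ∀ l p i, motive l p → motive (l + 1) (MvPolynomial.X i * p)) : motive l p := by
  have key : ∀ (d : ℕ) (s : Fin n →₀ ℕ) (a : ℝ), s.degree = d →
      motive d (MvPolynomial.monomial s a) := by
    intro d
    induction d with
    | zero =>
      intro s a hs
      have : s = 0 := (Finsupp.degree_eq_zero_iff s).1 hs
      subst this
      simpa using hC a
    | succ d ih =>
      intro s a hs
      obtain ⟨i, hi⟩ : ∃ i, s i ≠ 0 := by
        by_contra! h
        have : s = 0 := Finsupp.ext h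
        subst this
        simp at hs
      obtain ⟨t, rfl⟩ : ∃ t, s = Finsupp.single i 1 + t :=
        ⟨s - Finsupp.single i 1, by
          rw [add_tsub_cancel_of_le]
          simpa [Finsupp.single_le_iff] using Nat.one_le_iff_ne_zero.2 hi⟩
      have ht : t.degree = d := by
        rw [map_add, Finsupp.degree_single] at hs
        omega
      have := hX d _ i (ih t a ht)
      rwa [MvPolynomial.monomial_single_add, pow_one]
  rw [p.as_sum]
  refine Finset.sum_induction _ _ (hadd l) (h0 l) ?_ |> fun h => h
  intro s hs
  refine key l s _ ?_
  have := hp (MvPolynomial.mem_support_iff.1 hs)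
  rw [Finsupp.degree_eq_weight_one]
  exact this

theorem pd_congr {i : Fin n} {f g : Sm n} {x : Euc n} (h : (f : Euc n → ℝ) =ᶠ[𝓝 x] g) :
    (pd i f : Euc n → ℝ) =ᶠ[𝓝 x] pd i g := by
  filter_upwards [h.fderiv (𝕜 := ℝ)] with y hy
  rw [pd_apply, pd_apply, hy]

theorem op_congr (p : MvPolynomial (Fin n) ℝ) {f g : Sm n} {x : Euc n}
    (h : (f : Euc n → ℝ) =ᶠ[𝓝 x] g) : (op n p f : Euc n → ℝ) =ᶠ[𝓝 x] op n p g := by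
  induction p using MvPolynomial.induction_on with
  | C a =>
    filter_upwards [h] with y hy
    simp [hy]
  | add p q hp hq =>
    filter_upwards [hp, hq] with y h1 h2
    simp [h1, h2]
  | mul_X p i hp =>
    rw [mul_comm, op_X_mul, op_X_mul]
    exact pd_congr hp

theorem op_eq_zero_of_notMem (p : MvPolynomial (Fin n) ℝ) {f : Sm n} {x : Euc n}
    (h : x ∉ tsupport (f : Euc n → ℝ)) : op n p f x = 0 := by
  have h1 : (f : Euc n → ℝ) =ᶠ[𝓝 x] (0 : Sm n) := notMem_tsupport_iff_eventuallyEq.1 h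
  have := (op_congr p h1).self_of_nhds
  simpa using this

theorem tsupport_op (p : MvPolynomial (Fin n) ℝ) (f : Sm n) :
    tsupport (op n p f : Euc n → ℝ) ⊆ tsupport (f : Euc n → ℝ) := by
  refine closure_minimal (fun x hx => ?_) (isClosed_tsupport _)
  by_contra h
  exact hx (op_eq_zero_of_notMem p h)

theorem hasCompactSupport_op (p : MvPolynomial (Fin n) ℝ) {f : Sm n}
    (hf : HasCompactSupport (f : Euc n → ℝ)) : HasCompactSupport (op n p f : Euc n → ℝ) :=
  hf.of_isClosed_subset (isClosed_tsupport _) (tsupport_op p f)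

/-- Composition with `y ↦ c • y + a`. -/
def aff (c : ℝ) (a : Euc n) : Sm n →ₗ[ℝ] Sm n where
  toFun f := ⟨fun y => f (c • y + a),
    (Sm.smooth f).comp ((contDiff_const_smul c).add contDiff_const)⟩
  map_add' _ _ := rfl
  map_smul' _ _ := rfl

@[simp] theorem aff_apply (c : ℝ) (a : Euc n) (f : Sm n) (y : Euc n) :
    aff c a f y = f (c • y + a) := rfl

theorem pd_aff (c : ℝ) (a : Euc n) (i : Fin n) (f : Sm n) :
    pd i (aff c a f) = c • aff c a (pd i f) := by
  refine Sm.ext fun y => ?_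
  have h1 : HasFDerivAt (fun y : Euc n => c • y + a) (c • ContinuousLinearMap.id ℝ (Euc n)) y :=
    ((hasFDerivAt_id y).const_smul c).add_const a
  have h2 := (Sm.differentiable f (c • y + a)).hasFDerivAt.comp y h1
  change fderiv ℝ (fun y => f (c • y + a)) y (stdVec n i) = _
  have h3 : fderiv ℝ (fun y => f (c • y + a)) y = _ := h2.fderiv
  rw [h3]
  simp [pd_apply]

theorem op_aff {l : ℕ} {p : MvPolynomial (Fin n) ℝ} (hp : p.IsHomogeneous l)
    (c : ℝ) (a : Euc n) (f : Sm n) :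
    op n p (aff c a f) = c ^ l • aff c a (op n p f) := by
  refine homog_induction (motive := fun l p => op n p (aff c a f) = c ^ l • aff c a (op n p f))
    hp ?_ ?_ ?_ ?_
  · intro b; simp
  · intro l; simp
  · intro l p q h1 h2; simp [h1, h2]
  · intro l p i h
    rw [op_X_mul, h, map_smul, pd_aff, op_X_mul, smul_smul, pow_succ]

theorem integrable_of_compactSupport {f : Sm n} (hf : HasCompactSupport (f : Euc n → ℝ)) :
    Integrable (f : Euc n → ℝ) :=
  (Sm.continuous f).integrable_of_hasCompactSupport hf

theorem integral_pd_mul {f g : Sm n} (i : Fin n) (hg : HasCompactSupport (g : Euc n → ℝ)) :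
    ∫ x, pd i f x * g x = - ∫ x, f x * pd i g x := by
  have h := integral_mul_fderiv_eq_neg_fderiv_mul_of_integrable (μ := (volume : Measure (Euc n)))
    (f := (f : Euc n → ℝ)) (g := (g : Euc n → ℝ)) (v := stdVec n i) ?_ ?_ ?_
    (fun x _ => Sm.differentiable f x) (fun x _ => Sm.differentiable g x)
  · simp only [pd_apply]
    rw [h, neg_neg]
  · exact ((Sm.continuous (pd i f)).mul (Sm.continuous g)).integrable_of_hasCompactSupport
      hg.mul_left
  · have : HasCompactSupport (pd i g : Euc n → ℝ) := by
      simpa using hasCompactSupport_op (MvPolynomial.X i) hg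
    exact ((Sm.continuous f).mul (Sm.continuous (pd i g))).integrable_of_hasCompactSupport
      this.mul_left
  · exact ((Sm.continuous f).mul (Sm.continuous g)).integrable_of_hasCompactSupport
      hg.mul_left

theorem integral_op_mul {l : ℕ} {p : MvPolynomial (Fin n) ℝ} (hp : p.IsHomogeneous l)
    {f g : Sm n} (hg : HasCompactSupport (g : Euc n → ℝ)) :
    ∫ x, op n p f x * g x = (-1) ^ l * ∫ x, f x * op n p g x := by
  refine homog_induction (motive := fun l p => ∀ g : Sm n, HasCompactSupport (g : Euc n → ℝ) →
    ∫ x, op n p f x * g x = (-1) ^ l * ∫ x, f x * op n p g x) hp ?_ ?_ ?_ ?_ g hg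
  · intro a g _
    simp [mul_left_comm, mul_assoc]
  · intro l g _; simp
  · intro l p q h1 h2 g hg
    have i1 : ∀ (f g : Sm n), HasCompactSupport (g : Euc n → ℝ) →
        Integrable (fun x => f x * g x) := fun f g hg =>
      ((Sm.continuous f).mul (Sm.continuous g)).integrable_of_hasCompactSupport hg.mul_left
    simp only [op_add, Sm.add_apply, add_mul, mul_add]
    rw [integral_add (i1 _ _ hg) (i1 _ _ hg), h1 g hg, h2 g hg,
      integral_add (i1 _ _ (hasCompactSupport_op p hg)) (i1 _ _ (hasCompactSupport_op q hg))]
    ring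
  · intro l p i h g hg
    have hg' : HasCompactSupport (pd i g : Euc n → ℝ) := by
      simpa using hasCompactSupport_op (MvPolynomial.X i) hg
    rw [op_X_mul, integral_pd_mul i hg, h _ hg', mul_comm (MvPolynomial.X i), op_mul_X]
    ring

theorem integral_pd_eq_zero {f : Sm n} (i : Fin n) (hf : Integrable (f : Euc n → ℝ))
    (hf' : Integrable (pd i f : Euc n → ℝ)) : ∫ x, pd i f x = 0 := by
  have h := integral_mul_fderiv_eq_neg_fderiv_mul_of_integrable (μ := (volume : Measure (Euc n)))
    (f := fun _ => (1 : ℝ)) (g := (f : Euc n → ℝ)) (v := stdVec n i)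
    (by simp) (by simp only [one_mul]; exact hf') (by simpa using hf)
    (fun x _ => differentiableAt_const _) (fun x _ => Sm.differentiable f x)
  simpa [pd_apply] using h

end

noncomputable section

variable {n : ℕ}

open scoped FourierTransform SchwartzMap LineDeriv

/-- Real part of the inverse Fourier transform of a Schwartz function. -/
def ift : 𝓢(Euc n, ℂ) →ₗ[ℝ] Sm n where
  toFun h := ⟨fun x => (𝓕⁻ h x).re,
    (Complex.reCLM.contDiff.comp ((𝓕⁻ h).smooth ⊤) : ContDiff ℝ (⊤ : ℕ∞) fun x => (𝓕⁻ h x).re)⟩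
  map_add' f g := Sm.ext fun x => by
    change (𝓕⁻ (f + g) x).re = (𝓕⁻ f x).re + (𝓕⁻ g x).re
    rw [FourierTransform.fourierInv_add]; simp
  map_smul' c f := Sm.ext fun x => by
    change (𝓕⁻ (c • f) x).re = c * (𝓕⁻ f x).re
    rw [FourierTransform.fourierInv_smul]; simp

theorem ift_apply (h : 𝓢(Euc n, ℂ)) (x : Euc n) : ift h x = (𝓕⁻ h x).re := rfl

theorem inner_stdVec (ξ : Euc n) (i : Fin n) : inner ℝ ξ (stdVec n i) = ξ i := by
  simp [stdVec, EuclideanSpace.inner_single_right]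

theorem pd_ift (i : Fin n) (h : 𝓢(Euc n, ℂ)) :
    pd i (ift h) = ift ((2 * Real.pi * Complex.I : ℂ) •
      SchwartzMap.smulLeftCLM ℂ (inner ℝ · (stdVec n i)) h) := by
  refine Sm.ext fun x => ?_
  rw [ift_apply, ← SchwartzMap.lineDerivOp_fourierInv_eq,
    SchwartzMap.lineDerivOp_apply_eq_fderiv, pd_apply]
  have h1 : HasFDerivAt (fun y => (𝓕⁻ h y).re)
      (Complex.reCLM.comp (fderiv ℝ (⇑(𝓕⁻ h : 𝓢(Euc n, ℂ))) x)) x :=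
    Complex.reCLM.hasFDerivAt.comp x ((𝓕⁻ h).differentiableAt.hasFDerivAt)
  change fderiv ℝ (fun y => (𝓕⁻ h y).re) x _ = _
  rw [h1.fderiv]; rfl

theorem op_ift (p : MvPolynomial (Fin n) ℝ) (h : 𝓢(Euc n, ℂ)) :
    ∃ h' : 𝓢(Euc n, ℂ), op n p (ift h) = ift h' ∧
      ∀ ξ : Euc n, h' ξ = MvPolynomial.aeval
        (fun i => (2 * Real.pi * Complex.I * (ξ i : ℂ) : ℂ)) p * h ξ := by
  induction p using MvPolynomial.induction_on with
  | C a =>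
    exact ⟨a • h, by rw [op_C, map_smul], fun ξ => by simp⟩
  | add p q hp hq =>
    obtain ⟨f, hf, hf'⟩ := hp
    obtain ⟨g, hg, hg'⟩ := hq
    exact ⟨f + g, by rw [op_add, hf, hg, map_add], fun ξ => by simp [hf', hg', add_mul]⟩
  | mul_X p i hp =>
    obtain ⟨f, hf, hf'⟩ := hp
    refine ⟨_, by rw [mul_comm, op_X_mul, hf, pd_ift], fun ξ => ?_⟩
    have : (inner ℝ · (stdVec n i) : Euc n → ℝ).HasTemperateGrowth := by fun_prop
    rw [smul_apply, SchwartzMap.smulLeftCLM_apply_apply this, hf', inner_stdVec]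
    simp
    ring

/-- Rapid decay of a smooth function together with all its derivatives. -/
def IsSchw (f : Sm n) : Prop :=
  ∀ (p : MvPolynomial (Fin n) ℝ) (M : ℕ), ∃ C, ∀ x, |op n p f x| * (1 + ‖x‖) ^ M ≤ C

theorem isSchw_ift (h : 𝓢(Euc n, ℂ)) : IsSchw (ift h) := by
  intro p M
  obtain ⟨h', h1, -⟩ := op_ift p h
  have h2 := fun x => SchwartzMap.one_add_le_sup_seminorm_apply (𝕜 := ℝ) (m := (M, 0)) le_rfl le_rfl
    (𝓕⁻ h') x
  refine ⟨_, fun x => le_trans ?_ (h2 x)⟩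
  rw [norm_iteratedFDeriv_zero, h1, ift_apply, mul_comm]
  gcongr
  exact Complex.abs_re_le_norm _

theorem IsSchw.op {f : Sm n} (hf : IsSchw f) (q : MvPolynomial (Fin n) ℝ) :
    IsSchw (op n q f) := by
  intro p M
  simpa [op_mul] using hf (p * q) M

theorem IsSchw.pd {f : Sm n} (hf : IsSchw f) (i : Fin n) : IsSchw (pd i f) := by
  simpa using hf.op (MvPolynomial.X i)

theorem ift_scale (h h' : 𝓢(Euc n, ℂ)) (hh : ∀ ξ, h' ξ = h ((2 : ℝ)⁻¹ • ξ)) :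
    ift h' = (2 : ℝ) ^ n • aff 2 0 (ift h) := by
  refine Sm.ext fun x => ?_
  rw [Sm.smul_apply, aff_apply, ift_apply, ift_apply, add_zero]
  have e : 𝓕⁻ h' x = (2 : ℝ) ^ n • 𝓕⁻ h ((2 : ℝ) • x) := by
    rw [SchwartzMap.fourierInv_coe, SchwartzMap.fourierInv_coe, Real.fourierInv_eq,
      Real.fourierInv_eq]
    have := Measure.integral_comp_smul (volume : Measure (Euc n))
      (fun v : Euc n => Real.fourierChar (inner ℝ v ((2 : ℝ) • x)) • h v) (2 : ℝ)⁻¹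
    rw [finrank_euclideanSpace_fin] at this
    have h3 : |((2 : ℝ)⁻¹ ^ n)⁻¹| = 2 ^ n := by
      rw [inv_pow, inv_inv, abs_of_nonneg (by positivity)]
    rw [h3] at this
    rw [← this]
    congr 1
    funext v
    rw [hh, inner_smul_left, inner_smul_right]
    simp
  rw [e, Complex.smul_re, smul_eq_mul]

theorem integrable_of_decay {f : Euc n → ℝ} (hf : Continuous f) {C : ℝ}
    (h : ∀ x, |f x| * (1 + ‖x‖) ^ (n + 1) ≤ C) : Integrable f := by
  have h1 : Integrable (fun x : Euc n => C * (1 + ‖x‖) ^ (-((n : ℝ) + 1))) :=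
    (integrable_one_add_norm (by simp)).const_mul C
  refine h1.mono' hf.aestronglyMeasurable (ae_of_all _ fun x => ?_)
  rw [Real.rpow_neg (by positivity), ← div_eq_mul_inv, le_div_iff₀ (by positivity)]
  have := h x
  rw [← Real.rpow_natCast] at this
  simpa using this

theorem IsSchw.integrable {f : Sm n} (hf : IsSchw f) : Integrable (f : Euc n → ℝ) := by
  obtain ⟨C, hC⟩ := hf 1 (n + 1)
  exact integrable_of_decay (Sm.continuous f) (C := C) (by simpa using hC)

theorem integral_ift (h : 𝓢(Euc n, ℂ)) : ∫ x, ift h x = (h 0).re := by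
  have h1 : 𝓕 (𝓕⁻ h) 0 = h 0 := by rw [FourierTransform.fourier_fourierInv_eq]
  rw [SchwartzMap.fourier_coe, Real.fourier_eq] at h1
  simp only [inner_zero_right, neg_zero, AddChar.map_zero_eq_one, one_smul] at h1
  rw [← h1]
  exact integral_re ((𝓕⁻ h).integrable (μ := volume))

end

noncomputable section

open scoped FourierTransform SchwartzMap LineDeriv

variable {n : ℕ} {B C : Type} [Fintype B] [Fintype C] [DecidableEq C]

/-- A matrix of polynomials evaluated at a point. -/
def evM (a : Matrix B C (MvPolynomial (Fin n) ℝ)) (ξ : Euc n) : Matrix B C ℝ :=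
  a.map (MvPolynomial.eval (fun i => ξ i))

/-- Injectivity of the polynomial matrix away from the origin. -/
def Ell (a : Matrix B C (MvPolynomial (Fin n) ℝ)) : Prop :=
  ∀ ξ : Euc n, ξ ≠ 0 → Function.Injective (evM a ξ).mulVec

theorem Ell.exists_left_inverse {a : Matrix B C (MvPolynomial (Fin n) ℝ)} (ha : Ell a) :
    ∃ (d : MvPolynomial (Fin n) ℝ) (N : Matrix C B (MvPolynomial (Fin n) ℝ)),
      (∀ ξ : Euc n, ξ ≠ 0 → MvPolynomial.eval (fun i => ξ i) d ≠ 0) ∧ N * a = d • 1 := by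
  refine ⟨(a.transpose * a).det, (a.transpose * a).adjugate * a.transpose, fun ξ hξ => ?_, ?_⟩
  · have h1 : MvPolynomial.eval (fun i => ξ i) (a.transpose * a).det
        = ((evM a ξ).transpose * evM a ξ).det := by
      rw [RingHom.map_det]
      congr 1
      simp [evM, Matrix.map_mul, Matrix.transpose_map]
    rw [h1]
    have h2 : ((evM a ξ).transpose * evM a ξ).PosDef := by
      have := Matrix.PosDef.conjTranspose_mul_self (evM a ξ) (ha ξ hξ)
      simpa using this
    exact h2.det_pos.ne'
  · rw [Matrix.mul_assoc, Matrix.adjugate_mul]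

theorem aeval_homog {l : ℕ} {p : MvPolynomial (Fin n) ℝ} (hp : p.IsHomogeneous l) (z : ℂ)
    (ξ : Euc n) : MvPolynomial.aeval (fun i => (z * (ξ i : ℂ) : ℂ)) p
      = z ^ l * (MvPolynomial.eval (fun i => ξ i) p : ℂ) := by
  refine homog_induction (motive := fun l p => MvPolynomial.aeval
    (fun i => (z * (ξ i : ℂ) : ℂ)) p = z ^ l * (MvPolynomial.eval (fun i => ξ i) p : ℂ))
    hp ?_ ?_ ?_ ?_
  · intro b; simp
  · intro l; simp
  · intro l p q h1 h2; simp [h1, h2, mul_add]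
  · intro l p i h; simp only [map_mul, MvPolynomial.aeval_X, h, MvPolynomial.eval_X]; push_cast; ring

theorem contDiff_eval (p : MvPolynomial (Fin n) ℝ) :
    ContDiff ℝ (⊤ : ℕ∞) (fun ξ : Euc n => MvPolynomial.eval (fun i => ξ i) p) := by
  induction p using MvPolynomial.induction_on with
  | C a => simpa using contDiff_const
  | add p q hp hq => simpa using hp.add hq
  | mul_X p i hp =>
    have : ContDiff ℝ (⊤ : ℕ∞) (fun ξ : Euc n => ξ i) := by fun_prop
    simpa using hp.mul this

theorem exists_schwartz_kernel {k : ℕ} {a : Matrix B C (MvPolynomial (Fin n) ℝ)}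
    (hk : ∀ b c, (a b c).IsHomogeneous k) (ha : Ell a) :
    ∃ (κ : C → B → Sm n) (Φ : Sm n), (∀ c b, IsSchw (κ c b)) ∧ IsSchw Φ ∧ ∫ x, Φ x = 1 ∧
      (∀ c c', ∑ b, op n (a b c') (κ c b)
        = if c = c' then (2 : ℝ) ^ n • aff 2 0 Φ - Φ else 0) ∧
      ∀ w : B → ℝ, (∀ ξ : Euc n, ξ ≠ 0 → ∃ v, (evM a ξ).mulVec v = w) →
        ∀ b', ∑ c, ∑ b, w b • op n (a b' c) (κ c b)
          = w b' • ((2 : ℝ) ^ n • aff 2 0 Φ - Φ) := by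
  obtain ⟨d, N, hd, hN⟩ := ha.exists_left_inverse
  let χ : ContDiffBump (0 : Euc n) := ⟨1, 2, one_pos, one_lt_two⟩
  let z : ℂ := 2 * Real.pi * Complex.I
  have hz : z ≠ 0 := by simp [z, Real.pi_ne_zero]
  let ev : MvPolynomial (Fin n) ℝ → Euc n → ℝ := fun p ξ => MvPolynomial.eval (fun i => ξ i) p
  let ψ : Euc n → ℝ := fun ξ => χ ((2 : ℝ)⁻¹ • ξ) - χ ξ
  have hχs : ContDiff ℝ (⊤ : ℕ∞) χ := χ.contDiff
  have hψs : ContDiff ℝ (⊤ : ℕ∞) ψ := (hχs.comp (contDiff_const_smul _)).sub hχs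
  have hψ0 : ∀ ξ ∈ ball (0 : Euc n) 1, ψ ξ = 0 := by
    intro ξ hξ
    have h1 : χ ξ = 1 := χ.one_of_mem_closedBall (ball_subset_closedBall hξ)
    have h2 : χ ((2 : ℝ)⁻¹ • ξ) = 1 := χ.one_of_mem_closedBall (by
      rw [mem_ball_zero_iff] at hξ
      rw [mem_closedBall_zero_iff, norm_smul]
      simp only [norm_inv, Real.norm_ofNat]
      change _ ≤ (1 : ℝ)
      linarith [norm_nonneg ξ])
    simp [ψ, h1, h2]
  have hψc : HasCompactSupport ψ := by
    refine HasCompactSupport.intro (isCompact_closedBall (0 : Euc n) 4) fun ξ hξ => ?_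
    rw [mem_closedBall_zero_iff, not_le] at hξ
    have h1 : χ ξ = 0 := χ.zero_of_le_dist (by
      rw [dist_zero_right]; change (2 : ℝ) ≤ _; linarith)
    have h2 : χ ((2 : ℝ)⁻¹ • ξ) = 0 := χ.zero_of_le_dist (by
      rw [dist_zero_right, norm_smul]; simp only [norm_inv, Real.norm_ofNat]
      change (2 : ℝ) ≤ _; linarith)
    simp [ψ, h1, h2]
  let q : C → B → Euc n → ℝ := fun c b ξ => ψ ξ * (ev (N c b) ξ / ev d ξ)
  have hqs : ∀ c b, ContDiff ℝ (⊤ : ℕ∞) (q c b) := by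
    intro c b
    rw [contDiff_iff_contDiffAt]
    intro ξ
    by_cases hξ : ξ = 0
    · subst hξ
      refine (contDiffAt_const (c := (0 : ℝ))).congr_of_eventuallyEq ?_
      filter_upwards [ball_mem_nhds (0 : Euc n) one_pos] with y hy
      simp [q, hψ0 y hy]
    · exact hψs.contDiffAt.mul ((contDiff_eval _).contDiffAt.div (contDiff_eval _).contDiffAt
        (hd ξ hξ))
  let h : C → B → Euc n → ℂ := fun c b ξ => (z ^ k)⁻¹ * (q c b ξ : ℂ)
  have hhs : ∀ c b, ContDiff ℝ (⊤ : ℕ∞) (h c b) := fun c b =>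
    contDiff_const.mul (Complex.ofRealCLM.contDiff.comp (hqs c b))
  have hhc : ∀ c b, HasCompactSupport (h c b) := by
    intro c b
    have : HasCompactSupport (q c b) := hψc.mul_right
    exact (this.comp_left (g := fun x : ℝ => (x : ℂ)) (by simp)).mul_left
  have hXs : ContDiff ℝ (⊤ : ℕ∞) (fun ξ : Euc n => (χ ξ : ℂ)) :=
    Complex.ofRealCLM.contDiff.comp hχs
  have hXc : HasCompactSupport (fun ξ : Euc n => (χ ξ : ℂ)) :=
    χ.hasCompactSupport.comp_left (g := fun x : ℝ => (x : ℂ)) (by simp)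
  have hYs : ContDiff ℝ (⊤ : ℕ∞) (fun ξ : Euc n => (χ ((2 : ℝ)⁻¹ • ξ) : ℂ)) :=
    hXs.comp (contDiff_const_smul _)
  have hYc : HasCompactSupport (fun ξ : Euc n => (χ ((2 : ℝ)⁻¹ • ξ) : ℂ)) :=
    hXc.comp_smul (by norm_num)
  let X : 𝓢(Euc n, ℂ) := hXc.toSchwartzMap hXs
  let Y : 𝓢(Euc n, ℂ) := hYc.toSchwartzMap hYs
  let H : C → B → 𝓢(Euc n, ℂ) := fun c b => (hhc c b).toSchwartzMap (hhs c b)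
  have hYX : ift Y - ift X = (2 : ℝ) ^ n • aff 2 0 (ift X) - ift X := by
    rw [ift_scale X Y fun ξ => rfl]
  have hX0 : (X 0).re = 1 := by
    have : χ (0 : Euc n) = 1 := χ.one_of_mem_closedBall (by simp [χ.rIn_pos.le])
    change ((χ (0 : Euc n) : ℂ)).re = 1
    simp [this]
  choose G hG hG' using fun (b' : B) (c' : C) (c : C) (b : B) => op_ift (a b' c') (H c b)
  have hG2 : ∀ b' c' c b ξ, G b' c' c b ξ
      = ((ev (a b' c') ξ * q c b ξ : ℝ) : ℂ) := by
    intro b' c' c b ξ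
    rw [hG', aeval_homog (hk b' c')]
    change z ^ k * (ev (a b' c') ξ : ℂ) * ((z ^ k)⁻¹ * (q c b ξ : ℂ)) = _
    have : z ^ k ≠ 0 := pow_ne_zero _ hz
    push_cast
    field_simp
  have hNa : ∀ c c' (ξ : Euc n), ∑ b, ev (N c b) ξ * ev (a b c') ξ
      = if c = c' then ev d ξ else 0 := by
    intro c c' ξ
    have := congrFun (congrFun hN c) c'
    rw [Matrix.mul_apply] at this
    have h2 := congrArg (fun p => ev p ξ) this
    simp only [ev, map_sum, map_mul] at h2
    rw [h2]
    by_cases hc : c = c' <;> simp [hc, ev]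
  refine ⟨fun c b => ift (H c b), ift X, fun c b => isSchw_ift _, isSchw_ift _, ?_, ?_, ?_⟩
  · rw [integral_ift, hX0]
  · intro c c'
    simp only [hG, ← map_sum]
    rw [← hYX, ← map_sub]
    have : (∑ b, G b c' c b) = if c = c' then Y - X else 0 := by
      ext ξ
      rw [sum_apply]
      simp only [hG2, ← Complex.ofReal_sum]
      have e1 : ∑ b, ev (a b c') ξ * q c b ξ = if c = c' then ψ ξ else 0 := by
        by_cases h0 : ξ = 0
        · subst h0
          simp [q, hψ0 0 (by simp)]
        have : ∑ b, ev (a b c') ξ * q c b ξ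
            = ψ ξ / ev d ξ * ∑ b, ev (N c b) ξ * ev (a b c') ξ := by
          rw [Finset.mul_sum]
          refine Finset.sum_congr rfl fun b _ => ?_
          simp only [q]; ring
        rw [this, hNa]
        have := hd ξ h0
        split_ifs
        · field_simp [ev]
        · simp
      rw [e1]
      split_ifs
      · change ((χ ((2 : ℝ)⁻¹ • ξ) - χ ξ : ℝ) : ℂ) = (χ ((2 : ℝ)⁻¹ • ξ) : ℂ) - (χ ξ : ℂ)
        push_cast; rfl
      · simp
    rw [this]
    split_ifs
    · rfl
    · simp
  · intro w hw b'
    rw [← hYX, ← map_sub]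
    simp only [hG, ← map_smul, ← map_sum]
    congr 1
    ext ξ
    have e1 : ∑ c, ∑ b, w b * (ev (a b' c) ξ * q c b ξ) = w b' * ψ ξ := by
      by_cases h0 : ξ = 0
      · subst h0
        simp [q, hψ0 0 (by simp)]
      obtain ⟨v, hv⟩ := hw ξ h0
      have hv' : ∀ b, ∑ c, ev (a b c) ξ * v c = w b := fun b => by
        rw [← hv]; rfl
      have hd' : ev d ξ ≠ 0 := hd ξ h0
      have e2 : ∀ c, ∑ b, ev (N c b) ξ * w b = ev d ξ * v c := by
        intro c
        simp only [← hv', Finset.mul_sum, ← mul_assoc]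
        rw [Finset.sum_comm]
        simp only [← Finset.sum_mul, hNa]
        simp
      have : ∑ c, ∑ b, w b * (ev (a b' c) ξ * q c b ξ)
          = ψ ξ / ev d ξ * ∑ c, ev (a b' c) ξ * ∑ b, ev (N c b) ξ * w b := by
        simp only [Finset.mul_sum]
        refine Finset.sum_congr rfl fun c _ => Finset.sum_congr rfl fun b _ => ?_
        simp only [q]; ring
      rw [this]
      simp only [e2]
      rw [← hv' b']
      simp only [Finset.mul_sum, Finset.sum_mul]
      refine Finset.sum_congr rfl fun c _ => ?_
      field_simp
    simp only [sum_apply, smul_apply, hG2, Complex.real_smul, ← Complex.ofReal_mul,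
      ← Complex.ofReal_sum]
    rw [e1]
    change ((w b' * (χ ((2 : ℝ)⁻¹ • ξ) - χ ξ) : ℝ) : ℂ)
      = ((w b' : ℝ) : ℂ) * ((χ ((2 : ℝ)⁻¹ • ξ) : ℂ) - (χ ξ : ℂ))
    push_cast; rfl

end

noncomputable section

variable {n : ℕ}

theorem sum_apply_stdVec (v : Euc n) : ∑ i, v i • stdVec n i = v := by
  ext j
  simp [stdVec, Finset.sum_apply, Pi.single_apply]

/-- A multilinear map is bounded by its values on the standard basis. -/
theorem norm_multilinear_le {F : Type*} [NormedAddCommGroup F] [NormedSpace ℝ F] {m : ℕ}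
    (L : ContinuousMultilinearMap ℝ (fun _ : Fin m => Euc n) F) :
    ‖L‖ ≤ ∑ I : Fin m → Fin n, ‖L (fun i => stdVec n (I i))‖ := by
  refine ContinuousMultilinearMap.opNorm_le_bound (by positivity) fun v => ?_
  have h1 : v = fun i => ∑ j, v i j • stdVec n j := funext fun i => (sum_apply_stdVec (v i)).symm
  have h2 : L v = ∑ I : Fin m → Fin n, (∏ i, v i (I i)) • L (fun i => stdVec n (I i)) := by
    conv_lhs => rw [h1]
    rw [ContinuousMultilinearMap.map_sum]
    exact Finset.sum_congr rfl fun I _ => ContinuousMultilinearMap.map_smul_univ _ _ _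
  rw [h2, Finset.sum_mul]
  refine (norm_sum_le _ _).trans (Finset.sum_le_sum fun I _ => ?_)
  rw [norm_smul, mul_comm, norm_prod]
  gcongr with i
  exact PiLp.norm_apply_le (v i) (I i)

/-- Series of smooth functions whose derivatives of every order are summable uniformly. -/
def UnifSummable (f : ℕ → Sm n) : Prop :=
  ∀ p, ∃ u : ℕ → ℝ, Summable u ∧ ∀ i x, |op n p (f i) x| ≤ u i

theorem UnifSummable.pd {f : ℕ → Sm n} (hf : UnifSummable f) (j : Fin n) :
    UnifSummable (fun i => pd j (f i)) := by
  intro p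
  obtain ⟨u, hu, h⟩ := hf (p * MvPolynomial.X j)
  exact ⟨u, hu, by simpa [op_mul_X] using h⟩

theorem UnifSummable.iteratedFDeriv {f : ℕ → Sm n} (hf : UnifSummable f) (m : ℕ) :
    ∃ u : ℕ → ℝ, Summable u ∧ ∀ i x, ‖iteratedFDeriv ℝ m (f i) x‖ ≤ u i := by
  choose u hu h using fun I : Fin m → Fin n => hf (monoI I)
  refine ⟨fun i => ∑ I, u I i, summable_sum fun I _ => hu I, fun i x => ?_⟩
  refine (norm_multilinear_le _).trans (Finset.sum_le_sum fun I _ => ?_)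
  have := h I i x
  rwa [op_monoI] at this

/-- The sum of a uniformly summable series. -/
def smSum (f : ℕ → Sm n) (hf : UnifSummable f) : Sm n :=
  ⟨fun x => ∑' i, f i x, by
    choose v hv h using hf.iteratedFDeriv
    exact contDiff_tsum (N := (⊤ : ℕ∞)) (v := v) (fun i => Sm.smooth (f i))
      (fun k _ => hv k) (fun k i x _ => h k i x)⟩

theorem pd_smSum (f : ℕ → Sm n) (hf : UnifSummable f) (j : Fin n) :
    pd j (smSum f hf) = smSum (fun i => pd j (f i)) (hf.pd j) := by
  refine Sm.ext fun x => ?_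
  obtain ⟨u, hu, h⟩ := hf.iteratedFDeriv 1
  obtain ⟨u0, hu0, h0⟩ := hf 1
  have h1 : ∀ i x, ‖fderiv ℝ (f i) x‖ ≤ u i := by
    intro i x
    have := h i x
    rwa [norm_iteratedFDeriv_one] at this
  have hs : Summable fun i => f i 0 := hu0.of_norm_bounded fun i => by
    simpa using h0 i 0
  change fderiv ℝ (fun y => ∑' i, f i y) x _ = ∑' i, fderiv ℝ (f i) x _
  rw [fderiv_tsum_apply hu (fun i => Sm.differentiable (f i)) h1 hs]
  have hs2 : Summable fun i => fderiv ℝ (f i) x := hu.of_norm_bounded fun i => h1 i x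
  exact (ContinuousLinearMap.apply ℝ ℝ (stdVec n j)).map_tsum hs2

theorem hasSum_op_smSum (p : MvPolynomial (Fin n) ℝ) (f : ℕ → Sm n) (hf : UnifSummable f)
    (x : Euc n) : HasSum (fun i => op n p (f i) x) (op n p (smSum f hf) x) := by
  induction p using MvPolynomial.induction_on generalizing f with
  | C a =>
    obtain ⟨u0, hu0, h0⟩ := hf 1
    have hs : Summable fun i => f i x := hu0.of_norm_bounded fun i => by simpa using h0 i x
    simp only [op_C, Sm.smul_apply]
    exact hs.hasSum.mul_left a
  | add p q hp hq => simpa [op_add] using (hp f hf).add (hq f hf)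
  | mul_X p j hp =>
    simp only [op_mul_X, pd_smSum]
    exact hp _ (hf.pd j)

/-- Boundedness of all derivatives together with vanishing on the ball of radius `1/4`. -/
def IsCut (η : Sm n) : Prop :=
  (∀ p, ∃ C, ∀ x, |op n p η x| ≤ C) ∧ ∀ x ∈ ball (0 : Euc n) 4⁻¹, η x = 0

theorem IsCut.pd {η : Sm n} (h : IsCut η) (j : Fin n) : IsCut (pd j η) := by
  refine ⟨fun p => ?_, fun x hx => ?_⟩
  · obtain ⟨C, hC⟩ := h.1 (p * MvPolynomial.X j)
    refine ⟨C, fun x => ?_⟩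
    rw [← op_mul_X]
    exact hC x
  · have h0 : (η : Euc n → ℝ) =ᶠ[𝓝 x] (0 : Sm n) := by
      filter_upwards [isOpen_ball.mem_nhds hx] with y hy
      simp [h.2 y hy]
    rw [(pd_congr (i := j) h0).self_of_nhds, map_zero]
    rfl

theorem decay_cut (p : MvPolynomial (Fin n) ℝ) (l : ℕ) {η κ : Sm n} (hη : IsCut η)
    (hκ : IsSchw κ) : ∃ C, ∀ (i : ℕ) (c : ℝ), |c| ≤ ((2 : ℝ) ^ i) ^ l → ∀ x,
      |op n p (c • (η * aff ((2 : ℝ) ^ i) 0 κ)) x| * (1 + ‖x‖) ^ (n + 1) * 2 ^ i ≤ C := by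
  induction p using MvPolynomial.induction_on generalizing l η κ with
  | C a =>
    obtain ⟨C1, h1⟩ := hη.1 1
    obtain ⟨C2, h2⟩ := hκ 1 (n + 1 + (l + 1))
    have hC1 : 0 ≤ C1 := (abs_nonneg _).trans (h1 0)
    have hC2 : 0 ≤ C2 := le_trans (by positivity) (h2 0)
    refine ⟨|a| * C1 * (C2 * 4 ^ (l + 1)), fun i c hc x => ?_⟩
    by_cases hx : x ∈ ball (0 : Euc n) 4⁻¹
    · simp only [op_C, Sm.smul_apply, Sm.mul_apply, hη.2 x hx]
      simp; positivity
    · rw [mem_ball_zero_iff, not_lt] at hx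
      have h3 := h2 ((2 : ℝ) ^ i • x)
      have h4 := h1 x
      simp only [map_one, Module.End.one_apply] at h3 h4
      rw [norm_smul, norm_pow, Real.norm_ofNat] at h3
      set t : ℝ := 2 ^ i with ht
      have ht1 : 1 ≤ t := one_le_pow₀ one_le_two
      set K : ℝ := |κ (t • x)| with hK
      have hK0 : 0 ≤ K := abs_nonneg _
      have h5 : K * ((1 + ‖x‖) ^ (n + 1) * (t * 4⁻¹) ^ (l + 1)) ≤ C2 := by
        refine le_trans ?_ h3
        rw [pow_add (1 + t * ‖x‖) (n + 1) (l + 1)]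
        gcongr
        · nlinarith [norm_nonneg x]
        · nlinarith
      have h6 : K * ((1 + ‖x‖) ^ (n + 1) * t ^ (l + 1)) ≤ C2 * 4 ^ (l + 1) := by
        rw [mul_pow, inv_pow] at h5
        have : K * ((1 + ‖x‖) ^ (n + 1) * t ^ (l + 1)) =
          K * ((1 + ‖x‖) ^ (n + 1) * (t ^ (l + 1) * (4 ^ (l + 1))⁻¹)) * 4 ^ (l + 1) := by
          field_simp
        rw [this]
        gcongr
      simp only [op_C, Sm.smul_apply, Sm.mul_apply, aff_apply, add_zero, abs_mul]
      calc |a| * (|c| * (|η x| * K)) * (1 + ‖x‖) ^ (n + 1) * t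
          ≤ |a| * (t ^ l * (C1 * K)) * (1 + ‖x‖) ^ (n + 1) * t := by gcongr
        _ = |a| * C1 * (K * ((1 + ‖x‖) ^ (n + 1) * t ^ (l + 1))) := by ring
        _ ≤ _ := by gcongr
  | add p q hp hq =>
    obtain ⟨C1, h1⟩ := hp l hη hκ
    obtain ⟨C2, h2⟩ := hq l hη hκ
    refine ⟨C1 + C2, fun i c hc x => ?_⟩
    refine le_trans ?_ (add_le_add (h1 i c hc x) (h2 i c hc x))
    rw [← add_mul, ← add_mul, op_add, Sm.add_apply]
    gcongr
    exact abs_add_le _ _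
  | mul_X p j hp =>
    obtain ⟨C1, h1⟩ := hp l (hη.pd j) hκ
    obtain ⟨C2, h2⟩ := hp (l + 1) hη (hκ.pd j)
    refine ⟨C1 + C2, fun i c hc x => ?_⟩
    have hc2 : |c * 2 ^ i| ≤ ((2 : ℝ) ^ i) ^ (l + 1) := by
      rw [abs_mul, pow_succ, abs_of_nonneg (by positivity : (0 : ℝ) ≤ 2 ^ i)]
      gcongr
    refine le_trans ?_ (add_le_add (h1 i c hc x) (h2 i _ hc2 x))
    rw [← add_mul, ← add_mul, op_mul_X]
    have : pd j (c • (η * aff ((2 : ℝ) ^ i) 0 κ)) = c • (pd j η * aff ((2 : ℝ) ^ i) 0 κ)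
        + (c * 2 ^ i) • (η * aff ((2 : ℝ) ^ i) 0 (pd j κ)) := by
      rw [map_smul, pd_mul, pd_aff, smul_add, mul_smul_comm, smul_smul]
    rw [this, map_add, Sm.add_apply]
    gcongr
    exact abs_add_le _ _

theorem exists_cut (n : ℕ) : ∃ η : Sm n, IsCut η ∧ ∀ x : Euc n, 2⁻¹ ≤ ‖x‖ → η x = 1 := by
  let χ : ContDiffBump (0 : Euc n) := ⟨4⁻¹, 2⁻¹, by norm_num, by norm_num⟩
  let X : Sm n := ⟨χ, χ.contDiff⟩
  have hX : HasCompactSupport (X : Euc n → ℝ) := χ.hasCompactSupport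
  refine ⟨1 - X, ⟨fun p => ?_, fun x hx => ?_⟩, fun x hx => ?_⟩
  · obtain ⟨C, hC⟩ := (Sm.continuous (op n p X)).bounded_above_of_compact_support
      (hasCompactSupport_op p hX)
    have h1 : ∃ C', ∀ x, |op n p (1 : Sm n) x| ≤ C' := by
      induction p using MvPolynomial.induction_on generalizing C with
      | C a => exact ⟨|a|, by simp⟩
      | add p q hp hq =>
        obtain ⟨D1, h1⟩ := (Sm.continuous (op n p X)).bounded_above_of_compact_support
          (hasCompactSupport_op p hX)
        obtain ⟨D2, h2⟩ := (Sm.continuous (op n q X)).bounded_above_of_compact_support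
          (hasCompactSupport_op q hX)
        obtain ⟨C1, h1⟩ := hp D1 h1
        obtain ⟨C2, h2⟩ := hq D2 h2
        exact ⟨C1 + C2, fun x => by
          rw [op_add, Sm.add_apply]
          exact (abs_add_le _ _).trans (add_le_add (h1 x) (h2 x))⟩
      | mul_X p j hp =>
        have : pd j (1 : Sm n) = 0 := Sm.ext fun x => by
          change fderiv ℝ (fun _ : Euc n => (1 : ℝ)) x _ = 0
          simp
        exact ⟨0, fun x => by rw [op_mul_X, this, map_zero]; simp⟩
    obtain ⟨C', hC'⟩ := h1
    refine ⟨C' + C, fun x => ?_⟩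
    rw [map_sub, Sm.sub_apply]
    exact (abs_sub _ _).trans (add_le_add (hC' x) (hC x))
  · have : χ x = 1 := χ.one_of_mem_closedBall (ball_subset_closedBall hx)
    change 1 - χ x = 0
    rw [this, sub_self]
  · have : χ x = 0 := χ.zero_of_le_dist (by rw [dist_zero_right]; exact hx)
    change 1 - χ x = 1
    rw [this, sub_zero]

end

noncomputable section

variable {n : ℕ}

theorem integrable_op_smSum {f : ℕ → Sm n} (hf : UnifSummable f) {p : MvPolynomial (Fin n) ℝ}
    {u : ℕ → ℝ} (hu : Summable u) (h : ∀ i x, |op n p (f i) x| * (1 + ‖x‖) ^ (n + 1) ≤ u i) :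
    Integrable (op n p (smSum f hf) : Euc n → ℝ) := by
  refine integrable_of_decay (Sm.continuous _) (C := ∑' i, u i) fun x => ?_
  have h1 := hasSum_op_smSum p f hf x
  have h2 : Summable fun i => ‖op n p (f i) x‖ := summable_norm_iff.mpr h1.summable
  have h3 : |op n p (smSum f hf) x| ≤ ∑' i, |op n p (f i) x| := by
    rw [← h1.tsum_eq]
    exact norm_tsum_le_tsum_norm h2
  calc _ ≤ (∑' i, |op n p (f i) x|) * (1 + ‖x‖) ^ (n + 1) := by gcongr
    _ = ∑' i, |op n p (f i) x| * (1 + ‖x‖) ^ (n + 1) := tsum_mul_right.symm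
    _ ≤ _ := (h2.mul_right _).tsum_le_tsum (h · x) hu

/-- The dyadic sum `∑ 2^{i(n-k)} κ(2^i x)`, truncated near the origin. -/
theorem exists_dyadic_sum {κ : Sm n} (hκ : IsSchw κ) (k : ℕ) : ∃ G : Sm n,
    (tsupport (κ + ((2 : ℝ) ^ n / 2 ^ k) • aff 2 0 G - G : Sm n) ⊆ closedBall 0 2⁻¹) ∧
    (∀ p, Integrable (op n p G : Euc n → ℝ)) ∧
    ∀ p, ∀ x ∉ closedBall (0 : Euc n) 2⁻¹,
      HasSum (fun i : ℕ => ((2 : ℝ) ^ i) ^ n / (2 ^ i) ^ k * op n p (aff (2 ^ i) 0 κ) x)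
        (op n p G x) := by
  obtain ⟨η, hη, hη1⟩ := exists_cut n
  set c : ℕ → ℝ := fun i => ((2 : ℝ) ^ i) ^ n / (2 ^ i) ^ k with hc
  have hc1 : ∀ i, |c i| ≤ ((2 : ℝ) ^ i) ^ n := fun i => by
    rw [abs_of_nonneg (by positivity)]
    exact div_le_self (by positivity) (one_le_pow₀ (one_le_pow₀ one_le_two))
  choose D hD using fun p => decay_cut p n hη hκ
  set f : ℕ → Sm n := fun i => c i • (η * aff ((2 : ℝ) ^ i) 0 κ) with hf
  have hb : ∀ p i x, |op n p (f i) x| * (1 + ‖x‖) ^ (n + 1) ≤ D p * 2⁻¹ ^ i := fun p i x => by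
    rw [inv_pow, ← div_eq_mul_inv, le_div_iff₀ (by positivity)]
    exact hD p i (c i) (hc1 i) x
  have hgeo : Summable fun i : ℕ => (2 : ℝ)⁻¹ ^ i :=
    summable_geometric_of_lt_one (by norm_num) (by norm_num)
  have hfs : UnifSummable f := fun p => ⟨fun i => D p * 2⁻¹ ^ i, hgeo.mul_left _, fun i x =>
    le_trans (le_mul_of_one_le_right (abs_nonneg _)
      (one_le_pow₀ (by linarith [norm_nonneg x]))) (hb p i x)⟩
  have hsum : ∀ p, ∀ x ∉ closedBall (0 : Euc n) 2⁻¹,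
      HasSum (fun i => c i * op n p (aff (2 ^ i) 0 κ) x) (op n p (smSum f hfs) x) := by
    intro p x hx
    refine (hasSum_op_smSum p f hfs x).congr_fun ?_
    intro i
    have : ((f i : Sm n) : Euc n → ℝ) =ᶠ[𝓝 x] (c i • aff ((2 : ℝ) ^ i) 0 κ : Sm n) := by
      filter_upwards [isClosed_closedBall.isOpen_compl.mem_nhds hx] with y hy
      have hy' : 2⁻¹ ≤ ‖y‖ := by
        rw [Set.mem_compl_iff, mem_closedBall_zero_iff, not_le] at hy
        exact hy.le
      simp [hf, hη1 y hy']
    have h2 := (op_congr p this).self_of_nhds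
    rw [h2, map_smul, Sm.smul_apply]
  refine ⟨smSum f hfs, ?_, fun p => ?_, hsum⟩
  · refine closure_minimal (fun x hx => ?_) isClosed_closedBall
    by_contra hxb
    refine hx ?_
    have h1 := hsum 1 x hxb
    have hxb2 : (2 : ℝ) • x ∉ closedBall (0 : Euc n) 2⁻¹ := by
      rw [mem_closedBall_zero_iff, not_le] at hxb ⊢
      rw [norm_smul, Real.norm_ofNat]
      linarith
    have h2 := (hsum 1 _ hxb2).mul_left ((2 : ℝ) ^ n / 2 ^ k)
    have h3 := (hasSum_nat_add_iff' 1).mpr h1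
    have h4 : (fun i => (2 : ℝ) ^ n / 2 ^ k * (c i * op n 1 (aff (2 ^ i) 0 κ) ((2 : ℝ) • x)))
        = fun i => c (i + 1) * op n 1 (aff (2 ^ (i + 1)) 0 κ) x := by
      funext i
      simp only [map_one, Module.End.one_apply, aff_apply, smul_smul, ← pow_succ, hc, add_zero]
      rw [pow_succ (2 : ℝ) i, mul_pow, mul_pow]
      field_simp
    rw [h4] at h2
    have h5 := h2.unique h3
    simp only [map_one, Module.End.one_apply, Finset.sum_range_one, hc, pow_zero, one_pow,
      div_one, one_mul, aff_apply, one_smul, add_zero] at h5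
    simp only [Sm.sub_apply, Sm.add_apply, Sm.smul_apply, aff_apply, add_zero]
    linarith
  · exact integrable_op_smSum hfs (hgeo.mul_left (D p)) (hb p)

theorem integral_op_eq_zero {k : ℕ} {p : MvPolynomial (Fin n) ℝ} (hp : p.IsHomogeneous k)
    (hk : k ≠ 0) {G : Sm n} (hG : ∀ q, Integrable (op n q G : Euc n → ℝ)) :
    ∫ x, op n p G x = 0 := by
  refine homog_induction (motive := fun k p => k ≠ 0 → ∫ x, op n p G x = 0) hp
    (fun _ h => absurd rfl h) (fun _ _ => by simp) (fun l p q h1 h2 hl => ?_)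
    (fun l p i _ _ => ?_) hk
  · simp only [op_add, Sm.add_apply]
    rw [integral_add (hG p) (hG q), h1 hl, h2 hl, add_zero]
  · rw [op_X_mul]
    have := hG (MvPolynomial.X i * p)
    rw [op_X_mul] at this
    exact integral_pd_eq_zero i (hG p) this

theorem tendsto_dilate_zero {Φ : Sm n} (hΦ : IsSchw Φ) {x : Euc n} (hx : x ≠ 0) :
    Tendsto (fun N : ℕ => ((2 : ℝ) ^ N) ^ n * Φ ((2 : ℝ) ^ N • x)) atTop (𝓝 0) := by
  obtain ⟨C, hC⟩ := hΦ 1 (n + 1)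
  have hx' : 0 < ‖x‖ := norm_pos_iff.mpr hx
  have h0 : Tendsto (fun N : ℕ => C / ‖x‖ ^ (n + 1) * (2 : ℝ)⁻¹ ^ N) atTop (𝓝 0) := by
    simpa using (tendsto_pow_atTop_nhds_zero_of_lt_one (by norm_num : (0 : ℝ) ≤ 2⁻¹)
      (by norm_num)).const_mul (C / ‖x‖ ^ (n + 1))
  refine squeeze_zero_norm (fun N => ?_) h0
  have h := hC ((2 : ℝ) ^ N • x)
  simp only [map_one, Module.End.one_apply] at h
  rw [norm_smul, norm_pow, Real.norm_ofNat] at h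
  rw [Real.norm_eq_abs, abs_mul, abs_of_nonneg (by positivity : (0 : ℝ) ≤ (2 ^ N) ^ n), inv_pow,
    div_mul_eq_mul_div, ← div_eq_mul_inv, div_div, le_div_iff₀ (by positivity)]
  refine le_trans ?_ h
  calc _ = |Φ ((2 : ℝ) ^ N • x)| * (2 ^ N * ‖x‖) ^ (n + 1) := by ring
    _ ≤ _ := by gcongr; linarith

/-- Replacing a Schwartz solution of `∑ p_j(D) κ_j = t (2^n Φ(2·) - Φ)` by a compactly supported
one. -/
theorem exists_compact_telescope {ι : Type*} [Fintype ι] {k : ℕ} (hk : k ≠ 0)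
    {p : ι → MvPolynomial (Fin n) ℝ} (hp : ∀ j, (p j).IsHomogeneous k) {κ G : ι → Sm n}
    (hG : ∀ j q, Integrable (op n q (G j) : Euc n → ℝ))
    (hGs : ∀ j p, ∀ x ∉ closedBall (0 : Euc n) 2⁻¹,
      HasSum (fun i : ℕ => ((2 : ℝ) ^ i) ^ n / (2 ^ i) ^ k * op n p (aff (2 ^ i) 0 (κ j)) x)
        (op n p (G j) x))
    {Φ : Sm n} (hΦ : IsSchw Φ) (hΦ1 : ∫ x, Φ x = 1) {t : ℝ}
    (ht : ∑ j, op n (p j) (κ j) = t • ((2 : ℝ) ^ n • aff 2 0 Φ - Φ)) :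
    ∃ T : Sm n, tsupport (T : Euc n → ℝ) ⊆ closedBall 0 2⁻¹ ∧ ∫ x, T x = t ∧
      ∑ j, op n (p j) (κ j + ((2 : ℝ) ^ n / 2 ^ k) • aff 2 0 (G j) - G j)
        = (2 : ℝ) ^ n • aff 2 0 T - T := by
  refine ⟨t • Φ + ∑ j, op n (p j) (G j), ?_, ?_, ?_⟩
  · refine closure_minimal (fun x hx => ?_) isClosed_closedBall
    by_contra hxb
    refine hx ?_
    have hx0 : x ≠ 0 := by
      rintro rfl
      exact hxb (by simp)
    have h1 := hasSum_sum (s := Finset.univ) fun j _ => hGs j (p j) x hxb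
    have h2 : ∀ i : ℕ, ∑ j, ((2 : ℝ) ^ i) ^ n / (2 ^ i) ^ k *
        op n (p j) (aff (2 ^ i) 0 (κ j)) x = t * (((2 : ℝ) ^ (i + 1)) ^ n * Φ ((2 : ℝ) ^ (i + 1) • x))
          - t * (((2 : ℝ) ^ i) ^ n * Φ ((2 : ℝ) ^ i • x)) := by
      intro i
      have h3 := congrArg (fun F : Sm n => F ((2 : ℝ) ^ i • x)) ht
      simp only [Sm.sum_apply, Sm.smul_apply, Sm.sub_apply, aff_apply, add_zero, smul_smul] at h3
      simp only [op_aff (hp _), Sm.smul_apply, aff_apply, add_zero]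
      have h4 : ∀ j, ((2 : ℝ) ^ i) ^ n / (2 ^ i) ^ k * ((2 ^ i) ^ k * op n (p j) (κ j)
          ((2 : ℝ) ^ i • x)) = ((2 : ℝ) ^ i) ^ n * op n (p j) (κ j) ((2 : ℝ) ^ i • x) := by
        intro j
        field_simp
      simp only [h4]
      rw [← Finset.mul_sum, h3, pow_succ' (2 : ℝ) i, mul_pow]
      ring
    have h5 := h1.tendsto_sum_nat
    simp only [h2] at h5
    have h8 := fun N : ℕ => Finset.sum_range_sub
      (fun i => t * (((2 : ℝ) ^ i) ^ n * Φ ((2 : ℝ) ^ i • x))) N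
    simp only [h8] at h5
    have h6 := ((tendsto_dilate_zero hΦ hx0).const_mul t).sub_const
      (t * (((2 : ℝ) ^ 0) ^ n * Φ ((2 : ℝ) ^ 0 • x)))
    have h7 := tendsto_nhds_unique h5 h6
    simp only [Sm.add_apply, Sm.smul_apply, Sm.sum_apply, h7]
    simp
  · simp only [Sm.add_apply, Sm.smul_apply, Sm.sum_apply]
    rw [integral_add (hΦ.integrable.const_mul t) (integrable_finsetSum _ fun j _ => hG j _),
      integral_const_mul, hΦ1, integral_finsetSum _ fun j _ => hG j _]
    simp [integral_op_eq_zero (hp _) hk (hG _)]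
  · have h1 : ∀ j, op n (p j) (κ j + ((2 : ℝ) ^ n / 2 ^ k) • aff 2 0 (G j) - G j)
        = op n (p j) (κ j) + ((2 : ℝ) ^ n • aff 2 0 (op n (p j) (G j)) - op n (p j) (G j)) := by
      intro j
      rw [map_sub, map_add, map_smul, op_aff (hp j), smul_smul,
        div_mul_cancel₀ _ (by positivity), add_sub_assoc]
    simp only [h1]
    rw [Finset.sum_add_distrib, ht, Finset.sum_sub_distrib, map_add, map_smul, map_sum,
      ← Finset.smul_sum]
    module

variable {B C : Type} [Fintype B] [Fintype C] [DecidableEq C]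

/-- Compactly supported dyadic building blocks of a fundamental solution of an elliptic system. -/
theorem exists_compact_kernel {k : ℕ} (hk0 : k ≠ 0) {a : Matrix B C (MvPolynomial (Fin n) ℝ)}
    (hk : ∀ b c, (a b c).IsHomogeneous k) (ha : Ell a) :
    ∃ (β : C → B → Sm n) (T : C → C → Sm n),
      (∀ c b, tsupport (β c b : Euc n → ℝ) ⊆ closedBall 0 2⁻¹) ∧
      (∀ c c', tsupport (T c c' : Euc n → ℝ) ⊆ closedBall 0 2⁻¹) ∧
      (∀ c c', ∫ x, T c c' x = if c = c' then 1 else 0) ∧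
      (∀ c c', ∑ b, op n (a b c') (β c b) = (2 : ℝ) ^ n • aff 2 0 (T c c') - T c c') ∧
      ∀ w : B → ℝ, (∀ ξ : Euc n, ξ ≠ 0 → ∃ v, (evM a ξ).mulVec v = w) →
        ∀ b', ∃ T' : Sm n, tsupport (T' : Euc n → ℝ) ⊆ closedBall 0 2⁻¹ ∧ ∫ x, T' x = w b' ∧
          ∑ c, ∑ b, w b • op n (a b' c) (β c b) = (2 : ℝ) ^ n • aff 2 0 T' - T' := by
  obtain ⟨κ, Φ, hκ, hΦ, hΦ1, h1, h2⟩ := exists_schwartz_kernel hk ha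
  choose G hGt hGi hGs using fun c b => exists_dyadic_sum (hκ c b) k
  have key : ∀ c c', _ := fun c c' => exists_compact_telescope hk0 (fun b => hk b c')
    (κ := κ c) (G := G c) (fun b => hGi c b) (fun b => hGs c b) hΦ hΦ1
    (t := if c = c' then 1 else 0) (by rw [h1]; split_ifs <;> simp)
  choose T hT1 hT2 hT3 using key
  refine ⟨_, T, hGt, hT1, hT2, hT3, fun w hw b' => ?_⟩
  obtain ⟨T', hT'1, hT'2, hT'3⟩ := exists_compact_telescope hk0
    (p := fun q : C × B => w q.2 • a b' q.1) (κ := fun q => κ q.1 q.2) (G := fun q => G q.1 q.2)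
    (fun q => by
      rw [MvPolynomial.smul_eq_C_mul]
      simpa using (MvPolynomial.isHomogeneous_C _ (w q.2)).mul (hk b' q.1))
    (fun q => hGi _ _) (fun q => hGs _ _) hΦ hΦ1 (t := w b') (by
      rw [Fintype.sum_prod_type, ← h2 w hw b']
      simp)
  refine ⟨T', hT'1, hT'2, ?_⟩
  rw [← hT'3, Fintype.sum_prod_type]
  simp

end

noncomputable section

open scoped NNReal

variable {n : ℕ}

/-- The affine function `⟪ξ, · - z⟫`. -/
def affLin (ξ z : Euc n) : Sm n :=
  ⟨fun y => inner ℝ ξ (y - z), by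
    change ContDiff ℝ (⊤ : ℕ∞) (fun y : Euc n => (inner ℝ ξ (y - z) : ℝ))
    exact contDiff_const.inner ℝ (contDiff_id.sub contDiff_const)⟩

@[simp] theorem affLin_apply (ξ z y : Euc n) : affLin ξ z y = inner ℝ ξ (y - z) := rfl

theorem pd_affLin (ξ z : Euc n) (i : Fin n) : pd i (affLin ξ z) = ξ i • (1 : Sm n) := by
  refine Sm.ext fun y => ?_
  have : HasFDerivAt (fun y : Euc n => inner ℝ ξ (y - z)) (innerSL ℝ ξ) y := by
    exact ((innerSL ℝ ξ).hasFDerivAt (x := y - z)).comp y ((hasFDerivAt_id y).sub_const z)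
  change fderiv ℝ (fun y : Euc n => inner ℝ ξ (y - z)) y _ = _
  rw [this.fderiv]
  simpa using inner_stdVec ξ i

theorem pd_pow (i : Fin n) (f : Sm n) (m : ℕ) :
    pd i (f ^ (m + 1)) = ((m : ℝ) + 1) • (f ^ m * pd i f) := by
  induction m with
  | zero => simp
  | succ m ih =>
    rw [pow_succ, pd_mul, ih, pow_succ]
    push_cast
    refine Sm.ext fun x => ?_
    simp only [Sm.add_apply, Sm.mul_apply, Sm.smul_apply]
    ring

theorem op_mul_affLin_pow {l : ℕ} {p : MvPolynomial (Fin n) ℝ} (hp : p.IsHomogeneous l)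
    (ξ : Euc n) (L : ℕ) (f : Sm n) : ∃ C : ℝ, ∀ z ∈ closedBall (0 : Euc n) 1,
      ∀ y ∈ closedBall (0 : Euc n) 1,
        |op n p (((L + l).factorial : ℝ)⁻¹ • (f * affLin ξ z ^ (L + l))) y
          - MvPolynomial.eval (fun i => ξ i) p * (f y * inner ℝ ξ (y - z) ^ L / L.factorial)|
          ≤ C * ‖y - z‖ ^ (L + 1) := by
  refine homog_induction (motive := fun l p => ∀ (L : ℕ) (f : Sm n), ∃ C : ℝ,
    ∀ z ∈ closedBall (0 : Euc n) 1, ∀ y ∈ closedBall (0 : Euc n) 1,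
        |op n p (((L + l).factorial : ℝ)⁻¹ • (f * affLin ξ z ^ (L + l))) y
          - MvPolynomial.eval (fun i => ξ i) p * (f y * inner ℝ ξ (y - z) ^ L / L.factorial)|
          ≤ C * ‖y - z‖ ^ (L + 1)) hp ?_ ?_ ?_ ?_ L f
  · intro a L f
    refine ⟨0, fun z _ y _ => le_of_eq ?_⟩
    simp only [zero_mul, abs_eq_zero]
    simp only [op_C, Sm.smul_apply, Sm.mul_apply, MvPolynomial.eval_C, add_zero]
    have : (affLin ξ z ^ L : Sm n) y = inner ℝ ξ (y - z) ^ L := rfl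
    rw [this]
    ring
  · intro l L f
    exact ⟨0, fun z _ y _ => by simp⟩
  · intro l p q h1 h2 L f
    obtain ⟨C1, h1⟩ := h1 L f
    obtain ⟨C2, h2⟩ := h2 L f
    refine ⟨C1 + C2, fun z hz y hy => ?_⟩
    rw [add_mul]
    refine le_trans ?_ (add_le_add (h1 z hz y hy) (h2 z hz y hy))
    rw [op_add, Sm.add_apply, map_add]
    refine le_trans (le_of_eq ?_) (abs_add_le _ _)
    congr 1
    ring
  · intro l p i hp L f
    obtain ⟨C1, h1⟩ := hp (L + 1) (pd i f)
    obtain ⟨C2, h2⟩ := hp L (ξ i • f)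
    obtain ⟨D, hD⟩ := (isCompact_closedBall (0 : Euc n) 1).exists_bound_of_continuousOn
      (Sm.continuous (pd i f)).continuousOn
    have hC1 : 0 ≤ |C1| := abs_nonneg _
    refine ⟨2 * |C1| + C2 + |MvPolynomial.eval (fun i => ξ i) p| * D * ‖ξ‖ ^ (L + 1),
      fun z hz y hy => ?_⟩
    have h1' := h1 z hz y hy
    have h2' := h2 z hz y hy
    have hyz : ‖y - z‖ ≤ 2 := by
      rw [mem_closedBall_zero_iff] at hz hy
      linarith [norm_sub_le y z]
    have h3 : op n (MvPolynomial.X i * p)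
        (((L + (l + 1)).factorial : ℝ)⁻¹ • (f * affLin ξ z ^ (L + (l + 1))))
        = op n p (((L + 1 + l).factorial : ℝ)⁻¹ • (pd i f * affLin ξ z ^ (L + 1 + l)))
          + op n p (((L + l).factorial : ℝ)⁻¹ • ((ξ i • f) * affLin ξ z ^ (L + l))) := by
      rw [mul_comm, op_mul_X, ← map_add, map_smul, pd_mul, ← add_assoc, pd_pow, pd_affLin,
        show L + 1 + l = L + l + 1 by ring, Nat.factorial_succ]
      congr 1
      refine Sm.ext fun x => ?_
      simp only [Sm.add_apply, Sm.mul_apply, Sm.smul_apply, Sm.one_apply]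
      have : ((L + l : ℕ) : ℝ) + 1 ≠ 0 := by positivity
      push_cast
      push_cast at this
      field_simp
    rw [h3, Sm.add_apply]
    set E1 := op n p (((L + 1 + l).factorial : ℝ)⁻¹ • (pd i f * affLin ξ z ^ (L + 1 + l))) y
    set E2 := op n p (((L + l).factorial : ℝ)⁻¹ • ((ξ i • f) * affLin ξ z ^ (L + l))) y
    set e := MvPolynomial.eval (fun i => ξ i) p
    have h4 : |e * (pd i f y * inner ℝ ξ (y - z) ^ (L + 1) / (L + 1).factorial)|
        ≤ |e| * D * ‖ξ‖ ^ (L + 1) * ‖y - z‖ ^ (L + 1) := by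
      rw [abs_mul, abs_div, abs_mul, abs_pow, Nat.abs_cast]
      have h5 : |inner ℝ ξ (y - z)| ≤ ‖ξ‖ * ‖y - z‖ := abs_real_inner_le_norm _ _
      have h6 : |pd i f y| ≤ D := hD y hy
      have h10 : 0 ≤ D := (abs_nonneg _).trans h6
      have h7 : (1 : ℝ) ≤ (L + 1).factorial := by exact_mod_cast Nat.factorial_pos _
      calc _ ≤ |e| * (|pd i f y| * |inner ℝ ξ (y - z)| ^ (L + 1)) := by
            gcongr
            exact div_le_self (by positivity) h7
        _ ≤ |e| * (D * (‖ξ‖ * ‖y - z‖) ^ (L + 1)) := by gcongr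
        _ = _ := by ring
    have h8 : |E1 - e * (pd i f y * inner ℝ ξ (y - z) ^ (L + 1) / (L + 1).factorial)|
        ≤ 2 * |C1| * ‖y - z‖ ^ (L + 1) := by
      refine h1'.trans ?_
      calc _ ≤ |C1| * ‖y - z‖ ^ (L + 1 + 1) := by gcongr; exact le_abs_self _
        _ = |C1| * (‖y - z‖ ^ (L + 1) * ‖y - z‖) := by rw [pow_succ]
        _ ≤ |C1| * (‖y - z‖ ^ (L + 1) * 2) := by gcongr
        _ = _ := by ring
    have h9 : E1 + E2 - MvPolynomial.eval (fun i => ξ i) (MvPolynomial.X i * p)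
          * (f y * inner ℝ ξ (y - z) ^ L / L.factorial)
        = (E1 - e * (pd i f y * inner ℝ ξ (y - z) ^ (L + 1) / (L + 1).factorial))
          + (E2 - e * ((ξ i • f) y * inner ℝ ξ (y - z) ^ L / L.factorial))
          + e * (pd i f y * inner ℝ ξ (y - z) ^ (L + 1) / (L + 1).factorial) := by
      rw [map_mul, MvPolynomial.eval_X, Sm.smul_apply]
      ring
    rw [h9, add_mul, add_mul]
    exact (abs_add_three _ _ _).trans (add_le_add (add_le_add h8 h2') h4)

variable {B C : Type} [Fintype B]

/-- Homogeneous vector-valued polynomials of positive degree annihilating the columns of `a`. -/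
def Annih (a : Matrix B C (MvPolynomial (Fin n) ℝ)) (l : ℕ)
    (q : B → MvPolynomial (Fin n) ℝ) : Prop :=
  (∀ b, (q b).IsHomogeneous (l + 1)) ∧ ∀ c, ∑ b, q b * a b c = 0

/-- The cancellation condition for a symbol matrix. -/
def Canc [Fintype C] (a : Matrix B C (MvPolynomial (Fin n) ℝ)) : Prop :=
  ∀ w : B → ℝ, (∀ ξ : Euc n, ξ ≠ 0 → ∃ v, (evM a ξ).mulVec v = w) → w = 0

theorem homogeneousComponent_mul_of_homog (p : MvPolynomial (Fin n) ℝ) {k : ℕ}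
    {q : MvPolynomial (Fin n) ℝ} (hq : q.IsHomogeneous k) (l : ℕ) :
    MvPolynomial.homogeneousComponent (l + k) (p * q)
      = MvPolynomial.homogeneousComponent l p * q := by
  have h1 : ∀ i, MvPolynomial.homogeneousComponent (l + k)
      (MvPolynomial.homogeneousComponent i p * q)
      = if l = i then MvPolynomial.homogeneousComponent l p * q else 0 := by
    intro i
    have h2 : MvPolynomial.homogeneousComponent i p * q
        ∈ MvPolynomial.homogeneousSubmodule (Fin n) ℝ (i + k) :=
      (MvPolynomial.homogeneousComponent_isHomogeneous i p).mul hq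
    rw [MvPolynomial.homogeneousComponent_of_mem h2]
    by_cases h : l = i
    · simp [h]
    · simp [h]
  conv_lhs => rw [← MvPolynomial.sum_homogeneousComponent p]
  rw [Finset.sum_mul, map_sum]
  simp only [h1, Finset.sum_ite_eq, Finset.mem_range]
  split_ifs with h
  · rfl
  · rw [MvPolynomial.homogeneousComponent_eq_zero _ _ (by omega), zero_mul]

theorem span_annih [Fintype C] [DecidableEq C] [DecidableEq B] {k : ℕ}
    {a : Matrix B C (MvPolynomial (Fin n) ℝ)}
    (hk : ∀ b c, (a b c).IsHomogeneous k) (ha : Ell a) (hc : Canc a) :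
    Submodule.span ℝ {w : B → ℝ | ∃ l q, Annih a l q ∧ ∃ ξ : Euc n,
      w = fun b => MvPolynomial.eval (fun i => ξ i) (q b)} = ⊤ := by
  obtain ⟨d, N, hd, hN⟩ := ha.exists_left_inverse
  set S := {w : B → ℝ | ∃ l q, Annih a l q ∧ ∃ ξ : Euc n,
      w = fun b => MvPolynomial.eval (fun i => ξ i) (q b)}
  set R : Matrix B B (MvPolynomial (Fin n) ℝ) := d • 1 - a * N with hR
  have hRa : R * a = 0 := by
    rw [hR, Matrix.sub_mul, Matrix.mul_assoc, hN]
    simp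
  by_contra hS
  obtain ⟨g, hg0, hg⟩ := Submodule.exists_dual_map_eq_bot_of_lt_top (lt_top_iff_ne_top.mpr hS)
    inferInstance
  have hgS : ∀ w ∈ S, g w = 0 := fun w hw => by
    have : g w ∈ Submodule.map g (Submodule.span ℝ S) :=
      Submodule.mem_map_of_mem (Submodule.subset_span hw)
    rwa [hg, Submodule.mem_bot] at this
  set w : B → ℝ := fun b => g (Pi.single b 1) with hw
  have hgw : ∀ v : B → ℝ, g v = ∑ b, v b * w b := fun v => by
    conv_lhs => rw [LinearMap.pi_apply_eq_sum_univ g v]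
    refine Finset.sum_congr rfl fun b _ => ?_
    rw [smul_eq_mul, hw]
    congr 2
    funext b'
    rw [Pi.single_apply]
    simp only [eq_comm]
  have hann : ∀ l b0 i, Annih a l fun b =>
      MvPolynomial.X i * MvPolynomial.homogeneousComponent l (R b0 b) := by
    intro l b0 i
    refine ⟨fun b => ?_, fun c => ?_⟩
    · rw [add_comm]
      exact (MvPolynomial.isHomogeneous_X ℝ i).mul
        (MvPolynomial.homogeneousComponent_isHomogeneous _ _)
    · have h1 : ∑ b, R b0 b * a b c = 0 := by
        simpa [Matrix.mul_apply] using congrFun (congrFun hRa b0) c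
      have h2 := congrArg (MvPolynomial.homogeneousComponent (l + k)) h1
      rw [map_sum, map_zero] at h2
      simp only [mul_assoc]
      rw [← Finset.mul_sum]
      refine mul_eq_zero_of_right _ ?_
      rw [← h2]
      refine Finset.sum_congr rfl fun b _ => ?_
      exact (homogeneousComponent_mul_of_homog (R b0 b) (hk b c) l).symm
  have hw0 : w = 0 := by
    refine hc w fun ξ hξ => ?_
    obtain ⟨i, hi⟩ : ∃ i, ξ i ≠ 0 := by
      by_contra! h
      exact hξ (by ext i; simpa using h i)
    have hRw : ∀ b0, ∑ b, MvPolynomial.eval (fun i => ξ i) (R b0 b) * w b = 0 := by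
      intro b0
      have h1 : ∀ l, ∑ b, MvPolynomial.eval (fun i => ξ i)
          (MvPolynomial.homogeneousComponent l (R b0 b)) * w b = 0 := by
        intro l
        have := hgS _ ⟨l, _, hann l b0 i, ξ, rfl⟩
        rw [hgw] at this
        simp only [map_mul, MvPolynomial.eval_X, mul_assoc] at this
        rw [← Finset.mul_sum] at this
        exact (mul_eq_zero.mp this).resolve_left hi
      obtain ⟨M, hM⟩ : ∃ M, ∀ b, (R b0 b).totalDegree < M := by
        refine ⟨(∑ b, (R b0 b).totalDegree) + 1, fun b => Nat.lt_succ_of_le ?_⟩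
        exact Finset.single_le_sum (f := fun b => (R b0 b).totalDegree)
          (fun _ _ => Nat.zero_le _) (Finset.mem_univ b)
      have h2 : ∀ b, R b0 b = ∑ l ∈ Finset.range M,
          MvPolynomial.homogeneousComponent l (R b0 b) := by
        intro b
        conv_lhs => rw [← MvPolynomial.sum_homogeneousComponent (R b0 b)]
        refine Finset.sum_subset (Finset.range_subset_range.mpr (hM b)) fun l _ hl => ?_
        refine MvPolynomial.homogeneousComponent_eq_zero _ _ ?_
        rw [Finset.mem_range] at hl
        omega
      calc _ = ∑ b, ∑ l ∈ Finset.range M, MvPolynomial.eval (fun i => ξ i)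
              (MvPolynomial.homogeneousComponent l (R b0 b)) * w b := by
            refine Finset.sum_congr rfl fun b _ => ?_
            conv_lhs => rw [h2 b]
            rw [map_sum, Finset.sum_mul]
        _ = 0 := by
            rw [Finset.sum_comm]
            exact Finset.sum_eq_zero fun l _ => h1 l
    have hd' := hd ξ hξ
    refine ⟨(MvPolynomial.eval (fun i => ξ i) d)⁻¹ • (evM N ξ).mulVec w, ?_⟩
    have h3 : (evM a ξ).mulVec ((evM N ξ).mulVec w)
        = MvPolynomial.eval (fun i => ξ i) d • w := by
      funext b0
      have h4 := hRw b0
      have h5 : ∀ b, MvPolynomial.eval (fun i => ξ i) (R b0 b)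
          = MvPolynomial.eval (fun i => ξ i) d * (if b0 = b then 1 else 0)
            - (evM a ξ * evM N ξ) b0 b := by
        intro b
        rw [hR, evM, evM, ← Matrix.map_mul]
        simp [Matrix.one_apply]
        split_ifs <;> simp
      simp only [h5, sub_mul, Finset.sum_sub_distrib, mul_assoc, ite_mul, one_mul, zero_mul,
        mul_ite, mul_zero, Finset.sum_ite_eq, Finset.mem_univ, if_true] at h4
      rw [Matrix.mulVec_mulVec, Pi.smul_apply, smul_eq_mul]
      exact (sub_eq_zero.mp h4).symm
    rw [Matrix.mulVec_smul, h3, smul_smul, inv_mul_cancel₀ hd', one_smul]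
  refine hg0 (LinearMap.ext fun v => ?_)
  rw [hgw, hw0]
  simp

/-- Local functionals of order zero, bounded by `ν`, subject to the constraints dual to the
annihilators of `a`. -/
structure Cocancelling (a : Matrix B C (MvPolynomial (Fin n) ℝ)) (ν : Measure (Euc n))
    (ℓ : B → Sm n → ℝ) : Prop where
  add : ∀ b (f g : Sm n), HasCompactSupport (f : Euc n → ℝ) → HasCompactSupport (g : Euc n → ℝ) →
    ℓ b (f + g) = ℓ b f + ℓ b g
  smul : ∀ b (c : ℝ) (f : Sm n), HasCompactSupport (f : Euc n → ℝ) → ℓ b (c • f) = c * ℓ b f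
  bound : ∀ b (f : Sm n), HasCompactSupport (f : Euc n → ℝ) → ‖ℓ b f‖ₑ ≤ ∫⁻ y, ‖f y‖ₑ ∂ν
  ann : ∀ l q, Annih a l q → ∀ f : Sm n, HasCompactSupport (f : Euc n → ℝ) →
    ∑ b, ℓ b (op n (q b) f) = 0

theorem Sm.hasCompactSupport_add {f g : Sm n} (hf : HasCompactSupport (f : Euc n → ℝ))
    (hg : HasCompactSupport (g : Euc n → ℝ)) : HasCompactSupport ((f + g : Sm n) : Euc n → ℝ) :=
  hf.add hg

theorem Sm.hasCompactSupport_sub {f g : Sm n} (hf : HasCompactSupport (f : Euc n → ℝ))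
    (hg : HasCompactSupport (g : Euc n → ℝ)) : HasCompactSupport ((f - g : Sm n) : Euc n → ℝ) :=
  hf.sub hg

theorem Sm.hasCompactSupport_smul (c : ℝ) {f : Sm n} (hf : HasCompactSupport (f : Euc n → ℝ)) :
    HasCompactSupport ((c • f : Sm n) : Euc n → ℝ) :=
  hf.mono (Function.support_const_smul_subset _ _)

theorem hasCompactSupport_aff {c : ℝ} (hc : c ≠ 0) (a : Euc n) {f : Sm n}
    (hf : HasCompactSupport (f : Euc n → ℝ)) : HasCompactSupport (aff c a f : Euc n → ℝ) := by
  have h := hf.comp_homeomorph ((Homeomorph.smulOfNeZero c hc).trans (Homeomorph.addRight a))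
  exact h

theorem hasCompactSupport_of_subset {f : Euc n → ℝ} {R : ℝ}
    (hf : tsupport f ⊆ closedBall 0 R) : HasCompactSupport f :=
  (isCompact_closedBall _ _).of_isClosed_subset (isClosed_tsupport _) hf

theorem mem_ball_of_dilate {x y : Euc n} {r R : ℝ} (hr : 0 < r) (hR : R < 1)
    (h : (-r⁻¹) • y + r⁻¹ • x ∈ closedBall (0 : Euc n) R) : y ∈ ball x r := by
  rw [mem_closedBall_zero_iff, neg_smul, neg_add_eq_sub, ← smul_sub, norm_smul, norm_inv,
    Real.norm_of_nonneg hr.le, norm_sub_rev, inv_mul_le_iff₀ hr] at h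
  rw [mem_ball_iff_norm]
  nlinarith

theorem cocancel_annih {a : Matrix B C (MvPolynomial (Fin n) ℝ)} {l : ℕ}
    {q : B → MvPolynomial (Fin n) ℝ} (hq : Annih a l q) (ξ : Euc n) {γ : Sm n}
    (hγ : tsupport (γ : Euc n → ℝ) ⊆ closedBall 0 2⁻¹) :
    ∃ K : ℝ≥0, ∀ ν ℓ, Cocancelling a ν ℓ → ∀ x r, 0 < r → ∀ z ∈ ball x r,
      ‖∑ b, MvPolynomial.eval (fun i => ξ i) (q b) * ℓ b (aff (-r⁻¹) (r⁻¹ • x) γ)‖ₑ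
        ≤ K * ∫⁻ y in ball x r, ENNReal.ofReal (‖y - z‖ / r) ∂ν := by
  have hγc := hasCompactSupport_of_subset hγ
  choose D hD using fun b => op_mul_affLin_pow (hq.1 b) ξ 0 γ
  refine ⟨∑ b, (D b).toNNReal, fun ν ℓ hℓ x r hr z hz => ?_⟩
  have hr' : -r⁻¹ ≠ 0 := by simpa using hr.ne'
  set Z : Euc n := (-r⁻¹) • z + r⁻¹ • x with hZ
  have hZ1 : Z ∈ closedBall (0 : Euc n) 1 := by
    rw [mem_closedBall_zero_iff, hZ, neg_smul, neg_add_eq_sub, ← smul_sub, norm_smul, norm_inv,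
      Real.norm_of_nonneg hr.le, norm_sub_rev, inv_mul_le_iff₀ hr]
    rw [mem_ball_iff_norm] at hz
    linarith
  obtain ⟨Γ, hΓt, hΓ⟩ : ∃ Γ : Sm n, tsupport (Γ : Euc n → ℝ) ⊆ tsupport (γ : Euc n → ℝ) ∧
      ∀ b, ∀ y ∈ closedBall (0 : Euc n) 1, |op n (q b) Γ y
        - MvPolynomial.eval (fun i => ξ i) (q b) * γ y| ≤ D b * ‖y - Z‖ := by
    refine ⟨((0 + (l + 1)).factorial : ℝ)⁻¹ • (γ * affLin ξ Z ^ (0 + (l + 1))),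
      closure_mono fun y hy => ?_, fun b y hy => by simpa using hD b Z hZ1 y hy⟩
    contrapose! hy
    rw [Function.notMem_support] at hy ⊢
    simp [hy]
  have hΓc : HasCompactSupport (Γ : Euc n → ℝ) :=
    hγc.of_isClosed_subset (isClosed_tsupport _) hΓt
  set h : B → Sm n := fun b => op n (q b) Γ - MvPolynomial.eval (fun i => ξ i) (q b) • γ with hh
  have hhc : ∀ b, HasCompactSupport (h b : Euc n → ℝ) := fun b =>
    Sm.hasCompactSupport_sub (hasCompactSupport_op (q b) hΓc) (Sm.hasCompactSupport_smul _ hγc)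
  have hhb : ∀ b y, ‖(aff (-r⁻¹) (r⁻¹ • x) (h b) : Sm n) y‖ₑ
      ≤ (ball x r).indicator (fun y => (D b).toNNReal * ENNReal.ofReal (‖y - z‖ / r)) y := by
    intro b y
    by_cases hy : (-r⁻¹) • y + r⁻¹ • x ∈ closedBall (0 : Euc n) 2⁻¹
    · rw [Set.indicator_of_mem (mem_ball_of_dilate hr (by norm_num) hy)]
      have h1 := hΓ b ((-r⁻¹) • y + r⁻¹ • x) (closedBall_subset_closedBall (by norm_num) hy)
      have h2 : ‖(-r⁻¹) • y + r⁻¹ • x - Z‖ = ‖y - z‖ / r := by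
        rw [hZ, add_sub_add_right_eq_sub, ← smul_sub, norm_smul, norm_neg, norm_inv,
          Real.norm_of_nonneg hr.le, div_eq_inv_mul]
      rw [h2] at h1
      have h3 : (aff (-r⁻¹) (r⁻¹ • x) (h b) : Sm n) y
          = op n (q b) Γ ((-r⁻¹) • y + r⁻¹ • x)
          - MvPolynomial.eval (fun i => ξ i) (q b) * γ ((-r⁻¹) • y + r⁻¹ • x) := rfl
      rw [h3, Real.enorm_eq_ofReal_abs]
      have h4 : ((D b).toNNReal : ℝ≥0∞) = ENNReal.ofReal (D b) := rfl
      rw [h4, ← ENNReal.ofReal_mul' (by positivity)]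
      exact ENNReal.ofReal_le_ofReal h1
    · have h5 : (aff (-r⁻¹) (r⁻¹ • x) (h b) : Sm n) y = 0 := by
        have h6 : op n (q b) Γ ((-r⁻¹) • y + r⁻¹ • x) = 0 :=
          op_eq_zero_of_notMem _ fun h' => hy (hγ (hΓt h'))
        have h7 : γ ((-r⁻¹) • y + r⁻¹ • x) = 0 := image_eq_zero_of_notMem_tsupport fun h' =>
          hy (hγ h')
        rw [aff_apply, hh, Sm.sub_apply, Sm.smul_apply, h6, h7]
        simp
      rw [h5]
      simp
  have key : ∑ b, MvPolynomial.eval (fun i => ξ i) (q b) * ℓ b (aff (-r⁻¹) (r⁻¹ • x) γ)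
      = - ∑ b, ℓ b (aff (-r⁻¹) (r⁻¹ • x) (h b)) := by
    have h1 := hℓ.ann l q hq (aff (-r⁻¹) (r⁻¹ • x) Γ) (hasCompactSupport_aff hr' _ hΓc)
    have h2 : ∀ b, op n (q b) (aff (-r⁻¹) (r⁻¹ • x) Γ)
        = (-r⁻¹) ^ (l + 1) •
        (aff (-r⁻¹) (r⁻¹ • x) (h b)
          + MvPolynomial.eval (fun i => ξ i) (q b) • aff (-r⁻¹) (r⁻¹ • x) γ) := by
      intro b
      rw [op_aff (hq.1 b), hh, map_sub, map_smul, sub_add_cancel]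
    have hγa := hasCompactSupport_aff hr' (r⁻¹ • x) hγc
    have hha : ∀ b, HasCompactSupport (aff (-r⁻¹) (r⁻¹ • x) (h b) : Euc n → ℝ) := fun b =>
      hasCompactSupport_aff hr' _ (hhc b)
    have h3 : ∀ b, ℓ b ((-r⁻¹) ^ (l + 1) • (aff (-r⁻¹) (r⁻¹ • x) (h b)
          + MvPolynomial.eval (fun i => ξ i) (q b) • aff (-r⁻¹) (r⁻¹ • x) γ))
        = (-r⁻¹) ^ (l + 1) * (ℓ b (aff (-r⁻¹) (r⁻¹ • x) (h b))
          + MvPolynomial.eval (fun i => ξ i) (q b) * ℓ b (aff (-r⁻¹) (r⁻¹ • x) γ)) := by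
      intro b
      rw [hℓ.smul b _ _ (Sm.hasCompactSupport_add (hha b) (Sm.hasCompactSupport_smul _ hγa)),
        hℓ.add b _ _ (hha b) (Sm.hasCompactSupport_smul _ hγa), hℓ.smul b _ _ hγa]
    simp only [h2, h3] at h1
    rw [← Finset.mul_sum, Finset.sum_add_distrib] at h1
    have h4 := (mul_eq_zero.mp h1).resolve_left (pow_ne_zero _ hr')
    linarith
  rw [key, enorm_neg]
  calc ‖∑ b, ℓ b (aff (-r⁻¹) (r⁻¹ • x) (h b))‖ₑ
      ≤ ∑ b, ‖ℓ b (aff (-r⁻¹) (r⁻¹ • x) (h b))‖ₑ := enorm_sum_le _ _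
    _ ≤ ∑ b, (D b).toNNReal * ∫⁻ y in ball x r, ENNReal.ofReal (‖y - z‖ / r) ∂ν := by
        refine Finset.sum_le_sum fun b _ => ?_
        refine (hℓ.bound b _ (hasCompactSupport_aff hr' _ (hhc b))).trans ?_
        rw [← lintegral_const_mul' _ _ ENNReal.coe_ne_top, ← lintegral_indicator measurableSet_ball]
        exact lintegral_mono (hhb b)
    _ = _ := by
        rw [← Finset.sum_mul]
        push_cast
        rfl

/-- Cocancelling functionals see bumps only through their first moments. -/
theorem cocancel [Fintype C] [DecidableEq B] [DecidableEq C] {k : ℕ}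
    {a : Matrix B C (MvPolynomial (Fin n) ℝ)}
    (hk : ∀ b c, (a b c).IsHomogeneous k) (ha : Ell a) (hc : Canc a) {γ : Sm n}
    (hγ : tsupport (γ : Euc n → ℝ) ⊆ closedBall 0 2⁻¹) (b : B) :
    ∃ K : ℝ≥0, ∀ ν ℓ, Cocancelling a ν ℓ → ∀ x r, 0 < r → ∀ z ∈ ball x r,
      ‖ℓ b (aff (-r⁻¹) (r⁻¹ • x) γ)‖ₑ
        ≤ K * ∫⁻ y in ball x r, ENNReal.ofReal (‖y - z‖ / r) ∂ν := by
  have key : ∀ w : B → ℝ, ∃ K : ℝ≥0, ∀ ν ℓ, Cocancelling a ν ℓ → ∀ x r, 0 < r → ∀ z ∈ ball x r,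
      ‖∑ b, w b * ℓ b (aff (-r⁻¹) (r⁻¹ • x) γ)‖ₑ
        ≤ K * ∫⁻ y in ball x r, ENNReal.ofReal (‖y - z‖ / r) ∂ν := by
    intro w
    have hw : w ∈ Submodule.span ℝ {w : B → ℝ | ∃ l q, Annih a l q ∧ ∃ ξ : Euc n,
      w = fun b => MvPolynomial.eval (fun i => ξ i) (q b)} := by
      rw [span_annih hk ha hc]
      trivial
    induction hw using Submodule.span_induction with
    | mem w hw =>
      obtain ⟨l, q, hq, ξ, rfl⟩ := hw
      exact cocancel_annih hq ξ hγ
    | zero => exact ⟨0, by simp⟩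
    | add v w _ _ hv hw =>
      obtain ⟨K1, h1⟩ := hv
      obtain ⟨K2, h2⟩ := hw
      refine ⟨K1 + K2, fun ν ℓ hℓ x r hr z hz => ?_⟩
      simp only [Pi.add_apply, add_mul, Finset.sum_add_distrib, ENNReal.coe_add]
      exact (enorm_add_le _ _).trans (add_le_add (h1 ν ℓ hℓ x r hr z hz) (h2 ν ℓ hℓ x r hr z hz))
    | smul c v _ hv =>
      obtain ⟨K1, h1⟩ := hv
      refine ⟨‖c‖₊ * K1, fun ν ℓ hℓ x r hr z hz => ?_⟩
      simp only [Pi.smul_apply, smul_eq_mul, mul_assoc, ← Finset.mul_sum, ENNReal.coe_mul]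
      rw [enorm_mul]
      exact mul_le_mul_right (h1 ν ℓ hℓ x r hr z hz) _
  obtain ⟨K, hK⟩ := key (Pi.single b 1)
  refine ⟨K, fun ν ℓ hℓ x r hr z hz => ?_⟩
  simpa [Pi.single_apply] using hK ν ℓ hℓ x r hr z hz

end

noncomputable section

open scoped NNReal

theorem sum_min_geometric {θ ρ : ℝ} (hθ : 1 < θ) (hρ : ρ < 1) {u v : ℕ → ℝ}
    (hu : ∀ i, u (i + 1) = θ * u i) (hv : ∀ i, v (i + 1) = ρ * v i) (hu0 : ∀ i, 0 ≤ u i)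
    (hv0 : ∀ i, 0 ≤ v i) (huv : ∀ i, u i ≤ 1 ∨ v i ≤ 1) (L : ℕ) :
    ∑ i ∈ Finset.range L, min (u i) (v i) ≤ θ / (θ - 1) + 1 / (1 - ρ) := by
  have h1 : 0 < θ - 1 := by linarith
  have h2 : 0 < 1 - ρ := by linarith
  have key : ∀ L, ∑ i ∈ Finset.range L, min (u i) (v i)
      ≤ min (u L) θ / (θ - 1) + (1 - min 1 (v L)) / (1 - ρ) := by
    intro L
    induction L with
    | zero =>
      have : 0 ≤ min (u 0) θ := le_min (hu0 0) (by linarith)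
      have : 0 ≤ 1 - min 1 (v 0) := by linarith [min_le_left 1 (v 0)]
      simp only [Finset.range_zero, Finset.sum_empty]
      positivity
    | succ L ih =>
      rw [Finset.sum_range_succ]
      by_cases h : u L ≤ 1
      · have h3 : min (u (L + 1)) θ = θ * u L := by
          rw [hu]; exact min_eq_left (by nlinarith)
        have h4 : min (u L) θ = u L := min_eq_left (by linarith)
        have h5 : min 1 (v (L + 1)) ≤ min 1 (v L) := by
          rw [hv]; exact min_le_min le_rfl (by nlinarith [hv0 L])
        rw [h3]
        rw [h4] at ih
        have h6 : θ * u L / (θ - 1) = u L / (θ - 1) + u L := by field_simp; ring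
        have h7 : (1 - min 1 (v L)) / (1 - ρ) ≤ (1 - min 1 (v (L + 1))) / (1 - ρ) := by gcongr
        linarith [min_le_left (u L) (v L)]
      · have h' := (huv L).resolve_left h
        push Not at h
        have h3 : min (u (L + 1)) θ = θ := by
          rw [hu]; exact min_eq_right (by nlinarith)
        have h5 : min 1 (v (L + 1)) = ρ * v L := by
          rw [hv]; exact min_eq_right (by nlinarith [hv0 L])
        have h6 : min 1 (v L) = v L := min_eq_right h'
        have h7 : min (u L) θ / (θ - 1) ≤ θ / (θ - 1) := by
          gcongr; exact min_le_right _ _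
        rw [h6] at ih
        rw [h3, h5]
        have h8 : (1 - ρ * v L) / (1 - ρ) = (1 - v L) / (1 - ρ) + v L := by field_simp; ring
        linarith [min_le_right (u L) (v L)]
  refine (key L).trans ?_
  gcongr
  · exact min_le_right _ _
  · linarith [le_min zero_le_one (hv0 L)]

/-- An interpolation inequality for weighted sums of bounded sequences. -/
theorem sum_rpow_interpolation {θ p p₀ : ℝ} (hθ : 1 < θ) (hp₀ : 1 < p₀) (hp : p₀ < p) :
    ∃ C : ℝ, 0 ≤ C ∧ ∀ (b : ℕ → ℝ) (M : ℝ), 0 < M → (∀ i, 0 ≤ b i) → (∀ i, b i ≤ M) → ∀ L,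
      (∑ i ∈ Finset.range L, θ ^ i * b i) ^ p
        ≤ C * M ^ (p - p₀) * ∑ i ∈ Finset.range L, (θ ^ p) ^ i * b i ^ p₀ := by
  have hθ0 : 0 < θ := by linarith
  set δ := p / p₀ - 1 with hδ
  have hδ0 : 0 < δ := by rw [hδ, sub_pos, lt_div_iff₀ (by linarith)]; linarith
  set ρ := θ ^ (-δ) with hρ
  have hρ1 : ρ < 1 := Real.rpow_lt_one_of_one_lt_of_neg hθ (by linarith)
  set D := θ / (θ - 1) + 1 / (1 - ρ) with hD
  have hD0 : 0 ≤ D := by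
    have : 0 < θ - 1 := by linarith
    have : 0 < 1 - ρ := by linarith
    positivity
  refine ⟨D ^ p, by positivity, fun b M hM hb hbM L => ?_⟩
  set E := ∑ i ∈ Finset.range L, (θ ^ p) ^ i * b i ^ p₀ with hE
  have hterm : ∀ i, 0 ≤ (θ ^ p) ^ i * b i ^ p₀ := fun i => by
    have := hb i
    positivity
  have hiE : ∀ i ∈ Finset.range L, (θ ^ p) ^ i * b i ^ p₀ ≤ E := fun i hi =>
    Finset.single_le_sum (f := fun i => (θ ^ p) ^ i * b i ^ p₀) (fun i _ => hterm i) hi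
  have hE0 : 0 ≤ E := Finset.sum_nonneg fun i _ => hterm i
  rcases hE0.eq_or_lt with hE0 | hE0
  · have : ∑ i ∈ Finset.range L, θ ^ i * b i = 0 := by
      refine Finset.sum_eq_zero fun i hi => ?_
      have h1 := le_antisymm (hE0 ▸ hiE i hi) (hterm i)
      have h2 : b i ^ p₀ = 0 := (mul_eq_zero.mp h1).resolve_left (by positivity)
      rw [(Real.rpow_eq_zero (hb i) (by linarith)).mp h2, mul_zero]
    rw [this, ← hE0, Real.zero_rpow (by linarith), mul_zero]
  have hp0' : 0 < p := by linarith
  set X := E ^ (1 / p) * M ^ (1 - p₀ / p) with hX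
  have hX0 : 0 < X := by positivity
  have hXp : X ^ p = M ^ (p - p₀) * E := by
    rw [hX, Real.mul_rpow (by positivity) (by positivity), ← Real.rpow_mul hE0.le,
      ← Real.rpow_mul hM.le, one_div_mul_cancel hp0'.ne', Real.rpow_one, mul_comm]
    congr 2
    field_simp
  have hXδ : X ^ (1 + δ) = E ^ (1 / p₀) * M ^ δ := by
    rw [hX, Real.mul_rpow (by positivity) (by positivity), ← Real.rpow_mul hE0.le,
      ← Real.rpow_mul hM.le, hδ]
    congr 2 <;> field_simp <;> ring
  set u : ℕ → ℝ := fun i => M * θ ^ i / X with hu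
  have hu0 : ∀ i, 0 < u i := fun i => by positivity
  have hmin : ∀ i ∈ Finset.range L, θ ^ i * b i ≤ X * min (u i) (u i ^ (-δ)) := by
    intro i hi
    rw [mul_min_of_nonneg _ _ hX0.le]
    refine le_min ?_ ?_
    · rw [hu]
      simp only
      rw [mul_div_cancel₀ _ hX0.ne', mul_comm]
      gcongr
      exact hbM i
    · have h1 : θ ^ i * b i * (M * θ ^ i) ^ δ ≤ X ^ (1 + δ) := by
        rw [hXδ, Real.mul_rpow hM.le (by positivity), mul_left_comm (θ ^ i * b i), mul_comm]
        gcongr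
        have h2 := Real.rpow_le_rpow (hterm i) (hiE i hi) (by positivity : 0 ≤ 1 / p₀)
        refine le_trans (le_of_eq ?_) h2
        rw [Real.mul_rpow (by positivity) (by have := hb i; positivity), ← Real.rpow_mul (hb i),
          mul_one_div_cancel (by linarith), Real.rpow_one, mul_right_comm]
        congr 1
        rw [← Real.rpow_natCast θ i, ← Real.rpow_natCast (θ ^ p) i, ← Real.rpow_mul hθ0.le,
          ← Real.rpow_mul hθ0.le, ← Real.rpow_mul hθ0.le, ← Real.rpow_add hθ0, hδ]
        congr 1
        field_simp
        ring
      rw [hu]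
      simp only
      rw [Real.div_rpow (by positivity) hX0.le, Real.rpow_neg (by positivity), Real.rpow_neg hX0.le,
        div_inv_eq_mul, inv_mul_eq_div, mul_div_assoc', ← Real.rpow_one_add' hX0.le (by positivity),
        le_div_iff₀ (by positivity)]
      exact h1
  have hsum : ∑ i ∈ Finset.range L, θ ^ i * b i ≤ D * X := by
    refine (Finset.sum_le_sum hmin).trans ?_
    rw [← Finset.mul_sum, mul_comm]
    gcongr
    refine sum_min_geometric hθ hρ1 (fun i => ?_) (fun i => ?_) (fun i => (hu0 i).le)
      (fun i => (Real.rpow_pos_of_pos (hu0 i) _).le) (fun i => ?_) L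
    · rw [hu]; simp only; rw [pow_succ]; ring
    · have : u (i + 1) = θ * u i := by rw [hu]; simp only; rw [pow_succ]; ring
      rw [this, Real.mul_rpow hθ0.le (hu0 i).le]
    · rcases le_total (u i) 1 with h | h
      · exact Or.inl h
      · exact Or.inr (Real.rpow_le_one_of_one_le_of_nonpos h (by linarith))
  calc _ ≤ (D * X) ^ p := by
        refine Real.rpow_le_rpow (Finset.sum_nonneg fun i _ => ?_) hsum hp0'.le
        have := hb i
        positivity
    _ = _ := by rw [Real.mul_rpow hD0 hX0.le, hXp, mul_assoc]

end

noncomputable section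

open scoped NNReal

theorem rpow_sub_one_mul_sub_le {q a b : ℝ} (hq0 : 0 < q) (hq1 : q ≤ 1) (hb : 0 ≤ b)
    (hba : b ≤ a) : a ^ (q - 1) * (a - b) ≤ (a ^ q - b ^ q) / q := by
  rcases (hb.trans hba).eq_or_lt with ha | ha
  · obtain rfl : b = 0 := le_antisymm (ha ▸ hba) hb
    simp [← ha]
  have h := rpow_one_add_le_one_add_mul_self (s := b / a - 1)
    (by have := div_nonneg hb ha.le; linarith) hq0.le hq1
  rw [add_sub_cancel, Real.div_rpow hb ha.le, div_le_iff₀ (by positivity)] at h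
  rw [le_div_iff₀ hq0, Real.rpow_sub_one ha.ne']
  have : a ^ q / a * (a - b) * q = a ^ q - (1 + q * (b / a - 1)) * a ^ q := by
    field_simp; ring
  linarith

theorem sum_rpow_mul_le {q : ℝ} (hq0 : 0 < q) (hq1 : q < 1) {a d : ℕ → ℝ} (ha : ∀ i, 0 ≤ a i)
    (hanti : ∀ i, a (i + 1) ≤ a i) (hd0 : ∀ i, 0 ≤ d i) (hd : ∀ i, d i ≤ 2 * a i)
    (hrec : ∀ i, d i ≤ d (i + 1) / 2 + 2 * (a i - a (i + 1))) (L : ℕ) :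
    ∑ i ∈ Finset.range L, a i ^ (q - 1) * d i ≤ (4 / q + 2) * a 0 ^ q := by
  set e : ℕ → ℝ := fun i => a i ^ (q - 1) * d i with he
  have hstep : ∀ i, e i ≤ e (i + 1) / 2 + 2 / q * (a i ^ q - a (i + 1) ^ q) := by
    intro i
    have h1 := rpow_sub_one_mul_sub_le hq0 hq1.le (ha (i + 1)) (hanti i)
    have h2 : 0 ≤ a i ^ (q - 1) := Real.rpow_nonneg (ha i) _
    have h3 : a i ^ (q - 1) * d (i + 1) ≤ e (i + 1) := by
      rcases (ha (i + 1)).eq_or_lt with h | h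
      · have : d (i + 1) = 0 := le_antisymm (by simpa [← h] using hd (i + 1)) (hd0 _)
        simp [he, this]
      · exact mul_le_mul_of_nonneg_right
          (Real.rpow_le_rpow_of_nonpos h (hanti i) (by linarith)) (hd0 _)
    have h4 : e i ≤ a i ^ (q - 1) * (d (i + 1) / 2 + 2 * (a i - a (i + 1))) := by
      exact mul_le_mul_of_nonneg_left (hrec i) h2
    have h5 : 2 / q * (a i ^ q - a (i + 1) ^ q) = 2 * ((a i ^ q - a (i + 1) ^ q) / q) := by ring
    rw [h5]
    linarith
  have hsum : ∀ L, ∑ i ∈ Finset.range L, e i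
      ≤ (∑ i ∈ Finset.range L, e i + e L - e 0) / 2 + 2 / q * (a 0 ^ q - a L ^ q) := by
    intro L
    induction L with
    | zero => simp
    | succ L ih =>
      rw [Finset.sum_range_succ]
      have := hstep L
      linarith
  have hea : ∀ i, e i ≤ 2 * a i ^ q := by
    intro i
    rcases (ha i).eq_or_lt with h | h
    · have : d i = 0 := le_antisymm (by simpa [← h] using hd i) (hd0 _)
      simp only [he, this, mul_zero]
      have := Real.rpow_nonneg (ha i) q
      linarith
    · calc e i ≤ a i ^ (q - 1) * (2 * a i) :=
            mul_le_mul_of_nonneg_left (hd i) (Real.rpow_nonneg (ha i) _)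
        _ = 2 * a i ^ q := by rw [Real.rpow_sub_one h.ne']; field_simp
  have hanti' : a L ^ q ≤ a 0 ^ q :=
    Real.rpow_le_rpow (ha L) (antitone_nat_of_succ_le hanti (Nat.zero_le L)) hq0.le
  have he0 : 0 ≤ e 0 := mul_nonneg (Real.rpow_nonneg (ha 0) _) (hd0 0)
  have hL : 0 ≤ a L ^ q := Real.rpow_nonneg (ha L) _
  have h6 : 2 / q * (a 0 ^ q - a L ^ q) ≤ 2 / q * a 0 ^ q := by gcongr; linarith
  have h7 : 4 / q = 2 * (2 / q) := by ring
  rw [h7]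
  linarith [hsum L, hea L]

variable {n : ℕ}

/-- The mean distance of `m` restricted to `ball x r` from the point `z`, in units of `r`. -/
def meanDist (m : Measure (Euc n)) (r : ℝ) (x z : Euc n) : ℝ≥0∞ :=
  ∫⁻ y in ball x r, ENNReal.ofReal (‖y - z‖ / r) ∂m

theorem meanDist_le {m : Measure (Euc n)} {r : ℝ} (hr : 0 < r) {x z : Euc n} (hz : z ∈ ball x r) :
    meanDist m r x z ≤ 2 * m (ball x r) := by
  rw [← setLIntegral_const]
  refine setLIntegral_mono measurable_const fun y hy => ?_
  refine ENNReal.ofReal_le_of_le_toReal ?_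
  rw [ENNReal.toReal_ofNat]
  rw [div_le_iff₀ hr, ← dist_eq_norm]
  rw [mem_ball] at hy hz
  linarith [dist_triangle_right y z x]

theorem measurable_meanDist (m : Measure (Euc n)) [SFinite m] (r : ℝ) :
    Measurable (fun w : Euc n × Euc n => meanDist m r w.1 w.2) := by
  have : ∀ w : Euc n × Euc n, meanDist m r w.1 w.2 =
      ∫⁻ y, Set.indicator {t : (Euc n × Euc n) × Euc n | dist t.2 t.1.1 < r}
        (fun t => ENNReal.ofReal (‖t.2 - t.1.2‖ / r)) (w, y) ∂m := by
    intro w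
    rw [meanDist, ← lintegral_indicator measurableSet_ball]
    rfl
  simp_rw [this]
  refine Measurable.lintegral_prod_right' (f := fun t : (Euc n × Euc n) × Euc n => _) ?_
  refine Measurable.indicator (by fun_prop) ?_
  exact (isOpen_lt (by fun_prop) (by fun_prop)).measurableSet

theorem measurable_measure_ball (m : Measure (Euc n)) [SFinite m] (r : ℝ) :
    Measurable (fun x : Euc n => m (ball x r)) := by
  have : MeasurableSet {t : Euc n × Euc n | dist t.2 t.1 < r} :=
    (isOpen_lt (by fun_prop) (by fun_prop)).measurableSet
  exact measurable_measure_prodMk_left this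

theorem sum_meanDist_le {q : ℝ} (hq0 : 0 < q) (hq1 : q < 1) (m : Measure (Euc n))
    [IsFiniteMeasure m] (z : Euc n) {s : Euc n} (hs : ‖s‖ < 1) (L : ℕ) :
    ∑ i ∈ Finset.range L, (m (ball (z - (2⁻¹ : ℝ) ^ i • s) (2⁻¹ ^ i))).toReal ^ (q - 1) *
      (meanDist m (2⁻¹ ^ i) (z - (2⁻¹ : ℝ) ^ i • s) z).toReal
      ≤ (4 / q + 2) * (m Set.univ).toReal ^ q := by
  have hr : ∀ i, (0 : ℝ) < 2⁻¹ ^ i := fun i => by positivity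
  set N : ℕ → Set (Euc n) := fun i => ball (z - (2⁻¹ : ℝ) ^ i • s) (2⁻¹ ^ i) with hN
  have hz : ∀ i, z ∈ N i := fun i => by
    rw [hN, mem_ball, dist_eq_norm, sub_sub_cancel, norm_smul, Real.norm_of_nonneg (hr i).le]
    have := hr i
    nlinarith
  have hsub : ∀ i, N (i + 1) ⊆ N i := fun i => by
    refine ball_subset_ball' ?_
    rw [dist_eq_norm, sub_sub_sub_cancel_left, ← sub_smul, norm_smul, pow_succ,
      Real.norm_of_nonneg (by have := hr i; linarith)]
    have := hr i
    nlinarith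
  have hfin : ∀ i, meanDist m (2⁻¹ ^ i) (z - (2⁻¹ : ℝ) ^ i • s) z ≠ ⊤ := fun i =>
    ((meanDist_le (hr i) (hz i)).trans_lt
      (ENNReal.mul_lt_top (by simp) (measure_lt_top _ _))).ne
  refine (sum_rpow_mul_le hq0 hq1 (a := fun i => (m (N i)).toReal)
    (d := fun i => (meanDist m (2⁻¹ ^ i) (z - (2⁻¹ : ℝ) ^ i • s) z).toReal)
    (fun _ => ENNReal.toReal_nonneg) (fun i => ?_) (fun _ => ENNReal.toReal_nonneg)
    (fun i => ?_) (fun i => ?_) L).trans ?_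
  · exact ENNReal.toReal_mono (measure_ne_top _ _) (measure_mono (hsub i))
  · have := ENNReal.toReal_mono (by finiteness) (meanDist_le (m := m) (hr i) (hz i))
    rwa [ENNReal.toReal_mul] at this
  · have h1 : meanDist m (2⁻¹ ^ i) (z - (2⁻¹ : ℝ) ^ i • s) z
        ≤ 2⁻¹ * meanDist m (2⁻¹ ^ (i + 1)) (z - (2⁻¹ : ℝ) ^ (i + 1) • s) z
          + 2 * m (N i \ N (i + 1)) := by
      have hdis : Disjoint (N (i + 1)) (N i \ N (i + 1)) := Set.disjoint_sdiff_right
      have hU : N i = N (i + 1) ∪ (N i \ N (i + 1)) := (Set.union_sdiff_cancel (hsub i)).symm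
      have : meanDist m (2⁻¹ ^ i) (z - (2⁻¹ : ℝ) ^ i • s) z
        = ∫⁻ y in N i, ENNReal.ofReal (‖y - z‖ / 2⁻¹ ^ i) ∂m := rfl
      rw [this, hU, lintegral_union (measurableSet_ball.diff measurableSet_ball) hdis, ← hU]
      refine add_le_add (le_of_eq ?_) ?_
      · rw [meanDist, ← lintegral_const_mul _ (by fun_prop)]
        refine lintegral_congr fun y => ?_
        rw [show (2⁻¹ : ℝ≥0∞) = ENNReal.ofReal 2⁻¹ by
          rw [ENNReal.ofReal_inv_of_pos two_pos, ENNReal.ofReal_ofNat],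
          ← ENNReal.ofReal_mul (by norm_num)]
        congr 1
        rw [pow_succ]
        field_simp
      · rw [← setLIntegral_const]
        refine setLIntegral_mono measurable_const fun y hy => ?_
        refine ENNReal.ofReal_le_of_le_toReal ?_
        rw [ENNReal.toReal_ofNat]
        rw [div_le_iff₀ (hr i), ← dist_eq_norm]
        have h2 := hz i
        have h3 := hy.1
        simp only [hN, mem_ball] at h2 h3
        linarith [dist_triangle_right y z (z - (2⁻¹ : ℝ) ^ i • s)]
    have h2 := ENNReal.toReal_mono
      (by have := hfin (i + 1); finiteness) h1
    rw [ENNReal.toReal_add (by have := hfin (i + 1); finiteness) (by finiteness),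
      ENNReal.toReal_mul, ENNReal.toReal_mul,
      measure_sdiff (hsub i) measurableSet_ball.nullMeasurableSet (measure_ne_top _ _),
      ENNReal.toReal_sub_of_le (measure_mono (hsub i)) (measure_ne_top _ _)] at h2
    simp only [ENNReal.toReal_inv, ENNReal.toReal_ofNat] at h2
    linarith
  · have : 0 < 4 / q + 2 := by positivity
    gcongr
    · exact measure_ne_top _ _
    · exact Set.subset_univ _

theorem lintegral_comp_sub_smul {r : ℝ} (hr : 0 < r) (z : Euc n) {g : Euc n → ℝ≥0∞}
    (hg : Measurable g) :
    ENNReal.ofReal (r ^ n) * ∫⁻ s, g (z - r • s) = ∫⁻ x, g x := by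
  have h1 : ∫⁻ s, g (z - r • s) = ∫⁻ t, g (z - t) ∂(Measure.map (r • ·) (volume : Measure (Euc n))) :=
    by rw [lintegral_map (by fun_prop) (by fun_prop)]
  rw [h1, Measure.map_addHaar_smul _ hr.ne', lintegral_smul_measure, finrank_euclideanSpace,
    Fintype.card_fin, lintegral_sub_left_eq_self g z, smul_eq_mul, ← mul_assoc,
    ← ENNReal.ofReal_mul (by positivity), abs_of_pos (by positivity), mul_inv_cancel₀ (by positivity),
    ENNReal.ofReal_one, one_mul]

theorem lintegral_lintegral_ball {r : ℝ} (hr : 0 < r) (m : Measure (Euc n)) [SFinite m]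
    {g : Euc n → Euc n → ℝ≥0∞} (hg : Measurable (Function.uncurry g)) :
    ∫⁻ x, ∫⁻ z in ball x r, g x z ∂m =
      ENNReal.ofReal (r ^ n) * ∫⁻ z, (∫⁻ s in ball 0 1, g (z - r • s) z) ∂m := by
  set G : Euc n × Euc n → ℝ≥0∞ :=
    Set.indicator {t : Euc n × Euc n | dist t.2 t.1 < r} (Function.uncurry g) with hG
  have hGm : Measurable G :=
    hg.indicator (isOpen_lt (by fun_prop) (by fun_prop)).measurableSet
  have h1 : ∀ x, ∫⁻ z in ball x r, g x z ∂m = ∫⁻ z, G (x, z) ∂m := fun x => by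
    rw [← lintegral_indicator measurableSet_ball]; rfl
  simp_rw [h1]
  rw [lintegral_lintegral_swap (f := fun x z => G (x, z)) hGm.aemeasurable, ← lintegral_const_mul']
  · refine lintegral_congr fun z => ?_
    rw [← lintegral_comp_sub_smul hr z (g := fun x => G (x, z)) (hGm.comp measurable_prodMk_right),
      ← lintegral_indicator measurableSet_ball]
    congr 1
    refine lintegral_congr fun s => ?_
    simp only [hG, Set.indicator, Set.mem_ofPred_eq, mem_ball, dist_zero_right, Function.uncurry]
    congr 1
    rw [dist_eq_norm, sub_sub_cancel, norm_smul, Real.norm_of_nonneg hr.le, mul_lt_iff_lt_one_right hr]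
  · exact ENNReal.ofReal_ne_top

theorem rpow_le_lintegral_ball {q : ℝ} (hq0 : 0 < q) (K : ℝ≥0) {m : Measure (Euc n)}
    [IsFiniteMeasure m] {r : ℝ} (hr : 0 < r) {x : Euc n} {b : ℝ≥0∞}
    (hb : ∀ z ∈ ball x r, b ≤ K * meanDist m r x z) :
    b ^ (1 + q) ≤ (2 * K) ^ q * K * ∫⁻ z in ball x r, ENNReal.ofReal
      ((m (ball x r)).toReal ^ (q - 1) * (meanDist m r x z).toReal) ∂m := by
  set M := m (ball x r) with hM
  have hMt : M ≠ ⊤ := measure_ne_top _ _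
  have hbM : b ≤ 2 * K * M := by
    refine (hb x (mem_ball_self hr)).trans ?_
    rw [mul_comm 2, mul_assoc]
    exact mul_le_mul_right (meanDist_le hr (mem_ball_self hr)) _
  rcases eq_or_ne M 0 with h0 | h0
  · have : b = 0 := by simpa [h0] using hbM
    rw [this, ENNReal.zero_rpow_of_pos (by linarith)]
    exact bot_le
  have h1 : b * M ≤ K * ∫⁻ z in ball x r, meanDist m r x z ∂m := by
    rw [hM, ← setLIntegral_const, ← lintegral_const_mul' _ _ (by simp)]
    exact setLIntegral_mono' measurableSet_ball hb
  have h2 : ∀ z ∈ ball x r, ENNReal.ofReal (M.toReal ^ (q - 1) * (meanDist m r x z).toReal)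
      = M ^ (q - 1) * meanDist m r x z := by
    intro z hz
    have : meanDist m r x z ≠ ⊤ :=
      ((meanDist_le hr hz).trans_lt (ENNReal.mul_lt_top (by simp) hMt.lt_top)).ne
    rw [ENNReal.ofReal_mul (by positivity), ENNReal.ofReal_toReal this,
      ← ENNReal.ofReal_rpow_of_pos (ENNReal.toReal_pos h0 hMt), ENNReal.ofReal_toReal hMt]
  rw [setLIntegral_congr_fun measurableSet_ball h2, lintegral_const_mul' _ _ (by finiteness)]
  calc b ^ (1 + q) = b ^ q * b := by
        rw [add_comm, ENNReal.rpow_add_of_nonneg _ _ hq0.le zero_le_one, ENNReal.rpow_one]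
    _ ≤ (2 * K * M) ^ q * b := by gcongr
    _ = (2 * K) ^ q * M ^ (q - 1) * (b * M) := by
        rw [ENNReal.mul_rpow_of_nonneg _ _ hq0.le]
        have : M ^ q = M ^ (q - 1) * M := by
          rw [← ENNReal.rpow_one M, ← ENNReal.rpow_mul, ← ENNReal.rpow_mul, one_mul, one_mul,
            ← ENNReal.rpow_add _ _ h0 hMt, sub_add_cancel]
        rw [this]; ring
    _ ≤ (2 * K) ^ q * M ^ (q - 1) * (K * ∫⁻ z in ball x r, meanDist m r x z ∂m) := by gcongr
    _ = _ := by ring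

theorem tsum_lintegral_rpow_le (n : ℕ) {q : ℝ} (hq0 : 0 < q) (hq1 : q < 1) (K : ℝ≥0) :
    ∃ C : ℝ≥0, ∀ (m : Measure (Euc n)) [IsFiniteMeasure m] (b : ℕ → Euc n → ℝ≥0∞),
      (∀ i, Measurable (b i)) →
      (∀ i x, ∀ z ∈ ball x ((2⁻¹ : ℝ) ^ i), b i x ≤ K * meanDist m (2⁻¹ ^ i) x z) →
      ∑' i, 2 ^ (i * n) * ∫⁻ x, b i x ^ (1 + q) ≤ C * m Set.univ ^ (1 + q) := by
  set A := volume (ball (0 : Euc n) 1) with hA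
  have hAt : A ≠ ⊤ := measure_ball_lt_top.ne
  refine ⟨(2 * K) ^ q * K * (Real.toNNReal (4 / q + 2) * A.toNNReal), fun m _ b hbm hb => ?_⟩
  refine ENNReal.tsum_le_of_sum_range_le fun L => ?_
  set g : ℕ → Euc n → Euc n → ℝ≥0∞ := fun i x z => ENNReal.ofReal
      ((m (ball x (2⁻¹ ^ i))).toReal ^ (q - 1) * (meanDist m (2⁻¹ ^ i) x z).toReal) with hg
  have hgm : ∀ i, Measurable (Function.uncurry (g i)) := fun i => by
    have h1 := measurable_meanDist m (2⁻¹ ^ i)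
    have h2 : Measurable fun w : Euc n × Euc n => m (ball w.1 (2⁻¹ ^ i)) :=
      (measurable_measure_ball m (2⁻¹ ^ i)).comp measurable_fst
    exact ((h2.ennreal_toReal.pow_const _).mul h1.ennreal_toReal).ennreal_ofReal
  have hterm : ∀ i, 2 ^ (i * n) * ∫⁻ x, b i x ^ (1 + q)
      ≤ (2 * K) ^ q * K * ∫⁻ z, (∫⁻ s in ball 0 1, g i (z - (2⁻¹ : ℝ) ^ i • s) z) ∂m := by
    intro i
    have hr : (0 : ℝ) < 2⁻¹ ^ i := by positivity
    calc 2 ^ (i * n) * ∫⁻ x, b i x ^ (1 + q)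
        ≤ 2 ^ (i * n) * ∫⁻ x, (2 * K) ^ q * K * ∫⁻ z in ball x (2⁻¹ ^ i), g i x z ∂m := by
          gcongr with x
          exact rpow_le_lintegral_ball hq0 K hr (hb i x)
      _ = _ := by
          rw [lintegral_const_mul' _ _ (by finiteness), lintegral_lintegral_ball hr m (hgm i),
            ← mul_assoc, ← mul_assoc, mul_comm (2 ^ (i * n)), mul_assoc _ (2 ^ (i * n))]
          have : (2 : ℝ≥0∞) ^ (i * n) * ENNReal.ofReal (((2⁻¹ : ℝ) ^ i) ^ n) = 1 := by
            rw [← ENNReal.ofReal_ofNat, ← ENNReal.ofReal_pow (by norm_num),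
              ← ENNReal.ofReal_mul (by positivity), ← pow_mul, ← mul_pow]
            norm_num
          rw [this, mul_one]
  have hgm' : ∀ i, Measurable fun w : Euc n × Euc n => g i (w.1 - (2⁻¹ : ℝ) ^ i • w.2) w.1 :=
    fun i => (hgm i).comp (f := fun w : Euc n × Euc n => (w.1 - (2⁻¹ : ℝ) ^ i • w.2, w.1))
      (by fun_prop)
  have hgm'' : ∀ i, Measurable fun z => ∫⁻ s in ball 0 1, g i (z - (2⁻¹ : ℝ) ^ i • s) z :=
    fun i => Measurable.lintegral_prod_right' (ν := (volume : Measure (Euc n)).restrict (ball 0 1))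
      (f := fun w : Euc n × Euc n => g i (w.1 - (2⁻¹ : ℝ) ^ i • w.2) w.1) (hgm' i)
  have hgs : ∀ (z : Euc n), ∀ s ∈ ball (0 : Euc n) 1,
      ∑ i ∈ Finset.range L, g i (z - (2⁻¹ : ℝ) ^ i • s) z
        ≤ ENNReal.ofReal ((4 / q + 2) * (m Set.univ).toReal ^ q) := fun z s hs => by
    rw [← ENNReal.ofReal_sum_of_nonneg (fun i _ => by positivity)]
    exact ENNReal.ofReal_le_ofReal (sum_meanDist_le hq0 hq1 m z (by simpa using hs) L)
  clear_value g
  calc _ ≤ ∑ i ∈ Finset.range L, (2 * K) ^ q * K *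
          ∫⁻ z, (∫⁻ s in ball 0 1, g i (z - (2⁻¹ : ℝ) ^ i • s) z) ∂m :=
        Finset.sum_le_sum fun i _ => hterm i
    _ = (2 * K) ^ q * K * ∫⁻ z, (∫⁻ s in ball 0 1,
          ∑ i ∈ Finset.range L, g i (z - (2⁻¹ : ℝ) ^ i • s) z) ∂m := by
        rw [← Finset.mul_sum, ← lintegral_finsetSum]
        · congr 1
          refine lintegral_congr fun z => ?_
          rw [lintegral_finsetSum]
          exact fun i _ => (hgm' i).comp (measurable_prodMk_left (x := z))
        · exact fun i _ => hgm'' i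
    _ ≤ (2 * K) ^ q * K * ∫⁻ z, (∫⁻ s in ball (0 : Euc n) 1,
          ENNReal.ofReal ((4 / q + 2) * (m Set.univ).toReal ^ q)) ∂m := by
        refine mul_le_mul' le_rfl (lintegral_mono fun z => ?_)
        exact setLIntegral_mono measurable_const (hgs z)
    _ = _ := by
        rw [setLIntegral_const, lintegral_const, ENNReal.ofReal_mul (by positivity),
          ← ENNReal.ofReal_rpow_of_nonneg ENNReal.toReal_nonneg hq0.le,
          ENNReal.ofReal_toReal (measure_ne_top m _), add_comm 1 q,
          ENNReal.rpow_add_of_nonneg _ _ hq0.le zero_le_one, ENNReal.rpow_one]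
        push_cast
        rw [ENNReal.coe_toNNReal hAt, ENNReal.coe_rpow_of_nonneg _ hq0.le]
        push_cast
        rw [ENNReal.ofReal]
        ring

/-- The endpoint estimate for multiscale sums of functions controlled by the mean oscillation
of a measure. -/
theorem lintegral_tsum_rpow_le (n : ℕ) {θ p : ℝ} (hθ : 1 < θ) (hp : 1 < p) (hθp : θ ^ p = 2 ^ n)
    (K : ℝ≥0) :
    ∃ C : ℝ≥0, ∀ (m : Measure (Euc n)) [IsFiniteMeasure m] (b : ℕ → Euc n → ℝ≥0∞),
      (∀ i, Measurable (b i)) →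
      (∀ i x, ∀ z ∈ ball x ((2⁻¹ : ℝ) ^ i), b i x ≤ K * meanDist m (2⁻¹ ^ i) x z) →
      ∫⁻ x, (∑' i, ENNReal.ofReal (θ ^ i) * b i x) ^ p ≤ C * m Set.univ ^ p := by
  obtain ⟨q, hq0, hq1, hqp⟩ : ∃ q : ℝ, 0 < q ∧ q < 1 ∧ 1 + q < p := by
    refine ⟨min 2⁻¹ ((p - 1) / 2), lt_min (by norm_num) (by linarith), ?_, ?_⟩
    · exact (min_le_left _ _).trans_lt (by norm_num)
    · linarith [min_le_right (2⁻¹ : ℝ) ((p - 1) / 2)]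
  obtain ⟨C₁, hC₁⟩ := tsum_lintegral_rpow_le n hq0 hq1 K
  obtain ⟨C₂, hC₂0, hC₂⟩ := sum_rpow_interpolation hθ (by linarith : 1 < 1 + q) hqp
  have hp0 : 0 < p := by linarith
  have hq0' : 0 < 1 + q := by linarith
  refine ⟨C₂.toNNReal * (2 * (K + 1)) ^ (p - (1 + q)) * C₁, fun m _ b hbm hb => ?_⟩
  have hbM : ∀ i x, b i x ≤ 2 * (K + 1) * m Set.univ := by
    intro i x
    have hr : (0 : ℝ) < 2⁻¹ ^ i := by positivity
    calc b i x ≤ K * (2 * m (ball x (2⁻¹ ^ i))) :=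
          (hb i x x (mem_ball_self hr)).trans
            (mul_le_mul_right (meanDist_le hr (mem_ball_self hr)) _)
      _ ≤ (K + 1) * (2 * m Set.univ) := by gcongr; exacts [le_self_add, Set.subset_univ _]
      _ = _ := by ring
  rcases eq_or_ne (m Set.univ) 0 with h0 | h0
  · have : ∀ i x, b i x = 0 := fun i x => by simpa [h0] using hbM i x
    simp [this, ENNReal.zero_rpow_of_pos hp0]
  set M := 2 * (K + 1) * m Set.univ with hM
  have hmt := measure_ne_top m Set.univ
  have hMt : M ≠ ⊤ := by finiteness
  have hM0 : M ≠ 0 := mul_ne_zero (by simp) h0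
  have hbt : ∀ i x, b i x ≠ ⊤ := fun i x => ((hbM i x).trans_lt hMt.lt_top).ne
  have hpt : ∀ x, (∑' i, ENNReal.ofReal (θ ^ i) * b i x) ^ p
      ≤ C₂.toNNReal * M ^ (p - (1 + q)) * ∑' i, 2 ^ (i * n) * b i x ^ (1 + q) := by
    intro x
    rw [← ENNReal.le_rpow_inv_iff hp0]
    refine ENNReal.tsum_le_of_sum_range_le fun L => ?_
    rw [ENNReal.le_rpow_inv_iff hp0]
    have h := hC₂ (fun i => (b i x).toReal) M.toReal (ENNReal.toReal_pos hM0 hMt)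
      (fun i => ENNReal.toReal_nonneg) (fun i => ENNReal.toReal_mono hMt (hbM i x)) L
    have h1 : ∑ i ∈ Finset.range L, ENNReal.ofReal (θ ^ i) * b i x
        = ENNReal.ofReal (∑ i ∈ Finset.range L, θ ^ i * (b i x).toReal) := by
      rw [ENNReal.ofReal_sum_of_nonneg (fun i _ => by positivity)]
      refine Finset.sum_congr rfl fun i _ => ?_
      rw [ENNReal.ofReal_mul (by positivity), ENNReal.ofReal_toReal (hbt i x)]
    rw [h1, ENNReal.ofReal_rpow_of_nonneg (Finset.sum_nonneg fun i _ => by positivity) hp0.le]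
    refine (ENNReal.ofReal_le_ofReal h).trans ?_
    rw [ENNReal.ofReal_mul (by positivity), ENNReal.ofReal_mul hC₂0,
      ← ENNReal.ofReal_rpow_of_pos (ENNReal.toReal_pos hM0 hMt), ENNReal.ofReal_toReal hMt,
      ENNReal.ofReal_sum_of_nonneg (fun i _ => by positivity)]
    refine mul_le_mul' le_rfl ?_
    refine le_trans (le_of_eq (Finset.sum_congr rfl fun i _ => ?_)) (ENNReal.sum_le_tsum _)
    rw [ENNReal.ofReal_mul (by positivity), ← ENNReal.ofReal_rpow_of_nonneg
      ENNReal.toReal_nonneg hq0'.le, ENNReal.ofReal_toReal (hbt i x), hθp, ← pow_mul, mul_comm n,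
      ENNReal.ofReal_pow (by norm_num), ENNReal.ofReal_ofNat]
  calc _ ≤ ∫⁻ x, C₂.toNNReal * M ^ (p - (1 + q)) * ∑' i, 2 ^ (i * n) * b i x ^ (1 + q) :=
        lintegral_mono hpt
    _ = C₂.toNNReal * M ^ (p - (1 + q)) * ∑' i, 2 ^ (i * n) * ∫⁻ x, b i x ^ (1 + q) := by
        rw [lintegral_const_mul' _ _ (by finiteness), lintegral_tsum
          (fun i => (((hbm i).pow_const _).const_mul _).aemeasurable)]
        simp_rw [lintegral_const_mul _ ((hbm _).pow_const (1 + q))]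
    _ ≤ C₂.toNNReal * M ^ (p - (1 + q)) * (C₁ * m Set.univ ^ (1 + q)) := by
        gcongr; exact hC₁ m b hbm hb
    _ = _ := by
        have hpq : 0 ≤ p - (1 + q) := by linarith
        rw [hM, ENNReal.mul_rpow_of_nonneg _ _ hpq]
        push_cast
        rw [ENNReal.coe_rpow_of_nonneg _ hpq]
        push_cast
        have : m Set.univ ^ p = m Set.univ ^ (p - (1 + q)) * m Set.univ ^ (1 + q) := by
          rw [← ENNReal.rpow_add_of_nonneg _ _ hpq hq0'.le]; congr 1; ring
        rw [this]; ring

end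

noncomputable section

open scoped NNReal

variable {n : ℕ}

open scoped FourierTransform SchwartzMap LineDeriv

theorem fourier_dilate (Ψ Ψ' : 𝓢(Euc n, ℂ)) (i : ℕ)
    (h : ∀ x, Ψ' x = ((2 : ℝ) ^ i) ^ n • Ψ ((2 : ℝ) ^ i • x)) (ξ : Euc n) :
    𝓕 Ψ' ξ = 𝓕 Ψ (((2 : ℝ) ^ i)⁻¹ • ξ) := by
  rw [SchwartzMap.fourier_coe, SchwartzMap.fourier_coe, Real.fourier_eq, Real.fourier_eq]
  have := Measure.integral_comp_smul (volume : Measure (Euc n))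
    (fun v : Euc n => Real.fourierChar (-inner ℝ v (((2 : ℝ) ^ i)⁻¹ • ξ)) • Ψ v) ((2 : ℝ) ^ i)
  rw [finrank_euclideanSpace_fin, abs_of_nonneg (by positivity),
    eq_comm, inv_smul_eq_iff₀ (by positivity)] at this
  rw [this, ← integral_smul]
  congr 1
  funext v
  rw [h, inner_smul_left, inner_smul_right, smul_comm]
  simp

theorem norm_fourier_le (Ψ : 𝓢(Euc n, ℂ)) (h0 : ∫ x, Ψ x = 0) :
    ∃ C, 0 ≤ C ∧ ∀ ξ, ‖𝓕 Ψ ξ‖ ≤ C * ‖ξ‖ ∧ ‖ξ‖ * ‖𝓕 Ψ ξ‖ ≤ C := by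
  obtain ⟨C1, hC1, h1⟩ := (𝓕 Ψ).decay 1 0
  obtain ⟨C2, hC2, h2⟩ := (𝓕 Ψ).decay 0 1
  refine ⟨max C1 C2, hC1.le.trans (le_max_left _ _), fun ξ => ⟨?_, ?_⟩⟩
  · have hz : 𝓕 Ψ 0 = 0 := by
      rw [SchwartzMap.fourier_coe, Real.fourier_eq, ← h0]
      simp
    have := Convex.norm_image_sub_le_of_norm_fderiv_le (𝕜 := ℝ) (f := ⇑(𝓕 Ψ : 𝓢(Euc n, ℂ)))
      (C := C2)
      (s := Set.univ) (x := 0) (y := ξ) (fun x _ => SchwartzMap.differentiableAt _)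
      (fun x _ => by simpa [norm_iteratedFDeriv_one] using h2 x) convex_univ trivial trivial
    rw [hz, sub_zero, sub_zero] at this
    exact this.trans (by gcongr; exact le_max_right _ _)
  · have := h1 ξ
    rw [norm_iteratedFDeriv_zero, pow_one] at this
    exact this.trans (le_max_left _ _)

theorem sum_norm_fourier_le (Ψ : 𝓢(Euc n, ℂ)) (h0 : ∫ x, Ψ x = 0) :
    ∃ C, 0 ≤ C ∧ ∀ M ξ, ∑ i ∈ Finset.range M, ‖𝓕 Ψ (((2 : ℝ) ^ i)⁻¹ • ξ)‖ ≤ C := by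
  obtain ⟨C, hC, h⟩ := norm_fourier_le Ψ h0
  refine ⟨C * (2 / (2 - 1) + 1 / (1 - 2⁻¹)), by norm_num; positivity, fun M ξ => ?_⟩
  rcases eq_or_ne ξ 0 with rfl | hξ
  · have hz : 𝓕 Ψ 0 = 0 := by
      have := (h 0).1
      rwa [norm_zero, mul_zero, norm_le_zero_iff] at this
    simp only [smul_zero, hz, norm_zero, Finset.sum_const_zero]
    norm_num; positivity
  have hξ' : 0 < ‖ξ‖ := norm_pos_iff.mpr hξ
  refine le_trans (Finset.sum_le_sum fun i _ => ?_) (Finset.mul_sum _ _ _ |>.symm.trans_le <|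
    mul_le_mul_of_nonneg_left (sum_min_geometric (θ := 2) (ρ := 2⁻¹)
      (u := fun i => 2 ^ i * ‖ξ‖⁻¹) (v := fun i => (2⁻¹) ^ i * ‖ξ‖) (by norm_num) (by norm_num)
      (fun i => by ring) (fun i => by ring) ?_ ?_ ?_ M) hC)
  · obtain ⟨h1, h2⟩ := h (((2 : ℝ) ^ i)⁻¹ • ξ)
    rw [norm_smul, norm_inv, norm_pow, Real.norm_two] at h1 h2
    rw [← mul_min_of_nonneg _ _ hC |>.symm]
    refine le_min ?_ (by rwa [inv_pow])
    rw [← div_eq_mul_inv, mul_div_assoc', le_div_iff₀ hξ', mul_comm]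
    rw [inv_mul_eq_div, div_mul_eq_mul_div, div_le_iff₀ (by positivity)] at h2
    linarith
  all_goals first | (intro i; positivity) | skip
  intro i
  rcases le_total (2 ^ i * ‖ξ‖⁻¹) 1 with h | h
  · exact Or.inl h
  · right
    rw [← div_eq_mul_inv, le_div_iff₀ hξ', one_mul] at h
    rw [inv_pow, inv_mul_eq_div]
    exact div_le_one_of_le₀ h (by positivity)

theorem norm_toLp_sq (f : 𝓢(Euc n, ℂ)) : ‖f.toLp 2‖ ^ 2 = ∫ x, ‖f x‖ ^ 2 := by
  rw [SchwartzMap.norm_toLp' (by simp) (by simp)]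
  simp only [ENNReal.toReal_ofNat, Real.rpow_ofNat]
  rw [← Real.rpow_natCast, ← Real.rpow_mul (by positivity)]
  norm_num

theorem norm_sum_convolution_le (Ψ : ℕ → 𝓢(Euc n, ℂ))
    (hΨ : ∀ i x, Ψ i x = ((2 : ℝ) ^ i) ^ n • Ψ 0 ((2 : ℝ) ^ i • x)) (h0 : ∫ x, Ψ 0 x = 0) :
    ∃ C, 0 ≤ C ∧ ∀ M (g : 𝓢(Euc n, ℂ)),
      ‖(∑ i ∈ Finset.range M,
        SchwartzMap.convolution (ContinuousLinearMap.mul ℂ ℂ) (Ψ i) g).toLp 2‖ ≤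
          C * ‖g.toLp 2‖ := by
  obtain ⟨C, hC, h⟩ := sum_norm_fourier_le (Ψ 0) h0
  refine ⟨C, hC, fun M g => ?_⟩
  refine le_of_sq_le_sq ?_ (by positivity)
  rw [mul_pow, norm_toLp_sq, norm_toLp_sq, ← SchwartzMap.integral_norm_sq_fourier,
    ← SchwartzMap.integral_norm_sq_fourier g, ← integral_const_mul]
  have key : ∀ ξ, ‖𝓕 (∑ i ∈ Finset.range M,
      SchwartzMap.convolution (ContinuousLinearMap.mul ℂ ℂ) (Ψ i) g) ξ‖ ^ 2 ≤
      C ^ 2 * ‖𝓕 g ξ‖ ^ 2 := by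
    intro ξ
    have e : 𝓕 (∑ i ∈ Finset.range M,
        SchwartzMap.convolution (ContinuousLinearMap.mul ℂ ℂ) (Ψ i) g) ξ =
        (∑ i ∈ Finset.range M, 𝓕 (Ψ 0) (((2 : ℝ) ^ i)⁻¹ • ξ)) * 𝓕 g ξ := by
      have : 𝓕 (∑ i ∈ Finset.range M,
          SchwartzMap.convolution (ContinuousLinearMap.mul ℂ ℂ) (Ψ i) g) =
          ∑ i ∈ Finset.range M, 𝓕 (SchwartzMap.convolution
            (ContinuousLinearMap.mul ℂ ℂ) (Ψ i) g) :=
        map_sum (FourierTransform.fourierCLM ℂ 𝓢(Euc n, ℂ)) _ _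
      rw [this, sum_apply, Finset.sum_mul]
      refine Finset.sum_congr rfl fun i _ => ?_
      rw [SchwartzMap.fourier_convolution, SchwartzMap.pairing_apply_apply,
        fourier_dilate (Ψ 0) (Ψ i) i (hΨ i)]
      rfl
    rw [e, norm_mul, mul_pow]
    gcongr
    exact (norm_sum_le _ _).trans (h M ξ)
  have hi : ∀ f : 𝓢(Euc n, ℂ), Integrable fun x => ‖f x‖ ^ 2 := fun f =>
    (f.memLp 2 volume).integrable_norm_pow (by simp)
  exact integral_mono (hi _) ((hi _).const_mul _) key


/-- The `L¹`-normalised dilation of a smooth function. -/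
def dil (i : ℕ) (ψ : Sm n) : Sm n := ((2 : ℝ) ^ i) ^ n • aff ((2 : ℝ) ^ i) 0 ψ

theorem dil_apply (i : ℕ) (ψ : Sm n) (x : Euc n) :
    dil i ψ x = ((2 : ℝ) ^ i) ^ n * ψ ((2 : ℝ) ^ i • x) := by
  rw [dil, Sm.smul_apply, aff_apply, add_zero]

theorem norm_convolution_dilate_le (Ψ : ℕ → 𝓢(Euc n, ℂ))
    (hΨ : ∀ i x, Ψ i x = ((2 : ℝ) ^ i) ^ n • Ψ 0 ((2 : ℝ) ^ i • x)) (h0 : ∫ x, Ψ 0 x = 0)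
    (g : 𝓢(Euc n, ℂ)) :
    ∃ C, ∀ i y, ‖SchwartzMap.convolution (ContinuousLinearMap.mul ℂ ℂ) (Ψ i) g y‖ ≤
      C * 2⁻¹ ^ i := by
  obtain ⟨L, hL, h2⟩ := g.decay 0 1
  have hlip : ∀ x y, ‖g x - g y‖ ≤ L * ‖x - y‖ := fun x y =>
    Convex.norm_image_sub_le_of_norm_fderiv_le (𝕜 := ℝ) (s := Set.univ)
      (fun x _ => g.differentiableAt)
      (fun x _ => by simpa [norm_iteratedFDeriv_one] using h2 x) convex_univ trivial trivial
  have hi : Integrable fun x => ‖x‖ ^ 1 * ‖Ψ 0 x‖ := (Ψ 0).integrable_pow_mul volume 1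
  refine ⟨L * ∫ x, ‖x‖ ^ 1 * ‖Ψ 0 x‖, fun i y => ?_⟩
  rw [SchwartzMap.convolution_apply, convolution_def]
  simp only [ContinuousLinearMap.mul_apply']
  have e1 := Measure.integral_comp_smul (volume : Measure (Euc n))
    (fun t : Euc n => Ψ 0 t * g (y - ((2 : ℝ) ^ i)⁻¹ • t)) ((2 : ℝ) ^ i)
  rw [finrank_euclideanSpace_fin, abs_of_nonneg (by positivity), eq_comm,
    inv_smul_eq_iff₀ (by positivity), ← integral_smul] at e1
  have e2 : ∫ t, Ψ i t * g (y - t) = ∫ t, Ψ 0 t * g (y - ((2 : ℝ) ^ i)⁻¹ • t) := by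
    rw [e1]
    refine integral_congr_ae (ae_of_all _ fun t => ?_)
    simp only [hΨ i t]
    rw [inv_smul_smul₀ (by positivity), smul_mul_assoc]
  have hb : Integrable fun t => Ψ 0 t * g (y - ((2 : ℝ) ^ i)⁻¹ • t) := by
    obtain ⟨B, -, hB⟩ := g.decay 0 0
    refine ((Ψ 0).integrable (μ := volume)).mul_bdd (c := B) ?_ (ae_of_all _ fun t => ?_)
    · exact (g.continuous.comp (by fun_prop)).aestronglyMeasurable
    · simpa using hB (y - ((2 : ℝ) ^ i)⁻¹ • t)
  have e3 : ∫ t, Ψ i t * g (y - t) =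
      ∫ t, Ψ 0 t * (g (y - ((2 : ℝ) ^ i)⁻¹ • t) - g y) := by
    rw [e2]
    simp only [mul_sub]
    rw [integral_sub hb (((Ψ 0).integrable).mul_const _), integral_mul_const, h0]
    simp
  rw [e3]
  refine (norm_integral_le_of_norm_le ((hi.const_mul L).mul_const (2⁻¹ ^ i))
    (ae_of_all _ fun t => ?_)).trans_eq ?_
  · rw [norm_mul]
    have := hlip (y - ((2 : ℝ) ^ i)⁻¹ • t) y
    rw [sub_sub_cancel_left, norm_neg, norm_smul, norm_inv, norm_pow, Real.norm_two,
      ← inv_pow] at this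
    calc _ ≤ ‖Ψ 0 t‖ * (L * (2⁻¹ ^ i * ‖t‖)) := by
            gcongr; rwa [← inv_pow]
      _ = _ := by ring
  · rw [integral_mul_const, integral_const_mul]

theorem exists_complexify (f : Sm n) (hf : HasCompactSupport (f : Euc n → ℝ)) :
    ∃ F : 𝓢(Euc n, ℂ), ∀ x, F x = (f x : ℂ) :=
  ⟨(hf.comp_left (g := Complex.ofReal) rfl).toSchwartzMap
    (Complex.ofRealCLM.contDiff.comp (Sm.smooth f)), fun _ => rfl⟩

theorem exists_complexify_dil (ψ : Sm n) (hψ : HasCompactSupport (ψ : Euc n → ℝ)) (i : ℕ) :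
    ∃ F : 𝓢(Euc n, ℂ), ∀ x, F x = (dil i ψ (-x) : ℂ) := by
  have h1 : -(2 : ℝ) ^ i ≠ 0 := by simp
  have h2 := hasCompactSupport_aff h1 0 hψ
  obtain ⟨F, hF⟩ := exists_complexify (((2 : ℝ) ^ i) ^ n • aff (-((2 : ℝ) ^ i)) 0 ψ)
    (Sm.hasCompactSupport_smul _ h2)
  refine ⟨F, fun x => ?_⟩
  rw [hF, dil_apply, Sm.smul_apply, aff_apply, add_zero, neg_smul, smul_neg]

theorem exists_weak_sum (ψ : Sm n) (hψ : HasCompactSupport (ψ : Euc n → ℝ)) (h0 : ∫ x, ψ x = 0)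
    {H : Euc n → ℝ} (hH1 : Integrable H) (hH2 : MemLp H 2) :
    ∃ S : Euc n → ℝ, MemLp S 2 ∧ ∀ g : Sm n, HasCompactSupport (g : Euc n → ℝ) →
      HasSum (fun i => ∫ y, H y * ∫ z, dil i ψ (z - y) * g z) (∫ z, S z * g z) := by
  choose Ψ hΨ using exists_complexify_dil ψ hψ
  have hs : ∀ i x, Ψ i x = ((2 : ℝ) ^ i) ^ n • Ψ 0 ((2 : ℝ) ^ i • x) := by
    intro i x
    rw [hΨ, hΨ, dil_apply, dil_apply]
    simp
  have hΨ0 : ∫ x, Ψ 0 x = 0 := by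
    simp only [hΨ, dil_apply]
    rw [integral_complex_ofReal, integral_const_mul]
    have := integral_neg_eq_self (fun x => ψ x) volume
    simp [this, h0]
  obtain ⟨C, hC, hbd⟩ := norm_sum_convolution_le Ψ hs hΨ0
  have hHc : MemLp (fun x => (H x : ℂ)) 2 := hH2.ofReal
  let L : ℕ → 𝓢(Euc n, ℂ) →ₗ[ℂ] ℂ := fun i =>
    ((innerSL ℂ hHc.toLp).comp ((SchwartzMap.toLpCLM ℂ ℂ 2 volume).comp
      (SchwartzMap.convolution (ContinuousLinearMap.mul ℂ ℂ) (Ψ i)))).toLinearMap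
  have hLe : ∀ i g, L i g = inner ℂ hHc.toLp
      ((SchwartzMap.convolution (ContinuousLinearMap.mul ℂ ℂ) (Ψ i) g).toLp 2) :=
    fun i g => rfl
  have hLi : ∀ i g, L i g = ∫ y, (H y : ℂ) *
      SchwartzMap.convolution (ContinuousLinearMap.mul ℂ ℂ) (Ψ i) g y := by
    intro i g
    rw [hLe, L2.inner_def]
    refine integral_congr_ae ?_
    filter_upwards [hHc.coeFn_toLp, SchwartzMap.coeFn_toLp
      (SchwartzMap.convolution (ContinuousLinearMap.mul ℂ ℂ) (Ψ i) g) 2 volume] with y h1 h2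
    rw [h1, h2]
    simp [mul_comm]
  have hsum : ∀ g, Summable fun i => L i g := by
    intro g
    obtain ⟨D, hD⟩ := norm_convolution_dilate_le Ψ hs hΨ0 g
    refine Summable.of_norm_bounded (g := fun i => (∫ y, ‖H y‖) * D * 2⁻¹ ^ i)
      ((summable_geometric_of_lt_one (by norm_num) (by norm_num)).mul_left _) fun i => ?_
    rw [hLi]
    refine (norm_integral_le_of_norm_le (hH1.norm.mul_const (D * 2⁻¹ ^ i))
      (ae_of_all _ fun y => ?_)).trans_eq ?_
    · rw [norm_mul, Complex.norm_real]
      gcongr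
      exact hD i y
    · rw [integral_mul_const, mul_assoc]
  let Λ : 𝓢(Euc n, ℂ) →ₗ[ℂ] ℂ :=
    { toFun := fun g => ∑' i, L i g
      map_add' := fun f g => by
        simp only [map_add]
        exact (hsum f).tsum_add (hsum g)
      map_smul' := fun c g => by
        simp only [map_smul]
        exact (hsum g).tsum_const_smul c }
  have hΛ : ∀ g, ‖Λ g‖ ≤ ‖hHc.toLp‖ * C * ‖SchwartzMap.toLpCLM ℂ ℂ 2 volume g‖ := by
    intro g
    refine le_of_tendsto (hsum g).hasSum.tendsto_sum_nat.norm (Eventually.of_forall fun M => ?_)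
    have : ∑ i ∈ Finset.range M, L i g = inner ℂ hHc.toLp ((∑ i ∈ Finset.range M,
        SchwartzMap.convolution (ContinuousLinearMap.mul ℂ ℂ) (Ψ i) g).toLp 2) := by
      rw [← SchwartzMap.toLpCLM_apply (𝕜 := ℂ), map_sum, inner_sum]
      rfl
    rw [this, mul_assoc]
    refine (norm_inner_le_norm _ _).trans ?_
    gcongr
    exact hbd M g
  have hdense : DenseRange (SchwartzMap.toLpCLM ℂ ℂ 2 (volume : Measure (Euc n))) :=
    SchwartzMap.denseRange_toLpCLM ENNReal.ofNat_ne_top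
  let T := Λ.extendOfNorm (SchwartzMap.toLpCLM ℂ ℂ 2 (volume : Measure (Euc n))).toLinearMap
  have hT : ∀ g : 𝓢(Euc n, ℂ), T (g.toLp 2) = Λ g := fun g =>
    LinearMap.extendOfNorm_eq hdense ⟨_, hΛ⟩ g
  let S' : Lp ℂ 2 (volume : Measure (Euc n)) := (InnerProductSpace.toDual ℂ _).symm T
  have hS' : ∀ g : 𝓢(Euc n, ℂ), Λ g = inner ℂ S' (g.toLp 2) := by
    intro g
    rw [← hT, InnerProductSpace.toDual_symm_apply]
  refine ⟨fun x => (S' x).re, (Lp.memLp S').re, fun g hg => ?_⟩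
  obtain ⟨G, hG⟩ := exists_complexify g hg
  have h1 : HasSum (fun i => (L i G).re) (Λ G).re :=
    Complex.hasSum_re (hsum G).hasSum
  have h2 : (Λ G).re = ∫ z, (S' z).re * g z := by
    rw [hS', L2.inner_def, ← RCLike.re_eq_complex_re, ← integral_re (L2.integrable_inner _ _)]
    refine integral_congr_ae ?_
    filter_upwards [SchwartzMap.coeFn_toLp G 2 volume] with y h2
    rw [h2, hG]
    simp [mul_comm]
  rw [h2] at h1
  convert h1 using 1
  funext i
  have h3 : ∀ y, SchwartzMap.convolution (ContinuousLinearMap.mul ℂ ℂ) (Ψ i) G y =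
      ((∫ z, dil i ψ (z - y) * g z : ℝ) : ℂ) := by
    intro y
    rw [SchwartzMap.convolution_apply, convolution_eq_swap, ← integral_complex_ofReal]
    refine integral_congr_ae (ae_of_all _ fun z => ?_)
    simp only [ContinuousLinearMap.mul_apply', hΨ, hG, neg_sub]
    push_cast
    rfl
  rw [hLi, ← RCLike.re_eq_complex_re]
  simp only [h3, ← Complex.ofReal_mul]
  rw [integral_complex_ofReal]
  simp

end

noncomputable section

open scoped NNReal

variable {n : ℕ}

theorem exists_bound_lipschitz (ψ : Sm n) (hψ : HasCompactSupport (ψ : Euc n → ℝ)) :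
    ∃ B, 0 ≤ B ∧ (∀ x, |ψ x| ≤ B) ∧ ∀ x y, |ψ x - ψ y| ≤ B * ‖x - y‖ := by
  obtain ⟨B1, h1⟩ := hψ.exists_bound_of_continuous (Sm.continuous ψ)
  obtain ⟨K, hK⟩ := (Sm.smooth ψ).lipschitzWith_of_hasCompactSupport hψ (by simp)
  refine ⟨max B1 K, (K.2).trans (le_max_right _ _), fun x => (h1 x).trans (le_max_left _ _),
    fun x y => ?_⟩
  have := hK.dist_le_mul x y
  rw [Real.dist_eq, dist_eq_norm] at this
  exact this.trans (by gcongr; exact le_max_right _ _)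

theorem abs_integral_mul_sub_le {f k : Euc n → ℝ} (hf : LocallyIntegrable f)
    (hk : AEStronglyMeasurable k) {M : ℝ} (hM : ∀ y, |k y| ≤ M) {x : Euc n} {ρ : ℝ}
    (hs : ∀ y, k y ≠ 0 → y ∈ closedBall x ρ) :
    |(∫ y, f y * k y) - f x * ∫ y, k y| ≤ M * ∫ y in closedBall x ρ, |f y - f x| := by
  have hfs : IntegrableOn f (closedBall x ρ) :=
    hf.integrableOn_isCompact (isCompact_closedBall x ρ)
  have hks : IntegrableOn k (closedBall x ρ) :=
    IntegrableOn.of_bound measure_closedBall_lt_top hk.restrict M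
      (ae_of_all _ fun y => hM y)
  have hfk : IntegrableOn (fun y => f y * k y) (closedBall x ρ) :=
    Integrable.mul_bdd hfs hk.restrict (c := M) (ae_of_all _ fun y => hM y)
  have e1 : ∫ y, k y = ∫ y in closedBall x ρ, k y :=
    (setIntegral_eq_integral_of_forall_compl_eq_zero fun y hy => by
      by_contra h; exact hy (hs y h)).symm
  have e2 : ∫ y, f y * k y = ∫ y in closedBall x ρ, f y * k y :=
    (setIntegral_eq_integral_of_forall_compl_eq_zero fun y hy => by
      by_contra h; exact hy (hs y (right_ne_zero_of_mul h))).symm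
  have hc : IntegrableOn (fun _ => f x) (closedBall x ρ) :=
    integrableOn_const measure_closedBall_lt_top.ne
  rw [e1, e2, ← integral_const_mul, ← integral_sub hfk (hks.const_mul _), ← integral_const_mul]
  rw [← Real.norm_eq_abs]
  refine norm_integral_le_of_norm_le ((hfs.sub hc).abs.const_mul M) (ae_of_all _ fun y => ?_)
  rw [← sub_mul, norm_mul, mul_comm, Real.norm_eq_abs, Real.norm_eq_abs]
  exact mul_le_mul_of_nonneg_right (hM y) (abs_nonneg _)

/-- Rescaled mean oscillation of a function about its value at a point. -/
def osc (f : Euc n → ℝ) (i : ℕ) (x : Euc n) : ℝ :=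
  ((2 : ℝ) ^ i) ^ n * ∫ y in closedBall x (2⁻¹ ^ i), |f y - f x|

theorem osc_nonneg (f : Euc n → ℝ) (i : ℕ) (x : Euc n) : 0 ≤ osc f i x :=
  mul_nonneg (by positivity) (integral_nonneg fun _ => abs_nonneg _)

theorem ae_tendsto_osc {f : Euc n → ℝ} (hf : LocallyIntegrable f) :
    ∀ᵐ x, Tendsto (fun i => osc f i x) atTop (𝓝 0) := by
  filter_upwards [IsUnifLocDoublingMeasure.ae_tendsto_average_norm_sub volume hf 1] with x hx
  have hδ : Tendsto (fun i : ℕ => (2⁻¹ : ℝ) ^ i) atTop (𝓝[>] 0) :=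
    tendsto_nhdsWithin_iff.mpr ⟨tendsto_pow_atTop_nhds_zero_of_lt_one (by norm_num) (by norm_num),
      Eventually.of_forall fun i => by simp⟩
  have := (hx (fun _ => x) _ hδ (Eventually.of_forall fun i => by simp)).const_mul
    (volume.real (closedBall (0 : Euc n) 1))
  rw [mul_zero] at this
  refine this.congr fun i => ?_
  rw [setAverage_eq, smul_eq_mul, ← mul_assoc, osc]
  congr 1
  rw [measureReal_def, measureReal_def, Measure.addHaar_closedBall' _ x (by positivity),
    ENNReal.toReal_mul, ENNReal.toReal_ofReal (by positivity), finrank_euclideanSpace_fin]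
  have h0 : (volume (closedBall (0 : Euc n) 1)).toReal ≠ 0 :=
    (ENNReal.toReal_pos (measure_closedBall_pos _ _ one_pos).ne'
      measure_closedBall_lt_top.ne).ne'
  field_simp
  simp

theorem abs_sub_sum_le {u t : ℕ → ℝ} {s C : ℝ} {ε : ℕ → ℝ} (hu : HasSum u s) (N : ℕ)
    (h1 : ∀ i < N, |u i - t i| ≤ C * 2⁻¹ ^ (N - i) * ε i)
    (h2 : ∀ i, |u (i + N)| ≤ C * 2⁻¹ ^ i * ε N) :
    |s - ∑ i ∈ Finset.range N, t i| ≤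
      C * (∑ i ∈ Finset.range N, 2⁻¹ ^ (N - i) * ε i + 2 * ε N) := by
  have hg := (summable_geometric_of_lt_one (r := (2⁻¹ : ℝ)) (by norm_num) (by norm_num))
  have e : s - ∑ i ∈ Finset.range N, t i =
      ∑ i ∈ Finset.range N, (u i - t i) + ∑' i, u (i + N) := by
    rw [← hu.tsum_eq, ← hu.summable.sum_add_tsum_nat_add N, Finset.sum_sub_distrib]
    ring
  rw [e, mul_add]
  refine (abs_add_le _ _).trans (add_le_add ?_ ?_)
  · refine (Finset.abs_sum_le_sum_abs _ _).trans ?_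
    rw [Finset.mul_sum]
    exact Finset.sum_le_sum fun i hi => by
      simpa [mul_assoc] using h1 i (Finset.mem_range.mp hi)
  · have := tsum_of_norm_bounded (f := fun i => u (i + N)) (g := fun i => C * ε N * 2⁻¹ ^ i)
      (hg.mul_left _).hasSum fun i => by
        rw [Real.norm_eq_abs]; exact (h2 i).trans_eq (by ring)
    rw [tsum_mul_left, tsum_geometric_of_lt_one (by norm_num) (by norm_num),
      Real.norm_eq_abs] at this
    exact this.trans_eq (by norm_num; ring)

theorem tendsto_sum_geometric_mul {ε : ℕ → ℝ} (h : Tendsto ε atTop (𝓝 0)) :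
    Tendsto (fun N => ∑ i ∈ Finset.range N, (2⁻¹ : ℝ) ^ (N - i) * ε i) atTop (𝓝 0) := by
  obtain ⟨B, hB⟩ := h.norm.bddAbove_range
  have hB' : ∀ i, |ε i| ≤ B := fun i => hB ⟨i, rfl⟩
  have key : Tendsto (fun N => ∑' m, if m < N then (2⁻¹ : ℝ) ^ (m + 1) * ε (N - 1 - m) else 0)
      atTop (𝓝 (∑' m : ℕ, (0 : ℝ))) := by
    refine tendsto_tsum_of_dominated_convergence (bound := fun m => 2⁻¹ ^ m * B)
      ((summable_geometric_of_lt_one (by norm_num) (by norm_num)).mul_right _) (fun m => ?_)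
      (Eventually.of_forall fun N m => ?_)
    · have h1 : Tendsto (fun N => (2⁻¹ : ℝ) ^ (m + 1) * ε (N - 1 - m)) atTop (𝓝 0) := by
        simpa using (h.comp ((tendsto_sub_atTop_nat m).comp
          (tendsto_sub_atTop_nat 1))).const_mul ((2⁻¹ : ℝ) ^ (m + 1))
      refine h1.congr' ?_
      filter_upwards [eventually_gt_atTop m] with N hN
      rw [if_pos hN]
    · have hB0 : 0 ≤ B := (abs_nonneg _).trans (hB' 0)
      split_ifs
      · rw [norm_mul, Real.norm_eq_abs, Real.norm_eq_abs, abs_of_nonneg (by positivity)]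
        gcongr ?_ * ?_
        · exact pow_le_pow_of_le_one (by norm_num) (by norm_num) (by omega)
        · exact hB' _
      · simpa using by positivity
  rw [tsum_zero] at key
  refine key.congr fun N => ?_
  rw [tsum_eq_sum (s := Finset.range N) (fun m hm => if_neg (by simpa using hm)),
    ← Finset.sum_range_reflect]
  refine Finset.sum_congr rfl fun i hi => ?_
  have := Finset.mem_range.mp hi
  rw [if_pos (by omega), show N - 1 - (N - 1 - i) = i by omega,
    show N - 1 - i + 1 = N - i by omega]


theorem abs_dil_le {ψ : Sm n} {B : ℝ} (h : ∀ x, |ψ x| ≤ B) (i : ℕ) (x : Euc n) :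
    |dil i ψ x| ≤ ((2 : ℝ) ^ i) ^ n * B := by
  rw [dil_apply, abs_mul, abs_of_nonneg (by positivity)]
  gcongr
  exact h _

theorem abs_dil_sub_le {ψ : Sm n} {B : ℝ} (h : ∀ x y, |ψ x - ψ y| ≤ B * ‖x - y‖) (i : ℕ)
    (x y : Euc n) : |dil i ψ x - dil i ψ y| ≤ ((2 : ℝ) ^ i) ^ n * B * (2 ^ i * ‖x - y‖) := by
  rw [dil_apply, dil_apply, ← mul_sub, abs_mul, abs_of_nonneg (by positivity), mul_assoc]
  gcongr
  refine (h _ _).trans_eq ?_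
  rw [← smul_sub, norm_smul, norm_pow, Real.norm_two]

theorem norm_le_of_dil_ne_zero {ψ : Sm n} (h : tsupport (ψ : Euc n → ℝ) ⊆ closedBall 0 2⁻¹)
    {i : ℕ} {x : Euc n} (hx : dil i ψ x ≠ 0) : ‖x‖ ≤ 2⁻¹ * 2⁻¹ ^ i := by
  rw [dil_apply] at hx
  have := h (subset_tsupport _ (right_ne_zero_of_mul hx))
  rw [mem_closedBall_zero_iff, norm_smul, norm_pow, Real.norm_two] at this
  rw [inv_pow, ← div_eq_mul_inv, le_div_iff₀ (by positivity)]
  linarith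

theorem integral_dil (ψ : Sm n) (i : ℕ) : ∫ x, dil i ψ x = ∫ x, ψ x := by
  simp only [dil_apply]
  rw [integral_const_mul, Measure.integral_comp_smul, finrank_euclideanSpace_fin,
    abs_of_nonneg (by positivity), smul_eq_mul, mul_inv_cancel_left₀ (by positivity)]

theorem hasCompactSupport_dil {ψ : Sm n} (h : HasCompactSupport (ψ : Euc n → ℝ)) (i : ℕ) :
    HasCompactSupport (dil i ψ : Euc n → ℝ) :=
  Sm.hasCompactSupport_smul _ (hasCompactSupport_aff (by positivity) _ h)

theorem integrable_dil {ψ : Sm n} (h : HasCompactSupport (ψ : Euc n → ℝ)) (i : ℕ) :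
    Integrable (dil i ψ : Euc n → ℝ) :=
  integrable_of_compactSupport (hasCompactSupport_dil h i)

theorem exists_mollifier (n : ℕ) : ∃ η : Sm n, tsupport (η : Euc n → ℝ) ⊆ closedBall 0 2⁻¹ ∧
    (∀ x, 0 ≤ η x) ∧ ∫ x, η x = 1 := by
  let f : ContDiffBump (0 : Euc n) := ⟨4⁻¹, 2⁻¹, by norm_num, by norm_num⟩
  exact ⟨⟨f.normed volume, f.contDiff_normed⟩, (f.tsupport_normed_eq (μ := volume)).subset,
    f.nonneg_normed, f.integral_normed⟩

/-- The function `y ↦ ∫ ψ_i (z - y) η_N (x - z) dz`. -/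
def mollified (ψ η : Sm n) (i N : ℕ) (x y : Euc n) : ℝ :=
  ∫ z, dil i ψ (z - y) * dil N η (x - z)

section mollified

variable {ψ η : Sm n}

theorem mollified_eq_convolution (ψ η : Sm n) (i N : ℕ) (x y : Euc n) : mollified ψ η i N x y =
    MeasureTheory.convolution (fun z => dil N η (x - z)) (fun z => dil i ψ (-z))
      (ContinuousLinearMap.mul ℝ ℝ) volume y := by
  rw [mollified, convolution_def]
  refine integral_congr_ae (ae_of_all _ fun z => ?_)
  simp [mul_comm]

theorem integrable_mollified (hψ : tsupport (ψ : Euc n → ℝ) ⊆ closedBall 0 2⁻¹)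
    (hη : tsupport (η : Euc n → ℝ) ⊆ closedBall 0 2⁻¹)
    (i N : ℕ) (x : Euc n) : Integrable (mollified ψ η i N x) := by
  rw [funext (mollified_eq_convolution ψ η i N x)]
  exact Integrable.integrable_convolution _
    ((integrable_dil (hasCompactSupport_of_subset hη) N).comp_sub_left x)
    (integrable_dil (hasCompactSupport_of_subset hψ) i).comp_neg

theorem integral_mollified (hψ : tsupport (ψ : Euc n → ℝ) ⊆ closedBall 0 2⁻¹)
    (hη : tsupport (η : Euc n → ℝ) ⊆ closedBall 0 2⁻¹)
    (i N : ℕ) (x : Euc n) :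
    ∫ y, mollified ψ η i N x y = (∫ y, ψ y) * ∫ y, η y := by
  rw [funext (mollified_eq_convolution ψ η i N x), integral_convolution _
    ((integrable_dil (hasCompactSupport_of_subset hη) N).comp_sub_left x)
    (integrable_dil (hasCompactSupport_of_subset hψ) i).comp_neg,
    integral_sub_left_eq_self (fun z => dil N η z), integral_neg_eq_self (fun z => dil i ψ z),
    integral_dil, integral_dil]
  simp [mul_comm]

theorem mem_closedBall_of_mollified_ne_zero (hψ : tsupport (ψ : Euc n → ℝ) ⊆ closedBall 0 2⁻¹)
    (hη : tsupport (η : Euc n → ℝ) ⊆ closedBall 0 2⁻¹)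
    {i N : ℕ} {x y : Euc n}
    (h : mollified ψ η i N x y ≠ 0) : y ∈ closedBall x (2⁻¹ ^ min i N) := by
  by_contra hy
  refine h (integral_eq_zero_of_ae (ae_of_all _ fun z => ?_))
  by_contra hz
  have h1 := norm_le_of_dil_ne_zero hψ (left_ne_zero_of_mul hz)
  have h2 := norm_le_of_dil_ne_zero hη (right_ne_zero_of_mul hz)
  apply hy
  rw [mem_closedBall, dist_comm, dist_eq_norm, ← sub_add_sub_cancel x z y]
  have h3 : (2⁻¹ : ℝ) ^ i ≤ 2⁻¹ ^ min i N :=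
    pow_le_pow_of_le_one (by norm_num) (by norm_num) (min_le_left _ _)
  have h4 : (2⁻¹ : ℝ) ^ N ≤ 2⁻¹ ^ min i N :=
    pow_le_pow_of_le_one (by norm_num) (by norm_num) (min_le_right _ _)
  exact (norm_add_le _ _).trans (by linarith)

theorem integrable_mollified_integrand (hψ : tsupport (ψ : Euc n → ℝ) ⊆ closedBall 0 2⁻¹)
    (hη : tsupport (η : Euc n → ℝ) ⊆ closedBall 0 2⁻¹)
    (i N : ℕ) (x y : Euc n) :
    Integrable fun z => dil i ψ (z - y) * dil N η (x - z) := by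
  obtain ⟨B, -, h1, -⟩ := exists_bound_lipschitz ψ (hasCompactSupport_of_subset hψ)
  exact ((integrable_dil (hasCompactSupport_of_subset hη) N).comp_sub_left x).bdd_mul
    ((Sm.continuous (dil i ψ)).comp (by fun_prop)).aestronglyMeasurable
    (ae_of_all _ fun z => abs_dil_le h1 i _)

theorem abs_mollified_sub_le (hψ : tsupport (ψ : Euc n → ℝ) ⊆ closedBall 0 2⁻¹)
    (hη : tsupport (η : Euc n → ℝ) ⊆ closedBall 0 2⁻¹)
    (hη0 : ∀ x, 0 ≤ η x) (hη1 : ∫ x, η x = 1) {B : ℝ} (hB : 0 ≤ B)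
    (hL : ∀ x y, |ψ x - ψ y| ≤ B * ‖x - y‖) {i N : ℕ} (hi : i ≤ N) (x y : Euc n) :
    |mollified ψ η i N x y - dil i ψ (x - y)| ≤ ((2 : ℝ) ^ i) ^ n * (B * 2⁻¹ ^ (N - i)) := by
  have hηi := (integrable_dil (hasCompactSupport_of_subset hη) N).comp_sub_left x
  have e1 : ∫ z, dil N η (x - z) = 1 := by
    rw [integral_sub_left_eq_self (fun z => dil N η z), integral_dil, hη1]
  have e : mollified ψ η i N x y - dil i ψ (x - y) =
      ∫ z, (dil i ψ (z - y) - dil i ψ (x - y)) * dil N η (x - z) := by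
    simp only [sub_mul]
    rw [integral_sub (integrable_mollified_integrand hψ hη i N x y) (hηi.const_mul _),
      integral_const_mul, e1, mul_one, mollified]
  rw [e, ← Real.norm_eq_abs]
  refine (norm_integral_le_of_norm_le (hηi.const_mul (((2 : ℝ) ^ i) ^ n * (B * 2⁻¹ ^ (N - i))))
    (ae_of_all _ fun z => ?_)).trans_eq (by rw [integral_const_mul, e1, mul_one])
  have h0 : 0 ≤ dil N η (x - z) := by rw [dil_apply]; exact mul_nonneg (by positivity) (hη0 _)
  rw [norm_mul, Real.norm_eq_abs, Real.norm_eq_abs, abs_of_nonneg h0]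
  rcases eq_or_ne (dil N η (x - z)) 0 with hz | hz
  · rw [hz, mul_zero, mul_zero]
  have h2 := norm_le_of_dil_ne_zero hη hz
  refine mul_le_mul_of_nonneg_right ((abs_dil_sub_le hL i _ _).trans ?_) h0
  rw [sub_sub_sub_cancel_right, norm_sub_rev, mul_assoc]
  gcongr
  calc 2 ^ i * ‖x - z‖ ≤ 2 ^ i * 2⁻¹ ^ N := by
        gcongr
        exact h2.trans (by linarith [show (0 : ℝ) ≤ 2⁻¹ ^ N by positivity])
    _ = 2⁻¹ ^ (N - i) := by
        rw [pow_sub₀ _ (by norm_num) hi]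
        simp [mul_comm]

theorem abs_mollified_le (hψ : tsupport (ψ : Euc n → ℝ) ⊆ closedBall 0 2⁻¹)
    (hη : tsupport (η : Euc n → ℝ) ⊆ closedBall 0 2⁻¹)
    (hψ0 : ∫ x, ψ x = 0) {B D : ℝ} (hB : 0 ≤ B)
    (hL : ∀ x y, |η x - η y| ≤ B * ‖x - y‖) (hD : ∫ x, |ψ x| ≤ D) (i N : ℕ) (x y : Euc n) :
    |mollified ψ η (i + N) N x y| ≤ ((2 : ℝ) ^ N) ^ n * (B * D * 2⁻¹ ^ i) := by
  have hψi := (integrable_dil (hasCompactSupport_of_subset hψ) (i + N)).comp_sub_right y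
  have e1 : ∫ z, dil (i + N) ψ (z - y) = 0 := by
    rw [integral_sub_right_eq_self (fun z => dil (i + N) ψ z), integral_dil, hψ0]
  have e2 : ∫ z, |dil (i + N) ψ (z - y)| = ∫ z, |ψ z| := by
    rw [integral_sub_right_eq_self (fun z => |dil (i + N) ψ z|)]
    simp only [dil_apply, abs_mul]
    rw [integral_const_mul, Measure.integral_comp_smul volume (fun z => |ψ z|),
      finrank_euclideanSpace_fin, abs_of_nonneg (by positivity), abs_of_nonneg (by positivity),
      smul_eq_mul, mul_inv_cancel_left₀ (by positivity)]
  have e : mollified ψ η (i + N) N x y =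
      ∫ z, dil (i + N) ψ (z - y) * (dil N η (x - z) - dil N η (x - y)) := by
    simp only [mul_sub]
    rw [integral_sub (integrable_mollified_integrand hψ hη (i + N) N x y) (hψi.mul_const _),
      integral_mul_const, e1, zero_mul, sub_zero, mollified]
  rw [e, ← Real.norm_eq_abs]
  refine (norm_integral_le_of_norm_le (hψi.abs.mul_const (((2 : ℝ) ^ N) ^ n * (B * 2⁻¹ ^ i)))
    (ae_of_all _ fun z => ?_)).trans ?_
  · rw [norm_mul, Real.norm_eq_abs, Real.norm_eq_abs]
    rcases eq_or_ne (dil (i + N) ψ (z - y)) 0 with hz | hz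
    · rw [hz, abs_zero, zero_mul, zero_mul]
    have h2 := norm_le_of_dil_ne_zero hψ hz
    gcongr
    refine (abs_dil_sub_le hL N _ _).trans ?_
    rw [sub_sub_sub_cancel_left, norm_sub_rev, mul_assoc]
    gcongr
    calc 2 ^ N * ‖z - y‖ ≤ 2 ^ N * 2⁻¹ ^ (i + N) := by
          gcongr
          exact h2.trans (by linarith [show (0 : ℝ) ≤ 2⁻¹ ^ (i + N) by positivity])
      _ = 2⁻¹ ^ i := by
          rw [pow_add, mul_left_comm, ← mul_pow]
          norm_num
  · rw [integral_mul_const, e2]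
    calc (∫ z, |ψ z|) * (((2 : ℝ) ^ N) ^ n * (B * 2⁻¹ ^ i)) ≤
          D * (((2 : ℝ) ^ N) ^ n * (B * 2⁻¹ ^ i)) := by gcongr
      _ = _ := by ring

end mollified


theorem ae_tendsto_sum_dil (ψ : Sm n) (hψ : tsupport (ψ : Euc n → ℝ) ⊆ closedBall 0 2⁻¹)
    (h0 : ∫ x, ψ x = 0) {H : Euc n → ℝ} (hH1 : Integrable H) (hH2 : MemLp H 2) :
    ∀ᵐ x, ∃ l, Tendsto (fun N => ∑ i ∈ Finset.range N, ∫ y, H y * dil i ψ (x - y))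
      atTop (𝓝 l) := by
  have hψc := hasCompactSupport_of_subset hψ
  obtain ⟨S, hS, hsum⟩ := exists_weak_sum ψ hψc h0 hH1 hH2
  obtain ⟨η, hη, hη0, hη1⟩ := exists_mollifier n
  have hηc := hasCompactSupport_of_subset hη
  obtain ⟨B, hB, hψb, hψL⟩ := exists_bound_lipschitz ψ hψc
  obtain ⟨B', hB', hηb, hηL⟩ := exists_bound_lipschitz η hηc
  have hSl : LocallyIntegrable S := hS.locallyIntegrable (by simp)
  filter_upwards [ae_tendsto_osc hH1.locallyIntegrable, ae_tendsto_osc hSl] with x hx hx'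
  refine ⟨S x, ?_⟩
  set D := ∫ x, |ψ x|
  have hD : 0 ≤ D := integral_nonneg fun _ => abs_nonneg _
  set C := B + B' * D
  have hgx : ∀ N, ∃ g : Sm n, HasCompactSupport (g : Euc n → ℝ) ∧ ∀ z, g z = dil N η (x - z) := by
    intro N
    have h1 : -(2 : ℝ) ^ N ≠ 0 := by simp
    refine ⟨((2 : ℝ) ^ N) ^ n • aff (-(2 : ℝ) ^ N) ((2 : ℝ) ^ N • x) η,
      Sm.hasCompactSupport_smul _ (hasCompactSupport_aff h1 _ hηc), fun z => ?_⟩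
    rw [Sm.smul_apply, aff_apply, dil_apply, smul_sub, neg_smul, neg_add_eq_sub]
  choose g hgc hg using hgx
  have hest : ∀ N, |(∫ z, S z * g N z) - ∑ i ∈ Finset.range N, ∫ y, H y * dil i ψ (x - y)| ≤
      C * (∑ i ∈ Finset.range N, 2⁻¹ ^ (N - i) * osc H i x + 2 * osc H N x) := by
    intro N
    have hu := hsum (g N) (hgc N)
    simp only [hg] at hu
    simp only [hg]
    have hm : ∀ i y, ∫ z, dil i ψ (z - y) * dil N η (x - z) = mollified ψ η i N x y :=
      fun i y => rfl
    simp only [hm] at hu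
    have hmi := fun i => integrable_mollified hψ hη i N x
    have hm0 : ∀ i, ∫ y, mollified ψ η i N x y = 0 := fun i => by
      rw [integral_mollified hψ hη, h0, zero_mul]
    refine abs_sub_sum_le hu N (fun i hi => ?_) fun i => ?_
    · have hdi := (integrable_dil hψc i).comp_sub_left x
      have hd0 : ∫ y, dil i ψ (x - y) = 0 := by
        rw [integral_sub_left_eq_self (fun z => dil i ψ z), integral_dil, h0]
      have hb : ∀ y, |mollified ψ η i N x y - dil i ψ (x - y)| ≤
          ((2 : ℝ) ^ i) ^ n * (B * 2⁻¹ ^ (N - i)) :=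
        fun y => abs_mollified_sub_le hψ hη hη0 hη1 hB hψL hi.le x y
      have h1 := abs_integral_mul_sub_le hH1.locallyIntegrable
        ((hmi i).sub hdi).aestronglyMeasurable hb (x := x) (ρ := 2⁻¹ ^ i) (fun y hy => by
          by_contra hc
          refine hy ?_
          have h2 : mollified ψ η i N x y = 0 := by
            by_contra h
            have := mem_closedBall_of_mollified_ne_zero hψ hη h
            rw [min_eq_left hi.le] at this
            exact hc this
          have h3 : dil i ψ (x - y) = 0 := by
            by_contra h
            have := norm_le_of_dil_ne_zero hψ h
            refine hc ?_
            rw [mem_closedBall, dist_comm, dist_eq_norm]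
            linarith [show (0 : ℝ) ≤ 2⁻¹ ^ i by positivity]
          simp [h2, h3])
      have e0 : ∫ y, ((mollified ψ η i N x) - fun y => dil i ψ (x - y)) y = 0 := by
        rw [integral_sub' (hmi i) hdi, hm0, hd0, sub_zero]
      rw [e0, mul_zero, sub_zero] at h1
      have hi1 : Integrable fun y => H y * (mollified ψ η i N x y - dil i ψ (x - y)) :=
        hH1.mul_bdd ((hmi i).sub hdi).aestronglyMeasurable (ae_of_all _ hb)
      have hi2 : Integrable fun y => H y * dil i ψ (x - y) :=
        hH1.mul_bdd hdi.aestronglyMeasurable (ae_of_all _ fun y => abs_dil_le hψb i _)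
      have e1 : (∫ y, H y * mollified ψ η i N x y) - ∫ y, H y * dil i ψ (x - y) =
          ∫ y, H y * (mollified ψ η i N x y - dil i ψ (x - y)) := by
        rw [sub_eq_iff_eq_add, ← integral_add hi1 hi2]
        exact integral_congr_ae (ae_of_all _ fun y => by ring)
      rw [e1]
      refine h1.trans (le_of_eq_of_le (b := B * 2⁻¹ ^ (N - i) * osc H i x) (by rw [osc]; ring) ?_)
      have := osc_nonneg H i x
      gcongr
      exact le_add_of_nonneg_right (by positivity)
    · have h1 := abs_integral_mul_sub_le hH1.locallyIntegrable
        (hmi (i + N)).aestronglyMeasurable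
        (abs_mollified_le hψ hη h0 hB' hηL le_rfl i N x) (x := x) (ρ := 2⁻¹ ^ N) (fun y hy => by
          have := mem_closedBall_of_mollified_ne_zero hψ hη hy
          rwa [min_eq_right (by omega)] at this)
      rw [hm0, mul_zero, sub_zero] at h1
      refine h1.trans (le_of_eq_of_le (b := B' * D * 2⁻¹ ^ i * osc H N x) (by rw [osc]; ring) ?_)
      have := osc_nonneg H N x
      gcongr
      exact le_add_of_nonneg_left hB
  have hlim1 : Tendsto (fun N => ∫ z, S z * g N z) atTop (𝓝 (S x)) := by
    rw [tendsto_iff_norm_sub_tendsto_zero]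
    refine squeeze_zero (fun _ => norm_nonneg _) (fun N => ?_) (by simpa using hx'.const_mul B')
    have h1 := abs_integral_mul_sub_le hSl (Sm.continuous (g N)).aestronglyMeasurable
      (M := ((2 : ℝ) ^ N) ^ n * B') (x := x) (ρ := 2⁻¹ ^ N)
      (fun y => by rw [hg]; exact abs_dil_le hηb N _) (fun y hy => by
        rw [hg] at hy
        have := norm_le_of_dil_ne_zero hη hy
        rw [mem_closedBall, dist_comm, dist_eq_norm]
        linarith [show (0 : ℝ) ≤ 2⁻¹ ^ N by positivity])
    have e1 : ∫ y, g N y = 1 := by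
      simp only [hg]
      rw [integral_sub_left_eq_self (fun z => dil N η z), integral_dil, hη1]
    rw [e1, mul_one] at h1
    exact h1.trans_eq (by rw [osc]; ring)
  have hlim2 : Tendsto (fun N => C * (∑ i ∈ Finset.range N, 2⁻¹ ^ (N - i) * osc H i x +
      2 * osc H N x)) atTop (𝓝 0) := by
    simpa using ((tendsto_sum_geometric_mul hx).add (hx.const_mul 2)).const_mul C
  have hlim3 := squeeze_zero_norm (fun N => (Real.norm_eq_abs _).trans_le (hest N)) hlim2
  simpa using hlim1.sub hlim3

end

noncomputable section

open scoped NNReal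

variable {n : ℕ}

theorem ae_tendsto_sum_dil_of_bounded (ψ : Sm n)
    (hψ : tsupport (ψ : Euc n → ℝ) ⊆ closedBall 0 2⁻¹)
    (h0 : ∫ x, ψ x = 0) {H : Euc n → ℝ} (hH : Integrable H) {C : ℝ} (hC : ∀ᵐ x, |H x| ≤ C) :
    ∀ᵐ x, ∃ l, Tendsto (fun N => ∑ i ∈ Finset.range N, ∫ y, H y * dil i ψ (x - y))
      atTop (𝓝 l) := by
  refine ae_tendsto_sum_dil ψ hψ h0 hH ?_
  rw [memLp_two_iff_integrable_sq hH.aestronglyMeasurable]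
  simp only [pow_two]
  exact hH.bdd_mul hH.aestronglyMeasurable hC

/-- The points at which a measure grows at most like `lam` times the volume. -/
def growthSet (μ : Measure (Euc n)) (lam : ℝ≥0) : Set (Euc n) :=
  {x | ∀ r > 0, μ (closedBall x r) ≤ lam * volume (closedBall x r)}

theorem isClosed_growthSet (μ : Measure (Euc n)) (lam : ℝ≥0) :
    IsClosed (growthSet μ lam) := by
  refine isClosed_of_closure_subset fun x hx r hr => ?_
  have hlim : Tendsto (fun s : ℝ => (lam : ℝ≥0∞) * (ENNReal.ofReal (s ^ n) *
      volume (closedBall (0 : Euc n) 1))) (𝓝[>] r)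
      (𝓝 (lam * (ENNReal.ofReal (r ^ n) * volume (closedBall (0 : Euc n) 1)))) := by
    have h1 : Tendsto (fun s : ℝ => ENNReal.ofReal (s ^ n)) (𝓝[>] r)
        (𝓝 (ENNReal.ofReal (r ^ n))) :=
      ((ENNReal.continuous_ofReal.comp (continuous_pow n)).tendsto r).mono_left nhdsWithin_le_nhds
    exact ENNReal.Tendsto.const_mul (ENNReal.Tendsto.mul_const h1 (Or.inr
      measure_closedBall_lt_top.ne)) (Or.inr ENNReal.coe_ne_top)
  rw [Measure.addHaar_closedBall' volume x hr.le, finrank_euclideanSpace_fin]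
  refine ge_of_tendsto hlim ?_
  filter_upwards [self_mem_nhdsWithin] with s hs
  obtain ⟨y, hy, hxy⟩ := Metric.mem_closure_iff.mp hx (s - r) (sub_pos.mpr hs)
  have hs0 : 0 < s := hr.trans hs
  have hys := hy s hs0
  rw [Measure.addHaar_closedBall' volume y hs0.le, finrank_euclideanSpace_fin] at hys
  refine le_trans (measure_mono ?_) hys
  exact closedBall_subset_closedBall' (by linarith)

theorem ae_exists_mem_growthSet (μ : Measure (Euc n)) [IsFiniteMeasure μ] :
    ∀ᵐ x, ∃ l : ℕ, x ∈ growthSet μ l := by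
  filter_upwards [Besicovitch.ae_tendsto_rnDeriv μ volume, Measure.rnDeriv_lt_top μ volume]
    with x hx hx'
  have hpos : ∀ r > 0, volume (closedBall x r) ≠ 0 := fun r hr =>
    (Metric.measure_closedBall_pos volume x hr).ne'
  have hfin : ∀ r, volume (closedBall x r) ≠ ∞ := fun r => measure_closedBall_lt_top.ne
  have h1 : ∀ᶠ r in 𝓝[>] (0 : ℝ), μ (closedBall x r) / volume (closedBall x r)
      < μ.rnDeriv volume x + 1 :=
    hx.eventually_lt_const (ENNReal.lt_add_right hx'.ne one_ne_zero)
  obtain ⟨ε, hε, h2⟩ := mem_nhdsGT_iff_exists_Ioo_subset.mp h1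
  have hε : 0 < ε := hε
  have h3 : μ Set.univ / volume (closedBall x (ε / 2)) ≠ ∞ :=
    ENNReal.div_ne_top (measure_ne_top _ _) (hpos _ (by positivity))
  obtain ⟨l, hl⟩ := ENNReal.exists_nat_gt (r := max (μ.rnDeriv volume x + 1)
    (μ Set.univ / volume (closedBall x (ε / 2))))
    (max_lt (ENNReal.add_lt_top.mpr ⟨hx', ENNReal.one_lt_top⟩) h3.lt_top).ne
  refine ⟨l, fun r hr => ?_⟩
  rw [ENNReal.coe_natCast]
  rw [← ENNReal.div_le_iff (hpos r hr) (hfin r)]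
  rcases lt_or_ge r ε with h | h
  · exact (h2 ⟨hr, h⟩).le.trans ((le_max_left _ _).trans hl.le)
  · refine le_trans ?_ ((le_max_right _ _).trans hl.le)
    gcongr
    · exact Set.subset_univ _
    · linarith

theorem restrict_growthSet_le (μ : Measure (Euc n)) [IsFiniteMeasure μ] (lam : ℝ≥0) :
    μ.restrict (growthSet μ lam) ≤ lam • volume := by
  refine Measure.le_iff.mpr fun S hS => ?_
  rw [Measure.restrict_apply hS]
  have := (Besicovitch.vitaliFamily μ).measure_le_of_frequently_le (lam • volume)
    (ρ := μ) Measure.AbsolutelyContinuous.rfl (S ∩ growthSet μ lam) (fun x hx => ?_)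
  · exact this.trans (measure_mono Set.inter_subset_left)
  · refine ((Besicovitch.tendsto_filterAt μ x).frequently ?_)
    refine Eventually.frequently ?_
    filter_upwards [self_mem_nhdsWithin] with r hr
    exact hx.2 r hr

theorem ae_tendsto_sum_dil_of_le (ψ : Sm n) (hψ : tsupport (ψ : Euc n → ℝ) ⊆ closedBall 0 2⁻¹)
    (h0 : ∫ x, ψ x = 0) (μ : Measure (Euc n)) [IsFiniteMeasure μ] {lam : ℝ≥0}
    (hμ : μ ≤ lam • volume) :
    ∀ᵐ x, ∃ l, Tendsto (fun N => ∑ i ∈ Finset.range N, ∫ y, dil i ψ (x - y) ∂μ) atTop (𝓝 l) := by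
  have hac : μ ≪ volume := (Measure.absolutelyContinuous_of_le hμ).trans
    (Measure.smul_absolutelyContinuous)
  have hb : ∀ᵐ x, |(μ.rnDeriv volume x).toReal| ≤ lam := by
    have : μ.rnDeriv volume ≤ᵐ[volume] fun _ => (lam : ℝ≥0∞) := by
      refine ae_le_of_forall_setLIntegral_le_of_sigmaFinite (Measure.measurable_rnDeriv _ _)
        fun s hs _ => ?_
      rw [setLIntegral_const]
      exact (Measure.setLIntegral_rnDeriv_le s).trans (hμ s)
    filter_upwards [this] with x hx
    rw [abs_of_nonneg ENNReal.toReal_nonneg]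
    exact ENNReal.toReal_le_coe_of_le_coe hx
  filter_upwards [ae_tendsto_sum_dil_of_bounded ψ hψ h0 Measure.integrable_toReal_rnDeriv hb]
    with x hx
  simp_rw [← integral_rnDeriv_smul hac, smul_eq_mul]
  exact hx

/-- The normalised indicator of the ball around `y` whose radius is half the distance to `F`. -/
def smear (F : Set (Euc n)) (y z : Euc n) : ℝ :=
  Set.indicator {q : Euc n × Euc n | dist q.2 q.1 ≤ infDist q.1 F / 2}
    (fun q => (volume.real (closedBall q.1 (infDist q.1 F / 2)))⁻¹) (y, z)

theorem smear_apply (F : Set (Euc n)) (y z : Euc n) : smear F y z =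
    (closedBall y (infDist y F / 2)).indicator
      (fun _ => (volume.real (closedBall y (infDist y F / 2)))⁻¹) z := by
  by_cases h : dist z y ≤ infDist y F / 2
  · rw [smear, Set.indicator_of_mem (by exact h), Set.indicator_of_mem (mem_closedBall.mpr h)]
  · rw [smear, Set.indicator_of_notMem (by exact h),
      Set.indicator_of_notMem (by rwa [mem_closedBall])]

theorem smear_nonneg (F : Set (Euc n)) (y z : Euc n) : 0 ≤ smear F y z :=
  Set.indicator_nonneg (fun _ _ => by positivity) _

theorem measurable_smear (F : Set (Euc n)) :
    Measurable (fun q : Euc n × Euc n => smear F q.1 q.2) := by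
  have h : (fun q : Euc n × Euc n => (volume.real (closedBall q.1 (infDist q.1 F / 2)))⁻¹) =
      fun q => ((infDist q.1 F / 2) ^ n * volume.real (closedBall (0 : Euc n) 1))⁻¹ := by
    funext q
    have h0 : 0 ≤ infDist q.1 F / 2 := div_nonneg infDist_nonneg (by norm_num)
    rw [Measure.real, Measure.addHaar_closedBall' volume q.1 h0, finrank_euclideanSpace_fin,
      ENNReal.toReal_mul, ENNReal.toReal_ofReal (by positivity)]
    rfl
  simp only [smear]
  rw [h]
  have hc : Continuous fun q : Euc n × Euc n => infDist q.1 F / 2 :=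
    ((continuous_infDist_pt F).comp continuous_fst).div_const 2
  refine Measurable.indicator ?_ (isClosed_le (continuous_snd.dist continuous_fst) hc).measurableSet
  exact ((hc.measurable.pow_const n).mul_const _).inv

theorem integral_smear_mul (F : Set (Euc n)) (y : Euc n) (f : Euc n → ℝ) :
    ∫ z, smear F y z * f z = ⨍ z in closedBall y (infDist y F / 2), f z := by
  simp_rw [smear_apply, ← Set.indicator_mul_left]
  rw [integral_indicator measurableSet_closedBall, integral_const_mul, setAverage_eq, smul_eq_mul]

theorem lintegral_smear_le (F : Set (Euc n)) (y : Euc n) :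
    ∫⁻ z, ENNReal.ofReal (smear F y z) ≤ 1 := by
  have : ∀ z, ENNReal.ofReal (smear F y z) = (closedBall y (infDist y F / 2)).indicator
      (fun _ => ENNReal.ofReal (volume.real (closedBall y (infDist y F / 2)))⁻¹) z := by
    intro z
    rw [smear_apply]
    by_cases h : z ∈ closedBall y (infDist y F / 2)
    · rw [Set.indicator_of_mem h, Set.indicator_of_mem h]
    · rw [Set.indicator_of_notMem h, Set.indicator_of_notMem h, ENNReal.ofReal_zero]
  simp_rw [this]
  rw [lintegral_indicator measurableSet_closedBall, setLIntegral_const]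
  rw [← ofReal_measureReal measure_closedBall_lt_top.ne, ← ENNReal.ofReal_mul (by positivity),
    ENNReal.ofReal_le_one]
  exact inv_mul_le_one

theorem lintegral_smear_growthSet_le {μ : Measure (Euc n)} {lam : ℝ≥0}
    (hF : (growthSet μ lam).Nonempty) (z : Euc n) :
    ∫⁻ y in (growthSet μ lam)ᶜ, ENNReal.ofReal (smear (growthSet μ lam) y z) ∂μ
      ≤ (lam * 6 ^ n : ℝ≥0) := by
  set F := growthSet μ lam with hFdef
  have hcl : IsClosed F := isClosed_growthSet μ lam
  rcases (infDist_nonneg (s := F) (x := z)).eq_or_lt with hz | hz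
  · rw [setLIntegral_congr_fun (g := fun _ => 0) hcl.isOpen_compl.measurableSet]
    · simp
    · intro y hy
      have hy' : 0 < infDist y F := (hcl.notMem_iff_infDist_pos hF).mp hy
      simp only
      rw [smear_apply, Set.indicator_of_notMem, ENNReal.ofReal_zero]
      intro h
      have := infDist_le_infDist_add_dist (s := F) (x := y) (y := z)
      rw [mem_closedBall, dist_comm] at h
      linarith
  obtain ⟨p, hp, hpd⟩ := hcl.exists_infDist_eq_dist hF z
  set d := infDist z F with hd
  set V := volume.real (closedBall (0 : Euc n) 1) with hV
  have hVpos : 0 < V := ENNReal.toReal_pos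
    (Metric.measure_closedBall_pos volume _ one_pos).ne' measure_closedBall_lt_top.ne
  calc ∫⁻ y in Fᶜ, ENNReal.ofReal (smear F y z) ∂μ
      ≤ ∫⁻ y, (closedBall p (2 * d)).indicator
          (fun _ => ENNReal.ofReal ((d / 3) ^ n * V)⁻¹) y ∂μ := by
        refine (setLIntegral_le_lintegral _ _).trans (lintegral_mono fun y => ?_)
        by_cases h : z ∈ closedBall y (infDist y F / 2)
        · have h1 := infDist_le_infDist_add_dist (s := F) (x := y) (y := z)
          have h2 := infDist_le_infDist_add_dist (s := F) (x := z) (y := y)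
          have h' := h
          rw [mem_closedBall] at h'
          rw [dist_comm] at h1
          rw [Set.indicator_of_mem, smear_apply, Set.indicator_of_mem h]
          · gcongr
            rw [Measure.real, Measure.addHaar_closedBall' volume y (by linarith),
              finrank_euclideanSpace_fin, ENNReal.toReal_mul, ENNReal.toReal_ofReal
              (pow_nonneg (by linarith) _)]
            have h3 : d / 3 ≤ infDist y F / 2 := by linarith
            exact mul_le_mul_of_nonneg_right (pow_le_pow_left₀ (by positivity) h3 _) hVpos.le
          · rw [mem_closedBall]
            have := dist_triangle y z p
            rw [dist_comm y z] at this
            linarith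
        · rw [smear_apply, Set.indicator_of_notMem h, ENNReal.ofReal_zero]
          exact bot_le
    _ = ENNReal.ofReal ((d / 3) ^ n * V)⁻¹ * μ (closedBall p (2 * d)) := by
        rw [lintegral_indicator measurableSet_closedBall, setLIntegral_const]
    _ ≤ ENNReal.ofReal ((d / 3) ^ n * V)⁻¹ * (lam * volume (closedBall p (2 * d))) := by
        gcongr
        exact hp _ (by positivity)
    _ = (lam * 6 ^ n : ℝ≥0) := by
        rw [Measure.addHaar_closedBall' volume p (by positivity), finrank_euclideanSpace_fin,
          ← ofReal_measureReal (s := closedBall (0 : Euc n) 1) measure_closedBall_lt_top.ne, ← hV,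
          ← ENNReal.ofReal_coe_nnreal (p := lam), ← ENNReal.ofReal_mul (by positivity),
          ← ENNReal.ofReal_mul (by positivity), ← ENNReal.ofReal_mul (by positivity),
          ← ENNReal.ofReal_coe_nnreal]
        congr 1
        push_cast
        have : (2 * d) ^ n = 6 ^ n * (d / 3) ^ n := by rw [← mul_pow]; congr 1; ring
        rw [this]
        have : 0 < (d / 3) ^ n := by positivity
        field_simp
/-- The total smearing of `μ` outside of `F`. -/
def smeared (F : Set (Euc n)) (μ : Measure (Euc n)) : Measure (Euc n) :=
  volume.withDensity fun z => ∫⁻ y in Fᶜ, ENNReal.ofReal (smear F y z) ∂μ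

theorem measurable_lintegral_smear (F : Set (Euc n)) (μ : Measure (Euc n)) [IsFiniteMeasure μ] :
    Measurable fun z => ∫⁻ y in Fᶜ, ENNReal.ofReal (smear F y z) ∂μ :=
  Measurable.lintegral_prod_left' (f := fun q : Euc n × Euc n => ENNReal.ofReal (smear F q.1 q.2))
    (measurable_smear F).ennreal_ofReal

theorem lintegral_lintegral_smear_le (F : Set (Euc n)) (μ : Measure (Euc n)) [IsFiniteMeasure μ] :
    ∫⁻ z, ∫⁻ y in Fᶜ, ENNReal.ofReal (smear F y z) ∂μ ≤ μ Set.univ := by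
  rw [lintegral_lintegral_swap (f := fun z y => ENNReal.ofReal (smear F y z))
    ((measurable_smear F).ennreal_ofReal.comp measurable_swap).aemeasurable]
  calc ∫⁻ y in Fᶜ, (∫⁻ z, ENNReal.ofReal (smear F y z)) ∂μ
      ≤ ∫⁻ y in Fᶜ, 1 ∂μ := lintegral_mono fun y => lintegral_smear_le F y
    _ ≤ μ Set.univ := by
        rw [setLIntegral_one]
        exact measure_mono (Set.subset_univ _)

instance (F : Set (Euc n)) (μ : Measure (Euc n)) [IsFiniteMeasure μ] :
    IsFiniteMeasure (smeared F μ) :=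
  isFiniteMeasure_withDensity
    ((lintegral_lintegral_smear_le F μ).trans_lt (measure_lt_top _ _)).ne

theorem smeared_growthSet_le {μ : Measure (Euc n)} {lam : ℝ≥0}
    (hF : (growthSet μ lam).Nonempty) :
    smeared (growthSet μ lam) μ ≤ (lam * 6 ^ n : ℝ≥0) • volume := by
  refine Measure.le_iff.mpr fun S hS => ?_
  rw [smeared, withDensity_apply _ hS]
  refine (lintegral_mono fun z => lintegral_smear_growthSet_le hF z).trans ?_
  rw [setLIntegral_const]
  rfl

theorem integrable_smear_mul (F : Set (Euc n)) (μ : Measure (Euc n)) [IsFiniteMeasure μ]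
    {f : Euc n → ℝ} (hf : Continuous f) {B : ℝ} (hB : ∀ x, |f x| ≤ B) :
    Integrable (fun q : Euc n × Euc n => smear F q.2 q.1 * f q.1)
      (volume.prod (μ.restrict Fᶜ)) := by
  have hm : Measurable fun q : Euc n × Euc n => smear F q.2 q.1 * f q.1 :=
    ((measurable_smear F).comp measurable_swap).mul (hf.measurable.comp measurable_fst)
  refine ⟨hm.aestronglyMeasurable, ?_⟩
  rw [HasFiniteIntegral, lintegral_prod _ hm.enorm.aemeasurable]
  calc ∫⁻ z, ∫⁻ y in Fᶜ, ‖smear F y z * f z‖ₑ ∂μ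
      ≤ ∫⁻ z, ENNReal.ofReal B * ∫⁻ y in Fᶜ, ENNReal.ofReal (smear F y z) ∂μ := by
        refine lintegral_mono fun z => ?_
        rw [← lintegral_const_mul' _ _ ENNReal.ofReal_ne_top]
        refine lintegral_mono fun y => ?_
        rw [enorm_mul, mul_comm, Real.enorm_of_nonneg (smear_nonneg F y z),
          Real.enorm_eq_ofReal_abs]
        gcongr
        exact hB z
    _ = ENNReal.ofReal B * ∫⁻ z, ∫⁻ y in Fᶜ, ENNReal.ofReal (smear F y z) ∂μ :=
        lintegral_const_mul' _ _ ENNReal.ofReal_ne_top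
    _ < ∞ := ENNReal.mul_lt_top ENNReal.ofReal_lt_top
        ((lintegral_lintegral_smear_le F μ).trans_lt (measure_lt_top _ _))

theorem integrable_setAverage (F : Set (Euc n)) (μ : Measure (Euc n)) [IsFiniteMeasure μ]
    {f : Euc n → ℝ} (hf : Continuous f) {B : ℝ} (hB : ∀ x, |f x| ≤ B) :
    IntegrableOn (fun y => ⨍ z in closedBall y (infDist y F / 2), f z) Fᶜ μ := by
  simp_rw [← integral_smear_mul]
  exact (integrable_smear_mul F μ hf hB).integral_prod_right

theorem integral_smeared (F : Set (Euc n)) (μ : Measure (Euc n)) [IsFiniteMeasure μ]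
    {f : Euc n → ℝ} (hf : Continuous f) {B : ℝ} (hB : ∀ x, |f x| ≤ B) :
    ∫ z, f z ∂(smeared F μ) = ∫ y in Fᶜ, (⨍ z in closedBall y (infDist y F / 2), f z) ∂μ := by
  have hfin := ae_lt_top (measurable_lintegral_smear F μ)
    ((lintegral_lintegral_smear_le F μ).trans_lt (measure_lt_top _ _)).ne
  rw [smeared, integral_withDensity_eq_integral_toReal_smul (measurable_lintegral_smear F μ) hfin]
  have h1 : ∀ z, (∫⁻ y in Fᶜ, ENNReal.ofReal (smear F y z) ∂μ).toReal • f z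
      = ∫ y in Fᶜ, smear F y z * f z ∂μ := by
    intro z
    rw [integral_mul_const, integral_eq_lintegral_of_nonneg_ae
      (Eventually.of_forall fun y => smear_nonneg F y z)
      ((measurable_smear F).comp measurable_prodMk_right).aestronglyMeasurable, smul_eq_mul]
  simp_rw [h1]
  rw [integral_integral_swap (integrable_smear_mul F μ hf hB)]
  simp_rw [integral_smear_mul]

theorem abs_sub_setAverage_le {f : Euc n → ℝ} (hf : Continuous f) {y : Euc n} {r K : ℝ}
    (hr : 0 < r) (h : ∀ z ∈ closedBall y r, |f y - f z| ≤ K) :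
    |f y - ⨍ z in closedBall y r, f z| ≤ K := by
  have := (convex_closedBall (f y) K).set_average_mem (μ := volume) (t := closedBall y r) (f := f)
    isClosed_closedBall (Metric.measure_closedBall_pos volume y hr).ne'
    measure_closedBall_lt_top.ne ((ae_restrict_iff' measurableSet_closedBall).mpr
      (Eventually.of_forall fun z hz => by
        rw [mem_closedBall, dist_comm, Real.dist_eq]; exact h z hz))
    (hf.continuousOn.integrableOn_compact (isCompact_closedBall y r))
  rwa [mem_closedBall, dist_comm, Real.dist_eq] at this

theorem abs_dil_sub_setAverage_le {ψ : Sm n}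
    (hψ : tsupport (ψ : Euc n → ℝ) ⊆ closedBall 0 2⁻¹) {B : ℝ} (hB : 0 ≤ B)
    (hL : ∀ x y, |ψ x - ψ y| ≤ B * ‖x - y‖) {F : Set (Euc n)} {x y : Euc n} (hx : x ∈ F)
    (hy : 0 < infDist y F) (i : ℕ) :
    |dil i ψ (x - y) - ⨍ z in closedBall y (infDist y F / 2), dil i ψ (x - z)| ≤
      (closedBall y (2⁻¹ ^ i)).indicator (fun _ => ((2 : ℝ) ^ i) ^ n * B *
        min (2 ^ i * infDist y F) (2⁻¹ ^ i * (infDist y F)⁻¹)) x := by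
  have hd : infDist y F ≤ dist x y := by rw [dist_comm]; exact infDist_le_dist_of_mem hx
  have hc : Continuous fun z => dil i ψ (x - z) := by
    have := Sm.continuous (dil i ψ)
    fun_prop
  by_cases hxy : x ∈ closedBall y (2⁻¹ ^ i)
  · rw [Set.indicator_of_mem hxy]
    refine abs_sub_setAverage_le (f := fun z => dil i ψ (x - z)) hc (by positivity) fun z hz => ?_
    refine (abs_dil_sub_le hL i _ _).trans ?_
    rw [mem_closedBall] at hz hxy
    have h1 : 2 ^ i * infDist y F ≤ 1 := by
      have h : infDist y F ≤ ((2 : ℝ) ^ i)⁻¹ := by rw [← inv_pow]; exact hd.trans hxy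
      calc 2 ^ i * infDist y F ≤ 2 ^ i * ((2 : ℝ) ^ i)⁻¹ := by gcongr
        _ = 1 := mul_inv_cancel₀ (by positivity)
    have h2 : min ((2 : ℝ) ^ i * infDist y F) (2⁻¹ ^ i * (infDist y F)⁻¹) = 2 ^ i * infDist y F := by
      refine min_eq_left (h1.trans ?_)
      rw [inv_pow, ← mul_inv]
      exact (one_le_inv₀ (by positivity)).mpr h1
    rw [h2]
    gcongr
    rw [sub_sub_sub_cancel_left, ← dist_eq_norm]
    linarith
  · rw [Set.indicator_of_notMem hxy]
    refine abs_sub_setAverage_le (f := fun z => dil i ψ (x - z)) hc (by positivity) fun z hz => ?_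
    rw [mem_closedBall] at hz hxy
    have hpos : (0 : ℝ) < 2⁻¹ ^ i := by positivity
    have e1 : dil i ψ (x - y) = 0 := by
      by_contra h
      have := norm_le_of_dil_ne_zero hψ h
      rw [← dist_eq_norm] at this
      linarith
    have e2 : dil i ψ (x - z) = 0 := by
      by_contra h
      have := norm_le_of_dil_ne_zero hψ h
      rw [← dist_eq_norm] at this
      have := dist_triangle x z y
      linarith
    simp only [e1, e2, sub_self, abs_zero, le_refl]

theorem lintegral_tsum_annulus_le (μ : Measure (Euc n)) [IsFiniteMeasure μ] {B : ℝ}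
    (hB : 0 ≤ B) {F : Set (Euc n)} (hF : MeasurableSet F) (hpos : ∀ y ∉ F, 0 < infDist y F) :
    ∫⁻ x, ∑' i : ℕ, ∫⁻ y in Fᶜ, ENNReal.ofReal ((closedBall y (2⁻¹ ^ i)).indicator
      (fun _ => ((2 : ℝ) ^ i) ^ n * B *
        min (2 ^ i * infDist y F) (2⁻¹ ^ i * (infDist y F)⁻¹)) x) ∂μ ≠ ∞ ∧
    ∀ᵐ x, ∑' i : ℕ, ∫⁻ y in Fᶜ, ENNReal.ofReal ((closedBall y (2⁻¹ ^ i)).indicator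
      (fun _ => ((2 : ℝ) ^ i) ^ n * B *
        min (2 ^ i * infDist y F) (2⁻¹ ^ i * (infDist y F)⁻¹)) x) ∂μ < ∞ := by
  set c : ℕ → Euc n → ℝ := fun i y => min (2 ^ i * infDist y F) (2⁻¹ ^ i * (infDist y F)⁻¹)
    with hc
  have hδ : Measurable fun y => infDist y F := (continuous_infDist_pt F).measurable
  have hcm : ∀ i, Measurable (c i) := fun i => (hδ.const_mul _).min (hδ.inv.const_mul _)
  have hc0 : ∀ i y, 0 ≤ c i y := fun i y => le_min (mul_nonneg (by positivity) infDist_nonneg)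
    (mul_nonneg (by positivity) (inv_nonneg.mpr infDist_nonneg))
  have hΦ : ∀ i : ℕ, Measurable fun q : Euc n × Euc n => ENNReal.ofReal
      ((closedBall q.2 (2⁻¹ ^ i)).indicator (fun _ => ((2 : ℝ) ^ i) ^ n * B * c i q.2) q.1) := by
    intro i
    refine Measurable.ennreal_ofReal ?_
    have : (fun q : Euc n × Euc n => (closedBall q.2 ((2⁻¹ : ℝ) ^ i)).indicator
        (fun _ => ((2 : ℝ) ^ i) ^ n * B * c i q.2) q.1) =
        Set.indicator {q : Euc n × Euc n | dist q.1 q.2 ≤ 2⁻¹ ^ i}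
          (fun q => ((2 : ℝ) ^ i) ^ n * B * c i q.2) := by
      funext q
      by_cases h : dist q.1 q.2 ≤ 2⁻¹ ^ i
      · rw [Set.indicator_of_mem (mem_closedBall.mpr h), Set.indicator_of_mem (by exact h)]
      · rw [Set.indicator_of_notMem (by rwa [mem_closedBall]),
          Set.indicator_of_notMem (by exact h)]
    rw [this]
    exact Measurable.indicator (((hcm i).comp measurable_snd).const_mul _)
      (isClosed_le (continuous_fst.dist continuous_snd) continuous_const).measurableSet
  have hG : Measurable fun x => ∑' i : ℕ, ∫⁻ y in Fᶜ, ENNReal.ofReal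
      ((closedBall y (2⁻¹ ^ i)).indicator (fun _ => ((2 : ℝ) ^ i) ^ n * B * c i y) x) ∂μ :=
    Measurable.tsum fun i => (hΦ i).lintegral_prod_right'
  set V := volume.real (closedBall (0 : Euc n) 1) with hV
  have hfin : ∫⁻ x, ∑' i : ℕ, ∫⁻ y in Fᶜ, ENNReal.ofReal ((closedBall y (2⁻¹ ^ i)).indicator
      (fun _ => ((2 : ℝ) ^ i) ^ n * B * c i y) x) ∂μ ≠ ∞ := by
    rw [lintegral_tsum fun i => ((hΦ i).lintegral_prod_right').aemeasurable]
    have h1 : ∀ i : ℕ, ∫⁻ x, ∫⁻ y in Fᶜ, ENNReal.ofReal ((closedBall y (2⁻¹ ^ i)).indicator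
        (fun _ => ((2 : ℝ) ^ i) ^ n * B * c i y) x) ∂μ
        = ∫⁻ y in Fᶜ, ENNReal.ofReal (B * V * c i y) ∂μ := by
      intro i
      rw [lintegral_lintegral_swap (hΦ i).aemeasurable]
      refine lintegral_congr fun y => ?_
      have : ∀ x, ENNReal.ofReal ((closedBall y (2⁻¹ ^ i)).indicator
          (fun _ => ((2 : ℝ) ^ i) ^ n * B * c i y) x) = (closedBall y (2⁻¹ ^ i)).indicator
          (fun _ => ENNReal.ofReal (((2 : ℝ) ^ i) ^ n * B * c i y)) x := by
        intro x
        by_cases h : x ∈ closedBall y (2⁻¹ ^ i)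
        · rw [Set.indicator_of_mem h, Set.indicator_of_mem h]
        · rw [Set.indicator_of_notMem h, Set.indicator_of_notMem h, ENNReal.ofReal_zero]
      simp_rw [this]
      rw [lintegral_indicator measurableSet_closedBall, setLIntegral_const,
        Measure.addHaar_closedBall' volume y (by positivity), finrank_euclideanSpace_fin,
        ← ofReal_measureReal (s := closedBall (0 : Euc n) 1) measure_closedBall_lt_top.ne, ← hV,
        ← ENNReal.ofReal_mul (by positivity),
        ← ENNReal.ofReal_mul (mul_nonneg (by positivity) (hc0 i y))]
      congr 1
      have h2 : ((2 : ℝ) ^ i) ^ n * (2⁻¹ ^ i) ^ n = 1 := by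
        rw [← mul_pow, ← mul_pow]; norm_num
      linear_combination B * c i y * V * h2
    simp_rw [h1]
    rw [← lintegral_tsum fun i => ((hcm i).const_mul _).ennreal_ofReal.aemeasurable]
    refine ne_top_of_le_ne_top (b := ENNReal.ofReal (B * V * 4) * μ Set.univ)
      (ENNReal.mul_ne_top ENNReal.ofReal_ne_top (measure_ne_top _ _)) ?_
    calc ∫⁻ y in Fᶜ, ∑' i, ENNReal.ofReal (B * V * c i y) ∂μ
        ≤ ∫⁻ y in Fᶜ, ENNReal.ofReal (B * V * 4) ∂μ := by
          refine setLIntegral_mono' hF.compl fun y hy => ?_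
          refine ENNReal.tsum_le_of_sum_range_le fun L => ?_
          rw [← ENNReal.ofReal_sum_of_nonneg
            fun i _ => mul_nonneg (by positivity) (hc0 i y), ← Finset.mul_sum]
          gcongr
          have hd := hpos y hy
          have := sum_min_geometric (θ := 2) (ρ := 2⁻¹) one_lt_two (by norm_num)
            (u := fun i => 2 ^ i * infDist y F) (v := fun i => 2⁻¹ ^ i * (infDist y F)⁻¹)
            (fun i => by ring) (fun i => by ring) (fun i => by positivity)
            (fun i => by positivity) (fun i => ?_) L
          · refine this.trans (by norm_num)
          · rcases le_total (2 ^ i * infDist y F) 1 with h | h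
            · exact Or.inl h
            · right
              rw [inv_pow, ← mul_inv]
              exact inv_le_one_of_one_le₀ h
      _ ≤ ENNReal.ofReal (B * V * 4) * μ Set.univ := by
          rw [setLIntegral_const]
          gcongr
          exact Set.subset_univ _
  exact ⟨hfin, ae_lt_top hG hfin⟩

theorem ae_tendsto_sum_dil_on_growthSet (ψ : Sm n)
    (hψ : tsupport (ψ : Euc n → ℝ) ⊆ closedBall 0 2⁻¹) (h0 : ∫ x, ψ x = 0) (μ : Measure (Euc n))
    [IsFiniteMeasure μ] (lam : ℝ≥0) :
    ∀ᵐ x, x ∈ growthSet μ lam →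
      ∃ l, Tendsto (fun N => ∑ i ∈ Finset.range N, ∫ y, dil i ψ (x - y) ∂μ) atTop (𝓝 l) := by
  rcases (growthSet μ lam).eq_empty_or_nonempty with he | hF
  · simp [he]
  have hcl := isClosed_growthSet μ lam
  have h1 := ae_tendsto_sum_dil_of_le ψ hψ h0 _ (restrict_growthSet_le μ lam)
  have h2 := ae_tendsto_sum_dil_of_le ψ hψ h0 _ (smeared_growthSet_le hF)
  generalize growthSet μ lam = F at *
  have hψc := hasCompactSupport_of_subset hψ
  obtain ⟨B, hB, hψb, hψL⟩ := exists_bound_lipschitz ψ hψc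
  have hpos : ∀ y ∉ F, 0 < infDist y F := fun y hy => (hcl.notMem_iff_infDist_pos hF).mp hy
  filter_upwards [h1, h2, (lintegral_tsum_annulus_le μ hB hcl.measurableSet hpos).2]
    with x ⟨l1, hl1⟩ ⟨l2, hl2⟩ hx3 hxF
  have hcont : ∀ i, Continuous fun y => dil i ψ (x - y) := fun i => by
    have := Sm.continuous (dil i ψ)
    fun_prop
  have hbd : ∀ i y, |dil i ψ (x - y)| ≤ ((2 : ℝ) ^ i) ^ n * B := fun i y => abs_dil_le hψb i _
  have hInt : ∀ i, Integrable (fun y => dil i ψ (x - y)) μ := fun i =>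
    Integrable.of_bound (hcont i).aestronglyMeasurable _ (Eventually.of_forall (hbd i))
  have hsum : Summable fun i => (∫ y in Fᶜ, dil i ψ (x - y) ∂μ) -
      ∫ y, dil i ψ (x - y) ∂(smeared F μ) := by
    refine Summable.of_norm (tsum_enorm_ne_top_iff_summable_norm.mp
      (ne_top_of_le_ne_top hx3.ne (ENNReal.tsum_le_tsum fun i => ?_)))
    rw [integral_smeared F μ (hcont i) (hbd i),
      ← integral_sub (hInt i).integrableOn (integrable_setAverage F μ (hcont i) (hbd i))]
    refine (enorm_integral_le_lintegral_enorm _).trans ?_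
    refine setLIntegral_mono' hcl.measurableSet.compl fun y hy => ?_
    rw [Real.enorm_eq_ofReal_abs]
    exact ENNReal.ofReal_le_ofReal (abs_dil_sub_setAverage_le hψ hB hψL hxF (hpos y hy) i)
  refine ⟨l1 + (l2 + ∑' i, ((∫ y in Fᶜ, dil i ψ (x - y) ∂μ) -
      ∫ y, dil i ψ (x - y) ∂(smeared F μ))), ?_⟩
  refine (hl1.add (hl2.add hsum.hasSum.tendsto_sum_nat)).congr fun N => ?_
  rw [← Finset.sum_add_distrib, ← Finset.sum_add_distrib]
  refine Finset.sum_congr rfl fun i _ => ?_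
  rw [← integral_add_compl hcl.measurableSet (hInt i)]
  ring

/-- For a locally finite measure `μ` and a test function `ψ` of mean zero, the dyadic sums
`∑ i < N, ψ_i * μ` converge almost everywhere. -/
theorem ae_tendsto_sum_dil_measure (ψ : Sm n)
    (hψ : tsupport (ψ : Euc n → ℝ) ⊆ closedBall 0 2⁻¹) (h0 : ∫ x, ψ x = 0) (μ : Measure (Euc n))
    [IsLocallyFiniteMeasure μ] :
    ∀ᵐ x, ∃ l, Tendsto (fun N => ∑ i ∈ Finset.range N, ∫ y, dil i ψ (x - y) ∂μ) atTop (𝓝 l) := by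
  have hfin : ∀ R : ℕ, IsFiniteMeasure (μ.restrict (ball (0 : Euc n) (R + 1))) := fun R =>
    ⟨by rw [Measure.restrict_apply_univ]; exact measure_ball_lt_top⟩
  have h : ∀ᵐ x, ∀ R l : ℕ, x ∈ growthSet (μ.restrict (ball (0 : Euc n) (R + 1))) l →
      ∃ t, Tendsto (fun N => ∑ i ∈ Finset.range N,
        ∫ y, dil i ψ (x - y) ∂(μ.restrict (ball (0 : Euc n) (R + 1)))) atTop (𝓝 t) := by
    rw [ae_all_iff]
    intro R
    rw [ae_all_iff]
    intro l
    exact ae_tendsto_sum_dil_on_growthSet ψ hψ h0 _ _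
  have h' : ∀ᵐ x, ∀ R : ℕ, ∃ l : ℕ, x ∈ growthSet (μ.restrict (ball (0 : Euc n) (R + 1))) l := by
    rw [ae_all_iff]
    exact fun R => ae_exists_mem_growthSet _
  filter_upwards [h, h'] with x hx hx'
  obtain ⟨R, hR⟩ := exists_nat_gt ‖x‖
  obtain ⟨l, hl⟩ := hx' R
  obtain ⟨t, ht⟩ := hx R l hl
  refine ⟨t, ht.congr fun N => Finset.sum_congr rfl fun i _ => ?_⟩
  refine setIntegral_eq_integral_of_forall_compl_eq_zero fun y hy => ?_
  by_contra hne
  have h1 := norm_le_of_dil_ne_zero hψ hne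
  have h2 : (2⁻¹ : ℝ) ^ i ≤ 1 := pow_le_one₀ (by norm_num) (by norm_num)
  rw [mem_ball_zero_iff, not_lt] at hy
  have h3 : ‖y‖ ≤ ‖x‖ + ‖x - y‖ := by
    rw [norm_sub_rev]; exact norm_le_norm_add_norm_sub' y x
  linarith

end

noncomputable section

open scoped NNReal

variable {n : ℕ}

/-- Convolution of the measure `f σ` with a function. -/
def conv (σ : Measure (Euc n)) (f γ : Euc n → ℝ) (x : Euc n) : ℝ := ∫ y, f y * γ (x - y) ∂σ

theorem integrable_mul_of_hasCompactSupport {σ : Measure (Euc n)} {f g : Euc n → ℝ}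
    (hf : LocallyIntegrable f σ) (hg : Continuous g) (hgc : HasCompactSupport g) :
    Integrable (fun y => f y * g y) σ := by
  simpa only [smul_eq_mul] using hf.integrable_smul_right_of_hasCompactSupport hg hgc

theorem hasCompactSupport_comp_sub_left {g : Euc n → ℝ} (hg : HasCompactSupport g) (x : Euc n) :
    HasCompactSupport (fun y => g (x - y)) :=
  hg.comp_homeomorph (Homeomorph.subLeft x)

theorem integrable_conv {σ : Measure (Euc n)} {f g : Euc n → ℝ}
    (hf : LocallyIntegrable f σ) (hg : Continuous g) (hgc : HasCompactSupport g) (x : Euc n) :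
    Integrable (fun y => f y * g (x - y)) σ :=
  integrable_mul_of_hasCompactSupport hf (hg.comp (continuous_const.sub continuous_id))
    (hasCompactSupport_comp_sub_left hgc x)

theorem conv_hasFDerivAt {σ : Measure (Euc n)} [IsLocallyFiniteMeasure σ] {f : Euc n → ℝ}
    (hf : LocallyIntegrable f σ) (γ : Sm n) (hγ : HasCompactSupport (γ : Euc n → ℝ))
    (x : Euc n) :
    HasFDerivAt (conv σ f γ) (∫ y, f y • fderiv ℝ γ (x - y) ∂σ) x := by
  have hc : Continuous (fderiv ℝ (γ : Euc n → ℝ)) :=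
    (Sm.smooth γ).continuous_fderiv (by simp)
  have hcs : HasCompactSupport (fderiv ℝ (γ : Euc n → ℝ)) := hγ.fderiv ℝ
  obtain ⟨M, hM⟩ := hcs.exists_bound_of_continuous hc
  obtain ⟨R, hR⟩ := hcs.isCompact.isBounded.subset_closedBall 0
  have hM0 : 0 ≤ M := (norm_nonneg _).trans (hM 0)
  have hloc : IntegrableOn f (closedBall x (R + 1)) σ :=
    hf.integrableOn_isCompact (isCompact_closedBall x (R + 1))
  refine hasFDerivAt_integral_of_dominated_of_fderiv_le
    (F := fun z y => f y * γ (z - y)) (F' := fun z y => f y • fderiv ℝ γ (z - y))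
    (bound := (closedBall x (R + 1)).indicator fun y => |f y| * M)
    (ball_mem_nhds x one_pos)
    (Eventually.of_forall fun z =>
      (integrable_conv hf (Sm.continuous γ) hγ z).aestronglyMeasurable)
    (integrable_conv hf (Sm.continuous γ) hγ x)
    (hf.aestronglyMeasurable.smul
      (hc.comp (continuous_const.sub continuous_id)).aestronglyMeasurable)
    (ae_of_all _ fun y z hz => ?_) ?_ (ae_of_all _ fun y z hz => ?_)
  · by_cases hy : y ∈ closedBall x (R + 1)
    · rw [Set.indicator_of_mem hy, norm_smul, Real.norm_eq_abs]
      gcongr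
      exact hM _
    · rw [Set.indicator_of_notMem hy]
      have : fderiv ℝ (γ : Euc n → ℝ) (z - y) = 0 := by
        by_contra h
        have h1 := hR (subset_tsupport _ h)
        rw [mem_closedBall_zero_iff] at h1
        rw [mem_ball_iff_norm] at hz
        rw [mem_closedBall_iff_norm] at hy
        have := norm_add_le (x - z) (z - y)
        rw [sub_add_sub_cancel] at this
        rw [norm_sub_rev] at hz hy
        linarith
      rw [this, smul_zero, norm_zero]
  · rw [integrable_indicator_iff measurableSet_closedBall]
    exact hloc.abs.mul_const M
  · have h1 : HasFDerivAt (fun z : Euc n => z - y) (ContinuousLinearMap.id ℝ _) z :=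
      (hasFDerivAt_id z).sub_const y
    have h2 := ((Sm.differentiable γ (z - y)).hasFDerivAt.comp z h1).const_mul (f y)
    simpa using h2

theorem conv_fderiv {σ : Measure (Euc n)} [IsLocallyFiniteMeasure σ] {f : Euc n → ℝ}
    (hf : LocallyIntegrable f σ) (γ : Sm n) (hγ : HasCompactSupport (γ : Euc n → ℝ))
    (i : Fin n) (x : Euc n) :
    fderiv ℝ (conv σ f γ) x (stdVec n i) = conv σ f (pd i γ) x := by
  rw [(conv_hasFDerivAt hf γ hγ x).fderiv, ContinuousLinearMap.integral_apply]
  · rfl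
  · have hc : Continuous (fderiv ℝ (γ : Euc n → ℝ)) :=
      (Sm.smooth γ).continuous_fderiv (by simp)
    exact hf.integrable_smul_right_of_hasCompactSupport
      (hc.comp (continuous_const.sub continuous_id))
      ((hγ.fderiv ℝ).comp_homeomorph (Homeomorph.subLeft x))

theorem conv_contDiff {σ : Measure (Euc n)} [IsLocallyFiniteMeasure σ] {f : Euc n → ℝ}
    (hf : LocallyIntegrable f σ) (γ : Sm n) (hγ : HasCompactSupport (γ : Euc n → ℝ)) :
    ContDiff ℝ (⊤ : ℕ∞) (conv σ f γ) :=
  hγ.contDiff_convolution_right (ContinuousLinearMap.mul ℝ ℝ) hf (Sm.smooth γ)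

open Classical in
/-- `conv` as a smooth function (zero outside its natural domain). -/
def convS (σ : Measure (Euc n)) [IsLocallyFiniteMeasure σ] (f : Euc n → ℝ) (γ : Sm n) : Sm n :=
  if h : LocallyIntegrable f σ ∧ HasCompactSupport (γ : Euc n → ℝ) then
    ⟨conv σ f γ, conv_contDiff h.1 γ h.2⟩ else 0

theorem convS_apply {σ : Measure (Euc n)} [IsLocallyFiniteMeasure σ] {f : Euc n → ℝ}
    (hf : LocallyIntegrable f σ) {γ : Sm n} (hγ : HasCompactSupport (γ : Euc n → ℝ))
    (x : Euc n) : convS σ f γ x = conv σ f γ x := by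
  rw [convS, dif_pos ⟨hf, hγ⟩]

theorem coe_convS {σ : Measure (Euc n)} [IsLocallyFiniteMeasure σ] {f : Euc n → ℝ}
    (hf : LocallyIntegrable f σ) {γ : Sm n} (hγ : HasCompactSupport (γ : Euc n → ℝ)) :
    (convS σ f γ : Euc n → ℝ) = conv σ f γ := funext (convS_apply hf hγ)

theorem conv_add {σ : Measure (Euc n)} {f : Euc n → ℝ} (hf : LocallyIntegrable f σ)
    {γ δ : Sm n} (hγ : HasCompactSupport (γ : Euc n → ℝ)) (hδ : HasCompactSupport (δ : Euc n → ℝ))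
    (x : Euc n) : conv σ f (γ + δ : Sm n) x = conv σ f γ x + conv σ f δ x := by
  rw [conv, conv, conv, ← integral_add (integrable_conv hf (Sm.continuous γ) hγ x)
    (integrable_conv hf (Sm.continuous δ) hδ x)]
  exact integral_congr_ae (ae_of_all _ fun y => mul_add _ _ _)

theorem conv_smul (σ : Measure (Euc n)) (f : Euc n → ℝ) (c : ℝ) (γ : Sm n) (x : Euc n) :
    conv σ f (c • γ : Sm n) x = c * conv σ f γ x := by
  rw [conv, conv, ← integral_const_mul]
  exact integral_congr_ae (ae_of_all _ fun y => mul_left_comm _ _ _)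

theorem conv_zero (σ : Measure (Euc n)) (f : Euc n → ℝ) (x : Euc n) :
    conv σ f (0 : Sm n) x = 0 := by
  simp [conv]

theorem Sm.hasCompactSupport_zero : HasCompactSupport ((0 : Sm n) : Euc n → ℝ) :=
  HasCompactSupport.zero

theorem op_convS {σ : Measure (Euc n)} [IsLocallyFiniteMeasure σ] {f : Euc n → ℝ}
    (hf : LocallyIntegrable f σ) {l : ℕ} {p : MvPolynomial (Fin n) ℝ} (hp : p.IsHomogeneous l)
    {γ : Sm n} (hγ : HasCompactSupport (γ : Euc n → ℝ)) :
    op n p (convS σ f γ) = convS σ f (op n p γ) := by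
  revert γ
  refine homog_induction (motive := fun _ p => ∀ {γ : Sm n},
    HasCompactSupport (γ : Euc n → ℝ) → op n p (convS σ f γ) = convS σ f (op n p γ)) hp
    (fun a γ hγ => ?_) (fun l γ hγ => ?_) (fun l p q hp hq γ hγ => ?_)
    (fun l p i hp γ hγ => ?_)
  · have h := Sm.hasCompactSupport_smul a hγ
    rw [op_C, op_C]
    refine Sm.ext fun x => ?_
    rw [convS_apply hf h, conv_smul, Sm.smul_apply, convS_apply hf hγ]
  · refine Sm.ext fun x => ?_
    simp only [map_zero, LinearMap.zero_apply]
    rw [convS_apply hf Sm.hasCompactSupport_zero, conv_zero, Sm.zero_apply]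
  · have h1 := hasCompactSupport_op p hγ
    have h2 := hasCompactSupport_op q hγ
    have h := Sm.hasCompactSupport_add h1 h2
    rw [op_add, hp hγ, hq hγ, op_add]
    refine Sm.ext fun x => ?_
    rw [Sm.add_apply, convS_apply hf h1, convS_apply hf h2, convS_apply hf h, conv_add hf h1 h2]
  · have h1 := hasCompactSupport_op p hγ
    have h2 := hasCompactSupport_op (MvPolynomial.X i * p) hγ
    rw [op_X_mul, hp hγ]
    refine Sm.ext fun x => ?_
    rw [pd_apply, convS_apply hf h2, coe_convS hf h1, conv_fderiv hf _ h1, op_X_mul]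

end

noncomputable section

open scoped NNReal

variable {n : ℕ}

theorem dil_sub (i : ℕ) (ψ φ : Sm n) : dil i (ψ - φ) = dil i ψ - dil i φ := by
  rw [dil, dil, dil, map_sub, smul_sub]

theorem dil_sum {ι : Type*} (s : Finset ι) (i : ℕ) (ψ : ι → Sm n) :
    dil i (∑ b ∈ s, ψ b) = ∑ b ∈ s, dil i (ψ b) := by
  simp only [dil, map_sum, Finset.smul_sum]

theorem op_dil {l : ℕ} {p : MvPolynomial (Fin n) ℝ} (hp : p.IsHomogeneous l) (i : ℕ) (ψ : Sm n) :
    op n p (dil i ψ) = ((2 : ℝ) ^ i) ^ l • dil i (op n p ψ) := by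
  rw [dil, dil, map_smul, op_aff hp, smul_comm]

theorem dil_succ (i : ℕ) (T : Sm n) :
    dil i ((2 : ℝ) ^ n • aff 2 0 T) = dil (i + 1) T := by
  refine Sm.ext fun x => ?_
  rw [dil_apply, dil_apply, Sm.smul_apply, aff_apply, add_zero, smul_smul, pow_succ' 2 i, mul_pow]
  ring

theorem conv_sub {σ : Measure (Euc n)} {f : Euc n → ℝ} (hf : LocallyIntegrable f σ)
    {γ δ : Sm n} (hγ : HasCompactSupport (γ : Euc n → ℝ)) (hδ : HasCompactSupport (δ : Euc n → ℝ))
    (x : Euc n) : conv σ f (γ - δ : Sm n) x = conv σ f γ x - conv σ f δ x := by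
  have h := Sm.hasCompactSupport_smul (-1) hδ
  rw [sub_eq_add_neg, ← neg_one_smul ℝ δ, conv_add hf hγ h, conv_smul]
  ring

theorem Sm.hasCompactSupport_sum {ι : Type*} (s : Finset ι) {γ : ι → Sm n}
    (hγ : ∀ b, HasCompactSupport (γ b : Euc n → ℝ)) :
    HasCompactSupport ((∑ b ∈ s, γ b : Sm n) : Euc n → ℝ) := by
  classical
  induction s using Finset.induction_on with
  | empty => rw [Finset.sum_empty]; exact Sm.hasCompactSupport_zero
  | insert b s hb ih => rw [Finset.sum_insert hb]; exact Sm.hasCompactSupport_add (hγ b) ih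

theorem conv_sum {ι : Type*} (s : Finset ι) {σ : Measure (Euc n)} {f : Euc n → ℝ}
    (hf : LocallyIntegrable f σ) {γ : ι → Sm n}
    (hγ : ∀ b, HasCompactSupport (γ b : Euc n → ℝ)) (x : Euc n) :
    conv σ f (∑ b ∈ s, γ b : Sm n) x = ∑ b ∈ s, conv σ f (γ b) x := by
  classical
  induction s using Finset.induction_on with
  | empty => simp [conv]
  | insert b s hb ih =>
    rw [Finset.sum_insert hb, Finset.sum_insert hb,
      conv_add hf (hγ b) (Sm.hasCompactSupport_sum s hγ), ih]

variable {B C : Type} [Fintype C]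

/-- The system `∑_c a_{bc}(∂) u_c = f_b σ` in the sense of distributions. -/
def WeakEq (k : ℕ) (a : Matrix B C (MvPolynomial (Fin n) ℝ)) (u : C → Euc n → ℝ)
    (σ : Measure (Euc n)) (f : B → Euc n → ℝ) : Prop :=
  ∀ b (θ : Sm n), HasCompactSupport (θ : Euc n → ℝ) →
    (-1 : ℝ) ^ k * ∑ c, ∫ x, u c x * op n (a b c) θ x = ∫ x, f b x * θ x ∂σ

variable {k : ℕ} {a : Matrix B C (MvPolynomial (Fin n) ℝ)} {u : C → Euc n → ℝ}
  {σ : Measure (Euc n)} {f : B → Euc n → ℝ}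

theorem WeakEq.sum_conv (h : WeakEq k a u σ f) (hk : ∀ b c, (a b c).IsHomogeneous k) (b : B)
    {ψ : Sm n} (hψ : HasCompactSupport (ψ : Euc n → ℝ)) (x : Euc n) :
    ∑ c, conv volume (u c) (op n (a b c) ψ) x = conv σ (f b) ψ x := by
  have e : ∀ (φ : Sm n) y, (aff (-1) x φ : Sm n) y = φ (x - y) := fun φ y => by
    rw [aff_apply, neg_one_smul, neg_add_eq_sub]
  have := h b (aff (-1) x ψ) (hasCompactSupport_aff (by norm_num) x hψ)
  simp only [op_aff (hk b _), Sm.smul_apply, e, mul_left_comm _ ((-1 : ℝ) ^ k),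
    integral_const_mul] at this
  rw [← Finset.mul_sum, ← mul_assoc, ← mul_pow, neg_one_mul, neg_neg, one_pow, one_mul] at this
  exact this

theorem WeakEq.conv_dil_sub [Fintype B] (h : WeakEq k a u σ f) (hk : ∀ b c, (a b c).IsHomogeneous k)
    (hu : ∀ c, LocallyIntegrable (u c)) {β : B → Sm n} {T : C → Sm n}
    (hβ : ∀ b, HasCompactSupport (β b : Euc n → ℝ))
    (hT : ∀ c, HasCompactSupport (T c : Euc n → ℝ))
    (hβT : ∀ c, ∑ b, op n (a b c) (β b) = (2 : ℝ) ^ n • aff 2 0 (T c) - T c) (i : ℕ) (x : Euc n) :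
    ∑ c, conv volume (u c) (dil (i + 1) (T c)) x - ∑ c, conv volume (u c) (dil i (T c)) x
      = (((2 : ℝ) ^ i) ^ k)⁻¹ * ∑ b, conv σ (f b) (dil i (β b)) x := by
  have h1 : ∀ c, conv volume (u c) (dil (i + 1) (T c)) x - conv volume (u c) (dil i (T c)) x
      = ∑ b, (((2 : ℝ) ^ i) ^ k)⁻¹ * conv volume (u c) (op n (a b c) (dil i (β b))) x := by
    intro c
    rw [← conv_sub (hu c) (hasCompactSupport_dil (hT c) _) (hasCompactSupport_dil (hT c) _),
      ← dil_succ, ← dil_sub, ← hβT, dil_sum,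
      conv_sum _ (hu c) (fun b => hasCompactSupport_dil (hasCompactSupport_op _ (hβ b)) i)]
    refine Finset.sum_congr rfl fun b _ => ?_
    rw [op_dil (hk b c), conv_smul, inv_mul_cancel_left₀ (by positivity)]
  rw [← Finset.sum_sub_distrib, Finset.sum_congr rfl fun c _ => h1 c, Finset.sum_comm,
    Finset.mul_sum]
  refine Finset.sum_congr rfl fun b _ => ?_
  rw [← Finset.mul_sum, h.sum_conv hk b (hasCompactSupport_dil (hβ b) i)]

theorem ae_tendsto_conv_dil {u : Euc n → ℝ} (hu : LocallyIntegrable u) {T : Sm n}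
    (hT : tsupport (T : Euc n → ℝ) ⊆ closedBall 0 2⁻¹) :
    ∀ᵐ x, Tendsto (fun N => conv volume u (dil N T) x) atTop (𝓝 (u x * ∫ y, T y)) := by
  obtain ⟨M, hM0, hM, -⟩ := exists_bound_lipschitz T (hasCompactSupport_of_subset hT)
  filter_upwards [ae_tendsto_osc hu] with x hx
  rw [tendsto_iff_norm_sub_tendsto_zero]
  refine squeeze_zero (fun _ => norm_nonneg _) (fun N => ?_) (by simpa using hx.const_mul M)
  have h1 : ∫ y, dil N T (x - y) = ∫ y, T y := by
    rw [integral_sub_left_eq_self (fun y => dil N T y), integral_dil]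
  rw [← h1, Real.norm_eq_abs, osc, ← mul_assoc, mul_comm M]
  refine abs_integral_mul_sub_le hu
    ((Sm.continuous (dil N T)).comp (continuous_const.sub continuous_id)).aestronglyMeasurable
    (fun y => abs_dil_le hM N _) fun y hy => ?_
  have : ‖x - y‖ ≤ 2⁻¹ * 2⁻¹ ^ N := norm_le_of_dil_ne_zero hT hy
  rw [mem_closedBall_iff_norm, norm_sub_rev]
  have h0 : (0 : ℝ) ≤ 2⁻¹ ^ N := by positivity
  linarith

theorem lintegral_enorm_dil (ψ : Sm n) (i : ℕ) : ∫⁻ x, ‖dil i ψ x‖ₑ = ∫⁻ x, ‖ψ x‖ₑ := by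
  have h := lintegral_comp_sub_smul (n := n) (r := 2 ^ i) (by positivity) 0
    (g := fun x => ‖ψ (-x)‖ₑ) ((Sm.continuous ψ).comp continuous_neg).enorm.measurable
  simp only [zero_sub, neg_neg] at h
  rw [lintegral_neg_eq_self (fun x => ‖ψ x‖ₑ)] at h
  rw [← h, ← lintegral_const_mul' _ _ ENNReal.ofReal_ne_top]
  refine lintegral_congr fun x => ?_
  rw [dil_apply, enorm_mul, Real.enorm_of_nonneg (by positivity)]

theorem lintegral_conv_le {σ : Measure (Euc n)} [IsLocallyFiniteMeasure σ] {f : Euc n → ℝ}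
    (hf1 : ∀ᵐ y ∂σ, |f y| ≤ 1) {ψ : Sm n} (hψ : tsupport (ψ : Euc n → ℝ) ⊆ closedBall 0 2⁻¹)
    (R : ℝ) (i : ℕ) :
    ∫⁻ x in ball 0 R, ‖conv σ f (dil i ψ) x‖ₑ ≤ (∫⁻ x, ‖ψ x‖ₑ) * σ (ball 0 (R + 1)) := by
  have hc := Sm.continuous (dil i ψ)
  have hsf : SFinite σ := inferInstance
  have hm : Measurable fun z : Euc n × Euc n => ‖dil i ψ (z.1 - z.2)‖ₑ :=
    (hc.comp (continuous_fst.sub continuous_snd)).enorm.measurable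
  have h1 : ∀ x ∈ ball (0 : Euc n) R, ‖conv σ f (dil i ψ) x‖ₑ
      ≤ ∫⁻ y in ball 0 (R + 1), ‖dil i ψ (x - y)‖ₑ ∂σ := by
    intro x hx
    refine (enorm_integral_le_lintegral_enorm _).trans ?_
    rw [← lintegral_indicator measurableSet_ball]
    refine lintegral_mono_ae ?_
    filter_upwards [hf1] with y hy
    by_cases h : y ∈ ball (0 : Euc n) (R + 1)
    · rw [Set.indicator_of_mem h, enorm_mul]
      refine mul_le_of_le_one_left bot_le ?_
      rw [← ofReal_norm, ENNReal.ofReal_le_one]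
      exact hy
    · rw [Set.indicator_of_notMem h]
      have : dil i ψ (x - y) = 0 := by
        by_contra h'
        have h2 := norm_le_of_dil_ne_zero hψ h'
        have h3 : (2⁻¹ : ℝ) ^ i ≤ 1 := pow_le_one₀ (by norm_num) (by norm_num)
        rw [mem_ball_zero_iff] at h hx
        have h4 := norm_sub_le x (x - y)
        rw [sub_sub_cancel] at h4
        linarith
      rw [this, mul_zero, enorm_zero]
  calc _ ≤ ∫⁻ x in ball 0 R, ∫⁻ y in ball 0 (R + 1), ‖dil i ψ (x - y)‖ₑ ∂σ :=
        setLIntegral_mono' measurableSet_ball h1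
    _ ≤ ∫⁻ x, ∫⁻ y in ball 0 (R + 1), ‖dil i ψ (x - y)‖ₑ ∂σ := setLIntegral_le_lintegral _ _
    _ = ∫⁻ y in ball 0 (R + 1), (∫⁻ x, ‖dil i ψ (x - y)‖ₑ) ∂σ :=
        lintegral_lintegral_swap (f := fun x y => ‖dil i ψ (x - y)‖ₑ) hm.aemeasurable
    _ = ∫⁻ y in ball 0 (R + 1), (∫⁻ x, ‖ψ x‖ₑ) ∂σ := by
        refine lintegral_congr fun y => ?_
        rw [lintegral_sub_right_eq_self (fun x => ‖dil i ψ x‖ₑ) y]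
        exact lintegral_enorm_dil ψ i
    _ = _ := by rw [lintegral_const, Measure.restrict_apply_univ]

end

noncomputable section

open scoped NNReal

variable {n : ℕ}

/-- The series `∑ g i` converges absolutely in `L¹_loc`. -/
def LocSummable (g : ℕ → Sm n) : Prop :=
  ∀ R : ℕ, ∑' i, ∫⁻ x in ball (0 : Euc n) R, ‖g i x‖ₑ ≠ ⊤

theorem LocSummable.lintegral_ne_top {g : ℕ → Sm n} (hg : LocSummable g) (R : ℕ) :
    ∫⁻ x in ball (0 : Euc n) R, ∑' i, ‖g i x‖ₑ ≠ ⊤ := by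
  rw [lintegral_tsum fun i => (Sm.continuous (g i)).enorm.measurable.aemeasurable]
  exact hg R

theorem LocSummable.ae_summable {g : ℕ → Sm n} (hg : LocSummable g) :
    ∀ᵐ x, Summable fun i => ‖g i x‖ := by
  have h1 : ∀ᵐ x, ∀ R : ℕ, x ∈ ball (0 : Euc n) R → Summable fun i => ‖g i x‖ := by
    rw [ae_all_iff]
    intro R
    rw [← ae_restrict_iff' measurableSet_ball]
    have hm : AEMeasurable (fun x => ∑' i, ‖g i x‖ₑ) (volume.restrict (ball (0 : Euc n) R)) :=
      (Measurable.tsum fun i => (Sm.continuous (g i)).enorm.measurable).aemeasurable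
    filter_upwards [ae_lt_top' hm (hg.lintegral_ne_top R)] with x hx
    exact tsum_enorm_ne_top_iff_summable_norm.1 hx.ne
  filter_upwards [h1] with x hx
  obtain ⟨R, hR⟩ := exists_nat_gt ‖x‖
  exact hx R (mem_ball_zero_iff.2 hR)

theorem locallyIntegrable_of_ball {f : Euc n → ℝ}
    (hf : ∀ R : ℕ, IntegrableOn f (ball 0 R)) : LocallyIntegrable f := by
  refine locallyIntegrable_iff.2 fun K hK => ?_
  obtain ⟨R, hR⟩ := hK.isBounded.subset_ball 0
  obtain ⟨N, hN⟩ := exists_nat_ge R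
  exact (hf N).mono_set (hR.trans (ball_subset_ball hN))

theorem LocSummable.locallyIntegrable {g : ℕ → Sm n} (hg : LocSummable g) :
    LocallyIntegrable fun x => ∑' i, g i x := by
  refine locallyIntegrable_of_ball fun R => ⟨?_, ?_⟩
  · exact (Measurable.tsum fun i => (Sm.continuous (g i)).measurable).aestronglyMeasurable
  · refine lt_of_le_of_lt (lintegral_mono fun x => ?_) (hg.lintegral_ne_top R).lt_top
    exact enorm_tsum_le_tsum_enorm

theorem LocSummable.hasSum_integral {g : ℕ → Sm n} (hg : LocSummable g) {ψ : Sm n}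
    (hψ : HasCompactSupport (ψ : Euc n → ℝ)) :
    HasSum (fun i => ∫ x, g i x * ψ x) (∫ x, (∑' i, g i x) * ψ x) := by
  obtain ⟨M, hM⟩ := hψ.exists_bound_of_continuous (Sm.continuous ψ)
  obtain ⟨R, hR⟩ := hψ.isCompact.isBounded.subset_ball 0
  obtain ⟨N, hN⟩ := exists_nat_ge R
  have hi : ∀ i, Integrable (fun x => g i x * ψ x) := fun i =>
    ((Sm.continuous (g i)).mul (Sm.continuous ψ)).integrable_of_hasCompactSupport hψ.mul_left
  have h := hasSum_integral_of_summable_integral_norm hi ?_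
  · simpa only [tsum_mul_right] using h
  · have h2 : ∀ i, ∫⁻ x, ‖g i x * ψ x‖ₑ
        ≤ ENNReal.ofReal M * ∫⁻ x in ball (0 : Euc n) N, ‖g i x‖ₑ := by
      intro i
      rw [← lintegral_const_mul' _ _ ENNReal.ofReal_ne_top,
        ← lintegral_indicator measurableSet_ball]
      refine lintegral_mono fun x => ?_
      by_cases hx : x ∈ ball (0 : Euc n) N
      · rw [Set.indicator_of_mem hx, enorm_mul, mul_comm]
        gcongr
        rw [← ofReal_norm]
        exact ENNReal.ofReal_le_ofReal (hM x)
      · have : ψ x = 0 := by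
          by_contra h'
          exact hx (ball_subset_ball hN (hR (subset_tsupport _ h')))
        rw [this, mul_zero, enorm_zero]
        exact bot_le
    have h3 : ∑' i, ∫⁻ x, ‖g i x * ψ x‖ₑ ≠ ⊤ := by
      refine ne_top_of_le_ne_top ?_ (ENNReal.tsum_le_tsum h2)
      rw [ENNReal.tsum_mul_left]
      exact ENNReal.mul_ne_top ENNReal.ofReal_ne_top (hg N)
    have h4 := ENNReal.summable_toReal h3
    refine h4.congr fun i => ?_
    rw [integral_norm_eq_lintegral_enorm (hi i).aestronglyMeasurable]

theorem weakDeriv_series {l : ℕ} {p : MvPolynomial (Fin n) ℝ} (hp : p.IsHomogeneous l)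
    {u : Euc n → ℝ} {τ : Sm n} {d : ℕ → Sm n} (hd : LocSummable d)
    (hpd : LocSummable fun i => op n p (d i))
    (hu : ∀ᵐ x, Tendsto (fun N => τ x + ∑ i ∈ Finset.range N, d i x) atTop (𝓝 (u x)))
    {φ : Sm n} (hφ : HasCompactSupport (φ : Euc n → ℝ)) :
    ∫ x, u x * op n p φ x
      = (-1) ^ l * ∫ x, (op n p τ x + ∑' i, op n p (d i) x) * φ x := by
  have hpφ := hasCompactSupport_op p hφ
  have e1 : ∀ᵐ x, u x = τ x + ∑' i, d i x := by
    filter_upwards [hu, hd.ae_summable] with x h1 h2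
    exact tendsto_nhds_unique h1 (h2.of_norm.hasSum.tendsto_sum_nat.const_add _)
  have i1 : ∀ (g ψ : Sm n), HasCompactSupport (ψ : Euc n → ℝ) →
      Integrable (fun x => g x * ψ x) := fun g ψ hψ =>
    ((Sm.continuous g).mul (Sm.continuous ψ)).integrable_of_hasCompactSupport hψ.mul_left
  have i2 : ∀ (g : ℕ → Sm n) (ψ : Sm n), LocSummable g → HasCompactSupport (ψ : Euc n → ℝ) →
      Integrable (fun x => (∑' i, g i x) * ψ x) := fun g ψ hg hψ =>
    integrable_mul_of_hasCompactSupport hg.locallyIntegrable (Sm.continuous ψ) hψ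
  have e2 : ∫ x, u x * op n p φ x
      = (∫ x, τ x * op n p φ x) + ∫ x, (∑' i, d i x) * op n p φ x := by
    rw [← integral_add (i1 _ _ hpφ) (i2 _ _ hd hpφ)]
    refine integral_congr_ae ?_
    filter_upwards [e1] with x hx
    rw [hx, add_mul]
  have e3 : ∫ x, (op n p τ x + ∑' i, op n p (d i) x) * φ x
      = (∫ x, op n p τ x * φ x) + ∫ x, (∑' i, op n p (d i) x) * φ x := by
    rw [← integral_add (i1 _ _ hφ) (i2 _ _ hpd hφ)]
    exact integral_congr_ae (ae_of_all _ fun x => add_mul _ _ _)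
  have s : ((-1 : ℝ) ^ l) * (-1) ^ l = 1 := by rw [← mul_pow]; simp
  rw [e2, e3, integral_op_mul hp hφ, mul_add, ← mul_assoc, s, one_mul,
    ← (hd.hasSum_integral hpφ).tsum_eq, ← (hpd.hasSum_integral hφ).tsum_eq, ← tsum_mul_left]
  congr 1
  refine tsum_congr fun i => ?_
  rw [integral_op_mul hp hφ, ← mul_assoc, s, one_mul]

end

noncomputable section

open scoped NNReal

variable {n : ℕ}

/-- A dyadic layer of the potential of order `j` with profile `γ` of the measure `f σ`. -/
def layer (σ : Measure (Euc n)) [IsLocallyFiniteMeasure σ] (f : Euc n → ℝ) (j : ℕ) (γ : Sm n)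
    (i : ℕ) : Sm n := (((2 : ℝ) ^ i) ^ j)⁻¹ • convS σ f (dil i γ)

/-- The potential of order `j` with profile `γ` of the measure `f σ`. -/
def potential (σ : Measure (Euc n)) [IsLocallyFiniteMeasure σ] (f : Euc n → ℝ) (j : ℕ) (γ : Sm n)
    (x : Euc n) : ℝ := ∑' i, layer σ f j γ i x

theorem layer_apply {σ : Measure (Euc n)} [IsLocallyFiniteMeasure σ] {f : Euc n → ℝ}
    (hf : LocallyIntegrable f σ) (j : ℕ) {γ : Sm n} (hγ : HasCompactSupport (γ : Euc n → ℝ))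
    (i : ℕ) (x : Euc n) :
    layer σ f j γ i x = (((2 : ℝ) ^ i) ^ j)⁻¹ * conv σ f (dil i γ) x := by
  rw [layer, Sm.smul_apply, convS_apply hf (hasCompactSupport_dil hγ i)]

theorem op_layer {σ : Measure (Euc n)} [IsLocallyFiniteMeasure σ] {f : Euc n → ℝ}
    (hf : LocallyIntegrable f σ) {l j k : ℕ} (hljk : l + j = k) {p : MvPolynomial (Fin n) ℝ}
    (hp : p.IsHomogeneous l) {γ : Sm n} (hγ : HasCompactSupport (γ : Euc n → ℝ)) (i : ℕ) :
    op n p (layer σ f k γ i) = layer σ f j (op n p γ) i := by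
  have h1 := hasCompactSupport_dil hγ i
  have h2 := hasCompactSupport_dil (hasCompactSupport_op p hγ) i
  have h3 := Sm.hasCompactSupport_smul (((2 : ℝ) ^ i) ^ l) h2
  rw [layer, layer, map_smul, op_convS hf hp h1, op_dil hp]
  refine Sm.ext fun x => ?_
  rw [Sm.smul_apply, Sm.smul_apply, convS_apply hf h3, convS_apply hf h2, conv_smul, ← hljk,
    pow_add, ← mul_assoc, mul_inv_rev, inv_mul_cancel_right₀ (by positivity)]

theorem locSummable_layer {σ : Measure (Euc n)} [IsLocallyFiniteMeasure σ] {f : Euc n → ℝ}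
    (hf : LocallyIntegrable f σ) (hf1 : ∀ᵐ y ∂σ, |f y| ≤ 1) {j : ℕ} (hj : 1 ≤ j) {γ : Sm n}
    (hγ : tsupport (γ : Euc n → ℝ) ⊆ closedBall 0 2⁻¹) : LocSummable (layer σ f j γ) := by
  intro R
  have hγc := hasCompactSupport_of_subset hγ
  have hb : ∀ i, ∫⁻ x in ball (0 : Euc n) R, ‖layer σ f j γ i x‖ₑ
      ≤ (2⁻¹ : ℝ≥0∞) ^ i * ((∫⁻ x, ‖γ x‖ₑ) * σ (ball 0 (R + 1))) := by
    intro i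
    have h1 : ∀ x, ‖layer σ f j γ i x‖ₑ ≤ (2⁻¹ : ℝ≥0∞) ^ i * ‖conv σ f (dil i γ) x‖ₑ := by
      intro x
      rw [layer_apply hf j hγc, enorm_mul]
      gcongr
      rw [Real.enorm_of_nonneg (by positivity), ← ENNReal.ofReal_ofNat 2,
        ← ENNReal.ofReal_inv_of_pos two_pos, ← ENNReal.ofReal_pow (by norm_num)]
      refine ENNReal.ofReal_le_ofReal ?_
      rw [inv_pow]
      gcongr
      exact le_self_pow₀ (one_le_pow₀ one_le_two) (by omega)
    refine (lintegral_mono h1).trans ?_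
    rw [lintegral_const_mul' _ _ (by finiteness)]
    gcongr
    exact lintegral_conv_le hf1 hγ R i
  refine ne_top_of_le_ne_top ?_ (ENNReal.tsum_le_tsum hb)
  rw [ENNReal.tsum_mul_right, ENNReal.tsum_geometric, ENNReal.one_sub_inv_two, inv_inv]
  have h2 : ∫⁻ x, ‖γ x‖ₑ ≠ ⊤ := (integrable_of_compactSupport hγc).2.ne
  have h3 : σ (ball 0 (R + 1)) ≠ ⊤ := measure_ball_lt_top.ne
  finiteness

theorem locSummable_sum {ι : Type*} (s : Finset ι) {g : ι → ℕ → Sm n}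
    (hg : ∀ b, LocSummable (g b)) : LocSummable fun i => ∑ b ∈ s, g b i := by
  intro R
  have h : ∀ i, ∫⁻ x in ball (0 : Euc n) R, ‖(∑ b ∈ s, g b i : Sm n) x‖ₑ
      ≤ ∑ b ∈ s, ∫⁻ x in ball (0 : Euc n) R, ‖g b i x‖ₑ := by
    intro i
    rw [← lintegral_finsetSum _ fun b _ => (Sm.continuous (g b i)).enorm.measurable]
    refine lintegral_mono fun x => ?_
    rw [Sm.sum_apply]
    exact enorm_sum_le _ _
  refine ne_top_of_le_ne_top ?_ (ENNReal.tsum_le_tsum h)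
  rw [Summable.tsum_finsetSum fun _ _ => ENNReal.summable]
  exact ENNReal.sum_ne_top.2 fun b _ => hg b R

variable {B C : Type} [Fintype B] [Fintype C] [DecidableEq C]

theorem weakDeriv_potential {k : ℕ} {a : Matrix B C (MvPolynomial (Fin n) ℝ)}
    (hk : ∀ b c, (a b c).IsHomogeneous k) {β : C → B → Sm n} {T : C → C → Sm n}
    (hβ : ∀ c b, tsupport (β c b : Euc n → ℝ) ⊆ closedBall 0 2⁻¹)
    (hT : ∀ c c', tsupport (T c c' : Euc n → ℝ) ⊆ closedBall 0 2⁻¹)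
    (hT1 : ∀ c c', ∫ x, T c c' x = if c = c' then 1 else 0)
    (hβT : ∀ c c', ∑ b, op n (a b c') (β c b) = (2 : ℝ) ^ n • aff 2 0 (T c c') - T c c')
    {u : C → Euc n → ℝ} {σ : Measure (Euc n)} [IsLocallyFiniteMeasure σ] {f : B → Euc n → ℝ}
    (h : WeakEq k a u σ f) (hu : ∀ c, LocallyIntegrable (u c))
    (hf : ∀ b, LocallyIntegrable (f b) σ) (hf1 : ∀ b, ∀ᵐ y ∂σ, |f b y| ≤ 1)
    {l j : ℕ} (hlj : l + j = k) (hj : 1 ≤ j) {p : MvPolynomial (Fin n) ℝ}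
    (hp : p.IsHomogeneous l) (c : C) :
    ∃ τ : Sm n, ∀ φ : Sm n, HasCompactSupport (φ : Euc n → ℝ) →
      ∫ x, u c x * op n p φ x = (-1) ^ l *
        ∫ x, (τ x + ∑ b, potential σ (f b) j (op n p (β c b)) x) * φ x := by
  have hβc := fun b => hasCompactSupport_of_subset (hβ c b)
  have hTc := fun c' => hasCompactSupport_of_subset (hT c c')
  have hpβ : ∀ b, tsupport (op n p (β c b) : Euc n → ℝ) ⊆ closedBall 0 2⁻¹ := fun b =>
    (tsupport_op p _).trans (hβ c b)
  set d : ℕ → Sm n := fun i => ∑ b, layer σ (f b) k (β c b) i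
  set τ : Sm n := ∑ c', convS volume (u c') (dil 0 (T c c'))
  have hd : LocSummable d := locSummable_sum _ fun b =>
    locSummable_layer (hf b) (hf1 b) (hj.trans (by omega)) (hβ c b)
  have hop : ∀ i, op n p (d i) = ∑ b, layer σ (f b) j (op n p (β c b)) i := fun i => by
    rw [map_sum]
    exact Finset.sum_congr rfl fun b _ => op_layer (hf b) hlj hp (hβc b) i
  have hl := fun b => locSummable_layer (hf b) (hf1 b) hj (hpβ b)
  have hpd : LocSummable fun i => op n p (d i) := by
    simp only [hop]
    exact locSummable_sum _ hl
  have hsum : ∀ x N, τ x + ∑ i ∈ Finset.range N, d i x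
      = ∑ c', conv volume (u c') (dil N (T c c')) x := by
    intro x N
    induction N with
    | zero =>
      rw [Finset.sum_range_zero, add_zero, Sm.sum_apply]
      exact Finset.sum_congr rfl fun c' _ => convS_apply (hu c') (hasCompactSupport_dil (hTc c') 0) x
    | succ N ih =>
      rw [Finset.sum_range_succ, ← add_assoc, ih, ← eq_sub_iff_add_eq', 
        h.conv_dil_sub hk hu hβc hTc (hβT c), Sm.sum_apply, Finset.mul_sum]
      exact Finset.sum_congr rfl fun b _ => layer_apply (hf b) k (hβc b) N x
  have hlim : ∀ᵐ x, Tendsto (fun N => τ x + ∑ i ∈ Finset.range N, d i x) atTop (𝓝 (u c x)) := by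
    have h1 := ae_all_iff.2 fun c' => ae_tendsto_conv_dil (hu c') (hT c c')
    filter_upwards [h1] with x hx
    simp only [hsum]
    have h2 := tendsto_finsetSum Finset.univ fun c' _ => hx c'
    simpa [hT1] using h2
  refine ⟨op n p τ, fun φ hφ => ?_⟩
  rw [weakDeriv_series hp hd hpd hlim hφ]
  congr 1
  refine integral_congr_ae ?_
  filter_upwards [ae_all_iff.2 fun b => (hl b).ae_summable] with x hx
  simp only [hop, Sm.sum_apply, potential]
  rw [Summable.tsum_finsetSum fun b _ => (hx b).of_norm]

end

noncomputable section

open scoped NNReal Nat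

variable {n : ℕ}

/-- The directional derivative along `v` as a polynomial in the partial derivatives. -/
def dirPoly (v : Euc n) : MvPolynomial (Fin n) ℝ := ∑ i, MvPolynomial.C (v i) * MvPolynomial.X i

theorem dirPoly_pow (v : Euc n) (a : ℕ) :
    dirPoly v ^ a = ∑ J : Fin a → Fin n, MvPolynomial.C (∏ i, v (J i)) * monoI J := by
  have h := Finset.prod_univ_sum (fun _ : Fin a => (Finset.univ : Finset (Fin n)))
    (fun _ i => MvPolynomial.C (σ := Fin n) (v i) * MvPolynomial.X i)
  rw [Finset.prod_const, Finset.card_univ, Fintype.card_fin, Fintype.piFinset_univ] at h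
  rw [dirPoly, h]
  refine Finset.sum_congr rfl fun J _ => ?_
  rw [Finset.prod_mul_distrib, monoI, map_prod]

theorem op_dirPoly_pow (v : Euc n) (a : ℕ) (g : Sm n) (x : Euc n) :
    op n (dirPoly v ^ a) g x
      = ∑ J : Fin a → Fin n, (∏ i, v (J i)) * op n (monoI J) g x := by
  rw [dirPoly_pow, op_sum, Sm.sum_apply]
  refine Finset.sum_congr rfl fun J _ => ?_
  rw [op_mul, op_C, Sm.smul_apply]

theorem op_dirPoly (v : Euc n) (g : Sm n) (x : Euc n) :
    op n (dirPoly v) g x = fderiv ℝ g x v := by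
  rw [dirPoly, op_sum, Sm.sum_apply]
  conv_rhs => rw [← sum_apply_stdVec v, map_sum]
  refine Finset.sum_congr rfl fun i _ => ?_
  rw [op_mul, op_C, Sm.smul_apply, op_X, pd_apply, map_smul, smul_eq_mul]

theorem iteratedDeriv_line (g : Sm n) (x₀ v : Euc n) (a : ℕ) (t : ℝ) :
    iteratedDeriv a (fun t : ℝ => g (x₀ + t • v)) t = op n (dirPoly v ^ a) g (x₀ + t • v) := by
  induction a generalizing t with
  | zero => simp
  | succ a ih =>
    rw [iteratedDeriv_succ, funext ih, pow_succ', op_mul, op_dirPoly]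
    have h1 : HasDerivAt (fun t : ℝ => x₀ + t • v) v t := by
      simpa using ((hasDerivAt_id t).smul_const v).const_add x₀
    exact ((Sm.differentiable (op n (dirPoly v ^ a) g) _).hasFDerivAt.comp_hasDerivAt t h1).deriv

theorem abs_op_dirPoly_pow_le (v : Euc n) (a : ℕ) (g : Sm n) (x : Euc n) {M : ℝ}
    (hM : ∀ J : Fin a → Fin n, |op n (monoI J) g x| ≤ M) :
    |op n (dirPoly v ^ a) g x| ≤ n ^ a * ‖v‖ ^ a * M := by
  rw [op_dirPoly_pow]
  refine (Finset.abs_sum_le_sum_abs _ _).trans ?_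
  have h : ∀ J : Fin a → Fin n, |(∏ i, v (J i)) * op n (monoI J) g x| ≤ ‖v‖ ^ a * M := by
    intro J
    rw [abs_mul, Finset.abs_prod]
    refine mul_le_mul ?_ (hM J) (abs_nonneg _) (by positivity)
    calc ∏ i, |v (J i)| ≤ ∏ _i : Fin a, ‖v‖ := Finset.prod_le_prod (fun _ _ => abs_nonneg _)
          fun i _ => PiLp.norm_apply_le v (J i)
      _ = _ := by simp
  refine (Finset.sum_le_sum fun J _ => h J).trans (le_of_eq ?_)
  simp [mul_assoc]

/-- The polynomial of degree at most `j` centred at `x₀` with prescribed derivatives. -/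
def polyOf (j : ℕ) (L : ∀ a, (Fin a → Fin n) → ℝ) (x₀ x : Euc n) : ℝ :=
  ∑ a ∈ Finset.range (j + 1), (a ! : ℝ)⁻¹ * ∑ J : Fin a → Fin n, (∏ i, (x - x₀) (J i)) * L a J

theorem abs_sub_taylor_le (g : Sm n) (j : ℕ) {x₀ x : Euc n} {r M : ℝ} (hM0 : 0 ≤ M)
    (hx : x ∈ ball x₀ r)
    (hM : ∀ y ∈ ball x₀ r, ∀ J : Fin (j + 1) → Fin n, |op n (monoI J) g y| ≤ M) :
    |g x - polyOf j (fun _ J => op n (monoI J) g x₀) x₀ x| ≤ n ^ (j + 1) * r ^ (j + 1) * M := by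
  set v := x - x₀
  have hr : ‖v‖ < r := by rwa [← mem_ball_iff_norm]
  have hf : ContDiff ℝ (⊤ : ℕ∞) (fun t : ℝ => g (x₀ + t • v)) :=
    (Sm.smooth g).comp (contDiff_const.add (contDiff_id.smul contDiff_const))
  have hit : ∀ a, ∀ t ∈ Set.Icc (0 : ℝ) 1,
      iteratedDerivWithin a (fun t : ℝ => g (x₀ + t • v)) (Set.Icc 0 1) t
        = op n (dirPoly v ^ a) g (x₀ + t • v) := fun a t ht => by
    rw [iteratedDerivWithin_eq_iteratedDeriv (uniqueDiffOn_Icc one_pos)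
      (hf.of_le (by exact_mod_cast le_top)).contDiffAt ht, iteratedDeriv_line]
  have h := taylor_mean_remainder_bound (f := fun t : ℝ => g (x₀ + t • v)) (n := j)
    (C := n ^ (j + 1) * r ^ (j + 1) * M) zero_le_one
    (hf.of_le (by exact_mod_cast le_top)).contDiffOn (Set.right_mem_Icc.2 zero_le_one)
    (fun t ht => ?_)
  · have e : taylorWithinEval (fun t : ℝ => g (x₀ + t • v)) j (Set.Icc 0 1) 0 1
        = polyOf j (fun _ J => op n (monoI J) g x₀) x₀ x := by
      rw [taylor_within_apply, polyOf]
      refine Finset.sum_congr rfl fun a _ => ?_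
      rw [hit a 0 (Set.left_mem_Icc.2 zero_le_one), op_dirPoly_pow]
      simp [v]
    rw [e] at h
    simp only [one_smul, v, add_sub_cancel, sub_zero, one_pow, mul_one] at h
    refine h.trans (div_le_self ?_ (by exact_mod_cast Nat.one_le_iff_ne_zero.2 (Nat.factorial_ne_zero j)))
    have : 0 ≤ r := (norm_nonneg v).trans hr.le
    positivity
  · rw [hit _ t ht]
    have hy : x₀ + t • v ∈ ball x₀ r := by
      rw [mem_ball_iff_norm, add_sub_cancel_left, norm_smul, Real.norm_of_nonneg ht.1]
      exact lt_of_le_of_lt (mul_le_of_le_one_left (norm_nonneg _) ht.2) hr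
    refine (abs_op_dirPoly_pow_le v (j + 1) g _ (hM _ hy)).trans ?_
    gcongr

theorem abs_polyOf_le {j : ℕ} {L : ∀ a, (Fin a → Fin n) → ℝ} {x₀ x : Euc n} {r : ℝ}
    (hx : x ∈ ball x₀ r) :
    |polyOf j L x₀ x| ≤ ∑ a ∈ Finset.range (j + 1), ∑ J : Fin a → Fin n, r ^ a * |L a J| := by
  have hr : ‖x - x₀‖ < r := by rwa [← mem_ball_iff_norm]
  refine (Finset.abs_sum_le_sum_abs _ _).trans (Finset.sum_le_sum fun a _ => ?_)
  rw [abs_mul]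
  refine (mul_le_of_le_one_left (abs_nonneg _) ?_).trans
    ((Finset.abs_sum_le_sum_abs _ _).trans (Finset.sum_le_sum fun J _ => ?_))
  · rw [abs_of_nonneg (by positivity)]
    exact inv_le_one_of_one_le₀ (by exact_mod_cast Nat.one_le_iff_ne_zero.2 (Nat.factorial_ne_zero a))
  · rw [abs_mul, Finset.abs_prod]
    gcongr
    calc ∏ i, |(x - x₀) (J i)| ≤ ∏ _i : Fin a, r := Finset.prod_le_prod (fun _ _ => abs_nonneg _)
          fun i _ => (PiLp.norm_apply_le (x - x₀) (J i)).trans hr.le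
      _ = _ := by simp

theorem polyOf_sub (j : ℕ) (L L' : ∀ a, (Fin a → Fin n) → ℝ) (x₀ x : Euc n) :
    polyOf j (fun a J => L a J - L' a J) x₀ x = polyOf j L x₀ x - polyOf j L' x₀ x := by
  simp only [polyOf, mul_sub, Finset.sum_sub_distrib]

theorem polyOf_sum {ι : Type*} (s : Finset ι) (j : ℕ) (L : ι → ∀ a, (Fin a → Fin n) → ℝ)
    (x₀ x : Euc n) :
    polyOf j (fun a J => ∑ i ∈ s, L i a J) x₀ x = ∑ i ∈ s, polyOf j (L i) x₀ x := by
  simp only [polyOf, Finset.mul_sum]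
  rw [Finset.sum_comm]
  refine Finset.sum_congr rfl fun a _ => ?_
  rw [Finset.sum_comm]

section Poly

variable {F : Type*} [NormedAddCommGroup F] [NormedSpace ℝ F]

theorem IsPolyDeg.zero (j : ℕ) : IsPolyDeg n j (fun _ => (0 : F)) :=
  ⟨contDiff_const, fun x => by
    simp [show (fun _ : Euc n => (0 : F)) = 0 from rfl]⟩

theorem IsPolyDeg.add {j : ℕ} {P Q : Euc n → F} (hP : IsPolyDeg n j P) (hQ : IsPolyDeg n j Q) :
    IsPolyDeg n j (fun x => P x + Q x) := by
  refine ⟨hP.1.add hQ.1, fun x => ?_⟩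
  have h := iteratedFDeriv_add_apply (𝕜 := ℝ) (x := x) (i := j + 1)
    (hP.1.of_le (by exact_mod_cast le_top)).contDiffAt
    (hQ.1.of_le (by exact_mod_cast le_top)).contDiffAt
  have h' : (fun x => P x + Q x) = P + Q := rfl
  rw [h', h, hP.2, hQ.2, add_zero]

theorem IsPolyDeg.sum {ι : Type*} {s : Finset ι} {j : ℕ} {P : ι → Euc n → F}
    (hP : ∀ i ∈ s, IsPolyDeg n j (P i)) : IsPolyDeg n j (fun x => ∑ i ∈ s, P i x) := by
  classical
  induction s using Finset.induction_on with
  | empty => simpa using IsPolyDeg.zero j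
  | insert b s hb ih =>
    simp only [Finset.sum_insert hb]
    exact (hP b (by simp)).add (ih fun i hi => hP i (by simp [hi]))

theorem IsPolyDeg.smul_const {j : ℕ} {P : Euc n → ℝ} (hP : IsPolyDeg n j P) (v : F) :
    IsPolyDeg n j (fun x => P x • v) := by
  refine ⟨hP.1.smul contDiff_const, fun x => ?_⟩
  have h := ((ContinuousLinearMap.id ℝ ℝ).smulRight v).iteratedFDeriv_comp_left
    (hP.1.contDiffAt (x := x)) (i := j + 1) (by exact_mod_cast le_top)
  have h' : (fun x => P x • v) = ((ContinuousLinearMap.id ℝ ℝ).smulRight v) ∘ P := rfl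
  rw [h', h, hP.2]
  ext
  simp

theorem IsPolyDeg.const_mul {j : ℕ} {P : Euc n → ℝ} (hP : IsPolyDeg n j P) (c : ℝ) :
    IsPolyDeg n j (fun x => c * P x) := by
  simpa [mul_comm] using hP.smul_const c

theorem IsPolyDeg.succ {j : ℕ} {P : Euc n → F} (hP : IsPolyDeg n j P) : IsPolyDeg n (j + 1) P := by
  refine ⟨hP.1, fun x => ?_⟩
  ext m
  rw [iteratedFDeriv_succ_apply_left, show iteratedFDeriv ℝ (j + 1) P = fun _ => 0
    from funext hP.2, fderiv_fun_const]
  rfl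

theorem IsPolyDeg.mono {i j : ℕ} (hij : i ≤ j) {P : Euc n → F} (hP : IsPolyDeg n i P) :
    IsPolyDeg n j P := by
  induction hij with
  | refl => exact hP
  | step _ ih => exact ih.succ

theorem isPolyDeg_const (j : ℕ) (c : F) : IsPolyDeg n j (fun _ => c) :=
  (show IsPolyDeg n 0 (fun _ => c) from ⟨contDiff_const, fun x => by
    rw [← norm_eq_zero, norm_iteratedFDeriv_one]; simp⟩).mono (Nat.zero_le j)

theorem isPolyDeg_coord (x₀ : Euc n) (i : Fin n) : IsPolyDeg n 1 (fun x => (x - x₀) i) := by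
  refine ⟨by fun_prop, fun x => ?_⟩
  have h1 : ∀ x, fderiv ℝ (fun x : Euc n => (x - x₀) i) x = EuclideanSpace.proj i := fun x => by
    have := (EuclideanSpace.proj (𝕜 := ℝ) i).hasFDerivAt.comp x ((hasFDerivAt_id x).sub_const x₀)
    rw [ContinuousLinearMap.comp_id] at this
    exact this.fderiv
  rw [← norm_eq_zero, ← norm_iteratedFDeriv_fderiv, funext h1, norm_iteratedFDeriv_one]
  simp

theorem IsPolyDeg.affine_mul {j : ℕ} {A P : Euc n → ℝ} (hA : IsPolyDeg n 1 A)
    (hP : IsPolyDeg n j P) : IsPolyDeg n (j + 1) (fun x => A x * P x) := by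
  refine ⟨hA.1.mul hP.1, fun x => ?_⟩
  rw [← norm_eq_zero]
  refine le_antisymm ((norm_iteratedFDeriv_mul_le (hA.1.of_le (m := (j + 1 + 1 : ℕ))
    (by exact_mod_cast le_top)) (hP.1.of_le (by exact_mod_cast le_top)) x le_rfl).trans
    (Finset.sum_nonpos fun i hi => ?_)) (norm_nonneg _)
  rcases i with _ | _ | i
  · have := hP.succ.2 x
    simp [this]
  · simp [hP.2 x]
  · have := (hA.mono (show 1 ≤ i + 1 by omega)).2 x
    simp [this]

theorem isPolyDeg_polyOf (j : ℕ) (L : ∀ a, (Fin a → Fin n) → ℝ) (x₀ : Euc n) :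
    IsPolyDeg n j (polyOf j L x₀) := by
  have h : ∀ (a : ℕ) (J : Fin a → Fin n), IsPolyDeg n a (fun x => ∏ i, (x - x₀) (J i)) := by
    intro a
    induction a with
    | zero => intro J; simpa using isPolyDeg_const 0 (1 : ℝ)
    | succ a ih =>
      intro J
      simp only [Fin.prod_univ_succ]
      exact (isPolyDeg_coord x₀ (J 0)).affine_mul (ih fun i => J i.succ)
  refine IsPolyDeg.sum fun a ha => IsPolyDeg.const_mul (IsPolyDeg.sum fun J _ => ?_) _
  exact ((h a J).smul_const (L a J)).mono (by simpa [Nat.lt_succ_iff] using ha)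

end Poly

end

noncomputable section

open scoped NNReal Nat

variable {n : ℕ}

/-- The `L^p` mean over a ball. -/
def avg (p : ℝ) (G : Euc n → ℝ≥0∞) (x : Euc n) (r : ℝ) : ℝ≥0∞ :=
  ((volume (ball x r))⁻¹ * ∫⁻ y in ball x r, G y ^ p) ^ (1 / p)

theorem memT_iff {F : Type*} [NormedAddCommGroup F] [NormedSpace ℝ F] {j : ℕ} {p : ℝ}
    {f : Euc n → F} {x : Euc n} :
    MemT n j p f x ↔ ∃ P, IsPolyDeg n j P ∧ SmallO (avg p (fun y => ‖f y - P y‖ₑ) x) j := Iff.rfl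

theorem avg_mono {p : ℝ} (hp : 0 < p) {F G : Euc n → ℝ≥0∞} {x : Euc n} {r : ℝ}
    (h : ∀ᵐ y, y ∈ ball x r → F y ≤ G y) : avg p F x r ≤ avg p G x r := by
  unfold avg
  have h' : ∀ᵐ y ∂volume.restrict (ball x r), F y ^ p ≤ G y ^ p := by
    rw [ae_restrict_iff' measurableSet_ball]
    filter_upwards [h] with y hy hyb
    exact ENNReal.rpow_le_rpow (hy hyb) hp.le
  have := lintegral_mono_ae h'
  gcongr

theorem avg_const_le {p : ℝ} (hp : 0 < p) (c : ℝ≥0∞) (x : Euc n) (r : ℝ) :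
    avg p (fun _ => c) x r ≤ c := by
  unfold avg
  rw [lintegral_const, Measure.restrict_apply_univ, mul_left_comm]
  calc _ ≤ (c ^ p * 1) ^ (1 / p) := by gcongr; exact ENNReal.inv_mul_le_one _
    _ = c := by rw [mul_one, ← ENNReal.rpow_mul, mul_one_div_cancel hp.ne', ENNReal.rpow_one]

theorem avg_add_le {p : ℝ} (hp : 1 ≤ p) {F G : Euc n → ℝ≥0∞} (hF : AEMeasurable F)
    (hG : AEMeasurable G) (x : Euc n) (r : ℝ) :
    avg p (fun y => F y + G y) x r ≤ avg p F x r + avg p G x r := by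
  have h := ENNReal.lintegral_Lp_add_le hF.restrict hG.restrict hp (μ := volume.restrict (ball x r))
  have h0 : 0 ≤ 1 / p := by positivity
  unfold avg
  rw [ENNReal.mul_rpow_of_nonneg _ _ h0, ENNReal.mul_rpow_of_nonneg _ _ h0,
    ENNReal.mul_rpow_of_nonneg _ _ h0, ← mul_add]
  gcongr
  exact h

theorem avg_le {p : ℝ} (hp : 0 < p) {F : Euc n → ℝ≥0∞} {x : Euc n} {r : ℝ} {D : ℝ≥0∞}
    (h : ∫⁻ y in ball x r, F y ^ p ≤ D ^ p) : avg p F x r ≤ (volume (ball x r))⁻¹ ^ (1 / p) * D := by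
  unfold avg
  rw [ENNReal.mul_rpow_of_nonneg _ _ (by positivity)]
  gcongr
  refine (ENNReal.rpow_le_rpow h (by positivity)).trans (le_of_eq ?_)
  rw [← ENNReal.rpow_mul, mul_one_div_cancel hp.ne', ENNReal.rpow_one]

theorem smallO_iff {Q : ℝ → ℝ≥0∞} {a : ℝ} :
    SmallO Q a ↔ ∀ ε : ℝ≥0, 0 < ε → ∀ᶠ r in 𝓝[>] (0 : ℝ), Q r ≤ ε * ENNReal.ofReal (r ^ a) := by
  have key : ∀ ε : ℝ≥0∞, ∀ r ∈ Set.Ioi (0 : ℝ),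
      (Q r / ENNReal.ofReal (r ^ a) ≤ ε ↔ Q r ≤ ε * ENNReal.ofReal (r ^ a)) := by
    intro ε r hr
    have h : 0 < r ^ a := Real.rpow_pos_of_pos hr a
    rw [ENNReal.div_le_iff (by simpa using h) ENNReal.ofReal_ne_top]
  rw [SmallO, ENNReal.tendsto_nhds_zero]
  constructor
  · intro h ε hε
    filter_upwards [h ε (by exact_mod_cast hε), self_mem_nhdsWithin] with r h1 h2
    exact (key _ r h2).1 h1
  · intro h ε hε
    obtain ⟨ε', h0, h1⟩ := ENNReal.lt_iff_exists_nnreal_btwn.1 hε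
    filter_upwards [h ε' (by exact_mod_cast h0), self_mem_nhdsWithin] with r h2 h3
    exact ((key _ r h3).2 h2).trans h1.le

theorem SmallO.mono {Q Q' : ℝ → ℝ≥0∞} {a : ℝ} (h : SmallO Q a)
    (hQ : ∀ᶠ r in 𝓝[>] (0 : ℝ), Q' r ≤ Q r) : SmallO Q' a :=
  tendsto_of_tendsto_of_tendsto_of_le_of_le' tendsto_const_nhds h
    (Eventually.of_forall fun _ => bot_le) (hQ.mono fun r hr => by gcongr)

theorem SmallO.add {Q Q' : ℝ → ℝ≥0∞} {a : ℝ} (h : SmallO Q a) (h' : SmallO Q' a) :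
    SmallO (fun r => Q r + Q' r) a := by
  have := Tendsto.add (M := ℝ≥0∞) h h'
  rw [add_zero] at this
  exact this.congr fun r => (ENNReal.add_div).symm

theorem smallO_zero (a : ℝ) : SmallO (fun _ => 0) a := by simp [SmallO]

theorem SmallO.avg_sum {ι : Type*} (s : Finset ι) {p : ℝ} (hp : 1 ≤ p) {a : ℝ} {x : Euc n}
    {G : ι → Euc n → ℝ≥0∞} (hG : ∀ i, AEMeasurable (G i)) (h : ∀ i, SmallO (avg p (G i) x) a) :
    SmallO (avg p (fun y => ∑ i ∈ s, G i y) x) a := by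
  classical
  induction s using Finset.induction_on with
  | empty =>
    refine (smallO_zero a).mono (Eventually.of_forall fun r => ?_)
    simpa using avg_const_le (by linarith : 0 < p) 0 x r
  | insert b s hb ih =>
    refine ((h b).add ih).mono (Eventually.of_forall fun r => ?_)
    simp only [Finset.sum_insert hb]
    exact avg_add_le hp (hG b) (Finset.aemeasurable_fun_sum s fun i _ => hG i) x r

theorem smallO_of_le_pow {Q : ℝ → ℝ≥0∞} {j : ℕ} {M : ℝ}
    (h : ∀ᶠ r in 𝓝[>] (0 : ℝ), Q r ≤ ENNReal.ofReal (M * r ^ (j + 1))) : SmallO Q j := by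
  have h1 : Tendsto (fun r : ℝ => ENNReal.ofReal (M * r)) (𝓝[>] 0) (𝓝 0) := by
    have : Tendsto (fun r : ℝ => ENNReal.ofReal (M * r)) (𝓝 0) (𝓝 (ENNReal.ofReal (M * 0))) :=
      ((ENNReal.continuous_ofReal.comp (continuous_const.mul continuous_id)).tendsto 0)
    simpa using this.mono_left nhdsWithin_le_nhds
  refine tendsto_of_tendsto_of_tendsto_of_le_of_le' tendsto_const_nhds h1
    (Eventually.of_forall fun _ => bot_le) ?_
  filter_upwards [h, self_mem_nhdsWithin] with r hr hr0
  have hr0' : (0 : ℝ) < r := hr0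
  rw [Real.rpow_natCast, ENNReal.div_le_iff (by simpa using pow_pos hr0' j) ENNReal.ofReal_ne_top,
    ← ENNReal.ofReal_mul' (by positivity), mul_assoc, ← pow_succ']
  exact hr

theorem memT_smooth (g : Sm n) {p : ℝ} (hp : 0 < p) (j : ℕ) (x₀ : Euc n) :
    SmallO (avg p (fun y => ‖g y - polyOf j (fun _ J => op n (monoI J) g x₀) x₀ y‖ₑ) x₀) j := by
  obtain ⟨M, hM⟩ : ∃ M : ℝ, ∀ y ∈ closedBall x₀ 1, ∀ J : Fin (j + 1) → Fin n,
      |op n (monoI J) g y| ≤ M := by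
    have h : ∀ J : Fin (j + 1) → Fin n, ∃ M : ℝ, ∀ y ∈ closedBall x₀ 1, |op n (monoI J) g y| ≤ M :=
      fun J => (isCompact_closedBall x₀ 1).exists_bound_of_continuousOn
        (Sm.continuous (op n (monoI J) g)).continuousOn
    choose M hM using h
    refine ⟨∑ J, |M J|, fun y hy J => ((hM J y hy).trans (le_abs_self _)).trans ?_⟩
    exact Finset.single_le_sum (f := fun J => |M J|) (fun _ _ => abs_nonneg _) (Finset.mem_univ J)
  refine smallO_of_le_pow (M := n ^ (j + 1) * |M|) ?_
  have h1 : ∀ᶠ r in 𝓝[>] (0 : ℝ), r < 1 :=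
    (eventually_lt_nhds one_pos).filter_mono nhdsWithin_le_nhds
  filter_upwards [h1] with r hr
  refine (avg_mono hp (ae_of_all _ fun y hy => ?_)).trans (avg_const_le hp _ x₀ r)
  have h2 := abs_sub_taylor_le g j (abs_nonneg M) hy fun y hy J =>
    (hM y (ball_subset_closedBall (ball_subset_ball hr.le hy)) J).trans (le_abs_self M)
  rw [← ofReal_norm, Real.norm_eq_abs]
  refine ENNReal.ofReal_le_ofReal (h2.trans (le_of_eq ?_))
  ring

end

noncomputable section

open scoped NNReal

variable {n : ℕ}

/-- `ν` has vanishing `n`-dimensional density at `x`. -/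
def ZeroDensity (ν : Measure (Euc n)) (x : Euc n) : Prop :=
  Tendsto (fun r => ν (closedBall x r) / ENNReal.ofReal (r ^ n)) (𝓝[>] 0) (𝓝 0)

theorem zeroDensity_of_volume {ν : Measure (Euc n)} {x : Euc n}
    (h : Tendsto (fun r => ν (closedBall x r) / volume (closedBall x r)) (𝓝[>] 0) (𝓝 0)) :
    ZeroDensity ν x := by
  have hc0 : volume (closedBall (0 : Euc n) 1) ≠ 0 :=
    (Metric.measure_closedBall_pos volume _ one_pos).ne'
  have hct : volume (closedBall (0 : Euc n) 1) ≠ ⊤ := measure_closedBall_lt_top.ne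
  have h1 := ENNReal.Tendsto.const_mul (a := volume (closedBall (0 : Euc n) 1)) h (Or.inr hct)
  rw [mul_zero] at h1
  refine h1.congr' ?_
  filter_upwards [self_mem_nhdsWithin] with r hr
  have hr0 : (0 : ℝ) < r := hr
  rw [Measure.addHaar_closedBall' volume x hr0.le, finrank_euclideanSpace_fin, mul_comm,
    ENNReal.div_eq_inv_mul, ENNReal.div_eq_inv_mul, ENNReal.mul_inv (Or.inr hct) (Or.inr hc0)]
  calc _ = (ENNReal.ofReal (r ^ n))⁻¹ * ν (closedBall x r) *
        ((volume (closedBall (0 : Euc n) 1))⁻¹ * volume (closedBall (0 : Euc n) 1)) := by ring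
    _ = _ := by rw [ENNReal.inv_mul_cancel hc0 hct, mul_one]

theorem ZeroDensity.add {ν ν' : Measure (Euc n)} {x : Euc n} (h : ZeroDensity ν x)
    (h' : ZeroDensity ν' x) : ZeroDensity (ν + ν') x := by
  have := Tendsto.add (M := ℝ≥0∞) h h'
  rw [add_zero] at this
  refine this.congr fun r => ?_
  rw [Measure.add_apply, ENNReal.add_div]

theorem ZeroDensity.sum {ι : Type*} (s : Finset ι) {ν : ι → Measure (Euc n)} {x : Euc n}
    (h : ∀ i, ZeroDensity (ν i) x) : ZeroDensity (∑ i ∈ s, ν i) x := by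
  classical
  induction s using Finset.induction_on with
  | empty => simp [ZeroDensity]
  | insert b s hb ih => rw [Finset.sum_insert hb]; exact (h b).add ih

theorem isLocallyFiniteMeasure_withDensity_enorm {g : Euc n → ℝ} (hg : LocallyIntegrable g) :
    IsLocallyFiniteMeasure (volume.withDensity fun y => ‖g y‖ₑ) := by
  refine ⟨fun x => ⟨closedBall x 1, closedBall_mem_nhds x one_pos, ?_⟩⟩
  rw [withDensity_apply _ measurableSet_closedBall]
  exact (hg.integrableOn_isCompact (isCompact_closedBall x 1)).2

theorem isLocallyFiniteMeasure_add {ν ν' : Measure (Euc n)} (h : IsLocallyFiniteMeasure ν)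
    (h' : IsLocallyFiniteMeasure ν') : IsLocallyFiniteMeasure (ν + ν') := by
  refine ⟨fun x => ⟨closedBall x 1, closedBall_mem_nhds x one_pos, ?_⟩⟩
  rw [Measure.add_apply]
  exact ENNReal.add_lt_top.2 ⟨measure_closedBall_lt_top, measure_closedBall_lt_top⟩

theorem isLocallyFiniteMeasure_sum {ι : Type*} (s : Finset ι) {ν : ι → Measure (Euc n)}
    (h : ∀ i, IsLocallyFiniteMeasure (ν i)) : IsLocallyFiniteMeasure (∑ i ∈ s, ν i) := by
  classical
  induction s using Finset.induction_on with
  | empty => rw [Finset.sum_empty]; infer_instance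
  | insert b s hb ih =>
    rw [Finset.sum_insert hb]
    exact isLocallyFiniteMeasure_add (h b) ih

theorem ae_exists_zeroDensity {σ : Measure (Euc n)} [IsLocallyFiniteMeasure σ] {f : Euc n → ℝ}
    (hf : LocallyIntegrable f σ) (hf1 : ∀ᵐ y ∂σ, |f y| ≤ 1) :
    ∀ᵐ x, ∃ (h : ℝ) (ν : Measure (Euc n)), IsLocallyFiniteMeasure ν ∧ ZeroDensity ν x ∧
      ∀ φ : Sm n, HasCompactSupport (φ : Euc n → ℝ) →
        ‖(∫ y, f y * φ y ∂σ) - h * ∫ y, φ y‖ₑ ≤ ∫⁻ y, ‖φ y‖ₑ ∂ν := by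
  set s := σ.singularPart volume
  set ρ := σ.rnDeriv volume
  set F : Euc n → ℝ := fun y => (ρ y).toReal • f y
  have hdec : σ = s + volume.withDensity ρ := Measure.haveLebesgueDecomposition_add σ volume
  have hs : s ≤ σ := Measure.singularPart_le σ volume
  have hsf : IsLocallyFiniteMeasure s := Measure.isLocallyFiniteMeasure_of_le hs
  have hd : volume.withDensity ρ ≤ σ := Measure.withDensity_rnDeriv_le σ volume
  have hρm : Measurable ρ := Measure.measurable_rnDeriv σ volume
  have hρt : ∀ᵐ y, ρ y < ⊤ := Measure.rnDeriv_lt_top σ volume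
  have hF : LocallyIntegrable F := by
    rw [locallyIntegrable_iff]
    intro K hK
    have h1 : IntegrableOn f K (volume.withDensity ρ) :=
      (hf.integrableOn_isCompact hK).mono_measure hd
    rw [IntegrableOn, restrict_withDensity hK.measurableSet,
      integrable_withDensity_iff_integrable_smul' hρm (ae_restrict_of_ae hρt)] at h1
    exact h1
  filter_upwards [(Besicovitch.vitaliFamily (volume : Measure (Euc n))).ae_tendsto_lintegral_enorm_sub_div hF,
    Besicovitch.ae_tendsto_rnDeriv s volume, Measure.rnDeriv_singularPart σ volume] with x hx hx1 hx2
  have hFx : LocallyIntegrable fun y => F y - F x := hF.sub (locallyIntegrable_const (F x))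
  have hν := isLocallyFiniteMeasure_withDensity_enorm hFx
  refine ⟨F x, s + volume.withDensity fun y => ‖F y - F x‖ₑ, isLocallyFiniteMeasure_add hsf hν,
    ZeroDensity.add (zeroDensity_of_volume ?_) (zeroDensity_of_volume ?_), fun φ hφ => ?_⟩
  · rw [hx2] at hx1
    exact hx1
  · refine (hx.comp (Besicovitch.tendsto_filterAt volume x)).congr fun r => ?_
    rw [Function.comp, withDensity_apply _ measurableSet_closedBall]
  · have hφc := Sm.continuous φ
    have i1 := integrable_mul_of_hasCompactSupport hf hφc hφ
    have i2 := integrable_mul_of_hasCompactSupport hF hφc hφ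
    have i3 : Integrable fun y => (F y - F x) * φ y :=
      integrable_mul_of_hasCompactSupport hFx hφc hφ
    have e1 : (∫ y, f y * φ y ∂σ) - F x * ∫ y, φ y
        = (∫ y, f y * φ y ∂s) + ∫ y, (F y - F x) * φ y := by
      have e2 : ∫ y, f y * φ y ∂(volume.withDensity ρ) = ∫ y, F y * φ y := by
        rw [integral_withDensity_eq_integral_toReal_smul hρm hρt]
        simp only [F, smul_eq_mul, mul_assoc]
      have e3 : ∫ y, (F y - F x) * φ y = (∫ y, F y * φ y) - F x * ∫ y, φ y := by
        simp only [sub_mul]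
        rw [integral_sub i2 ((integrable_of_compactSupport hφ).const_mul _), integral_const_mul]
      have e4 : ∫ y, f y * φ y ∂σ = (∫ y, f y * φ y ∂s) + ∫ y, f y * φ y ∂(volume.withDensity ρ) := by
        rw [← integral_add_measure (i1.mono_measure hs) (i1.mono_measure hd), ← hdec]
      rw [e4, e2, e3, add_sub_assoc]
    rw [e1, lintegral_add_measure, lintegral_withDensity_eq_lintegral_mul₀
      hFx.aestronglyMeasurable.enorm hφc.enorm.measurable.aemeasurable]
    refine (enorm_add_le _ _).trans (add_le_add ?_ ?_)
    · refine (enorm_integral_le_lintegral_enorm _).trans (lintegral_mono_ae ?_)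
      have hf2 : ∀ᵐ y ∂s, |f y| ≤ 1 := ae_mono hs hf1
      filter_upwards [hf2] with y hy
      rw [enorm_mul]
      refine mul_le_of_le_one_left bot_le ?_
      rw [← ofReal_norm, ENNReal.ofReal_le_one]
      exact hy
    · refine (enorm_integral_le_lintegral_enorm _).trans (le_of_eq ?_)
      refine lintegral_congr fun y => ?_
      rw [enorm_mul, Pi.mul_apply]

theorem ae_exists_zeroDensity_family {B : Type} [Fintype B] {σ : Measure (Euc n)}
    [IsLocallyFiniteMeasure σ] {f : B → Euc n → ℝ} (hf : ∀ b, LocallyIntegrable (f b) σ)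
    (hf1 : ∀ b, ∀ᵐ y ∂σ, |f b y| ≤ 1) :
    ∀ᵐ x, ∃ (h : B → ℝ) (ν : Measure (Euc n)), IsLocallyFiniteMeasure ν ∧ ZeroDensity ν x ∧
      ∀ b, ∀ φ : Sm n, HasCompactSupport (φ : Euc n → ℝ) →
        ‖(∫ y, f b y * φ y ∂σ) - h b * ∫ y, φ y‖ₑ ≤ ∫⁻ y, ‖φ y‖ₑ ∂ν := by
  filter_upwards [ae_all_iff.2 fun b => ae_exists_zeroDensity (hf b) (hf1 b)] with x hx
  choose h ν h1 h2 h3 using hx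
  refine ⟨h, ∑ b, ν b, isLocallyFiniteMeasure_sum _ h1, ZeroDensity.sum _ h2, fun b φ hφ => ?_⟩
  refine (h3 b φ hφ).trans (lintegral_mono' ?_ le_rfl)
  exact Finset.single_le_sum (f := ν) (fun _ _ => Measure.zero_le _) (Finset.mem_univ b)

end

noncomputable section

open scoped NNReal

variable {n : ℕ}

theorem exists_limit_geometric {c ε : ℕ → ℝ} {q : ℝ} (hq0 : 0 < q) (hq : q ≤ 2⁻¹)
    (hε : Tendsto ε atTop (𝓝 0)) (h : ∀ i, |c i| ≤ q ^ i * ε i) :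
    ∃ l, Tendsto (fun N => (q⁻¹) ^ N * |∑ i ∈ Finset.range N, c i - l|) atTop (𝓝 0) := by
  obtain ⟨B, hB⟩ := hε.norm.bddAbove_range
  have hB' : ∀ i, ε i ≤ B := fun i => (le_abs_self _).trans (hB ⟨i, rfl⟩)
  have hg : Summable fun i => q ^ i := summable_geometric_of_lt_one hq0.le (by linarith)
  have hs : Summable c := by
    refine Summable.of_norm_bounded (g := fun i => q ^ i * B) (hg.mul_right B) fun i => ?_
    exact (h i).trans (mul_le_mul_of_nonneg_left (hB' i) (by positivity))
  refine ⟨∑' i, c i, ?_⟩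
  rw [Metric.tendsto_atTop]
  intro δ hδ
  obtain ⟨N₀, hN₀⟩ := (Metric.tendsto_atTop.1 hε) (δ / 3) (by positivity)
  refine ⟨N₀, fun N hN => ?_⟩
  have h1 : ‖∑' i, c (i + N)‖ ≤ (1 - q)⁻¹ * (q ^ N * (δ / 3)) := by
    refine tsum_of_norm_bounded (g := fun i => q ^ i * (q ^ N * (δ / 3)))
      ((hasSum_geometric_of_lt_one hq0.le (by linarith)).mul_right _) fun i => ?_
    refine (h (i + N)).trans ?_
    have := hN₀ (i + N) (by omega)
    rw [Real.dist_0_eq_abs] at this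
    rw [pow_add, ← mul_assoc]
    gcongr
    exact (le_abs_self _).trans this.le
  have h2 : (1 - q)⁻¹ ≤ 2 := by
    rw [inv_le_comm₀ (by linarith) two_pos]
    linarith
  have h3 : ∑ i ∈ Finset.range N, c i - ∑' i, c i = - ∑' i, c (i + N) := by
    rw [← hs.sum_add_tsum_nat_add N]
    ring
  rw [h3, abs_neg, Real.dist_0_eq_abs, abs_mul, abs_abs, abs_of_pos (by positivity)]
  calc q⁻¹ ^ N * |∑' i, c (i + N)| ≤ q⁻¹ ^ N * (2 * (q ^ N * (δ / 3))) := by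
        gcongr
        refine h1.trans ?_
        gcongr
    _ = 2 * (δ / 3) * (q⁻¹ * q) ^ N := by rw [mul_pow]; ring
    _ < δ := by rw [inv_mul_cancel₀ hq0.ne', one_pow]; linarith

/-- The pointwise estimate for the low frequencies. -/
theorem abs_sum_sub_polyOf_le {E : ℕ → Sm n} {x₀ : Euc n} {j : ℕ} {ε : ℕ → ℝ} (hε0 : ∀ i, 0 ≤ ε i)
    (hA : ∀ (J : Fin (j + 1) → Fin n) i, ∀ x ∈ ball x₀ (((2 : ℝ) ^ i)⁻¹),
      |op n (monoI J) (E i) x| ≤ (((2 : ℝ) ^ i) ^ j)⁻¹ * (2 ^ i) ^ (j + 1) * ε i)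
    (L : ∀ a, (Fin a → Fin n) → ℝ) {N : ℕ} {r : ℝ} (hr1 : r * 2 ^ N ≤ 1)
    (hr2 : 1 ≤ 2 * (r * 2 ^ N)) {y : Euc n} (hy : y ∈ ball x₀ r) :
    |∑ i ∈ Finset.range N, E i y - polyOf j L x₀ y| ≤ r ^ j *
      (n ^ (j + 1) * ∑ i ∈ Finset.range N, (2⁻¹ : ℝ) ^ (N - i) * ε i +
        ∑ a ∈ Finset.range (j + 1), ∑ J : Fin a → Fin n, 2 ^ (j - a) * (((2 : ℝ) ^ N) ^ (j - a) *
          |∑ i ∈ Finset.range N, op n (monoI J) (E i) x₀ - L a J|)) := by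
  have hr0 : 0 < r := by
    by_contra h
    have : r * 2 ^ N ≤ 0 := mul_nonpos_of_nonpos_of_nonneg (by linarith) (by positivity)
    linarith
  set T : ℕ → ∀ a, (Fin a → Fin n) → ℝ := fun i _ J => op n (monoI J) (E i) x₀
  have e : ∑ i ∈ Finset.range N, E i y - polyOf j L x₀ y
      = ∑ i ∈ Finset.range N, (E i y - polyOf j (T i) x₀ y)
        + polyOf j (fun a J => ∑ i ∈ Finset.range N, T i a J - L a J) x₀ y := by
    rw [polyOf_sub j (fun a J => ∑ i ∈ Finset.range N, T i a J) L, polyOf_sum,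
      Finset.sum_sub_distrib]
    ring
  rw [e, mul_add]
  refine (abs_add_le _ _).trans (add_le_add ?_ ?_)
  · rw [Finset.mul_sum, Finset.mul_sum]
    refine (Finset.abs_sum_le_sum_abs _ _).trans (Finset.sum_le_sum fun i hi => ?_)
    have hiN : i ≤ N := (Finset.mem_range.1 hi).le
    have hsub : r ≤ ((2 : ℝ) ^ i)⁻¹ := by
      rw [le_inv_comm₀ hr0 (by positivity), ← one_div, le_div_iff₀ hr0, mul_comm]
      refine le_trans ?_ hr1
      gcongr
      exact one_le_two
    have hM0 : 0 ≤ (((2 : ℝ) ^ i) ^ j)⁻¹ * (2 ^ i) ^ (j + 1) * ε i :=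
      mul_nonneg (by positivity) (hε0 i)
    have h1 := abs_sub_taylor_le (E i) j hM0 hy fun z hz J => hA J i z (ball_subset_ball hsub hz)
    refine h1.trans ?_
    have e1 : ((2 : ℝ) ^ i) = 2⁻¹ ^ (N - i) * 2 ^ N := by
      rw [← pow_sub_mul_pow (2 : ℝ) (Nat.sub_le N i), Nat.sub_sub_self hiN, ← mul_assoc,
        mul_right_comm, ← mul_pow]
      norm_num
    have e2 : (((2 : ℝ) ^ i) ^ j)⁻¹ * (2 ^ i) ^ (j + 1) = 2 ^ i := by
      rw [pow_succ, inv_mul_cancel_left₀ (by positivity)]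
    rw [e2]
    calc (n : ℝ) ^ (j + 1) * r ^ (j + 1) * (2 ^ i * ε i)
        = n ^ (j + 1) * r ^ j * (2⁻¹ ^ (N - i) * ε i) * (r * 2 ^ N) := by rw [e1]; ring
      _ ≤ n ^ (j + 1) * r ^ j * (2⁻¹ ^ (N - i) * ε i) * 1 := by
          have := hε0 i
          gcongr
      _ = _ := by ring
  · refine (abs_polyOf_le hy).trans ?_
    simp only [Finset.mul_sum]
    refine Finset.sum_le_sum fun a ha => Finset.sum_le_sum fun J _ => ?_
    have haj : a ≤ j := by have := Finset.mem_range.1 ha; omega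
    rw [← mul_assoc, ← mul_assoc, mul_assoc (r ^ j), ← mul_pow]
    gcongr
    calc r ^ a = r ^ a * 1 ^ (j - a) := by rw [one_pow, mul_one]
      _ ≤ r ^ a * (2 * (r * 2 ^ N)) ^ (j - a) := by gcongr
      _ = r ^ a * r ^ (j - a) * (2 * 2 ^ N) ^ (j - a) := by
          rw [mul_assoc, ← mul_pow]; ring_nf
      _ = _ := by rw [← pow_add, Nat.add_sub_cancel' haj]

theorem smallO_avg_tsum_sub_polyOf {E : ℕ → Sm n} {x₀ : Euc n} {j : ℕ} {p : ℝ} (hp : 1 ≤ p)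
    {ε : ℕ → ℝ} (hε0 : ∀ i, 0 ≤ ε i) (hε : Tendsto ε atTop (𝓝 0))
    (hA : ∀ a ≤ j + 1, ∀ (J : Fin a → Fin n) i, ∀ x ∈ ball x₀ (((2 : ℝ) ^ i)⁻¹),
      |op n (monoI J) (E i) x| ≤ (((2 : ℝ) ^ i) ^ j)⁻¹ * (2 ^ i) ^ a * ε i)
    (hB : ∀ J : Fin j → Fin n, ∃ l,
      Tendsto (fun N => ∑ i ∈ Finset.range N, op n (monoI J) (E i) x₀) atTop (𝓝 l))
    (hC : ∀ᵐ y, Summable fun i => ‖E i y‖)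
    (hD : ∀ δ : ℝ≥0, 0 < δ → ∀ᶠ r in 𝓝[>] (0 : ℝ), ∀ N : ℕ, 1 ≤ 2 * (r * 2 ^ N) →
      avg p (fun y => ∑' i, ‖E (i + N) y‖ₑ) x₀ r ≤ δ * ENNReal.ofReal (r ^ j)) :
    ∃ L, SmallO (avg p (fun y => ‖(∑' i, E i y) - polyOf j L x₀ y‖ₑ) x₀) j := by
  have hlim : ∀ a, ∀ J : Fin a → Fin n, ∃ l, a ≤ j → Tendsto (fun N => ((2 : ℝ) ^ N) ^ (j - a) *
      |∑ i ∈ Finset.range N, op n (monoI J) (E i) x₀ - l|) atTop (𝓝 0) := by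
    intro a J
    rcases lt_trichotomy a j with h | h | h
    · obtain ⟨m, rfl⟩ : ∃ m, j = a + (m + 1) := ⟨j - a - 1, by omega⟩
      have hq : ((2 : ℝ) ^ (m + 1))⁻¹ ≤ 2⁻¹ := by
        gcongr
        exact le_self_pow₀ one_le_two (by omega)
      obtain ⟨l, hl⟩ := exists_limit_geometric (c := fun i => op n (monoI J) (E i) x₀)
        (by positivity) hq hε fun i => by
          refine (hA a (by omega) J i x₀ (mem_ball_self (by positivity))).trans (le_of_eq ?_)
          rw [pow_add (_ ^ i) a (m + 1), mul_inv_rev, inv_mul_cancel_right₀ (by positivity),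
            inv_pow, ← pow_mul, ← pow_mul, mul_comm i]
      refine ⟨l, fun _ => ?_⟩
      refine hl.congr fun N => ?_
      rw [Nat.add_sub_cancel_left, inv_inv, ← pow_mul, ← pow_mul, mul_comm N]
    · subst h
      obtain ⟨l, hl⟩ := hB J
      refine ⟨l, fun _ => ?_⟩
      simp only [Nat.sub_self, pow_zero, one_mul]
      have := (hl.sub_const l).abs
      rwa [sub_self, abs_zero] at this
    · exact ⟨0, fun h' => absurd h' (by omega)⟩
  choose L hL using hlim
  refine ⟨L, ?_⟩
  set H : ℕ → ℝ := fun N => n ^ (j + 1) * ∑ i ∈ Finset.range N, (2⁻¹ : ℝ) ^ (N - i) * ε i +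
        ∑ a ∈ Finset.range (j + 1), ∑ J : Fin a → Fin n, 2 ^ (j - a) * (((2 : ℝ) ^ N) ^ (j - a) *
          |∑ i ∈ Finset.range N, op n (monoI J) (E i) x₀ - L a J|) with hHdef
  have hH : Tendsto H atTop (𝓝 0) := by
    have h1 := (tendsto_sum_geometric_mul hε).const_mul ((n : ℝ) ^ (j + 1))
    have h2 := tendsto_finsetSum (Finset.range (j + 1)) fun a ha => tendsto_finsetSum Finset.univ
      fun (J : Fin a → Fin n) _ => (hL a J (by have := Finset.mem_range.1 ha; omega)).const_mul
        ((2 : ℝ) ^ (j - a))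
    have h3 := h1.add h2
    simp only [mul_zero, Finset.sum_const_zero, add_zero] at h3
    exact h3
  have hp0 : 0 < p := by linarith
  rw [smallO_iff]
  intro δ hδ
  obtain ⟨N₀, hN₀⟩ := Metric.tendsto_atTop.1 hH (δ / 2) (by positivity)
  have hsmall : ∀ᶠ r in 𝓝[>] (0 : ℝ), r < 2⁻¹ ^ N₀ :=
    (eventually_lt_nhds (by positivity)).filter_mono nhdsWithin_le_nhds
  filter_upwards [hD (δ / 2) (by positivity), hsmall, self_mem_nhdsWithin] with r h1 h2 h3
  have hr0 : (0 : ℝ) < r := h3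
  obtain ⟨N, hN1, hN2⟩ := exists_nat_pow_near_of_lt_one hr0
    (h2.le.trans (pow_le_one₀ (by norm_num) (by norm_num))) (by norm_num : (0 : ℝ) < 2⁻¹)
    (by norm_num)
  have hNN : N₀ ≤ N := by
    by_contra hcon
    have : (2⁻¹ : ℝ) ^ N₀ ≤ 2⁻¹ ^ (N + 1) :=
      pow_le_pow_of_le_one (by norm_num) (by norm_num) (by omega)
    linarith
  have hr1 : r * 2 ^ N ≤ 1 := by
    rwa [inv_pow, ← one_div, le_div_iff₀ (by positivity)] at hN2
  have hr2 : 1 ≤ 2 * (r * 2 ^ N) := by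
    rw [inv_pow, ← one_div, div_lt_iff₀ (by positivity), pow_succ] at hN1
    linarith
  have hHN : H N ≤ δ / 2 := by
    have := hN₀ N hNN
    rw [Real.dist_0_eq_abs] at this
    exact (le_abs_self _).trans this.le
  have hmeas : Measurable fun y => ∑' i, ‖E (i + N) y‖ₑ :=
    Measurable.tsum fun i => (Sm.continuous (E (i + N))).enorm.measurable
  calc avg p (fun y => ‖(∑' i, E i y) - polyOf j L x₀ y‖ₑ) x₀ r
      ≤ avg p (fun y => ENNReal.ofReal (r ^ j * (δ / 2)) + ∑' i, ‖E (i + N) y‖ₑ) x₀ r := by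
        refine avg_mono hp0 ?_
        filter_upwards [hC] with y hy hyb
        have e : (∑' i, E i y) - polyOf j L x₀ y
            = (∑ i ∈ Finset.range N, E i y - polyOf j L x₀ y) + ∑' i, E (i + N) y := by
          rw [← hy.of_norm.sum_add_tsum_nat_add N]
          ring
        rw [e]
        refine (enorm_add_le _ _).trans (add_le_add ?_ enorm_tsum_le_tsum_enorm)
        rw [← ofReal_norm, Real.norm_eq_abs]
        refine ENNReal.ofReal_le_ofReal ?_
        refine (abs_sum_sub_polyOf_le hε0 (hA (j + 1) le_rfl) L hr1 hr2 hyb).trans ?_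
        exact mul_le_mul_of_nonneg_left hHN (by positivity)
    _ ≤ ENNReal.ofReal (r ^ j * (δ / 2)) + (δ / 2 : ℝ≥0) * ENNReal.ofReal (r ^ j) :=
        (avg_add_le hp aemeasurable_const hmeas.aemeasurable x₀ r).trans
          (add_le_add (avg_const_le hp0 _ x₀ r) (h1 N hr2))
    _ = δ * ENNReal.ofReal (r ^ (j : ℝ)) := by
        rw [Real.rpow_natCast, mul_comm (r ^ j), ENNReal.ofReal_mul (by positivity), ← add_mul]
        congr 1
        have e1 : ENNReal.ofReal ((δ : ℝ) / 2) = ((δ / 2 : ℝ≥0) : ℝ≥0∞) := by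
          rw [← ENNReal.ofReal_coe_nnreal]
          push_cast
          rfl
        rw [e1, ← ENNReal.coe_add, add_halves]

end

noncomputable section

open scoped NNReal

variable {n : ℕ}

theorem tendsto_mul_const_nhdsGT_zero {c : ℝ} (hc : 0 < c) :
    Tendsto (fun r : ℝ => c * r) (𝓝[>] 0) (𝓝[>] 0) := by
  refine tendsto_nhdsWithin_iff.2 ⟨?_, ?_⟩
  · have : Tendsto (fun r : ℝ => c * r) (𝓝 0) (𝓝 (c * 0)) := (continuous_const_mul c).tendsto 0
    rw [mul_zero] at this
    exact this.mono_left nhdsWithin_le_nhds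
  · filter_upwards [self_mem_nhdsWithin] with r hr
    exact mul_pos hc hr

/-- The estimate for the high frequencies. -/
theorem avg_tail_le {E : ℕ → Sm n} {x₀ : Euc n} {j : ℕ} (hj : 1 ≤ j) (hjn : j < n)
    {ν : Measure (Euc n)} [IsLocallyFiniteMeasure ν] (hν : ZeroDensity ν x₀) {K : ℝ≥0}
    (hK : ∀ i x, ∀ z ∈ ball x ((2⁻¹ : ℝ) ^ i),
      ‖E i x‖ₑ ≤ ENNReal.ofReal (((2 : ℝ) ^ (n - j)) ^ i) * (K * meanDist ν (2⁻¹ ^ i) x z))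
    {δ : ℝ≥0} (hδ : 0 < δ) :
    ∀ᶠ r in 𝓝[>] (0 : ℝ), ∀ N : ℕ, 1 ≤ 2 * (r * 2 ^ N) →
      avg ((n : ℝ) / ((n : ℝ) - (j : ℝ))) (fun y => ∑' i, ‖E (i + N) y‖ₑ) x₀ r
        ≤ δ * ENNReal.ofReal (r ^ j) := by
  have hnj : (0 : ℝ) < (n : ℝ) - j := by
    have : (j : ℝ) < n := by exact_mod_cast hjn
    linarith
  have hn0 : (0 : ℝ) < n := by exact_mod_cast (by omega : 0 < n)
  set p : ℝ := (n : ℝ) / ((n : ℝ) - (j : ℝ))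
  have hp : 1 < p := by
    rw [one_lt_div hnj]
    have : (0 : ℝ) < j := by exact_mod_cast hj
    linarith
  have hp0 : 0 < p := by linarith
  set θ : ℝ := 2 ^ (n - j)
  have hθ : 1 < θ := one_lt_pow₀ one_lt_two (by omega)
  have hcast : ((n - j : ℕ) : ℝ) = (n : ℝ) - j := Nat.cast_sub hjn.le
  have hθp : θ ^ p = 2 ^ n := by
    change ((2 : ℝ) ^ (n - j)) ^ ((n : ℝ) / ((n : ℝ) - (j : ℝ))) = 2 ^ n
    rw [← Real.rpow_natCast 2 (n - j), ← Real.rpow_mul two_pos.le, hcast,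
      mul_div_cancel₀ _ hnj.ne', Real.rpow_natCast]
  obtain ⟨C, hC⟩ := lintegral_tsum_rpow_le n hθ hp hθp K
  have hc0 : volume (ball (0 : Euc n) 1) ≠ 0 := (Metric.measure_ball_pos volume _ one_pos).ne'
  have hct : volume (ball (0 : Euc n) 1) ≠ ⊤ := measure_ball_lt_top.ne
  set D : ℝ≥0∞ := (volume (ball (0 : Euc n) 1))⁻¹ ^ (1 / p) * C ^ (1 / p) *
    ENNReal.ofReal (3 ^ n)
  have hD : D ≠ ⊤ := by
    have : (volume (ball (0 : Euc n) 1))⁻¹ ^ (1 / p) ≠ ⊤ :=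
      ENNReal.rpow_ne_top_of_nonneg (by positivity) (ENNReal.inv_ne_top.2 hc0)
    have h2 : (C : ℝ≥0∞) ^ (1 / p) ≠ ⊤ :=
      ENNReal.rpow_ne_top_of_nonneg (by positivity) ENNReal.coe_ne_top
    finiteness
  have hlim := ENNReal.Tendsto.const_mul (a := D)
    (hν.comp (tendsto_mul_const_nhdsGT_zero (by norm_num : (0 : ℝ) < 3))) (Or.inr hD)
  rw [mul_zero] at hlim
  have hev := ENNReal.tendsto_nhds_zero.1 hlim δ (by exact_mod_cast hδ)
  filter_upwards [hev, self_mem_nhdsWithin] with r h1 hr N hN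
  have hr0 : (0 : ℝ) < r := hr
  have hfin : IsFiniteMeasure (ν.restrict (closedBall x₀ (3 * r))) :=
    ⟨by rw [Measure.restrict_apply_univ]; exact measure_closedBall_lt_top⟩
  set b : ℕ → Euc n → ℝ≥0∞ := fun i => if N ≤ i then
    (ball x₀ r).indicator (fun x => (ENNReal.ofReal (θ ^ i))⁻¹ * ‖E i x‖ₑ) else 0 with hb
  have hθi : ∀ i, ENNReal.ofReal (θ ^ i) ≠ 0 := fun i => by
    rw [Ne, ENNReal.ofReal_eq_zero, not_le]; positivity
  have hS5 := hC (ν.restrict (closedBall x₀ (3 * r))) b (fun i => by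
      rw [hb]
      dsimp only
      split_ifs
      · exact ((Sm.continuous (E i)).enorm.measurable.const_mul _).indicator measurableSet_ball
      · exact measurable_const) (fun i x z hz => by
      rw [hb]
      dsimp only
      split_ifs with hi
      · by_cases hx : x ∈ ball x₀ r
        · rw [Set.indicator_of_mem hx, ENNReal.inv_mul_le_iff (hθi i) ENNReal.ofReal_ne_top]
          refine (hK i x z hz).trans (le_of_eq ?_)
          have hsub : ball x ((2⁻¹ : ℝ) ^ i) ⊆ closedBall x₀ (3 * r) := by
            refine fun y hy => ?_
            rw [mem_closedBall]
            rw [mem_ball] at hy hx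
            have h3 : (2⁻¹ : ℝ) ^ i ≤ 2⁻¹ ^ N := pow_le_pow_of_le_one (by norm_num) (by norm_num) hi
            have h4 : (2⁻¹ : ℝ) ^ N ≤ 2 * r := by
              rw [inv_pow, ← one_div, div_le_iff₀ (by positivity), mul_assoc]
              exact hN
            linarith [dist_triangle y x x₀]
          rw [meanDist, meanDist, Measure.restrict_restrict measurableSet_ball,
            Set.inter_eq_left.2 hsub]
        · rw [Set.indicator_of_notMem hx]
          exact bot_le
      · exact bot_le)
  have hInt : ∫⁻ y in ball x₀ r, (∑' i, ‖E (i + N) y‖ₑ) ^ p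
      ≤ ((C : ℝ≥0∞) ^ (1 / p) * ν (closedBall x₀ (3 * r))) ^ p := by
    rw [Measure.restrict_apply_univ] at hS5
    rw [ENNReal.mul_rpow_of_nonneg _ _ hp0.le, ← ENNReal.rpow_mul, one_div_mul_cancel hp0.ne',
      ENNReal.rpow_one]
    refine le_trans ?_ hS5
    refine le_trans (setLIntegral_mono' measurableSet_ball fun y hy => ?_)
      (setLIntegral_le_lintegral (ball x₀ r) _)
    refine ENNReal.rpow_le_rpow ?_ hp0.le
    refine le_trans (le_of_eq (tsum_congr fun i => ?_))
      (ENNReal.tsum_comp_le_tsum_of_injective (f := fun i => i + N) (add_left_injective N)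
        fun i => ENNReal.ofReal (θ ^ i) * b i y)
    rw [hb]
    dsimp only
    rw [if_pos (by omega), Set.indicator_of_mem hy,
      ENNReal.mul_inv_cancel_left (hθi _) ENNReal.ofReal_ne_top]
  refine (avg_le hp0 hInt).trans ?_
  have hvol : (volume (ball x₀ r))⁻¹ ^ (1 / p)
      = (ENNReal.ofReal (r ^ (n - j)))⁻¹ * (volume (ball (0 : Euc n) 1))⁻¹ ^ (1 / p) := by
    rw [Measure.addHaar_ball_of_pos volume x₀ hr0, finrank_euclideanSpace_fin,
      ENNReal.mul_inv (Or.inr hct) (Or.inr hc0), ENNReal.mul_rpow_of_nonneg _ _ (by positivity),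
      ENNReal.inv_rpow, ENNReal.ofReal_rpow_of_pos (by positivity)]
    congr 3
    rw [one_div_div, ← Real.rpow_natCast r n, ← Real.rpow_mul hr0.le, mul_div_cancel₀ _ hn0.ne',
      ← hcast, Real.rpow_natCast]
  have hsplit : ν (closedBall x₀ (3 * r)) = ENNReal.ofReal (3 ^ n) * ENNReal.ofReal (r ^ j) *
      ENNReal.ofReal (r ^ (n - j)) *
        (ν (closedBall x₀ (3 * r)) / ENNReal.ofReal ((3 * r) ^ n)) := by
    rw [← ENNReal.ofReal_mul (by positivity), ← ENNReal.ofReal_mul (by positivity),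
      mul_assoc ((3 : ℝ) ^ n), ← pow_add, Nat.add_sub_cancel' hjn.le, ← mul_pow,
      ENNReal.mul_div_cancel (by rw [Ne, ENNReal.ofReal_eq_zero, not_le]; positivity)
        ENNReal.ofReal_ne_top]
  have hrn : ENNReal.ofReal (r ^ (n - j)) ≠ 0 := by
    rw [Ne, ENNReal.ofReal_eq_zero, not_le]; positivity
  calc (volume (ball x₀ r))⁻¹ ^ (1 / p) * ((C : ℝ≥0∞) ^ (1 / p) * ν (closedBall x₀ (3 * r)))
      = ((ENNReal.ofReal (r ^ (n - j)))⁻¹ * ENNReal.ofReal (r ^ (n - j))) *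
        (D * (ν (closedBall x₀ (3 * r)) / ENNReal.ofReal ((3 * r) ^ n))) *
          ENNReal.ofReal (r ^ j) := by
        rw [hvol]
        conv_lhs => rw [hsplit]
        ring
    _ ≤ 1 * δ * ENNReal.ofReal (r ^ j) := by
        rw [ENNReal.inv_mul_cancel hrn ENNReal.ofReal_ne_top]
        gcongr
        exact h1
    _ = _ := by rw [one_mul]

theorem ae_tendsto_sum_conv_dil {σ : Measure (Euc n)} [IsLocallyFiniteMeasure σ] {f : Euc n → ℝ}
    (hf : LocallyIntegrable f σ) (hf1 : ∀ᵐ y ∂σ, |f y| ≤ 1) {ψ : Sm n}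
    (hψ : tsupport (ψ : Euc n → ℝ) ⊆ closedBall 0 2⁻¹) (h0 : ∫ x, ψ x = 0) :
    ∀ᵐ x, ∃ l, Tendsto (fun N => ∑ i ∈ Finset.range N, conv σ f (dil i ψ) x) atTop (𝓝 l) := by
  have hloc : ∀ g : Euc n → ℝ, (∀ᵐ y ∂σ, g y ≤ 1) →
      IsLocallyFiniteMeasure (σ.withDensity fun y => ENNReal.ofReal (g y)) := by
    intro g hg
    refine ⟨fun x => ⟨closedBall x 1, closedBall_mem_nhds x one_pos, ?_⟩⟩
    rw [withDensity_apply _ measurableSet_closedBall]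
    refine lt_of_le_of_lt (lintegral_mono_ae (g := fun _ => 1) ?_) ?_
    · filter_upwards [ae_restrict_of_ae hg] with y hy
      exact ENNReal.ofReal_le_one.2 hy
    · rw [setLIntegral_one]
      exact measure_closedBall_lt_top
  have l1 := hloc f (hf1.mono fun y hy => (le_abs_self _).trans hy)
  have l2 := hloc (fun y => -f y) (hf1.mono fun y hy => (neg_le_abs _).trans hy)
  filter_upwards [ae_tendsto_sum_dil_measure ψ hψ h0 (σ.withDensity fun y => ENNReal.ofReal (f y)),
    ae_tendsto_sum_dil_measure ψ hψ h0 (σ.withDensity fun y => ENNReal.ofReal (-f y))]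
    with x ⟨a, ha⟩ ⟨b, hb⟩
  refine ⟨a - b, (ha.sub hb).congr fun N => ?_⟩
  rw [← Finset.sum_sub_distrib]
  refine Finset.sum_congr rfl fun i _ => ?_
  have hfm : AEMeasurable f σ := hf.aestronglyMeasurable.aemeasurable
  have hi := integrable_conv hf (Sm.continuous (dil i ψ))
    (hasCompactSupport_dil (hasCompactSupport_of_subset hψ) i) x
  have hpos : ∀ g : Euc n → ℝ, AEMeasurable g σ → (∀ y, |g y| = |f y|) →
      ∫ y, dil i ψ (x - y) ∂(σ.withDensity fun y => ENNReal.ofReal (g y))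
        = ∫ y, max (g y) 0 * dil i ψ (x - y) ∂σ ∧
      Integrable (fun y => max (g y) 0 * dil i ψ (x - y)) σ := by
    intro g hg hgf
    constructor
    · rw [integral_withDensity_eq_integral_toReal_smul₀ hg.ennreal_ofReal
        (ae_of_all _ fun _ => ENNReal.ofReal_lt_top)]
      rfl
    · refine hi.mono ?_ (ae_of_all _ fun y => ?_)
      · exact ((hg.max aemeasurable_const).mul (((Sm.continuous (dil i ψ)).comp
          (continuous_const.sub continuous_id)).measurable.aemeasurable)).aestronglyMeasurable
      · rw [norm_mul, norm_mul]
        gcongr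
        rw [Real.norm_eq_abs, Real.norm_eq_abs, ← hgf, abs_of_nonneg (le_max_right _ _)]
        exact max_le (le_abs_self _) (abs_nonneg _)
  obtain ⟨e1, i1⟩ := hpos f hfm fun _ => rfl
  obtain ⟨e2, i2⟩ := hpos (fun y => -f y) hfm.neg fun y => abs_neg _
  rw [e1, e2, ← integral_sub i1 i2, conv]
  refine integral_congr_ae (ae_of_all _ fun y => ?_)
  dsimp only
  rw [← sub_mul]
  congr 1
  rcases le_total 0 (f y) with h | h
  · rw [max_eq_left h, max_eq_right (by linarith), sub_zero]
  · rw [max_eq_right h, max_eq_left (by linarith)]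
    ring

end

noncomputable section

open scoped NNReal

variable {n : ℕ}

/-- The difference of the layers of `f σ` and of the constant `h`. -/
def layerDiff (σ : Measure (Euc n)) [IsLocallyFiniteMeasure σ] (f : Euc n → ℝ) (h : ℝ) (j : ℕ)
    (γ : Sm n) (i : ℕ) : Sm n := layer σ f j γ i - h • layer volume (fun _ => 1) j γ i

theorem locallyIntegrable_one (μ : Measure (Euc n)) [IsLocallyFiniteMeasure μ] :
    LocallyIntegrable (fun _ : Euc n => (1 : ℝ)) μ := locallyIntegrable_const 1

theorem conv_one_dil (γ : Sm n) (i : ℕ) (x : Euc n) :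
    conv volume (fun _ => 1) (dil i γ) x = ∫ y, γ y := by
  rw [conv]
  simp only [one_mul]
  rw [integral_sub_left_eq_self (fun y => dil i γ y) volume x, integral_dil]

theorem conv_dil_eq (σ : Measure (Euc n)) (f : Euc n → ℝ) (γ : Sm n) (i : ℕ) (x : Euc n) :
    conv σ f (dil i γ) x
      = ((2 : ℝ) ^ i) ^ n * ∫ y, f y * aff (-(2 : ℝ) ^ i) ((2 : ℝ) ^ i • x) γ y ∂σ := by
  rw [conv, ← integral_const_mul]
  refine integral_congr_ae (ae_of_all _ fun y => ?_)
  dsimp only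
  rw [dil_apply, aff_apply, smul_sub, neg_smul, neg_add_eq_sub]
  ring

theorem WeakEq.cocancelling {B C : Type} [Fintype B] [Fintype C] {k : ℕ} {σ : Measure (Euc n)}
    {a : Matrix B C (MvPolynomial (Fin n) ℝ)} {u : C → Euc n → ℝ} {f : B → Euc n → ℝ}
    (hw : WeakEq k a u σ f) (hu : ∀ c, LocallyIntegrable (u c))
    (hf : ∀ b, LocallyIntegrable (f b) σ) {h : B → ℝ} {ν : Measure (Euc n)}
    (hν : ∀ b (φ : Sm n), HasCompactSupport (φ : Euc n → ℝ) →
      ‖(∫ y, f b y * φ y ∂σ) - h b * ∫ y, φ y‖ₑ ≤ ∫⁻ y, ‖φ y‖ₑ ∂ν) :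
    Cocancelling a ν fun b φ => (∫ y, f b y * φ y ∂σ) - h b * ∫ y, φ y := by
  have hi : ∀ b {φ : Sm n}, HasCompactSupport (φ : Euc n → ℝ) →
      Integrable (fun y => f b y * φ y) σ := fun b φ hφ =>
    integrable_mul_of_hasCompactSupport (hf b) (Sm.continuous φ) hφ
  constructor
  · intro b φ ψ hφ hψ
    simp only [Sm.add_apply, mul_add]
    rw [integral_add (hi b hφ) (hi b hψ), integral_add (integrable_of_compactSupport hφ)
      (integrable_of_compactSupport hψ)]
    ring
  · intro b c φ hφ
    simp only [Sm.smul_apply, mul_left_comm _ c]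
    rw [integral_const_mul, integral_const_mul]
    ring
  · exact hν
  · intro l q hq φ hφ
    have h0 : ∀ b, ∫ y, op n (q b) φ y = 0 := fun b =>
      integral_op_eq_zero (hq.1 b) l.succ_ne_zero fun p =>
        integrable_of_compactSupport (hasCompactSupport_op p hφ)
    simp only [h0, mul_zero, sub_zero]
    simp only [← hw _ _ (hasCompactSupport_op _ hφ), ← Finset.mul_sum]
    rw [Finset.sum_comm]
    refine mul_eq_zero_of_right _ (Finset.sum_eq_zero fun c _ => ?_)
    rw [← integral_finsetSum _ fun b _ => integrable_mul_of_hasCompactSupport (hu c)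
      (Sm.continuous _) (hasCompactSupport_op _ (hasCompactSupport_op _ hφ))]
    simp only [← Finset.mul_sum, ← op_mul, ← Sm.sum_apply, ← op_sum, mul_comm (a _ _)]
    simp only [hq.2 c, map_zero]
    simp

variable {σ : Measure (Euc n)} [IsLocallyFiniteMeasure σ] {f : Euc n → ℝ}

theorem layerDiff_apply (hf : LocallyIntegrable f σ) (h : ℝ) (j : ℕ) {γ : Sm n}
    (hγ : HasCompactSupport (γ : Euc n → ℝ)) (i : ℕ) (x : Euc n) :
    layerDiff σ f h j γ i x
      = (((2 : ℝ) ^ i) ^ j)⁻¹ * (conv σ f (dil i γ) x - h * ∫ y, γ y) := by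
  rw [layerDiff, Sm.sub_apply, Sm.smul_apply, layer_apply hf j hγ,
    layer_apply (locallyIntegrable_one volume) j hγ, conv_one_dil]
  ring

theorem layerDiff_apply_aff (hf : LocallyIntegrable f σ) (h : ℝ) (j : ℕ) {γ : Sm n}
    (hγ : HasCompactSupport (γ : Euc n → ℝ)) (i : ℕ) (x : Euc n) :
    layerDiff σ f h j γ i x = (((2 : ℝ) ^ i) ^ j)⁻¹ * ((2 : ℝ) ^ i) ^ n *
      ((∫ y, f y * aff (-(2 : ℝ) ^ i) ((2 : ℝ) ^ i • x) γ y ∂σ)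
        - h * ∫ y, aff (-(2 : ℝ) ^ i) ((2 : ℝ) ^ i • x) γ y) := by
  have h1 := conv_dil_eq volume (fun _ => 1) γ i x
  rw [conv_one_dil] at h1
  simp only [one_mul] at h1
  rw [layerDiff_apply hf h j hγ, conv_dil_eq, h1]
  ring

theorem op_layerDiff (hf : LocallyIntegrable f σ) (h : ℝ) (j : ℕ) {l : ℕ}
    {p : MvPolynomial (Fin n) ℝ} (hp : p.IsHomogeneous l) {γ : Sm n}
    (hγ : HasCompactSupport (γ : Euc n → ℝ)) (i : ℕ) :
    op n p (layerDiff σ f h j γ i) = ((2 : ℝ) ^ i) ^ l • layerDiff σ f h j (op n p γ) i := by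
  have key : ∀ (μ : Measure (Euc n)) [IsLocallyFiniteMeasure μ] (g : Euc n → ℝ),
      LocallyIntegrable g μ → op n p (layer μ g j γ i)
        = ((2 : ℝ) ^ i) ^ l • layer μ g j (op n p γ) i := by
    intro μ _ g hg
    have h1 := hasCompactSupport_dil hγ i
    have h2 := hasCompactSupport_dil (hasCompactSupport_op p hγ) i
    have h3 := Sm.hasCompactSupport_smul (((2 : ℝ) ^ i) ^ l) h2
    rw [layer, layer, map_smul, op_convS hg hp h1, op_dil hp]
    refine Sm.ext fun x => ?_
    rw [Sm.smul_apply, Sm.smul_apply, Sm.smul_apply, convS_apply hg h3, convS_apply hg h2,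
      conv_smul, mul_left_comm]
  rw [layerDiff, layerDiff, map_sub, map_smul, key σ f hf,
    key volume _ (locallyIntegrable_one volume), smul_sub, smul_comm h]

theorem abs_layerDiff_le (hf : LocallyIntegrable f σ) {h : ℝ} {ν : Measure (Euc n)}
    [IsLocallyFiniteMeasure ν]
    (hν : ∀ φ : Sm n, HasCompactSupport (φ : Euc n → ℝ) →
      ‖(∫ y, f y * φ y ∂σ) - h * ∫ y, φ y‖ₑ ≤ ∫⁻ y, ‖φ y‖ₑ ∂ν) (j : ℕ) {γ : Sm n}
    (hγ : tsupport (γ : Euc n → ℝ) ⊆ closedBall 0 2⁻¹) {M : ℝ} (hM : ∀ y, |γ y| ≤ M)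
    {x₀ x : Euc n} {i : ℕ} (hx : x ∈ ball x₀ (((2 : ℝ) ^ i)⁻¹)) :
    |layerDiff σ f h j γ i x| ≤ (((2 : ℝ) ^ i) ^ j)⁻¹ *
      (M * (((2 : ℝ) ^ i) ^ n * ν.real (closedBall x₀ (2 * ((2 : ℝ) ^ i)⁻¹)))) := by
  have hγc := hasCompactSupport_of_subset hγ
  have hM0 : 0 ≤ M := (abs_nonneg _).trans (hM 0)
  have h2 : (0 : ℝ) < 2 ^ i := by positivity
  rw [layerDiff_apply_aff hf h j hγc, abs_mul, abs_of_nonneg (by positivity), mul_assoc]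
  refine mul_le_mul_of_nonneg_left ?_ (by positivity)
  rw [mul_left_comm M]
  refine mul_le_mul_of_nonneg_left ?_ (by positivity)
  have h3 := hν _ (hasCompactSupport_aff (neg_ne_zero.2 h2.ne') ((2 : ℝ) ^ i • x) hγc)
  have h4 : ∫⁻ y, ‖aff (-(2 : ℝ) ^ i) ((2 : ℝ) ^ i • x) γ y‖ₑ ∂ν
      ≤ ENNReal.ofReal (M * ν.real (closedBall x₀ (2 * ((2 : ℝ) ^ i)⁻¹))) := by
    rw [ENNReal.ofReal_mul hM0, ofReal_measureReal (measure_closedBall_lt_top.ne),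
      ← setLIntegral_const, ← lintegral_indicator measurableSet_closedBall]
    refine lintegral_mono fun y => ?_
    by_cases hy : y ∈ closedBall x₀ (2 * ((2 : ℝ) ^ i)⁻¹)
    · rw [Set.indicator_of_mem hy, aff_apply, Real.enorm_eq_ofReal_abs]
      exact ENNReal.ofReal_le_ofReal (hM _)
    · rw [Set.indicator_of_notMem hy, aff_apply]
      by_contra hne
      refine hy ?_
      have h5 := hγ (subset_tsupport _ (Function.mem_support.2
        fun h0 => hne (by rw [h0, enorm_zero])))
      rw [mem_closedBall_zero_iff, neg_smul, neg_add_eq_sub, ← smul_sub, norm_smul,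
        Real.norm_of_nonneg h2.le, ← le_div_iff₀' h2, ← dist_eq_norm] at h5
      rw [mem_ball] at hx
      rw [mem_closedBall]
      rw [div_eq_mul_inv] at h5
      rw [dist_comm] at h5
      have : (0 : ℝ) < (2 ^ i)⁻¹ := by positivity
      linarith [dist_triangle y x x₀]
  have h5 := h3.trans h4
  rw [Real.enorm_eq_ofReal_abs, ENNReal.ofReal_le_ofReal_iff (by positivity)] at h5
  exact h5

theorem ZeroDensity.tendsto_real {ν : Measure (Euc n)} [IsLocallyFiniteMeasure ν] {x : Euc n}
    (hν : ZeroDensity ν x) :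
    Tendsto (fun i : ℕ => ((2 : ℝ) ^ i) ^ n * ν.real (closedBall x (2 * ((2 : ℝ) ^ i)⁻¹)))
      atTop (𝓝 0) := by
  have h0 : Tendsto (fun i : ℕ => ((2 : ℝ) ^ i)⁻¹) atTop (𝓝[>] 0) := by
    refine tendsto_nhdsWithin_iff.2 ⟨?_, Eventually.of_forall fun i => by
      show (0 : ℝ) < _
      positivity⟩
    simp_rw [← inv_pow]
    exact tendsto_pow_atTop_nhds_zero_of_lt_one (by norm_num) (by norm_num)
  have h1 := hν.comp ((tendsto_mul_const_nhdsGT_zero two_pos).comp h0)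
  have h2 := (ENNReal.tendsto_toReal ENNReal.zero_ne_top).comp h1
  have h3 := h2.const_mul ((2 : ℝ) ^ n)
  simp only [ENNReal.toReal_zero, mul_zero] at h3
  refine h3.congr fun i => ?_
  have : (0 : ℝ) < 2 ^ i := by positivity
  simp only [Function.comp_apply]
  rw [ENNReal.toReal_div, ENNReal.toReal_ofReal (by positivity), Measure.real]
  rw [mul_pow 2, inv_pow]
  field_simp

theorem exists_uniform_bound {γ : Sm n} (hγ : HasCompactSupport (γ : Euc n → ℝ)) (m : ℕ) :
    ∃ M : ℝ, 0 ≤ M ∧ ∀ a ≤ m, ∀ (J : Fin a → Fin n) x, |op n (monoI J) γ x| ≤ M := by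
  have h : ∀ a (J : Fin a → Fin n), ∃ B, 0 ≤ B ∧ ∀ x, |op n (monoI J) γ x| ≤ B := fun a J => by
    obtain ⟨B, hB, h1, _⟩ := exists_bound_lipschitz _ (hasCompactSupport_op (monoI J) hγ)
    exact ⟨B, hB, h1⟩
  choose B hB0 hB using h
  refine ⟨∑ a ∈ Finset.range (m + 1), ∑ J, B a J,
    Finset.sum_nonneg fun a _ => Finset.sum_nonneg fun J _ => hB0 a J, fun a ha J x => ?_⟩
  refine (hB a J x).trans ?_
  refine (Finset.single_le_sum (f := B a) (fun J _ => hB0 a J) (Finset.mem_univ J)).trans ?_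
  exact Finset.single_le_sum (f := fun a => ∑ J, B a J)
    (fun a _ => Finset.sum_nonneg fun J _ => hB0 a J) (Finset.mem_range.2 (by omega))

theorem potential_one (j : ℕ) {γ : Sm n} (hγ : HasCompactSupport (γ : Euc n → ℝ)) (x : Euc n) :
    potential volume (fun _ => 1) j γ x = ∑' i : ℕ, (((2 : ℝ) ^ i) ^ j)⁻¹ * ∫ y, γ y := by
  refine tsum_congr fun i => ?_
  rw [layer_apply (locallyIntegrable_one volume) j hγ, conv_one_dil]

theorem ae_exists_isPolyDeg_potential {B C : Type} [Fintype B] [Fintype C] [DecidableEq B]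
    [DecidableEq C] {k : ℕ} {a : Matrix B C (MvPolynomial (Fin n) ℝ)}
    (hk : ∀ b c, (a b c).IsHomogeneous k) (ha : Ell a) (hc : Canc a)
    {u : C → Euc n → ℝ} {f : B → Euc n → ℝ} (hw : WeakEq k a u σ f)
    (hu : ∀ c, LocallyIntegrable (u c)) (hf : ∀ b, LocallyIntegrable (f b) σ)
    (hf1 : ∀ b, ∀ᵐ y ∂σ, |f b y| ≤ 1) {j : ℕ} (hj : 1 ≤ j) (hjn : j < n) (b : B) {γ : Sm n}
    (hγ : tsupport (γ : Euc n → ℝ) ⊆ closedBall 0 2⁻¹) :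
    ∀ᵐ x₀, ∃ P : Euc n → ℝ, IsPolyDeg n j P ∧
      SmallO (avg ((n : ℝ) / ((n : ℝ) - (j : ℝ)))
        (fun y => ‖potential σ (f b) j γ y - P y‖ₑ) x₀) j := by
  have hγc := hasCompactSupport_of_subset hγ
  have hop0 : ∀ J : Fin j → Fin n, ∫ y, op n (monoI J) γ y = 0 := fun J =>
    integral_op_eq_zero (monoI_homog J) (by omega) fun q =>
      integrable_of_compactSupport (hasCompactSupport_op q hγc)
  have hlim := ae_all_iff.2 fun J : Fin j → Fin n =>
    ae_tendsto_sum_conv_dil (hf b) (hf1 b) ((tsupport_op (monoI J) γ).trans hγ) (hop0 J)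
  obtain ⟨K, hK⟩ := cocancel hk ha hc hγ b
  obtain ⟨M, hM0, hM⟩ := exists_uniform_bound hγc (j + 1)
  have hs1 := (locSummable_layer (hf b) (hf1 b) hj hγ).ae_summable
  have hs2 := (locSummable_layer (locallyIntegrable_one volume)
    (ae_of_all _ fun _ => by simp) hj hγ).ae_summable
  filter_upwards [ae_exists_zeroDensity_family hf hf1, hlim] with x₀ ⟨h, ν, hνl, hν0, hν⟩ hx₀
  have hcoc := hw.cocancelling hu hf hν
  have hnj : (0 : ℝ) < (n : ℝ) - j := by
    have : (j : ℝ) < n := by exact_mod_cast hjn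
    linarith
  have hp : 1 ≤ (n : ℝ) / ((n : ℝ) - (j : ℝ)) := by
    rw [one_le_div hnj]
    have : (0 : ℝ) ≤ j := by positivity
    linarith
  have hsum : ∀ᵐ y, HasSum (fun i => layerDiff σ (f b) (h b) j γ i y)
      (potential σ (f b) j γ y - h b * potential volume (fun _ => 1) j γ y) ∧
      Summable fun i => ‖layerDiff σ (f b) (h b) j γ i y‖ := by
    filter_upwards [hs1, hs2] with y h1 h2
    have h3 : HasSum (fun i => layerDiff σ (f b) (h b) j γ i y)
      (potential σ (f b) j γ y - h b * potential volume (fun _ => 1) j γ y) := by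
      simp only [layerDiff, Sm.sub_apply, Sm.smul_apply]
      exact h1.of_norm.hasSum.sub (h2.of_norm.hasSum.mul_left _)
    exact ⟨h3, h3.summable.norm⟩
  obtain ⟨L, hL⟩ := smallO_avg_tsum_sub_polyOf (E := layerDiff σ (f b) (h b) j γ) (x₀ := x₀)
    (j := j) hp
    (ε := fun i => M * (((2 : ℝ) ^ i) ^ n * ν.real (closedBall x₀ (2 * ((2 : ℝ) ^ i)⁻¹))))
    (fun i => by positivity) (by simpa using hν0.tendsto_real.const_mul M)
    (fun a ha J i x hx => by
      rw [op_layerDiff (hf b) _ _ (monoI_homog J) hγc, Sm.smul_apply, abs_mul,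
        abs_of_nonneg (by positivity), mul_right_comm, mul_comm _ (((2 : ℝ) ^ i) ^ a)]
      exact mul_le_mul_of_nonneg_left (abs_layerDiff_le (hf b) (hν b) j
        ((tsupport_op (monoI J) γ).trans hγ) (hM a ha J) hx) (by positivity))
    (fun J => by
      obtain ⟨l, hl⟩ := hx₀ J
      refine ⟨l, hl.congr fun N => Finset.sum_congr rfl fun i _ => ?_⟩
      rw [op_layerDiff (hf b) _ _ (monoI_homog J) hγc, Sm.smul_apply,
        layerDiff_apply (hf b) _ _ (hasCompactSupport_op _ hγc), hop0, mul_zero, sub_zero,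
        mul_inv_cancel_left₀ (by positivity)])
    (hsum.mono fun y hy => hy.2)
    (fun δ hδ => avg_tail_le hj hjn hν0 (K := K) (fun i x z hz => by
      have h1 := hK ν _ hcoc x (2⁻¹ ^ i) (by positivity) z hz
      rw [inv_pow, inv_inv] at h1
      rw [layerDiff_apply_aff (hf b) _ _ hγc, enorm_mul, Real.enorm_of_nonneg (by positivity)]
      have h2 : (((2 : ℝ) ^ i) ^ j)⁻¹ * ((2 : ℝ) ^ i) ^ n = (2 ^ (n - j)) ^ i := by
        rw [← Nat.sub_add_cancel hjn.le, pow_add, mul_comm, mul_inv_cancel_right₀ (by positivity),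
          Nat.add_sub_cancel, ← pow_mul, ← pow_mul, mul_comm]
      rw [h2]
      gcongr
      rw [meanDist, inv_pow]
      exact h1) hδ)
  set c := h b * ∑' i : ℕ, (((2 : ℝ) ^ i) ^ j)⁻¹ * ∫ y, γ y with hcdef
  refine ⟨fun y => polyOf j L x₀ y + c, (isPolyDeg_polyOf j L x₀).add (isPolyDeg_const _ _), ?_⟩
  refine hL.mono (Eventually.of_forall fun r => avg_mono (by linarith) ?_)
  filter_upwards [hsum] with y hy _
  rw [hy.1.tsum_eq, potential_one j hγc, ← hcdef]
  refine le_of_eq ?_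
  congr 1
  ring


end

noncomputable section

open scoped NNReal

variable {n : ℕ}

theorem mem_range_symbolMap_of_sphere {V W : Type*} [NormedAddCommGroup V] [InnerProductSpace ℝ V]
    [NormedAddCommGroup W] [InnerProductSpace ℝ W] {k : ℕ} (A : CoeffOp n k V W) {w : W}
    (h : ∀ ξ ∈ sphere (0 : Euc n) 1, w ∈ LinearMap.range (symbolMap n k A ξ)) {ξ : Euc n}
    (hξ : ξ ≠ 0) : w ∈ LinearMap.range (symbolMap n k A ξ) := by
  have hξ' : ‖ξ‖ ≠ 0 := norm_ne_zero_iff.2 hξ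
  obtain ⟨v, hv⟩ := h (‖ξ‖⁻¹ • ξ) (by simp [norm_smul, hξ'])
  refine ⟨(‖ξ‖⁻¹ ^ k) • v, ?_⟩
  rw [← hv, map_smul, symbolMap, symbolMap, LinearMap.sum_apply, LinearMap.sum_apply,
    Finset.smul_sum]
  refine Finset.sum_congr rfl fun I _ => ?_
  simp [Finset.prod_mul_distrib, smul_smul]

section Components

variable {V W : Type*}
  [NormedAddCommGroup V] [InnerProductSpace ℝ V] [FiniteDimensional ℝ V]
  [NormedAddCommGroup W] [InnerProductSpace ℝ W] [FiniteDimensional ℝ W]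

variable (V) in
/-- The index type of an orthonormal basis of `V`. -/
abbrev Idx : Type := Fin (Module.finrank ℝ V)

variable (V) in
/-- The chosen orthonormal basis of `V`. -/
abbrev onb : OrthonormalBasis (Idx V) ℝ V := stdOrthonormalBasis ℝ V

theorem onb_ext {x y : V} (h : ∀ c, ⟪onb V c, x⟫ = ⟪onb V c, y⟫) : x = y := by
  rw [← (onb V).sum_repr' x, ← (onb V).sum_repr' y]
  exact Finset.sum_congr rfl fun c _ => by rw [h c]

theorem inner_onb_sum (v : Idx V → ℝ) (c : Idx V) : ⟪onb V c, ∑ c', v c' • onb V c'⟫ = v c := by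
  simp [inner_sum, real_inner_smul_right, orthonormal_iff_ite.1 (onb V).orthonormal]

/-- The symbol of `A` as a matrix of polynomials. -/
def symbolMatrix {k : ℕ} (A : CoeffOp n k V W) :
    Matrix (Idx W) (Idx V) (MvPolynomial (Fin n) ℝ) :=
  fun b c => ∑ I, ⟪onb W b, A I (onb V c)⟫ • monoI I

theorem symbolMatrix_homog {k : ℕ} (A : CoeffOp n k V W) (b : Idx W) (c : Idx V) :
    (symbolMatrix A b c).IsHomogeneous k :=
  MvPolynomial.IsHomogeneous.sum _ _ _ fun I _ => by
    rw [MvPolynomial.smul_eq_C_mul]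
    simpa using (MvPolynomial.isHomogeneous_C (Fin n) _).mul (monoI_homog I)

theorem evM_symbolMatrix_mulVec {k : ℕ} (A : CoeffOp n k V W) (ξ : Euc n) (v : Idx V → ℝ)
    (b : Idx W) : (evM (symbolMatrix A) ξ).mulVec v b
      = ⟪onb W b, symbolMap n k A ξ (∑ c, v c • onb V c)⟫ := by
  have h1 : ∀ c, evM (symbolMatrix A) ξ b c = ⟪onb W b, symbolMap n k A ξ (onb V c)⟫ := by
    intro c
    rw [evM, Matrix.map_apply, symbolMatrix, map_sum, symbolMap, LinearMap.sum_apply, inner_sum]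
    refine Finset.sum_congr rfl fun I _ => ?_
    rw [MvPolynomial.smul_eval, eval_monoI, LinearMap.smul_apply, real_inner_smul_right, mul_comm]
  rw [map_sum, inner_sum]
  simp only [Matrix.mulVec, dotProduct, h1, map_smul, real_inner_smul_right, mul_comm]

theorem exists_mulVec_eq_iff {k : ℕ} (A : CoeffOp n k V W) (ξ : Euc n) (w : Idx W → ℝ) :
    (∃ v, (evM (symbolMatrix A) ξ).mulVec v = w) ↔
      ∑ b, w b • onb W b ∈ LinearMap.range (symbolMap n k A ξ) := by
  constructor
  · rintro ⟨v, rfl⟩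
    refine ⟨∑ c, v c • onb V c, ?_⟩
    conv_lhs => rw [← (onb W).sum_repr' (symbolMap n k A ξ (∑ c, v c • onb V c))]
    simp only [evM_symbolMatrix_mulVec]
  · rintro ⟨v, hv⟩
    refine ⟨fun c => ⟪onb V c, v⟫, funext fun b => ?_⟩
    rw [evM_symbolMatrix_mulVec, (onb V).sum_repr' v, hv, inner_sum]
    simp [real_inner_smul_right, orthonormal_iff_ite.1 (onb W).orthonormal]

theorem ell_symbolMatrix_iff {k : ℕ} (A : CoeffOp n k V W) :
    Ell (symbolMatrix A) ↔ IsElliptic n k A := by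
  refine forall₂_congr fun ξ _ => ⟨fun h => ?_, fun h v v' hv => ?_⟩
  · intro v v' hv
    have h1 : (fun c => ⟪onb V c, v⟫) = fun c => ⟪onb V c, v'⟫ := h (funext fun b => by
      rw [evM_symbolMatrix_mulVec, evM_symbolMatrix_mulVec, (onb V).sum_repr', (onb V).sum_repr',
        hv])
    rw [← (onb V).sum_repr' v, ← (onb V).sum_repr' v']
    exact Finset.sum_congr rfl fun c _ => by rw [congrFun h1 c]
  · have h1 : ∑ c, v c • onb V c = ∑ c, v' c • onb V c := h (by
      rw [← (onb W).sum_repr' (symbolMap n k A ξ _),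
        ← (onb W).sum_repr' (symbolMap n k A ξ (∑ c, v' c • onb V c))]
      refine Finset.sum_congr rfl fun b _ => ?_
      rw [← evM_symbolMatrix_mulVec, ← evM_symbolMatrix_mulVec, hv])
    funext c
    have h2 := congrArg (fun z => ⟪onb V c, z⟫) h1
    simpa [inner_sum, real_inner_smul_right, orthonormal_iff_ite.1 (onb V).orthonormal] using h2

theorem canc_symbolMatrix_iff {k : ℕ} (A : CoeffOp n k V W) :
    Canc (symbolMatrix A) ↔ IsCanceling n k A := by
  constructor
  · intro h
    refine Set.eq_singleton_iff_unique_mem.2 ⟨by simp, fun w hw => ?_⟩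
    have hw' : ∀ ξ ∈ sphere (0 : Euc n) 1, w ∈ LinearMap.range (symbolMap n k A ξ) := fun ξ hξ =>
      Set.mem_iInter₂.1 hw ξ hξ
    have h1 := h (fun b => ⟪onb W b, w⟫) fun ξ hξ => (exists_mulVec_eq_iff A ξ _).2 (by
      rw [(onb W).sum_repr' w]
      exact mem_range_symbolMap_of_sphere A hw' hξ)
    rw [← (onb W).sum_repr' w]
    exact Finset.sum_eq_zero fun b _ => by rw [congrFun h1 b, Pi.zero_apply, zero_smul]
  · intro h w hw
    have h1 : ∑ b, w b • onb W b ∈ ({0} : Set W) := by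
      rw [← h]
      refine Set.mem_iInter₂.2 fun ξ hξ => (exists_mulVec_eq_iff A ξ w).1 (hw ξ ?_)
      exact ne_zero_of_mem_unit_sphere ⟨ξ, hξ⟩
    funext b
    have h2 := congrArg (fun z => ⟪onb W b, z⟫) (Set.mem_singleton_iff.1 h1)
    simpa [inner_sum, real_inner_smul_right, orthonormal_iff_ite.1 (onb W).orthonormal] using h2

theorem op_symbolMatrix {k : ℕ} (A : CoeffOp n k V W) (b : Idx W) (c : Idx V) (θ : Sm n)
    (x : Euc n) : op n (symbolMatrix A b c) θ x
      = ∑ I, ⟪onb W b, A I (onb V c)⟫ * dirDeriv n k I θ x := by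
  simp only [symbolMatrix, map_sum, map_smul, LinearMap.sum_apply, LinearMap.smul_apply,
    Sm.sum_apply, Sm.smul_apply, op_monoI]

/-- The coordinates of a smooth map. -/
def coord (φ : Euc n → W) (hφ : ContDiff ℝ (⊤ : ℕ∞) φ) (b : Idx W) : Sm n :=
  ⟨fun x => ⟪onb W b, φ x⟫, (contDiff_const (c := onb W b)).inner ℝ hφ⟩

theorem coord_apply (φ : Euc n → W) (hφ : ContDiff ℝ (⊤ : ℕ∞) φ) (b : Idx W) (x : Euc n) :
    coord φ hφ b x = ⟪onb W b, φ x⟫ := rfl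

theorem inner_dirDeriv {k : ℕ} (I : Fin k → Fin n) (φ : Euc n → W)
    (hφ : ContDiff ℝ (⊤ : ℕ∞) φ) (b : Idx W) (x : Euc n) :
    ⟪onb W b, dirDeriv n k I φ x⟫ = dirDeriv n k I (coord φ hφ b) x := by
  have h := (innerSL ℝ (onb W b)).iteratedFDeriv_comp_left (x := x) (i := k) hφ.contDiffAt
    (by exact_mod_cast le_top)
  have h2 : ((coord φ hφ b : Sm n) : Euc n → ℝ) = (innerSL ℝ (onb W b)) ∘ φ := rfl
  rw [dirDeriv, dirDeriv, h2, h]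
  rfl

theorem locallyIntegrable_inner {σ : Measure (Euc n)} {u : Euc n → V} (hu : LocallyIntegrable u σ)
    (c : Idx V) : LocallyIntegrable (fun x => ⟪onb V c, u x⟫) σ := fun x =>
  (hu x).imp fun _ hs => ⟨hs.1, hs.2.const_inner _⟩

theorem hasDistribA_iff {k : ℕ} (A : CoeffOp n k V W) {u : Euc n → V} {σ : Measure (Euc n)}
    {f : Euc n → W} (hu : LocallyIntegrable u) (hf : LocallyIntegrable f σ) :
    HasDistribA n k A u σ f ↔ WeakEq k (symbolMatrix A) (fun c x => ⟪onb V c, u x⟫) σ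
      (fun b x => ⟪onb W b, f x⟫) := by
  have key : ∀ φ : Euc n → W, ∀ hφ : IsTestFun n φ,
      (∑ I : Fin k → Fin n, ∫ x, ⟪u x, LinearMap.adjoint (A I) (dirDeriv n k I φ x)⟫)
        = ∑ b, ∑ c, ∫ x, ⟪onb V c, u x⟫ * op n (symbolMatrix A b c) (coord φ hφ.1 b) x := by
    intro φ hφ
    have hd : ∀ b I, Continuous (dirDeriv n k I (coord φ hφ.1 b)) := fun b I =>
      (dirDeriv_smooth I _).continuous
    have hcpt : ∀ b, HasCompactSupport (coord φ hφ.1 b : Euc n → ℝ) := fun b =>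
      hφ.2.comp_left (g := fun w => ⟪onb W b, w⟫) (inner_zero_right _)
    have hdc : ∀ b I, HasCompactSupport (dirDeriv n k I (coord φ hφ.1 b)) := fun b I => by
      have h := hasCompactSupport_op (monoI I) (hcpt b)
      rwa [show (op n (monoI I) (coord φ hφ.1 b) : Euc n → ℝ) = dirDeriv n k I (coord φ hφ.1 b)
        from funext (op_monoI I _)] at h
    have hInt : ∀ b c I, Integrable fun x =>
        ⟪onb V c, u x⟫ * (⟪onb W b, A I (onb V c)⟫ * dirDeriv n k I (coord φ hφ.1 b) x) :=
      fun b c I => by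
        have := (integrable_mul_of_hasCompactSupport (locallyIntegrable_inner hu c) (hd b I)
          (hdc b I)).const_mul ⟪onb W b, A I (onb V c)⟫
        exact this.congr (ae_of_all _ fun x => mul_left_comm _ _ _)
    have h1 : ∀ I, ∫ x, ⟪u x, LinearMap.adjoint (A I) (dirDeriv n k I φ x)⟫
        = ∑ b, ∑ c, ∫ x,
          ⟪onb V c, u x⟫ * (⟪onb W b, A I (onb V c)⟫ * dirDeriv n k I (coord φ hφ.1 b) x) := by
      intro I
      rw [Finset.sum_congr rfl fun b _ => (integral_finsetSum _ fun c _ => hInt b c I).symm,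
        ← integral_finsetSum _ fun b _ => integrable_finsetSum _ fun c _ => hInt b c I]
      refine integral_congr_ae (ae_of_all _ fun x => ?_)
      dsimp only
      rw [LinearMap.adjoint_inner_right, ← (onb W).sum_inner_mul_inner]
      refine Finset.sum_congr rfl fun b _ => ?_
      rw [inner_dirDeriv I φ hφ.1 b x, real_inner_comm]
      conv_lhs => rw [← (onb V).sum_repr' (u x)]
      rw [map_sum, inner_sum, Finset.sum_mul]
      refine Finset.sum_congr rfl fun c _ => ?_
      rw [map_smul, real_inner_smul_right, mul_assoc]
    rw [Finset.sum_congr rfl fun I _ => h1 I, Finset.sum_comm]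
    refine Finset.sum_congr rfl fun b _ => ?_
    rw [Finset.sum_comm]
    refine Finset.sum_congr rfl fun c _ => ?_
    rw [← integral_finsetSum _ fun I _ => hInt b c I]
    refine integral_congr_ae (ae_of_all _ fun x => ?_)
    dsimp only
    rw [op_symbolMatrix, Finset.mul_sum]
  constructor
  · intro h b θ hθ
    have hφ : IsTestFun n fun x => θ x • onb W b :=
      ⟨(Sm.smooth θ).smul contDiff_const, hθ.smul_right⟩
    have hcoord : ∀ b', coord _ hφ.1 b' = if b = b' then θ else 0 := fun b' =>
      Sm.ext fun x => by
        rw [coord_apply, real_inner_smul_right, orthonormal_iff_ite.1 (onb W).orthonormal]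
        split_ifs with h1 h2 h2
        · rw [mul_one]
        · exact absurd h1.symm h2
        · exact absurd h2.symm h1
        · rw [mul_zero, Sm.zero_apply]
    have h1 := h _ hφ
    rw [key _ hφ, Finset.sum_eq_single b (fun b' _ hb => Finset.sum_eq_zero fun c _ => by
      rw [hcoord, if_neg hb.symm]; simp) (by simp)] at h1
    rw [hcoord, if_pos rfl] at h1
    rw [h1]
    refine integral_congr_ae (ae_of_all _ fun x => ?_)
    dsimp only
    rw [real_inner_smul_right, real_inner_comm, mul_comm]
  · intro h φ hφ
    have hcpt : ∀ b, HasCompactSupport (coord φ hφ.1 b : Euc n → ℝ) := fun b =>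
      hφ.2.comp_left (g := fun w => ⟪onb W b, w⟫) (inner_zero_right _)
    rw [key φ hφ, Finset.mul_sum, Finset.sum_congr rfl fun b _ => h b _ (hcpt b),
      ← integral_finsetSum _ fun b _ => integrable_mul_of_hasCompactSupport
        (locallyIntegrable_inner hf b) (Sm.continuous _) (hcpt b)]
    refine integral_congr_ae (ae_of_all _ fun x => ?_)
    dsimp only
    rw [← (onb W).sum_inner_mul_inner]
    exact Finset.sum_congr rfl fun b _ => by rw [coord_apply, real_inner_comm]

/-- Weak derivatives of order `m` of a scalar function. -/
def IsWeakDeriv {m : ℕ} (I : Fin m → Fin n) (u v : Euc n → ℝ) : Prop :=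
  ∀ φ : Sm n, HasCompactSupport (φ : Euc n → ℝ) →
    ∫ x, u x * op n (monoI I) φ x = (-1) ^ m * ∫ x, v x * φ x

theorem isWeakDerivFamily_iff {m : ℕ} {u : Euc n → V} {v : (Fin m → Fin n) → Euc n → V}
    (hu : LocallyIntegrable u) (hv : ∀ I, LocallyIntegrable (v I)) :
    IsWeakDerivFamily n m u v ↔ ∀ I c,
      IsWeakDeriv I (fun x => ⟪onb V c, u x⟫) fun x => ⟪onb V c, v I x⟫ := by
  have h1 : ∀ (g : Sm n) (hg : HasCompactSupport (g : Euc n → ℝ)) {w : Euc n → V}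
      (hw : LocallyIntegrable w) (c : Idx V),
      ⟪onb V c, ∫ x, g x • w x⟫ = ∫ x, ⟪onb V c, w x⟫ * g x := fun g hg w hw c => by
    rw [← integral_inner (hw.integrable_smul_left_of_hasCompactSupport (Sm.continuous g) hg)]
    refine integral_congr_ae (ae_of_all _ fun x => ?_)
    dsimp only
    rw [real_inner_smul_right, mul_comm]
  have hd : ∀ (I : Fin m → Fin n) (φ : Sm n), (fun x => dirDeriv n m I φ x • u x)
      = fun x => op n (monoI I) φ x • u x := fun I φ => funext fun x => by rw [op_monoI]
  constructor
  · intro h I c φ hφ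
    have h2 := congrArg (fun z => ⟪onb V c, z⟫) (h.2 I φ ⟨Sm.smooth φ, hφ⟩)
    rw [hd, h1 _ (hasCompactSupport_op _ hφ) hu, real_inner_smul_right, h1 _ hφ (hv I)] at h2
    exact h2
  · refine fun h => ⟨hv, fun I φ hφ => ?_⟩
    have h2 := hd I ⟨φ, hφ.1⟩
    have h3 : ∫ x, dirDeriv n m I φ x • u x = ∫ x, op n (monoI I) ⟨φ, hφ.1⟩ x • u x :=
      congrArg (fun F : Euc n → V => ∫ x, F x) h2
    refine onb_ext fun c => ?_
    rw [h3, h1 _ (hasCompactSupport_op _ hφ.2) hu, real_inner_smul_right,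
      h1 ⟨φ, hφ.1⟩ hφ.2 (hv I)]
    exact h I c ⟨φ, hφ.1⟩ hφ.2

theorem memT_of_coord {j : ℕ} {p : ℝ} (hp : 1 ≤ p) {f : Idx V → Euc n → ℝ}
    (hf : ∀ c, AEMeasurable (f c)) {x : Euc n}
    (h : ∀ c, ∃ P : Euc n → ℝ, IsPolyDeg n j P ∧ SmallO (avg p (fun y => ‖f c y - P y‖ₑ) x) j) :
    MemT n j p (fun y => ∑ c, f c y • onb V c) x := by
  choose P hP hPs using h
  refine memT_iff.2 ⟨fun y => ∑ c, P c y • onb V c,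
    IsPolyDeg.sum fun c _ => (hP c).smul_const _, ?_⟩
  refine (SmallO.avg_sum Finset.univ hp (fun c =>
    ((hf c).sub (hP c).1.continuous.measurable.aemeasurable).enorm) hPs).mono
    (Eventually.of_forall fun r => avg_mono (by linarith) (ae_of_all _ fun y _ => ?_))
  rw [← Finset.sum_sub_distrib]
  refine (enorm_sum_le _ _).trans (Finset.sum_le_sum fun c _ => ?_)
  rw [← sub_smul, enorm_smul, ← ofReal_norm (onb V c), (onb V).norm_eq_one, ENNReal.ofReal_one,
    mul_one]
  rfl

theorem exists_weakDeriv_memT {k j : ℕ} {A : CoeffOp n k V W} (hj1 : 1 ≤ j) (hjk : j ≤ k)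
    (hjn : j < n) (hE : IsElliptic n k A) (hC : IsCanceling n k A) {u : Euc n → V}
    (hu : MemBVAloc n k A u) :
    ∃ v : (Fin (k - j) → Fin n) → Euc n → V, IsWeakDerivFamily n (k - j) u v ∧
      ∀ᵐ x, ∀ I, MemT n j ((n : ℝ) / ((n : ℝ) - (j : ℝ))) (v I) x := by
  obtain ⟨hul, σ, f, hσ, hfl, hf1, hw⟩ := hu
  have hk := symbolMatrix_homog A
  have ha := (ell_symbolMatrix_iff A).2 hE
  have hc := (canc_symbolMatrix_iff A).2 hC
  have hw := (hasDistribA_iff A hul hfl).1 hw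
  have huc := locallyIntegrable_inner hul
  have hfc := locallyIntegrable_inner hfl
  have hfc1 : ∀ b, ∀ᵐ y ∂σ, |⟪onb W b, f y⟫| ≤ 1 := fun b => hf1.mono fun y hy => by
    have h := abs_real_inner_le_norm (onb W b) (f y)
    rwa [hy, (onb W).norm_eq_one, one_mul] at h
  obtain ⟨β, T, hβ, hT, hT1, hβT, -⟩ := exists_compact_kernel (by omega) hk ha
  choose τ hτ using fun (I : Fin (k - j) → Fin n) c =>
    weakDeriv_potential hk hβ hT hT1 hβT hw huc hfc hfc1 (Nat.sub_add_cancel hjk) hj1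
      (monoI_homog I) c
  have hγ : ∀ I c b, tsupport (op n (monoI I) (β c b) : Euc n → ℝ) ⊆ closedBall 0 2⁻¹ :=
    fun (I : Fin (k - j) → Fin n) c b => (tsupport_op _ _).trans (hβ c b)
  have hpot : ∀ I c b, LocallyIntegrable
      (potential σ (fun x => ⟪onb W b, f x⟫) j (op n (monoI I) (β c b))) :=
    fun (I : Fin (k - j) → Fin n) c b =>
      (locSummable_layer (hfc b) (hfc1 b) hj1 (hγ I c b)).locallyIntegrable
  set g : (Fin (k - j) → Fin n) → Idx V → Euc n → ℝ := fun I c x => τ I c x +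
    ∑ b, potential σ (fun x => ⟪onb W b, f x⟫) j (op n (monoI I) (β c b)) x with hg
  have hgl : ∀ I c, LocallyIntegrable (g I c) := fun I c => by
    exact (Sm.continuous (τ I c)).locallyIntegrable.add
      (locallyIntegrable_finsetSum _ fun b _ => hpot I c b)
  have hp : 1 ≤ (n : ℝ) / ((n : ℝ) - (j : ℝ)) := by
    have h1 : (j : ℝ) < n := by exact_mod_cast hjn
    have h2 : (0 : ℝ) ≤ j := by positivity
    rw [one_le_div (by linarith)]
    linarith
  refine ⟨fun I x => ∑ c, g I c x • onb V c, ?_, ?_⟩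
  · refine (isWeakDerivFamily_iff hul fun I => ?_).2 fun I c φ hφ => ?_
    · exact locallyIntegrable_finsetSum _ fun c _ x => (hgl I c x).imp fun _ hs =>
        ⟨hs.1, hs.2.smul_const _⟩
    · simp only [inner_onb_sum]
      exact hτ I c φ hφ
  · have hpoly := ae_all_iff.2 fun I => ae_all_iff.2 fun c => ae_all_iff.2 fun b =>
      ae_exists_isPolyDeg_potential hk ha hc hw huc hfc hfc1 hj1 hjn b (hγ I c b)
    filter_upwards [hpoly] with x hx I
    refine memT_of_coord hp (fun c => (hgl I c).aestronglyMeasurable.aemeasurable) fun c => ?_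
    choose P hP hPs using fun b => hx I c b
    refine ⟨fun y => polyOf j (fun _ J => op n (monoI J) (τ I c) x) x y + ∑ b, P b y,
      (isPolyDeg_polyOf _ _ _).add (IsPolyDeg.sum fun b _ => hP b), ?_⟩
    have hm : ∀ b, AEMeasurable fun y => ‖potential σ (fun x => ⟪onb W b, f x⟫) j
        (op n (monoI I) (β c b)) y - P b y‖ₑ := fun b =>
      ((hpot I c b).aestronglyMeasurable.aemeasurable.sub
        (hP b).1.continuous.measurable.aemeasurable).enorm
    refine ((memT_smooth (τ I c) (by linarith) j x).add
      (SmallO.avg_sum Finset.univ hp hm hPs)).mono (Eventually.of_forall fun r => ?_)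
    refine le_trans ?_ (avg_add_le hp (((Sm.continuous (τ I c)).sub
      (isPolyDeg_polyOf _ _ _).1.continuous).enorm.measurable.aemeasurable)
      (Finset.aemeasurable_fun_sum _ fun b _ => hm b) x r)
    refine avg_mono (by linarith) (ae_of_all _ fun y _ => ?_)
    rw [hg]
    dsimp only
    rw [add_sub_add_comm, ← Finset.sum_sub_distrib]
    exact (enorm_add_le _ _).trans (add_le_add_right (enorm_sum_le _ _) _)

end Components

end

noncomputable section

open scoped NNReal

variable {n : ℕ}

/-- Every solution `u` of `a(∂) u = g` with locally integrable `g` has weak derivatives of order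
`m` that are `p`-integrable near almost every point. -/
def LocRegular {B C : Type} [Fintype C] (k m : ℕ) (a : Matrix B C (MvPolynomial (Fin n) ℝ))
    (p : ℝ) : Prop :=
  ∀ (u : C → Euc n → ℝ) (g : B → Euc n → ℝ), (∀ c, LocallyIntegrable (u c)) →
    (∀ b, LocallyIntegrable (g b)) → WeakEq k a u volume g → ∀ (I : Fin m → Fin n) (c : C),
      ∃ v : Euc n → ℝ, LocallyIntegrable v ∧ IsWeakDeriv I (u c) v ∧
        ∀ᵐ x, ∃ r > 0, ∫⁻ y in ball x r, ‖v y‖ₑ ^ p < ⊤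

theorem memBVAloc_of_hasDistribA {V W : Type*}
    [NormedAddCommGroup V] [InnerProductSpace ℝ V] [FiniteDimensional ℝ V]
    [NormedAddCommGroup W] [InnerProductSpace ℝ W] [FiniteDimensional ℝ W] {k : ℕ}
    {A : CoeffOp n k V W} {u : Euc n → V} {g : Euc n → W} (hu : LocallyIntegrable u)
    (hg : LocallyIntegrable g) (h : HasDistribA n k A u volume g) : MemBVAloc n k A u := by
  have hgm : AEMeasurable (fun y => ‖g y‖ₑ) := hg.aestronglyMeasurable.enorm
  have hac : (volume.withDensity fun y => ‖g y‖ₑ) ≪ (volume : Measure (Euc n)) :=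
    withDensity_absolutelyContinuous _ _
  have hσ : IsLocallyFiniteMeasure (volume.withDensity fun y => ‖g y‖ₑ) := by
    refine ⟨fun x => ?_⟩
    obtain ⟨s, hs, hInt⟩ := hg x
    obtain ⟨t, hts, hto, hxt⟩ := _root_.mem_nhds_iff.1 hs
    refine ⟨t, hto.mem_nhds hxt, ?_⟩
    rw [withDensity_apply _ hto.measurableSet]
    exact (hInt.mono_set hts).2
  have hfm : AEStronglyMeasurable (fun y => ‖g y‖⁻¹ • g y) := by
    have h1 : AEStronglyMeasurable (fun y => ‖g y‖⁻¹) volume :=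
      (hg.aestronglyMeasurable.norm.aemeasurable.inv).aestronglyMeasurable
    exact h1.smul hg.aestronglyMeasurable
  refine ⟨hu, volume.withDensity fun y => ‖g y‖ₑ, fun y => ‖g y‖⁻¹ • g y, hσ, ?_, ?_, ?_⟩
  · refine (locallyIntegrable_const (1 : ℝ)).mono (hfm.mono_ac hac) (ae_of_all _ fun y => ?_)
    rw [norm_smul, norm_inv, norm_norm, norm_one]
    exact inv_mul_le_one
  · rw [ae_withDensity_iff' hgm]
    refine ae_of_all _ fun y hy => ?_
    have : ‖g y‖ ≠ 0 := by simpa using hy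
    rw [norm_smul, norm_inv, norm_norm, inv_mul_cancel₀ this]
  · intro φ hφ
    rw [h φ hφ, integral_withDensity_eq_integral_toReal_smul₀ hgm
      (ae_of_all _ fun _ => enorm_lt_top)]
    refine integral_congr_ae (ae_of_all _ fun y => ?_)
    dsimp only
    rw [toReal_enorm, real_inner_smul_left, smul_eq_mul]
    by_cases h0 : ‖g y‖ = 0
    · rw [h0, norm_eq_zero.1 h0]
      simp
    · rw [mul_inv_cancel_left₀ h0]

theorem lintegral_lt_top_of_avg {p : ℝ} (hp : 0 < p) {G : Euc n → ℝ≥0∞} {x : Euc n} {r : ℝ}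
    (h : avg p G x r < ⊤) : ∫⁻ y in ball x r, G y ^ p < ⊤ := by
  rw [avg, ENNReal.rpow_lt_top_iff_of_pos (by positivity)] at h
  have h0 : (volume (ball x r))⁻¹ ≠ 0 := ENNReal.inv_ne_zero.2 measure_ball_lt_top.ne
  refine lt_top_iff_ne_top.2 fun ht => ?_
  rw [ht, ENNReal.mul_top h0] at h
  exact lt_irrefl _ h

theorem exists_lintegral_lt_top_of_memT {F : Type*} [NormedAddCommGroup F] [NormedSpace ℝ F]
    {j : ℕ} {p : ℝ} (hp : 1 ≤ p) {f : Euc n → F} (hf : AEStronglyMeasurable f) {x : Euc n}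
    (h : MemT n j p f x) : ∃ r > 0, ∫⁻ y in ball x r, ‖f y‖ₑ ^ p < ⊤ := by
  obtain ⟨P, hP, hs⟩ := memT_iff.1 h
  have hev := (ENNReal.tendsto_nhds_zero.1 hs) 1 one_pos
  obtain ⟨r, hr, hr0⟩ := (hev.and self_mem_nhdsWithin).exists
  have hr0 : 0 < r := hr0
  refine ⟨r, hr0, lintegral_lt_top_of_avg (by linarith) ?_⟩
  have h1 : avg p (fun y => ‖f y - P y‖ₑ) x r < ⊤ := by
    rw [ENNReal.div_le_iff (by rw [Ne, ENNReal.ofReal_eq_zero, not_le]; positivity)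
      ENNReal.ofReal_ne_top, one_mul] at hr
    exact hr.trans_lt ENNReal.ofReal_lt_top
  obtain ⟨M, hM⟩ := (isCompact_closedBall x r).exists_bound_of_continuousOn
    hP.1.continuous.continuousOn
  have h2 : avg p (fun y => ‖P y‖ₑ) x r < ⊤ := by
    refine lt_of_le_of_lt ((avg_mono (G := fun _ => ENNReal.ofReal M) (by linarith)
      (ae_of_all _ fun y hy => ?_)).trans (avg_const_le (by linarith) _ x r)) ENNReal.ofReal_lt_top
    rw [← ofReal_norm]
    exact ENNReal.ofReal_le_ofReal (hM y (ball_subset_closedBall hy))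
  refine lt_of_le_of_lt ((avg_mono (by linarith) (ae_of_all _ fun y _ => ?_)).trans
    (avg_add_le hp ((hf.sub hP.1.continuous.aestronglyMeasurable).enorm)
      hP.1.continuous.enorm.measurable.aemeasurable x r)) (ENNReal.add_lt_top.2 ⟨h1, h2⟩)
  simpa using enorm_add_le (f y - P y) (P y)

theorem locRegular_of_forall {V W : Type*}
    [NormedAddCommGroup V] [InnerProductSpace ℝ V] [FiniteDimensional ℝ V]
    [NormedAddCommGroup W] [InnerProductSpace ℝ W] [FiniteDimensional ℝ W] {k m j : ℕ} {p : ℝ}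
    (hp : 1 ≤ p) {A : CoeffOp n k V W}
    (h : ∀ u : Euc n → V, MemBVAloc n k A u →
      ∃ v : (Fin m → Fin n) → Euc n → V, IsWeakDerivFamily n m u v ∧
        ∀ᵐ x, ∀ I, MemT n j p (v I) x) : LocRegular k m (symbolMatrix A) p := by
  intro u g hu hg hw I c
  have hsumV : LocallyIntegrable fun x => ∑ c, u c x • onb V c :=
    locallyIntegrable_finsetSum _ fun c _ x => (hu c x).imp fun _ hs => ⟨hs.1, hs.2.smul_const _⟩
  have hsumW : LocallyIntegrable fun x => ∑ b, g b x • onb W b :=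
    locallyIntegrable_finsetSum _ fun b _ x => (hg b x).imp fun _ hs => ⟨hs.1, hs.2.smul_const _⟩
  have hd : HasDistribA n k A (fun x => ∑ c, u c x • onb V c) volume
      (fun x => ∑ b, g b x • onb W b) :=
    (hasDistribA_iff A hsumV hsumW).2 (by simpa only [inner_onb_sum] using hw)
  obtain ⟨v, hv, hT⟩ := h _ (memBVAloc_of_hasDistribA hsumV hsumW hd)
  refine ⟨fun x => ⟪onb V c, v I x⟫, locallyIntegrable_inner (hv.1 I) c, ?_, ?_⟩
  · have h1 := (isWeakDerivFamily_iff hsumV hv.1).1 hv I c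
    simpa only [inner_onb_sum] using h1
  · filter_upwards [hT] with x hx
    obtain ⟨r, hr, hlt⟩ := exists_lintegral_lt_top_of_memT hp (hv.1 I).aestronglyMeasurable (hx I)
    refine ⟨r, hr, lt_of_le_of_lt (lintegral_mono fun y => ?_) hlt⟩
    refine ENNReal.rpow_le_rpow ?_ (by linarith)
    rw [← ofReal_norm, ← ofReal_norm]
    refine ENNReal.ofReal_le_ofReal ?_
    simpa using abs_real_inner_le_norm (onb V c) (v I y)

end

noncomputable section

open scoped NNReal

/-- A uniform boundedness principle for pointwise bounds on subsets of a space of test objects. -/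
theorem exists_bound_of_lp_pairing {T : Type*} {J : ℕ → T → ℝ} {N : T → ℝ≥0∞} {S : ℕ → Set T}
    (hJ : ∀ θ, ∃ K : ℝ, ∀ α, |J α θ| ≤ K)
    (h : ∀ y : lp (fun _ : ℕ => ℝ) 1, ∃ κ, ∃ M : ℕ, ∀ θ ∈ S κ,
      ‖∑' α, y α * J α θ‖ₑ ≤ M * N θ) :
    ∃ κ, ∃ M : ℝ≥0, ∀ α, ∀ θ ∈ S κ, ‖J α θ‖ₑ ≤ M * N θ := by
  have hnorm : ∀ y : lp (fun _ : ℕ => ℝ) 1, HasSum (fun α => |y α|) ‖y‖ := fun y => by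
    simpa using lp.hasSum_norm (p := 1) (by simp) y
  have hsum : ∀ θ (y : lp (fun _ : ℕ => ℝ) 1), Summable fun α => y α * J α θ := fun θ y => by
    obtain ⟨K, hK⟩ := hJ θ
    refine Summable.of_norm_bounded ((hnorm y).summable.mul_right K) fun α => ?_
    rw [norm_mul, Real.norm_eq_abs, Real.norm_eq_abs]
    exact mul_le_mul_of_nonneg_left (hK α) (abs_nonneg _)
  let L : T → (lp (fun _ : ℕ => ℝ) 1 →ₗ[ℝ] ℝ) := fun θ =>
    { toFun := fun y => ∑' α, y α * J α θ
      map_add' := fun y z => by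
        rw [← (hsum θ y).tsum_add (hsum θ z)]
        exact tsum_congr fun α => by simp [add_mul]
      map_smul' := fun r y => by
        rw [RingHom.id_apply, smul_eq_mul, ← tsum_mul_left]
        exact tsum_congr fun α => by simp [mul_assoc] }
  have hLc : ∀ θ, Continuous (L θ) := fun θ => by
    obtain ⟨K, hK⟩ := hJ θ
    refine (LinearMap.mkContinuous (L θ) K fun y => ?_).continuous
    rw [mul_comm]
    refine tsum_of_norm_bounded ((hnorm y).mul_right K) fun α => ?_
    rw [norm_mul, Real.norm_eq_abs, Real.norm_eq_abs]
    exact mul_le_mul_of_nonneg_left (hK α) (abs_nonneg _)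
  let F : ℕ × ℕ → Set (lp (fun _ : ℕ => ℝ) 1) := fun i =>
    {y | ∀ θ ∈ S i.1, ‖L θ y‖ₑ ≤ i.2 * N θ}
  have hFc : ∀ i, IsClosed (F i) := fun i => by
    have : F i = ⋂ θ ∈ S i.1, {y | ‖L θ y‖ₑ ≤ i.2 * N θ} := by
      ext y
      simp [F]
    rw [this]
    exact isClosed_biInter fun θ _ => isClosed_le (hLc θ).enorm continuous_const
  have hFu : ⋃ i, F i = Set.univ := by
    refine Set.eq_univ_of_forall fun y => ?_
    obtain ⟨κ, M, hM⟩ := h y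
    exact Set.mem_iUnion.2 ⟨(κ, M), hM⟩
  obtain ⟨⟨κ, M⟩, y₀, hy₀⟩ := nonempty_interior_of_iUnion_of_closed hFc hFu
  obtain ⟨ε, hε, hball⟩ := Metric.isOpen_iff.1 isOpen_interior y₀ hy₀
  refine ⟨κ, ‖ε / 2‖₊⁻¹ * (2 * M), fun α θ hθ => ?_⟩
  set s : lp (fun _ : ℕ => ℝ) 1 := lp.single 1 α (1 : ℝ) with hs
  have hLs : L θ s = J α θ := by
    change ∑' β, s β * J β θ = _
    rw [tsum_eq_single α fun β hβ => by rw [hs, lp.single_apply_ne _ _ _ hβ, zero_mul]]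
    rw [hs, lp.single_apply_self, one_mul]
  have hz : y₀ + (ε / 2) • s ∈ F (κ, M) := by
    refine interior_subset (hball ?_)
    rw [mem_ball, dist_self_add_left, norm_smul, hs, lp.norm_single (by simp), norm_one, mul_one,
      Real.norm_eq_abs, abs_of_pos (by positivity)]
    linarith
  have h1 : ‖L θ ((ε / 2) • s)‖ₑ ≤ 2 * M * N θ := by
    have h2 : (ε / 2) • s = (y₀ + (ε / 2) • s) - y₀ := by abel
    rw [h2, map_sub, mul_assoc, two_mul]
    exact (enorm_sub_le).trans (add_le_add (hz θ hθ) (interior_subset hy₀ θ hθ))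
  rw [map_smul, hLs, smul_eq_mul, enorm_mul] at h1
  have h0 : ‖ε / 2‖₊ ≠ 0 := by
    rw [Ne, nnnorm_eq_zero]
    positivity
  calc ‖J α θ‖ₑ = (‖ε / 2‖₊⁻¹ : ℝ≥0) * (‖ε / 2‖ₑ * ‖J α θ‖ₑ) := by
        rw [← mul_assoc, enorm_eq_nnnorm (ε / 2), ← ENNReal.coe_mul, inv_mul_cancel₀ h0, ENNReal.coe_one,
          one_mul]
    _ ≤ (‖ε / 2‖₊⁻¹ : ℝ≥0) * (2 * M * N θ) := by gcongr
    _ = _ := by push_cast; ring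

variable {n : ℕ}

/-- The `L^q` norm. -/
def lqNorm (q : ℝ) (θ : Euc n → ℝ) : ℝ≥0∞ := (∫⁻ x, ‖θ x‖ₑ ^ q) ^ (1 / q)

/-- Uniform local integrability of a family of smooth functions. -/
def UnifLoc {ι : Type*} (F : ι → Sm n) : Prop :=
  ∀ R : ℕ, ∃ K : ℝ≥0, ∀ i z, ∫⁻ x in ball z R, ‖F i x‖ₑ ≤ K

theorem lintegral_ball_aff (F : Sm n) (t z : Euc n) (R : ℝ) :
    ∫⁻ x in ball z R, ‖aff 1 t F x‖ₑ = ∫⁻ x in ball (z + t) R, ‖F x‖ₑ := by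
  have h := (measurePreserving_add_right (volume : Measure (Euc n)) t).setLIntegral_comp_preimage
    (s := ball (z + t) R) measurableSet_ball (Sm.continuous F).enorm.measurable
  rw [← h]
  congr 1
  · congr 1
    ext x
    simp [mem_ball]
  · funext x
    simp [aff_apply]

theorem UnifLoc.translates {F : ℕ → Sm n} (hF : UnifLoc F) (e : ℕ → Euc n) :
    UnifLoc fun α : ℕ => aff 1 (e α.unpair.2) (F α.unpair.1) := fun R => by
  obtain ⟨K, hK⟩ := hF R
  exact ⟨K, fun i z => (lintegral_ball_aff _ _ _ _).trans_le (hK _ _)⟩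

theorem UnifLoc.locSummable {F : ℕ → Sm n} (hF : UnifLoc F) (y : lp (fun _ : ℕ => ℝ) 1) :
    LocSummable fun α => y α • F α := fun R => by
  obtain ⟨K, hK⟩ := hF R
  have hy : ∑' α, ‖y α‖ₑ ≠ ⊤ := by
    have h1 : Summable fun α => ‖y α‖₊ := by
      rw [← NNReal.summable_coe]
      simpa using (lp.hasSum_norm (p := 1) (by simp) y).summable
    exact ENNReal.tsum_coe_ne_top_iff_summable.2 h1
  refine ne_top_of_le_ne_top (ENNReal.mul_ne_top hy (ENNReal.coe_ne_top (r := K))) ?_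
  rw [← ENNReal.tsum_mul_right]
  refine ENNReal.tsum_le_tsum fun α => ?_
  simp only [Sm.smul_apply, enorm_mul]
  rw [lintegral_const_mul _ (Sm.continuous (F α)).enorm.measurable]
  exact mul_le_mul_right (hK α 0) _

theorem UnifLoc.exists_bound {F : ℕ → Sm n} (hF : UnifLoc F) {ψ : Sm n}
    (hψ : HasCompactSupport (ψ : Euc n → ℝ)) : ∃ K : ℝ, ∀ α, |∫ x, F α x * ψ x| ≤ K := by
  obtain ⟨M, hM⟩ := hψ.exists_bound_of_continuous (Sm.continuous ψ)
  obtain ⟨R, hR⟩ := hψ.isCompact.isBounded.subset_ball 0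
  obtain ⟨N, hN⟩ := exists_nat_ge R
  obtain ⟨K, hK⟩ := hF N
  have hsub : tsupport ψ ⊆ ball (0 : Euc n) N := hR.trans (ball_subset_ball hN)
  refine ⟨(K * ENNReal.ofReal M).toReal, fun α => ?_⟩
  have h1 : ‖∫ x, F α x * ψ x‖ₑ ≤ K * ENNReal.ofReal M := by
    refine (enorm_integral_le_lintegral_enorm _).trans ?_
    have h2 : ∫⁻ x, ‖F α x * ψ x‖ₑ = ∫⁻ x in ball (0 : Euc n) N, ‖F α x * ψ x‖ₑ := by
      rw [setLIntegral_eq_of_support_subset]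
      intro x hx
      refine hsub (subset_tsupport _ fun h0 => hx ?_)
      simp [h0]
    rw [h2]
    refine (lintegral_mono (g := fun x => ‖F α x‖ₑ * ENNReal.ofReal M) fun x => ?_).trans ?_
    · rw [enorm_mul, ← ofReal_norm (ψ x)]
      exact mul_le_mul_right (ENNReal.ofReal_le_ofReal (hM x)) _
    · rw [lintegral_mul_const _ (Sm.continuous (F α)).enorm.measurable]
      exact mul_le_mul_left (hK α 0) _
  rw [← Real.norm_eq_abs, ← toReal_enorm]
  exact ENNReal.toReal_mono (ENNReal.mul_ne_top ENNReal.coe_ne_top ENNReal.ofReal_ne_top) h1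

theorem lqNorm_aff (q : ℝ) (t : Euc n) (θ : Sm n) : lqNorm q (aff 1 t θ) = lqNorm q θ := by
  unfold lqNorm
  simp only [aff_apply, one_smul]
  rw [lintegral_add_right_eq_self (fun x => ‖θ x‖ₑ ^ q) t]

theorem tsupport_aff_subset {q : Euc n} {r : ℝ} {θ : Sm n}
    (h : tsupport (θ : Euc n → ℝ) ⊆ closedBall 0 r) :
    tsupport (aff 1 (-q) θ : Euc n → ℝ) ⊆ closedBall q r := by
  refine closure_minimal (fun x hx => ?_) isClosed_closedBall
  have := h (subset_tsupport _ (show (1 : ℝ) • x + -q ∈ Function.support θ from hx))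
  simpa [mem_closedBall, dist_eq_norm, sub_eq_add_neg] using this

theorem enorm_integral_mul_le {p q : ℝ} (hpq : p.HolderConjugate q) {v : Euc n → ℝ}
    (hv : AEStronglyMeasurable v) {s : Set (Euc n)} {θ : Sm n}
    (hθ : tsupport (θ : Euc n → ℝ) ⊆ s) :
    ‖∫ x, v x * θ x‖ₑ ≤ (∫⁻ x in s, ‖v x‖ₑ ^ p) ^ (1 / p) * lqNorm q θ := by
  refine (enorm_integral_le_lintegral_enorm _).trans ?_
  have h2 : ∫⁻ x, ‖v x * θ x‖ₑ = ∫⁻ x in s, ‖v x * θ x‖ₑ := by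
    rw [setLIntegral_eq_of_support_subset]
    intro x hx
    refine hθ (subset_tsupport _ fun h0 => hx ?_)
    simp [h0]
  rw [h2]
  simp only [enorm_mul]
  refine (ENNReal.lintegral_mul_le_Lp_mul_Lq _ hpq hv.enorm.restrict
    (Sm.continuous θ).enorm.measurable.aemeasurable).trans ?_
  refine mul_le_mul_right (ENNReal.rpow_le_rpow (setLIntegral_le_lintegral _ _) ?_) _
  exact one_div_nonneg.2 hpq.symm.nonneg

theorem exists_bound_of_locRegular {B C : Type} [Fintype C] {k m : ℕ}
    {a : Matrix B C (MvPolynomial (Fin n) ℝ)} (ha : ∀ b c, (a b c).IsHomogeneous k) {p q : ℝ}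
    (hpq : p.HolderConjugate q) (h : LocRegular k m a p) {Φ : ℕ → C → Sm n}
    (hΦ : ∀ c, UnifLoc fun i => Φ i c)
    (haΦ : ∀ b, UnifLoc fun i => ∑ c, op n (a b c) (Φ i c)) (I : Fin m → Fin n) (c : C) :
    ∃ s > 0, ∃ K : ℝ≥0, ∀ i (θ : Sm n), tsupport (θ : Euc n → ℝ) ⊆ closedBall 0 s →
      ‖∫ x, Φ i c x * op n (monoI I) θ x‖ₑ ≤ K * lqNorm q θ := by
  set e : ℕ → Euc n := TopologicalSpace.denseSeq (Euc n) with he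
  set Ψ : C → ℕ → Sm n := fun c α => aff 1 (-e α.unpair.2) (Φ α.unpair.1 c) with hΨdef
  have hΨ : ∀ c, UnifLoc (Ψ c) := fun c => (hΦ c).translates fun l => -e l
  have haΨ : ∀ b, UnifLoc fun α => ∑ c, op n (a b c) (Ψ c α) := fun b => by
    have := (haΦ b).translates fun l => -e l
    convert this using 2 with α
    rw [map_sum]
    refine Finset.sum_congr rfl fun c _ => ?_
    rw [hΨdef, op_aff (ha b c), one_pow, one_smul]
  let T := {θ : Sm n // HasCompactSupport (θ : Euc n → ℝ)}
  let S : ℕ → Set T := fun κ =>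
    {θ | tsupport (θ.1 : Euc n → ℝ) ⊆ closedBall (e κ.unpair.1) (1 / ((κ.unpair.2 : ℝ) + 1))}
  obtain ⟨κ, K, hK⟩ := exists_bound_of_lp_pairing
    (T := T) (J := fun α θ => ∫ x, Ψ c α x * op n (monoI I) θ.1 x)
    (N := fun θ => lqNorm q θ.1) (S := S)
    (fun θ => (hΨ c).exists_bound (hasCompactSupport_op _ θ.2)) (fun y => by
      have hL := fun c => (hΨ c).locSummable y
      have hL' := fun b => (haΨ b).locSummable y
      have hw : WeakEq k a (fun c x => ∑' α, (y α • Ψ c α) x) volume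
          (fun b x => ∑' α, (y α • ∑ c, op n (a b c) (Ψ c α)) x) := by
        intro b θ hθ
        have h1 := fun c => (hL c).hasSum_integral (hasCompactSupport_op (a b c) hθ)
        have h2 := ((hasSum_sum fun c (_ : c ∈ Finset.univ) => h1 c).mul_left ((-1 : ℝ) ^ k))
        refine h2.unique ?_
        refine ((hL' b).hasSum_integral hθ).congr_fun fun α => ?_
        simp only [Sm.smul_apply, Sm.sum_apply, mul_assoc, integral_const_mul, Finset.sum_mul]
        rw [integral_finsetSum _ fun c _ => integrable_mul_of_hasCompactSupport
            (Sm.continuous _).locallyIntegrable (Sm.continuous θ) hθ, ← Finset.mul_sum,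
          mul_left_comm, Finset.mul_sum]
        congr 1
        exact Finset.sum_congr rfl fun c _ => (integral_op_mul (ha b c) hθ).symm
      obtain ⟨v, hv, hder, hae⟩ := h _ _ (fun c => (hL c).locallyIntegrable)
        (fun b => (hL' b).locallyIntegrable) hw I c
      obtain ⟨x, r, hr, hlt⟩ := hae.exists
      obtain ⟨M, hM⟩ := exists_nat_one_div_lt (half_pos hr)
      obtain ⟨l, hl⟩ := (TopologicalSpace.denseRange_denseSeq (Euc n)).exists_dist_lt x
        (half_pos hr)
      have hsub : closedBall (e l) (1 / ((M : ℝ) + 1)) ⊆ ball x r := fun z hz => by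
        rw [mem_ball]
        rw [mem_closedBall] at hz
        have : dist x (e l) < r / 2 := hl
        calc dist z x ≤ dist z (e l) + dist (e l) x := dist_triangle _ _ _
          _ < r := by rw [dist_comm (e l)]; linarith
      have hfin : (∫⁻ y in ball x r, ‖v y‖ₑ ^ p) ^ (1 / p) ≠ ⊤ :=
        ENNReal.rpow_ne_top_of_nonneg (one_div_nonneg.2 hpq.nonneg) hlt.ne
      obtain ⟨M', hM'⟩ := ENNReal.exists_nat_gt hfin
      refine ⟨Nat.pair l M, M', fun θ hθ => ?_⟩
      have hθ' : tsupport (θ.1 : Euc n → ℝ) ⊆ ball x r := by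
        refine subset_trans ?_ hsub
        simpa [S] using hθ
      have h1 := ((hL c).hasSum_integral (hasCompactSupport_op (monoI I) θ.2)).tsum_eq
      simp only [Sm.smul_apply, mul_assoc, integral_const_mul] at h1
      have h3 := hder θ.1 θ.2
      simp only [Sm.smul_apply] at h3
      rw [h1, h3, enorm_mul, enorm_pow, enorm_neg, enorm_one, one_pow, one_mul]
      exact (enorm_integral_mul_le hpq hv.aestronglyMeasurable hθ').trans
        (mul_le_mul_left hM'.le _))
  refine ⟨1 / ((κ.unpair.2 : ℝ) + 1), by positivity, K, fun i θ hθ => ?_⟩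
  set t := e κ.unpair.1 with ht
  have hcpt : HasCompactSupport (θ : Euc n → ℝ) :=
    hasCompactSupport_of_subset hθ
  have h1 := hK (Nat.pair i κ.unpair.1) ⟨aff 1 (-t) θ, hasCompactSupport_aff one_ne_zero _ hcpt⟩
    (tsupport_aff_subset hθ)
  rw [lqNorm_aff] at h1
  convert h1 using 2
  rw [hΨdef, op_aff (monoI_homog I), one_pow, one_smul]
  simp only [Nat.unpair_pair, aff_apply, one_smul]
  exact (integral_add_right_eq_self (fun x => Φ i c x * op n (monoI I) θ x) (-t)).symm

end

noncomputable section

open scoped NNReal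

variable {n : ℕ}

/-- The ridge function `x ↦ χ ⟪ξ, x⟫`. -/
def ridge (ξ : Euc n) (χ : {f : ℝ → ℝ // ContDiff ℝ (⊤ : ℕ∞) f}) : Sm n :=
  ⟨fun x => χ.1 ⟪ξ, x⟫, χ.2.comp (innerSL ℝ ξ).contDiff⟩

/-- The iterated derivative of a smooth function. -/
def smoothDeriv (l : ℕ) (χ : {f : ℝ → ℝ // ContDiff ℝ (⊤ : ℕ∞) f}) :
    {f : ℝ → ℝ // ContDiff ℝ (⊤ : ℕ∞) f} :=
  ⟨deriv^[l] χ.1, χ.2.iterate_deriv l⟩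

theorem pd_ridge (ξ : Euc n) (χ : {f : ℝ → ℝ // ContDiff ℝ (⊤ : ℕ∞) f}) (i : Fin n) :
    pd i (ridge ξ χ) = ξ i • ridge ξ (smoothDeriv 1 χ) := by
  refine Sm.ext fun x => ?_
  have h1 : HasDerivAt χ.1 (deriv χ.1 ⟪ξ, x⟫) ((innerSL ℝ ξ) x) :=
    ((χ.2.differentiable (by simp)) _).hasDerivAt
  have h2 := h1.comp_hasFDerivAt x (innerSL ℝ ξ).hasFDerivAt
  have h3 : HasFDerivAt (ridge ξ χ : Euc n → ℝ) (deriv χ.1 ⟪ξ, x⟫ • innerSL ℝ ξ) x := h2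
  rw [pd_apply, h3.fderiv, Sm.smul_apply]
  simp [stdVec, EuclideanSpace.inner_single_right, ridge, smoothDeriv, mul_comm]

theorem op_ridge {l : ℕ} {p : MvPolynomial (Fin n) ℝ} (hp : p.IsHomogeneous l) (ξ : Euc n)
    (χ : {f : ℝ → ℝ // ContDiff ℝ (⊤ : ℕ∞) f}) :
    op n p (ridge ξ χ) = MvPolynomial.eval (fun i => ξ i) p • ridge ξ (smoothDeriv l χ) := by
  refine homog_induction (motive := fun l p =>
    op n p (ridge ξ χ) = MvPolynomial.eval (fun i => ξ i) p • ridge ξ (smoothDeriv l χ))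
    hp ?_ ?_ ?_ ?_
  · intro c
    rw [op_C, MvPolynomial.eval_C]
    rfl
  · intro l
    simp
  · intro l p q h1 h2
    rw [op_add, h1, h2, map_add, add_smul]
  · intro l p i h1
    have h2 : smoothDeriv 1 (smoothDeriv l χ) = smoothDeriv (l + 1) χ :=
      Subtype.ext (Function.iterate_succ_apply' deriv l χ.1).symm
    rw [op_X_mul, h1, map_smul, pd_ridge, h2, map_mul, MvPolynomial.eval_X, smul_smul, mul_comm]

theorem eval_smul_of_homog {l : ℕ} {p : MvPolynomial (Fin n) ℝ} (hp : p.IsHomogeneous l)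
    (c : ℝ) (ξ : Fin n → ℝ) :
    MvPolynomial.eval (fun i => c * ξ i) p = c ^ l * MvPolynomial.eval ξ p := by
  refine homog_induction (motive := fun l p =>
    MvPolynomial.eval (fun i => c * ξ i) p = c ^ l * MvPolynomial.eval ξ p) hp ?_ ?_ ?_ ?_
  · simp
  · simp
  · intro l p q h1 h2
    rw [map_add, map_add, h1, h2, mul_add]
  · intro l p i h1
    rw [map_mul, map_mul, h1, MvPolynomial.eval_X, MvPolynomial.eval_X]
    ring

/-- Dilation by `t` in direction `ξ`. -/
def stretch (ξ : Euc n) (t : ℝ) : Euc n →ₗ[ℝ] Euc n :=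
  LinearMap.transvection ((t - 1) • (innerSL ℝ ξ : Euc n →ₗ[ℝ] ℝ)) ξ

theorem stretch_apply (ξ : Euc n) (t : ℝ) (x : Euc n) :
    stretch ξ t x = x + ((t - 1) * ⟪ξ, x⟫) • ξ := by
  simp [stretch, LinearMap.transvection.apply]

theorem det_stretch {ξ : Euc n} (hξ : ‖ξ‖ = 1) (t : ℝ) : LinearMap.det (stretch ξ t) = t := by
  rw [stretch, LinearMap.transvection.det]
  simp [hξ]

theorem inner_stretch {ξ : Euc n} (hξ : ‖ξ‖ = 1) (t : ℝ) (x : Euc n) :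
    ⟪ξ, stretch ξ t x⟫ = t * ⟪ξ, x⟫ := by
  rw [stretch_apply, inner_add_right, real_inner_smul_right, real_inner_self_eq_norm_sq, hξ]
  ring

theorem norm_le_norm_stretch (ξ : Euc n) {t : ℝ} (ht : 1 ≤ t) (x : Euc n) :
    ‖x‖ ≤ ‖stretch ξ t x‖ := by
  refine le_of_sq_le_sq ?_ (norm_nonneg _)
  rw [stretch_apply, norm_add_sq_real, real_inner_smul_right, real_inner_comm]
  have h1 : 0 ≤ (t - 1) * ⟪x, ξ⟫ ^ 2 := mul_nonneg (by linarith) (sq_nonneg _)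
  nlinarith [sq_nonneg ‖((t - 1) * ⟪x, ξ⟫) • ξ‖]

theorem lintegral_stretch {ξ : Euc n} (hξ : ‖ξ‖ = 1) {t : ℝ} (ht : 0 < t) {F : Euc n → ℝ≥0∞}
    (hF : Measurable F) :
    ∫⁻ x, F (stretch ξ t x) = ENNReal.ofReal t⁻¹ * ∫⁻ x, F x := by
  have hL : Measurable (stretch ξ t) := (LinearMap.continuous_of_finiteDimensional _).measurable
  rw [← lintegral_map hF hL, Measure.map_linearMap_addHaar_eq_smul_addHaar volume
    (by rw [det_stretch hξ]; exact ht.ne'), det_stretch hξ, abs_of_pos (inv_pos.2 ht),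
    lintegral_smul_measure, smul_eq_mul]

theorem integral_stretch {ξ : Euc n} (hξ : ‖ξ‖ = 1) {t : ℝ} (ht : 0 < t) {F : Euc n → ℝ}
    (hF : Continuous F) : ∫ x, F (stretch ξ t x) = t⁻¹ * ∫ x, F x := by
  have hL : Measurable (stretch ξ t) := (LinearMap.continuous_of_finiteDimensional _).measurable
  rw [← integral_map hL.aemeasurable hF.aestronglyMeasurable,
    Measure.map_linearMap_addHaar_eq_smul_addHaar volume
    (by rw [det_stretch hξ]; exact ht.ne'), det_stretch hξ, abs_of_pos (inv_pos.2 ht),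
    integral_smul_measure, ENNReal.toReal_ofReal (inv_pos.2 ht).le, smul_eq_mul]

/-- Precomposition with the dilation in direction `ξ`. -/
def Sm.stretch (ξ : Euc n) (t : ℝ) (η : Sm n) : Sm n :=
  ⟨fun x => η (_root_.stretch ξ t x),
    (Sm.smooth η).comp (_root_.stretch ξ t).toContinuousLinearMap.contDiff⟩

theorem lqNorm_stretch {ξ : Euc n} (hξ : ‖ξ‖ = 1) {t : ℝ} (ht : 0 < t) {q : ℝ} (hq : 0 < q)
    (η : Sm n) :
    lqNorm q (Sm.stretch ξ t η) = ENNReal.ofReal t⁻¹ ^ (1 / q) * lqNorm q η := by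
  unfold lqNorm
  rw [← ENNReal.mul_rpow_of_nonneg _ _ (by positivity)]
  congr 1
  exact lintegral_stretch hξ ht ((Sm.continuous η).enorm.measurable.pow_const q)

theorem tsupport_stretch_subset (ξ : Euc n) {t : ℝ} (ht : 1 ≤ t) {s : ℝ}
    {η : Sm n} (h : tsupport (η : Euc n → ℝ) ⊆ closedBall 0 s) :
    tsupport (Sm.stretch ξ t η : Euc n → ℝ) ⊆ closedBall 0 s := by
  refine closure_minimal (fun x hx => ?_) isClosed_closedBall
  have := h (subset_tsupport _ (show stretch ξ t x ∈ Function.support η from hx))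
  rw [mem_closedBall_zero_iff] at this ⊢
  exact (norm_le_norm_stretch ξ ht x).trans this

/-- Concentrating ridge functions are uniformly locally integrable. -/
theorem unifLoc_ridge {ξ : Euc n} (hξ : ‖ξ‖ = 1) {χ : {f : ℝ → ℝ // ContDiff ℝ (⊤ : ℕ∞) f}}
    {r : ℝ} (hχ : ∀ t, r < |t| → χ.1 t = 0) (τ : ℕ → ℝ) (hτ : ∀ i, 1 ≤ τ i) :
    UnifLoc fun i => τ i • aff (τ i) 0 (ridge ξ χ) := by
  intro R
  have hcs : HasCompactSupport χ.1 := by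
    refine (isCompact_closedBall (0 : ℝ) r).of_isClosed_subset (isClosed_tsupport _)
      (closure_minimal (fun t ht => ?_) isClosed_closedBall)
    rw [mem_closedBall_zero_iff, Real.norm_eq_abs]
    by_contra h
    exact ht (hχ t (not_le.1 h))
  obtain ⟨M, hM⟩ := hcs.exists_bound_of_continuous χ.2.continuous
  have hfin : ENNReal.ofReal M * volume (closedBall (0 : Euc n) (2 * R + r)) ≠ ⊤ :=
    ENNReal.mul_ne_top ENNReal.ofReal_ne_top measure_closedBall_lt_top.ne
  refine ⟨(ENNReal.ofReal M * volume (closedBall (0 : Euc n) (2 * R + r))).toNNReal,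
    fun i z => ?_⟩
  rw [ENNReal.coe_toNNReal hfin]
  have ht : 0 < τ i := one_pos.trans_le (hτ i)
  set z' := z - ⟪ξ, z⟫ • ξ with hz'
  have hpt : ∀ x ∈ ball z R, ‖(τ i • aff (τ i) 0 (ridge ξ χ)) x‖ₑ ≤ ENNReal.ofReal (τ i) *
      (closedBall z' (2 * R + r)).indicator (fun _ => ENNReal.ofReal M) (stretch ξ (τ i) x) := by
    intro x hx
    have hval : (τ i • aff (τ i) 0 (ridge ξ χ)) x = τ i * χ.1 (τ i * ⟪ξ, x⟫) := by
      rw [Sm.smul_apply, aff_apply, add_zero]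
      change _ * χ.1 ⟪ξ, τ i • x⟫ = _
      rw [real_inner_smul_right]
    rw [hval, enorm_mul, Real.enorm_of_nonneg ht.le]
    refine mul_le_mul_right ?_ _
    by_cases h0 : r < |τ i * ⟪ξ, x⟫|
    · rw [hχ _ h0, enorm_zero]
      exact bot_le
    · rw [Set.indicator_of_mem, ← ofReal_norm]
      · exact ENNReal.ofReal_le_ofReal (hM _)
      · rw [mem_closedBall, dist_eq_norm]
        rw [mem_ball, dist_eq_norm] at hx
        have h1 : stretch ξ (τ i) x - z'
            = (x - z) - ⟪ξ, x - z⟫ • ξ + (τ i * ⟪ξ, x⟫) • ξ := by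
          rw [stretch_apply, hz', inner_sub_right]
          module
        have h2 : |⟪ξ, x - z⟫| ≤ ‖x - z‖ := by
          simpa [hξ] using abs_real_inner_le_norm ξ (x - z)
        rw [h1]
        refine (norm_add_le _ _).trans ?_
        have h3 := norm_sub_le (x - z) (⟪ξ, x - z⟫ • ξ)
        rw [norm_smul, hξ, mul_one, Real.norm_eq_abs] at h3 ⊢
        linarith [not_lt.1 h0]
  have hmeas : Measurable fun y : Euc n =>
      (closedBall z' (2 * R + r)).indicator (fun _ => ENNReal.ofReal M) y :=
    measurable_const.indicator measurableSet_closedBall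
  calc ∫⁻ x in ball z R, ‖(τ i • aff (τ i) 0 (ridge ξ χ)) x‖ₑ
      ≤ ∫⁻ x in ball z R, ENNReal.ofReal (τ i) *
        (closedBall z' (2 * R + r)).indicator (fun _ => ENNReal.ofReal M)
          (stretch ξ (τ i) x) := setLIntegral_mono' measurableSet_ball hpt
    _ ≤ ∫⁻ x, ENNReal.ofReal (τ i) *
        (closedBall z' (2 * R + r)).indicator (fun _ => ENNReal.ofReal M)
          (stretch ξ (τ i) x) := setLIntegral_le_lintegral _ _
    _ = ENNReal.ofReal M * volume (closedBall (0 : Euc n) (2 * R + r)) := by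
      rw [lintegral_const_mul' _ _ ENNReal.ofReal_ne_top, lintegral_stretch hξ ht hmeas,
        ← mul_assoc, ← ENNReal.ofReal_mul ht.le, mul_inv_cancel₀ ht.ne', ENNReal.ofReal_one,
        one_mul, lintegral_indicator measurableSet_closedBall, setLIntegral_const,
        Measure.addHaar_closedBall_center]

theorem lqNorm_ne_top {q : ℝ} (hq : 0 < q) {θ : Sm n}
    (hθ : HasCompactSupport (θ : Euc n → ℝ)) : lqNorm q (θ : Euc n → ℝ) ≠ ⊤ := by
  have h1 : MemLp (θ : Euc n → ℝ) (ENNReal.ofReal q) :=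
    (Sm.continuous θ).memLp_of_hasCompactSupport hθ
  have h2 := lintegral_rpow_enorm_lt_top_of_eLpNorm_lt_top
    (by rw [Ne, ENNReal.ofReal_eq_zero, not_le]; exact hq) ENNReal.ofReal_ne_top h1.2
  rw [ENNReal.toReal_ofReal hq.le] at h2
  exact ENNReal.rpow_ne_top_of_nonneg (by positivity) h2.ne

/-- A cut-off of the monomial `t ^ m`. -/
def cutMonomial (m : ℕ) : {f : ℝ → ℝ // ContDiff ℝ (⊤ : ℕ∞) f} :=
  ⟨fun t => t ^ m * (⟨1, 2, one_pos, one_lt_two⟩ : ContDiffBump (0 : ℝ)) t,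
    (contDiff_id.pow m).mul (ContDiffBump.contDiff _)⟩

theorem cutMonomial_eq_zero (m : ℕ) {t : ℝ} (ht : 2 < |t|) : (cutMonomial m).1 t = 0 := by
  have : (⟨1, 2, one_pos, one_lt_two⟩ : ContDiffBump (0 : ℝ)) t = 0 :=
    ContDiffBump.zero_of_le_dist _ (by simpa using ht.le)
  change _ * _ = _
  rw [this, mul_zero]

theorem smoothDeriv_cutMonomial (m : ℕ) {t : ℝ} (ht : |t| < 1) :
    (smoothDeriv m (cutMonomial m)).1 t = m.factorial := by
  have h1 : (cutMonomial m).1 =ᶠ[𝓝 t] fun t => t ^ m := by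
    filter_upwards [(isOpen_lt continuous_abs continuous_const).mem_nhds ht] with s hs
    have : (⟨1, 2, one_pos, one_lt_two⟩ : ContDiffBump (0 : ℝ)) s = 1 :=
      ContDiffBump.one_of_mem_closedBall _ (by simpa using le_of_lt hs)
    change _ * _ = _
    rw [this, mul_one]
  change deriv^[m] (cutMonomial m).1 t = _
  rw [← iteratedDeriv_eq_iterate, h1.iteratedDeriv_eq, iteratedDeriv_eq_iterate, iter_deriv_pow]
  rw [← descPochhammer_eval_eq_prod_range, descPochhammer_eval_eq_descFactorial,
    Nat.descFactorial_self, Nat.sub_self, pow_zero, mul_one]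

/-- A smooth bump function. -/
theorem exists_bump {s : ℝ} (hs : 0 < s) : ∃ η : Sm n,
    tsupport (η : Euc n → ℝ) ⊆ closedBall 0 s ∧ (∀ x, ‖x‖ ≤ s / 2 → η x = 1) ∧
      (∀ x, 0 ≤ η x) ∧ (∀ x, η x ≤ 1) ∧ 0 < ∫ x, η x := by
  let f : ContDiffBump (0 : Euc n) := ⟨s / 2, s, by positivity, by linarith⟩
  refine ⟨⟨f, f.contDiff⟩, f.tsupport_eq.subset, fun x hx => f.one_of_mem_closedBall ?_,
    fun x => f.nonneg, fun x => f.le_one, f.integral_pos⟩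
  simpa [mem_closedBall] using hx

theorem ell_of_locRegular {B C : Type} [Fintype C] {k m : ℕ}
    {a : Matrix B C (MvPolynomial (Fin n) ℝ)} (ha : ∀ b c, (a b c).IsHomogeneous k) {p q : ℝ}
    (hpq : p.HolderConjugate q) (h : LocRegular k m a p) : Ell a := by
  have hq : 0 < q := hpq.symm.pos
  intro ξ₀ hξ₀
  rw [← Matrix.coe_mulVecLin]
  refine (injective_iff_map_eq_zero _).2 fun v hv => ?_
  by_contra hv0
  obtain ⟨c, hc⟩ := Function.ne_iff.1 hv0
  set ξ : Euc n := ‖ξ₀‖⁻¹ • ξ₀ with hξdef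
  have hξ : ‖ξ‖ = 1 := norm_smul_inv_norm hξ₀
  have hker : ∀ b, ∑ c, v c * MvPolynomial.eval (fun i => ξ i) (a b c) = 0 := fun b => by
    have h1 : ∑ c, MvPolynomial.eval (fun i => ξ₀ i) (a b c) * v c = 0 := congrFun hv b
    have h2 : ∀ c, MvPolynomial.eval (fun i => ξ i) (a b c)
        = ‖ξ₀‖⁻¹ ^ k * MvPolynomial.eval (fun i => ξ₀ i) (a b c) := fun c =>
      eval_smul_of_homog (ha b c) _ _
    simp only [h2]
    rw [← mul_zero (‖ξ₀‖⁻¹ ^ k), ← h1, Finset.mul_sum]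
    exact Finset.sum_congr rfl fun c _ => by ring
  obtain ⟨i₀, hi₀⟩ : ∃ i, ξ i ≠ 0 := by
    by_contra! h0
    have : ξ = 0 := by ext i; simpa using h0 i
    simp [this] at hξ
  set χ := cutMonomial m with hχ
  set τ : ℕ → ℝ := fun i => i + 1 with hτ
  have hτ1 : ∀ i, 1 ≤ τ i := fun i => by simp [hτ]
  have hop : ∀ {l : ℕ} {P : MvPolynomial (Fin n) ℝ} (_ : P.IsHomogeneous l) (i : ℕ),
      op n P (τ i • aff (τ i) 0 (ridge ξ χ)) = (MvPolynomial.eval (fun i => ξ i) P) •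
        (τ i * τ i ^ l) • aff (τ i) 0 (ridge ξ (smoothDeriv l χ)) := fun hP i => by
    rw [map_smul, op_aff hP, op_ridge hP, map_smul, smul_smul, smul_comm]
  have hun : UnifLoc fun i => τ i • aff (τ i) 0 (ridge ξ χ) :=
    unifLoc_ridge hξ (fun t ht => cutMonomial_eq_zero m ht) τ hτ1
  obtain ⟨s, hs, K, hK⟩ := exists_bound_of_locRegular ha hpq h
    (Φ := fun i c => v c • τ i • aff (τ i) 0 (ridge ξ χ)) (fun c R => by
      obtain ⟨K, hK⟩ := hun R
      refine ⟨‖v c‖₊ * K, fun i z => ?_⟩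
      simp only [Sm.smul_apply (v c), enorm_mul]
      rw [lintegral_const_mul' _ _ enorm_ne_top, ENNReal.coe_mul]
      exact mul_le_mul_right (hK i z) _) (fun b R => by
      refine ⟨0, fun i z => ?_⟩
      have : ∑ c, op n (a b c) (v c • τ i • aff (τ i) 0 (ridge ξ χ)) = 0 := by
        have h1 : ∀ c, op n (a b c) (v c • τ i • aff (τ i) 0 (ridge ξ χ))
            = (v c * MvPolynomial.eval (fun i => ξ i) (a b c)) • (τ i * τ i ^ k) •
              aff (τ i) 0 (ridge ξ (smoothDeriv k χ)) := fun c => by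
          rw [map_smul, hop (ha b c), smul_smul]
        rw [Finset.sum_congr rfl fun c _ => h1 c, ← Finset.sum_smul, hker, zero_smul]
      dsimp only
      rw [this]
      simp only [Sm.zero_apply, enorm_zero, lintegral_zero]
      exact bot_le) (fun _ => i₀) c
  obtain ⟨η, hηs, -, hη0, -, hηi⟩ := exists_bump (n := n) (lt_min hs (by norm_num : (0 : ℝ) < 1 / 2))
  have hηc : HasCompactSupport (η : Euc n → ℝ) := hasCompactSupport_of_subset hηs
  set D : ℝ := v c * ξ i₀ ^ m * m.factorial * ∫ x, η x with hD
  have hD0 : D ≠ 0 := mul_ne_zero (mul_ne_zero (mul_ne_zero hc (pow_ne_zero _ hi₀))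
    (Nat.cast_ne_zero.2 m.factorial_ne_zero)) hηi.ne'
  have hbound : ∀ i, ‖D‖ₑ ≤ K * (ENNReal.ofReal (τ i)⁻¹ ^ (1 / q) * lqNorm q η) := fun i => by
    have ht : 0 < τ i := one_pos.trans_le (hτ1 i)
    have hθs := tsupport_stretch_subset ξ (hτ1 i) hηs
    have h1 := hK i (Sm.stretch ξ (τ i) η)
      (hθs.trans (closedBall_subset_closedBall (min_le_left _ _)))
    rw [lqNorm_stretch hξ ht hq] at h1
    refine le_trans ?_ h1
    have h2 := integral_op_mul (f := v c • τ i • aff (τ i) 0 (ridge ξ χ))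
      (monoI_homog fun _ : Fin m => i₀) (hasCompactSupport_of_subset hθs)
    have h3 : ∫ x, op n (monoI fun _ : Fin m => i₀) (v c • τ i • aff (τ i) 0 (ridge ξ χ)) x
        * Sm.stretch ξ (τ i) η x = τ i ^ m * D := by
      rw [map_smul, hop (monoI_homog _), eval_monoI, Finset.prod_const, Finset.card_univ,
        Fintype.card_fin]
      have h4 : ∀ x, (v c • ξ i₀ ^ m • (τ i * τ i ^ m) •
          aff (τ i) 0 (ridge ξ (smoothDeriv m χ))) x * Sm.stretch ξ (τ i) η x
          = (v c * ξ i₀ ^ m * (τ i * τ i ^ m) * m.factorial) * η (stretch ξ (τ i) x) := by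
        intro x
        have h5 : aff (τ i) 0 (ridge ξ (smoothDeriv m χ)) x
            = (smoothDeriv m χ).1 ⟪ξ, stretch ξ (τ i) x⟫ := by
          rw [aff_apply, add_zero, inner_stretch hξ, ← real_inner_smul_right]
          rfl
        simp only [Sm.smul_apply, h5]
        change _ * η (stretch ξ (τ i) x) = _
        by_cases h0 : η (stretch ξ (τ i) x) = 0
        · rw [h0, mul_zero, mul_zero]
        · have h6 : ‖stretch ξ (τ i) x‖ ≤ 1 / 2 := by
            have := hηs (subset_tsupport _ h0)
            rw [mem_closedBall_zero_iff] at this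
            exact this.trans (min_le_right _ _)
          have h7 : |⟪ξ, stretch ξ (τ i) x⟫| < 1 := by
            have := abs_real_inner_le_norm ξ (stretch ξ (τ i) x)
            rw [hξ, one_mul] at this
            linarith
          rw [hχ, smoothDeriv_cutMonomial m h7]
          ring
      simp only [h4]
      rw [integral_const_mul, integral_stretch hξ ht (Sm.continuous η), hD]
      field_simp
    have h5 : ‖τ i ^ m * D‖ₑ = ‖∫ x, (v c • τ i • aff (τ i) 0 (ridge ξ χ)) x
        * op n (monoI fun _ : Fin m => i₀) (Sm.stretch ξ (τ i) η) x‖ₑ := by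
      rw [← h3, h2, enorm_mul, enorm_pow, enorm_neg, enorm_one, one_pow, one_mul]
    rw [← h5, enorm_mul (τ i ^ m), enorm_pow]
    refine le_mul_of_one_le_left bot_le (one_le_pow₀ ?_)
    rw [Real.enorm_of_nonneg ht.le]
    exact ENNReal.one_le_ofReal.2 (hτ1 i)
  have hlim : Tendsto (fun i => K * (ENNReal.ofReal (τ i)⁻¹ ^ (1 / q) * lqNorm q η)) atTop
      (𝓝 (K * (0 ^ (1 / q) * lqNorm q η))) := by
    refine ENNReal.Tendsto.const_mul (ENNReal.Tendsto.mul_const ?_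
      (Or.inr (lqNorm_ne_top hq hηc))) (Or.inr ENNReal.coe_ne_top)
    refine (ENNReal.continuous_rpow_const.tendsto _).comp ?_
    rw [← ENNReal.ofReal_zero]
    exact (ENNReal.continuous_ofReal.tendsto 0).comp
      (by simpa [hτ] using tendsto_one_div_add_atTop_nhds_zero_nat (𝕜 := ℝ))
  rw [ENNReal.zero_rpow_of_pos (by positivity), zero_mul, mul_zero] at hlim
  have := ge_of_tendsto' hlim hbound
  simp [hD0] at this

end

noncomputable section

open scoped NNReal

variable {n : ℕ}

theorem exists_eq_sum_monoI {l : ℕ} {p : MvPolynomial (Fin n) ℝ} (hp : p.IsHomogeneous l) :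
    ∃ α : (Fin l → Fin n) → ℝ, p = ∑ I, α I • monoI I := by
  refine homog_induction (motive := fun l p =>
    ∃ α : (Fin l → Fin n) → ℝ, p = ∑ I, α I • monoI I) hp ?_ ?_ ?_ ?_
  · intro c
    refine ⟨fun _ => c, ?_⟩
    simp [monoI, MvPolynomial.smul_eq_C_mul]
  · exact fun l => ⟨0, by simp⟩
  · rintro l p q ⟨α, rfl⟩ ⟨β, rfl⟩
    exact ⟨α + β, by simp [add_smul, Finset.sum_add_distrib]⟩
  · rintro l p i ⟨α, rfl⟩
    refine ⟨fun I => if I 0 = i then α (Fin.tail I) else 0, ?_⟩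
    rw [← (Fin.consEquiv fun _ => Fin n).sum_comp, Fintype.sum_prod_type, Finset.mul_sum,
      Finset.sum_eq_single i]
    · refine Finset.sum_congr rfl fun I _ => ?_
      simp [Fin.consEquiv, monoI, Fin.prod_univ_succ]
    · intro i' _ hi'
      exact Finset.sum_eq_zero fun I _ => by simp [Fin.consEquiv, hi']
    · simp

theorem monoI_append {m j : ℕ} (K : Fin (m + j) → Fin n) :
    monoI K = monoI (fun i => K (Fin.castAdd j i)) * monoI fun i => K (Fin.natAdd m i) := by
  simp [monoI, Fin.prod_univ_add]

theorem lintegral_comp_smul {t : ℝ} (ht : 0 < t) {F : Euc n → ℝ≥0∞} (hF : Measurable F) :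
    ∫⁻ x, F (t • x) = ENNReal.ofReal (t ^ n)⁻¹ * ∫⁻ x, F x := by
  rw [← lintegral_map hF (measurable_const_smul t), Measure.map_addHaar_smul _ ht.ne',
    finrank_euclideanSpace_fin, abs_of_pos (by positivity), lintegral_smul_measure, smul_eq_mul]

theorem enorm_sum_rpow_of_subsingleton {ι : Type*} (s : Finset ι) {f : ι → ℝ} {q : ℝ}
    (hq : 0 < q) (h : ∀ i i', f i ≠ 0 → f i' ≠ 0 → i = i') :
    ‖∑ i ∈ s, f i‖ₑ ^ q = ∑ i ∈ s, ‖f i‖ₑ ^ q := by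
  by_cases h0 : ∃ i ∈ s, f i ≠ 0
  · obtain ⟨i, hi, hne⟩ := h0
    have hz : ∀ i' ∈ s, i' ≠ i → f i' = 0 := fun i' _ hi' => by
      by_contra hc
      exact hi' (h _ _ hc hne)
    rw [Finset.sum_eq_single_of_mem i hi hz, Finset.sum_eq_single_of_mem i hi]
    intro i' hi' hne'
    rw [hz i' hi' hne', enorm_zero, ENNReal.zero_rpow_of_pos hq]
  · push Not at h0
    rw [Finset.sum_eq_zero h0, enorm_zero, ENNReal.zero_rpow_of_pos hq]
    refine (Finset.sum_eq_zero fun i hi => ?_).symm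
    rw [h0 i hi, enorm_zero, ENNReal.zero_rpow_of_pos hq]

theorem lqNorm_smul {q : ℝ} (hq : 0 < q) (c : ℝ) (θ : Sm n) :
    lqNorm q (c • θ) = ‖c‖ₑ * lqNorm q θ := by
  unfold lqNorm
  simp only [Sm.smul_apply, enorm_mul, ENNReal.mul_rpow_of_nonneg _ _ hq.le]
  rw [lintegral_const_mul _ ((Sm.continuous θ).enorm.measurable.pow_const q),
    ENNReal.mul_rpow_of_nonneg _ _ (by positivity), ← ENNReal.rpow_mul,
    mul_one_div_cancel hq.ne', ENNReal.rpow_one]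

/-- At the critical exponent, rescaled functions supported in an annulus have the same norm, and
disjoint supports make the norms of sums additive. -/
theorem lqNorm_sum_rescaled {q : ℝ} (hq : 0 < q) {j : ℕ} (hqj : q * j = n) {s : ℝ} (hs : 0 < s)
    {g : Sm n} (h1 : ∀ x, ‖x‖ < s / 2 → g x = 0) (h2 : ∀ x, s < ‖x‖ → g x = 0) (M : ℕ) :
    lqNorm q ((∑ i ∈ Finset.range M, ((4 : ℝ) ^ i) ^ j • aff ((4 : ℝ) ^ i) 0 g : Sm n))
      = (M : ℝ≥0∞) ^ (1 / q) * lqNorm q g := by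
  unfold lqNorm
  rw [← ENNReal.mul_rpow_of_nonneg _ _ (by positivity)]
  congr 1
  have hval : ∀ i x, (((4 : ℝ) ^ i) ^ j • aff ((4 : ℝ) ^ i) 0 g) x
      = ((4 : ℝ) ^ i) ^ j * g ((4 : ℝ) ^ i • x) := fun i x => by
    rw [Sm.smul_apply, aff_apply, add_zero]
  have hann : ∀ i x, (((4 : ℝ) ^ i) ^ j • aff ((4 : ℝ) ^ i) 0 g) x ≠ 0 →
      s / 2 ≤ (4 : ℝ) ^ i * ‖x‖ ∧ (4 : ℝ) ^ i * ‖x‖ ≤ s := by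
    intro i x h
    rw [hval] at h
    have h3 := right_ne_zero_of_mul h
    have h4 : ‖(4 : ℝ) ^ i • x‖ = (4 : ℝ) ^ i * ‖x‖ := by
      rw [norm_smul, Real.norm_of_nonneg (by positivity)]
    rw [← h4]
    exact ⟨not_lt.1 fun h => h3 (h1 _ h), not_lt.1 fun h => h3 (h2 _ h)⟩
  have hle : ∀ i i' x, (((4 : ℝ) ^ i) ^ j • aff ((4 : ℝ) ^ i) 0 g) x ≠ 0 →
      (((4 : ℝ) ^ i') ^ j • aff ((4 : ℝ) ^ i') 0 g) x ≠ 0 → i ≤ i' := by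
    intro i i' x h h'
    by_contra! hlt
    have h3 := (hann i x h).2
    have h4 := (hann i' x h').1
    have h5 : (4 : ℝ) ^ i' * 4 ≤ 4 ^ i := by
      rw [← pow_succ]
      exact pow_le_pow_right₀ (by norm_num) hlt
    nlinarith [mul_le_mul_of_nonneg_right h5 (norm_nonneg x)]
  have hsum : ∀ x, ‖(∑ i ∈ Finset.range M, ((4 : ℝ) ^ i) ^ j • aff ((4 : ℝ) ^ i) 0 g : Sm n) x‖ₑ ^ q
      = ∑ i ∈ Finset.range M, ‖(((4 : ℝ) ^ i) ^ j • aff ((4 : ℝ) ^ i) 0 g) x‖ₑ ^ q := fun x => by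
    rw [Sm.sum_apply]
    exact enorm_sum_rpow_of_subsingleton _ hq fun i i' h h' =>
      le_antisymm (hle i i' x h h') (hle i' i x h' h)
  have hone : ∀ i, ∫⁻ x, ‖(((4 : ℝ) ^ i) ^ j • aff ((4 : ℝ) ^ i) 0 g) x‖ₑ ^ q
      = ∫⁻ x, ‖g x‖ₑ ^ q := fun i => by
    have h4 : (0 : ℝ) < 4 ^ i := by positivity
    simp only [hval, enorm_mul, ENNReal.mul_rpow_of_nonneg _ _ hq.le]
    rw [lintegral_const_mul' _ _ (ENNReal.rpow_ne_top_of_nonneg hq.le enorm_ne_top),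
      lintegral_comp_smul h4 ((Sm.continuous g).enorm.measurable.pow_const q), ← mul_assoc,
      Real.enorm_of_nonneg (by positivity), ENNReal.ofReal_rpow_of_nonneg (by positivity) hq.le,
      ← ENNReal.ofReal_mul (by positivity), ← Real.rpow_natCast _ j, ← Real.rpow_mul h4.le,
      mul_comm (j : ℝ), hqj, Real.rpow_natCast, mul_inv_cancel₀ (by positivity),
      ENNReal.ofReal_one, one_mul]
  simp only [hsum]
  rw [lintegral_finsetSum _ fun i _ => (Sm.continuous _).enorm.measurable.pow_const q]
  rw [Finset.sum_congr rfl fun i _ => hone i, Finset.sum_const, Finset.card_range,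
    nsmul_eq_mul]

theorem UnifLoc.of_lintegral_le {ι : Type*} {F : ι → Sm n} {K : ℝ≥0∞} (hK : K ≠ ⊤)
    (h : ∀ i, ∫⁻ x, ‖F i x‖ₑ ≤ K) : UnifLoc F := fun _ =>
  ⟨K.toNNReal, fun i _ => by
    rw [ENNReal.coe_toNNReal hK]
    exact (setLIntegral_le_lintegral _ _).trans (h i)⟩

theorem lintegral_enorm_ne_top {f : Sm n} (hf : HasCompactSupport (f : Euc n → ℝ)) :
    ∫⁻ x, ‖f x‖ₑ ≠ ⊤ := (integrable_of_compactSupport hf).2.ne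

theorem lintegral_enorm_sum_le {ι : Type*} (s : Finset ι) (F : ι → Sm n) :
    ∫⁻ x, ‖(∑ i ∈ s, F i : Sm n) x‖ₑ ≤ ∑ i ∈ s, ∫⁻ x, ‖F i x‖ₑ := by
  rw [← lintegral_finsetSum _ fun i _ => (Sm.continuous (F i)).enorm.measurable]
  refine lintegral_mono fun x => ?_
  rw [Sm.sum_apply]
  exact enorm_sum_le _ _

/-- Dilations form an approximate identity. -/
theorem tendsto_integral_dil_mul {T θ : Sm n} (hT : HasCompactSupport (T : Euc n → ℝ))
    (hθ : HasCompactSupport (θ : Euc n → ℝ)) :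
    Tendsto (fun N => ∫ x, dil N T x * θ x) atTop (𝓝 ((∫ x, T x) * θ 0)) := by
  have h1 : ∀ N, ∫ x, dil N T x * θ x = ∫ x, T x * θ (((2 : ℝ) ^ N)⁻¹ • x) := fun N => by
    have h2 : (0 : ℝ) < 2 ^ N := by positivity
    have h3 := Measure.integral_comp_smul (volume : Measure (Euc n))
      (fun x => T x * θ (((2 : ℝ) ^ N)⁻¹ • x)) (2 ^ N)
    simp only [inv_smul_smul₀ h2.ne'] at h3
    simp only [dil_apply, mul_assoc]
    rw [integral_const_mul, h3, finrank_euclideanSpace_fin, abs_of_pos (by positivity),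
      smul_eq_mul, mul_inv_cancel_left₀ (by positivity)]
  simp only [h1]
  rw [← integral_mul_const]
  obtain ⟨M, hM⟩ := hθ.exists_bound_of_continuous (Sm.continuous θ)
  refine tendsto_integral_of_dominated_convergence (fun x => |T x| * M)
    (fun N => ((Sm.continuous T).mul ((Sm.continuous θ).comp
      (continuous_const_smul _))).aestronglyMeasurable)
    ((integrable_of_compactSupport hT).abs.mul_const M)
    (fun N => ae_of_all _ fun x => ?_) (ae_of_all _ fun x => ?_)
  · rw [norm_mul, Real.norm_eq_abs]
    exact mul_le_mul_of_nonneg_left (hM _) (abs_nonneg _)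
  · refine Tendsto.const_mul _ (((Sm.continuous θ).tendsto 0).comp ?_)
    have h4 : Tendsto (fun N : ℕ => ((2 : ℝ) ^ N)⁻¹) atTop (𝓝 0) :=
      tendsto_inv_atTop_zero.comp (tendsto_pow_atTop_atTop_of_one_lt one_lt_two)
    simpa using h4.smul_const x

theorem tendsto_integral_mul_aff (hn : n ≠ 0) {T η : Sm n}
    (hT : HasCompactSupport (T : Euc n → ℝ)) (hη : HasCompactSupport (η : Euc n → ℝ)) :
    Tendsto (fun i : ℕ => ∫ x, T x * aff ((4 : ℝ) ^ i) 0 η x) atTop (𝓝 0) := by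
  have h1 : ∀ i : ℕ, ∫ x, T x * aff ((4 : ℝ) ^ i) 0 η x
      = (((4 : ℝ) ^ n) ^ i)⁻¹ * ∫ x, dil (2 * i) η x * T x := fun i => by
    rw [← integral_const_mul]
    refine integral_congr_ae (ae_of_all _ fun x => ?_)
    have h2 : (2 : ℝ) ^ (2 * i) = 4 ^ i := by
      rw [pow_mul]
      norm_num
    dsimp only
    rw [dil_apply, aff_apply, add_zero, h2, ← pow_mul, ← pow_mul, mul_comm i n, mul_assoc,
      inv_mul_cancel_left₀ (by positivity), mul_comm]
  simp only [h1]
  have h2 : Tendsto (fun i : ℕ => (((4 : ℝ) ^ n) ^ i)⁻¹) atTop (𝓝 0) :=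
    tendsto_inv_atTop_zero.comp
      (tendsto_pow_atTop_atTop_of_one_lt (one_lt_pow₀ (by norm_num) hn))
  have h3 := h2.mul ((tendsto_integral_dil_mul hη hT).comp
    (tendsto_id.const_mul_atTop' (zero_lt_two (α := ℕ))))
  simpa using h3

end

noncomputable section

open scoped NNReal

variable {n : ℕ}

theorem exists_bound_sum {ι : Type*} [Fintype ι] {J : ι → ℕ → Sm n → ℝ} {N : Sm n → ℝ≥0∞}
    (h : ∀ t, ∃ s > 0, ∃ K : ℝ≥0, ∀ i (θ : Sm n), tsupport (θ : Euc n → ℝ) ⊆ closedBall 0 s →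
      ‖J t i θ‖ₑ ≤ K * N θ) :
    ∃ s > 0, ∃ K : ℝ≥0, ∀ i (θ : Sm n), tsupport (θ : Euc n → ℝ) ⊆ closedBall 0 s →
      ‖∑ t, J t i θ‖ₑ ≤ K * N θ := by
  choose σ hσ K hK using h
  have h1 : ∀ᶠ s in 𝓝[>] (0 : ℝ), ∀ t, s ≤ σ t :=
    eventually_all.2 fun t => Eventually.mono (Ioc_mem_nhdsGT (hσ t)) fun _ hs => hs.2
  obtain ⟨s, h2, hs⟩ := (h1.and self_mem_nhdsWithin).exists
  refine ⟨s, hs, ∑ t, K t, fun i θ hθ => (enorm_sum_le _ _).trans ?_⟩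
  rw [ENNReal.ofNNReal_finsetSum, Finset.sum_mul]
  exact Finset.sum_le_sum fun t _ => hK t i θ (hθ.trans (closedBall_subset_closedBall (h2 t)))

theorem exists_bound_op {m j : ℕ} {q : ℝ} {F : ℕ → Sm n}
    (hF : ∀ I : Fin m → Fin n, ∃ s > 0, ∃ K : ℝ≥0, ∀ i (θ : Sm n),
      tsupport (θ : Euc n → ℝ) ⊆ closedBall 0 s →
        ‖∫ x, F i x * op n (monoI I) θ x‖ₑ ≤ K * lqNorm q θ)
    {p : MvPolynomial (Fin n) ℝ} (hp : p.IsHomogeneous (m + j)) :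
    ∃ s > 0, ∃ K : ℝ≥0, ∀ i (θ : Sm n), tsupport (θ : Euc n → ℝ) ⊆ closedBall 0 s →
      ‖∫ x, F i x * op n p θ x‖ₑ ≤
        K * ∑ J : Fin j → Fin n, lqNorm q (op n (monoI J) θ) := by
  obtain ⟨α, rfl⟩ := exists_eq_sum_monoI hp
  obtain ⟨s, hs, K, hK⟩ := exists_bound_sum
    (J := fun (I : Fin (m + j) → Fin n) i θ => α I * ∫ x, F i x * op n (monoI I) θ x)
    (N := fun θ => ∑ J : Fin j → Fin n, lqNorm q (op n (monoI J) θ)) fun I => by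
      obtain ⟨s, hs, K, hK⟩ := hF fun i => I (Fin.castAdd j i)
      refine ⟨s, hs, ‖α I‖₊ * K, fun i θ hθ => ?_⟩
      rw [enorm_mul, ENNReal.coe_mul, mul_assoc, monoI_append]
      simp only [op_mul]
      refine mul_le_mul_right ((hK i _ ((tsupport_op _ θ).trans hθ)).trans ?_) _
      exact mul_le_mul_right (Finset.single_le_sum
        (f := fun J : Fin j → Fin n => lqNorm q (op n (monoI J) θ)) (fun _ _ => bot_le)
        (Finset.mem_univ fun i => I (Fin.natAdd m i))) _
  refine ⟨s, hs, K, fun i θ hθ => ?_⟩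
  convert hK i θ hθ using 2
  have hθc := hasCompactSupport_of_subset hθ
  simp only [← integral_const_mul]
  rw [← integral_finsetSum]
  · refine integral_congr_ae (ae_of_all _ fun x => ?_)
    dsimp only
    rw [op_sum, Sm.sum_apply, Finset.mul_sum]
    refine Finset.sum_congr rfl fun I _ => ?_
    rw [map_smul, LinearMap.smul_apply, Sm.smul_apply]
    ring
  · exact fun I _ => (((Sm.continuous (F i)).mul (Sm.continuous _)).integrable_of_hasCompactSupport
      (hasCompactSupport_op _ hθc).mul_left).const_mul _

theorem op_monoI_eq_zero_of_const {j : ℕ} (hj : j ≠ 0) (J : Fin j → Fin n) {η : Sm n} {s : ℝ}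
    (h : ∀ x, ‖x‖ ≤ s → η x = 1) {x : Euc n} (hx : ‖x‖ < s) : op n (monoI J) η x = 0 := by
  obtain ⟨j, rfl⟩ := Nat.exists_eq_succ_of_ne_zero hj
  have h1 : (η : Euc n → ℝ) =ᶠ[𝓝 x] (1 : Sm n) := by
    filter_upwards [(isOpen_lt continuous_norm continuous_const).mem_nhds hx] with y hy
    exact h y (le_of_lt hy)
  rw [(op_congr _ h1).self_of_nhds]
  have h2 : pd (J (Fin.last j)) (1 : Sm n) = 0 := Sm.ext fun x => by
    change fderiv ℝ (fun _ : Euc n => (1 : ℝ)) x _ = 0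
    simp
  have h3 : monoI J = monoI (fun i : Fin j => J i.castSucc) * MvPolynomial.X (J (Fin.last j)) := by
    simp [monoI, Fin.prod_univ_castSucc]
  rw [h3, op_mul_X, h2, map_zero, Sm.zero_apply]

/-- A difference of a point evaluation and a smooth functional cannot be bounded by the critical
Sobolev norm. -/
theorem eq_zero_of_critical_bound (hn : n ≠ 0) {j : ℕ} (hj : j ≠ 0) {q : ℝ} (hq : 1 < q)
    (hqj : q * j = n) {T : Sm n} (hT : HasCompactSupport (T : Euc n → ℝ)) {ω s : ℝ} (hs : 0 < s)
    {K : ℝ≥0} (h : ∀ θ : Sm n, tsupport (θ : Euc n → ℝ) ⊆ closedBall 0 s →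
      ‖ω * θ 0 - ∫ x, T x * θ x‖ₑ ≤ K * ∑ J : Fin j → Fin n, lqNorm q (op n (monoI J) θ)) :
    ω = 0 := by
  have hq0 : 0 < q := one_pos.trans hq
  obtain ⟨η, hηs, hη1, -⟩ := exists_bump (n := n) hs
  have hηc : HasCompactSupport (η : Euc n → ℝ) := hasCompactSupport_of_subset hηs
  set Θ : ℕ → Sm n := fun M => (M : ℝ)⁻¹ • ∑ i ∈ Finset.range M, aff ((4 : ℝ) ^ i) 0 η with hΘ
  have hΘs : ∀ M, tsupport (Θ M : Euc n → ℝ) ⊆ closedBall 0 s := fun M => by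
    refine closure_minimal (fun x hx => ?_) isClosed_closedBall
    rw [Function.mem_support, hΘ, Sm.smul_apply, Sm.sum_apply] at hx
    obtain ⟨i, -, hi⟩ := Finset.exists_ne_zero_of_sum_ne_zero (right_ne_zero_of_mul hx)
    rw [aff_apply, add_zero] at hi
    have h1 := hηs (subset_tsupport _ hi)
    rw [mem_closedBall_zero_iff, norm_smul, Real.norm_of_nonneg (by positivity)] at h1
    rw [mem_closedBall_zero_iff]
    exact (le_mul_of_one_le_left (norm_nonneg x) (one_le_pow₀ (by norm_num))).trans h1
  have hnorm : ∀ (J : Fin j → Fin n) M, lqNorm q (op n (monoI J) (Θ M))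
      = ‖(M : ℝ)⁻¹‖ₑ * ((M : ℝ≥0∞) ^ (1 / q) * lqNorm q (op n (monoI J) η)) := fun J M => by
    rw [hΘ, map_smul, lqNorm_smul hq0, map_sum, ← lqNorm_sum_rescaled hq0 hqj hs
      (fun x hx => op_monoI_eq_zero_of_const hj J hη1 hx)
      (fun x hx => op_eq_zero_of_notMem _ fun hx' => by
        have := hηs hx'
        rw [mem_closedBall_zero_iff] at this
        linarith) M]
    simp only [op_aff (monoI_homog J)]
  have hval : ∀ M : ℕ, ω * Θ M 0 - ∫ x, T x * Θ M x = (M : ℝ)⁻¹ * ∑ i ∈ Finset.range M,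
      (ω - ∫ x, T x * aff ((4 : ℝ) ^ i) 0 η x) := fun M => by
    have h1 : ∀ i, Integrable fun x => T x * aff ((4 : ℝ) ^ i) 0 η x := fun i =>
      ((Sm.continuous T).mul (Sm.continuous _)).integrable_of_hasCompactSupport hT.mul_right
    have h2 : η 0 = 1 := hη1 0 (by rw [norm_zero]; positivity)
    simp only [hΘ, Sm.smul_apply, Sm.sum_apply, aff_apply (y := 0), smul_zero, add_zero, h2]
    have h3 : ∀ x, T x * ((M : ℝ)⁻¹ * ∑ i ∈ Finset.range M, aff ((4 : ℝ) ^ i) 0 η x)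
        = (M : ℝ)⁻¹ * ∑ i ∈ Finset.range M, T x * aff ((4 : ℝ) ^ i) 0 η x := fun x => by
      rw [← Finset.mul_sum]
      ring
    simp only [h3]
    rw [integral_const_mul, integral_finsetSum _ fun i _ => h1 i, Finset.sum_sub_distrib,
      Finset.sum_const, Finset.sum_const, nsmul_eq_mul, nsmul_eq_mul]
    ring
  have hlim1 : Tendsto (fun M => ‖ω * Θ M 0 - ∫ x, T x * Θ M x‖ₑ) atTop (𝓝 ‖ω‖ₑ) := by
    simp only [hval]
    refine (Filter.Tendsto.cesaro ?_).enorm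
    simpa using (tendsto_integral_mul_aff hn hT hηc).const_sub ω
  have hlim2 : Tendsto (fun M : ℕ => K * ∑ J : Fin j → Fin n, lqNorm q (op n (monoI J) (Θ M)))
      atTop (𝓝 0) := by
    have h1 : Tendsto (fun M : ℕ => ‖(M : ℝ)⁻¹‖ₑ * (M : ℝ≥0∞) ^ (1 / q)) atTop (𝓝 0) := by
      have h2 : Tendsto (fun M : ℕ => ENNReal.ofReal ((M : ℝ) ^ (-(1 - 1 / q)))) atTop
          (𝓝 (ENNReal.ofReal 0)) := by
        refine (ENNReal.continuous_ofReal.tendsto 0).comp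
          ((tendsto_rpow_neg_atTop ?_).comp tendsto_natCast_atTop_atTop)
        rw [sub_pos, div_lt_one hq0]
        exact hq
      rw [ENNReal.ofReal_zero] at h2
      refine h2.congr' ?_
      filter_upwards [eventually_gt_atTop 0] with M hM
      have hM' : (0 : ℝ) < M := Nat.cast_pos.2 hM
      rw [Real.enorm_of_nonneg (by positivity), ← ENNReal.ofReal_natCast,
        ENNReal.ofReal_rpow_of_pos hM', ← ENNReal.ofReal_mul (by positivity), neg_sub,
        Real.rpow_sub hM', Real.rpow_one, div_eq_inv_mul]
    have h3 : ∀ J : Fin j → Fin n, Tendsto (fun M => lqNorm q (op n (monoI J) (Θ M))) atTop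
        (𝓝 0) := fun J => by
      simp only [hnorm, ← mul_assoc]
      simpa using ENNReal.Tendsto.mul_const h1
        (Or.inr (lqNorm_ne_top hq0 (hasCompactSupport_op (monoI J) hηc)))
    simpa using ENNReal.Tendsto.const_mul (tendsto_finsetSum Finset.univ fun J _ => h3 J)
      (Or.inr (ENNReal.coe_ne_top (r := K)))
  have := le_of_tendsto_of_tendsto' hlim1 hlim2 fun M => h (Θ M) (hΘs M)
  simpa using this

theorem canc_of_locRegular {B C : Type} [Fintype B] [Fintype C] {k m j : ℕ} (hn : n ≠ 0)
    (hj : j ≠ 0) (hk : k = m + j) {a : Matrix B C (MvPolynomial (Fin n) ℝ)}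
    (ha : ∀ b c, (a b c).IsHomogeneous k) {p q : ℝ} (hpq : p.HolderConjugate q)
    (hqj : q * j = n) (h : LocRegular k m a p) : Canc a := by
  classical
  subst hk
  intro w hw
  funext b'
  obtain ⟨β, -, hβ, -, -, -, hT⟩ := exists_compact_kernel (by omega) ha (ell_of_locRegular ha hpq h)
  choose T hTs hTi hTβ using hT w hw
  have hβc : ∀ c b, HasCompactSupport (β c b : Euc n → ℝ) := fun c b =>
    hasCompactSupport_of_subset (hβ c b)
  have hTc : ∀ b, HasCompactSupport (T b : Euc n → ℝ) := fun b =>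
    hasCompactSupport_of_subset (hTs b)
  set Ψ : C → Sm n := fun c => ∑ b, w b • β c b with hΨ
  have hΨc : ∀ c, HasCompactSupport (Ψ c : Euc n → ℝ) := fun c =>
    Sm.hasCompactSupport_sum _ fun b => Sm.hasCompactSupport_smul _ (hβc c b)
  have hΨT : ∀ b, ∑ c, op n (a b c) (Ψ c) = (2 : ℝ) ^ n • aff 2 0 (T b) - T b := fun b => by
    rw [← hTβ b]
    simp only [hΨ, map_sum, map_smul]
  set Φ : ℕ → C → Sm n := fun N c =>
    ∑ i ∈ Finset.range N, (((2 : ℝ) ^ i) ^ (m + j))⁻¹ • dil i (Ψ c) with hΦ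
  have haΦ : ∀ b N, ∑ c, op n (a b c) (Φ N c) = dil N (T b) - T b := fun b N => by
    have h1 : ∀ i, ∑ c, op n (a b c) ((((2 : ℝ) ^ i) ^ (m + j))⁻¹ • dil i (Ψ c))
        = dil (i + 1) (T b) - dil i (T b) := fun i => by
      have h2 : ∀ c, op n (a b c) ((((2 : ℝ) ^ i) ^ (m + j))⁻¹ • dil i (Ψ c))
          = dil i (op n (a b c) (Ψ c)) := fun c => by
        rw [map_smul, op_dil (ha b c), inv_smul_smul₀ (by positivity)]
      rw [Finset.sum_congr rfl fun c _ => h2 c, ← dil_sum, hΨT, dil_sub, dil_succ]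
    have h3 : dil 0 (T b) = T b := Sm.ext fun x => by simp [dil_apply]
    simp only [hΦ, map_sum]
    rw [Finset.sum_comm, Finset.sum_congr rfl fun i _ => h1 i,
      Finset.sum_range_sub (fun i => dil i (T b)), h3]
  have hΦu : ∀ c, UnifLoc fun N => Φ N c := fun c => by
    refine UnifLoc.of_lintegral_le
      (ENNReal.mul_ne_top ENNReal.ofNat_ne_top (lintegral_enorm_ne_top (hΨc c)) :
        2 * ∫⁻ x, ‖Ψ c x‖ₑ ≠ ⊤) fun N => (lintegral_enorm_sum_le _ _).trans ?_
    have h1 : ∀ i, ∫⁻ x, ‖((((2 : ℝ) ^ i) ^ (m + j))⁻¹ • dil i (Ψ c)) x‖ₑ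
        ≤ 2⁻¹ ^ i * ∫⁻ x, ‖Ψ c x‖ₑ := fun i => by
      simp only [Sm.smul_apply, enorm_mul]
      rw [lintegral_const_mul' _ _ enorm_ne_top, lintegral_enorm_dil]
      refine mul_le_mul_left ?_ _
      rw [Real.enorm_of_nonneg (by positivity), ← ENNReal.inv_pow,
        ENNReal.ofReal_inv_of_pos (by positivity)]
      refine ENNReal.inv_le_inv' ?_
      rw [← ENNReal.ofReal_ofNat, ← ENNReal.ofReal_pow zero_le_two]
      exact ENNReal.ofReal_le_ofReal
        (le_self_pow₀ (one_le_pow₀ one_le_two) (by omega))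
    refine (Finset.sum_le_sum fun i _ => h1 i).trans ?_
    rw [← Finset.sum_mul]
    exact mul_le_mul_left ((ENNReal.sum_le_tsum _).trans_eq ENNReal.tsum_geometric_two) _
  have haΦu : ∀ b, UnifLoc fun N => ∑ c, op n (a b c) (Φ N c) := fun b => by
    refine UnifLoc.of_lintegral_le
      (ENNReal.mul_ne_top ENNReal.ofNat_ne_top (lintegral_enorm_ne_top (hTc b)) :
        2 * ∫⁻ x, ‖T b x‖ₑ ≠ ⊤) fun N => ?_
    rw [haΦ, two_mul]
    nth_rw 1 [← lintegral_enorm_dil (T b) N]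
    rw [← lintegral_add_left (Sm.continuous _).enorm.measurable]
    exact lintegral_mono fun x => enorm_sub_le
  obtain ⟨s, hs, K, hK⟩ := exists_bound_sum
    (J := fun c N θ => ∫ x, Φ N c x * op n (a b' c) θ x)
    (N := fun θ => ∑ J : Fin j → Fin n, lqNorm q (op n (monoI J) θ)) fun c =>
      exists_bound_op (fun I => exists_bound_of_locRegular ha hpq h hΦu haΦu I c) (ha b' c)
  refine eq_zero_of_critical_bound hn hj hpq.symm.lt hqj (hTc b') hs (K := K) fun θ hθ => ?_
  have hθc := hasCompactSupport_of_subset hθ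
  have hInt : ∀ f : Sm n, Integrable fun x => f x * θ x := fun f =>
    ((Sm.continuous f).mul (Sm.continuous θ)).integrable_of_hasCompactSupport hθc.mul_left
  have hlim : Tendsto (fun N => ‖(∫ x, dil N (T b') x * θ x) - ∫ x, T b' x * θ x‖ₑ) atTop
      (𝓝 ‖w b' * θ 0 - ∫ x, T b' x * θ x‖ₑ) := by
    rw [← hTi b']
    exact ((tendsto_integral_dil_mul (hTc b') hθc).sub_const _).enorm
  refine le_of_tendsto' hlim fun N => ?_
  refine le_of_eq_of_le ?_ (hK N θ hθ)
  rw [← integral_sub (hInt _) (hInt _)]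
  have h1 : ∀ x, dil N (T b') x * θ x - T b' x * θ x
      = ∑ c, op n (a b' c) (Φ N c) x * θ x := fun x => by
    rw [← sub_mul, ← Sm.sub_apply, ← haΦ, Sm.sum_apply, Finset.sum_mul]
  simp only [h1]
  rw [integral_finsetSum _ fun c _ => hInt _, Finset.sum_congr rfl fun c _ =>
    integral_op_mul (ha b' c) hθc, ← Finset.mul_sum, enorm_mul, enorm_pow, enorm_neg, enorm_one,
    one_pow, one_mul]

end

/-- Theorem 1.3(1): for `1 ≤ j ≤ min{k, n-1}`, the a.e.
`t^{j, n/(n-j)}`-regularity of `D^{k-j} u` for all `u ∈ BV^𝒜_loc` is equivalent to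
`𝒜` being elliptic and canceling. -/
theorem statement3 (n k j : ℕ) {V W : Type*}
    [NormedAddCommGroup V] [InnerProductSpace ℝ V] [FiniteDimensional ℝ V]
    [NormedAddCommGroup W] [InnerProductSpace ℝ W] [FiniteDimensional ℝ W]
    (A : CoeffOp n k V W) (hA : IsSymmetricOp n k A)
    (hj1 : 1 ≤ j) (hjk : j ≤ k) (hjn : j < n) :
    (∀ u : Euc n → V, MemBVAloc n k A u →
        ∃ v : (Fin (k - j) → Fin n) → Euc n → V, IsWeakDerivFamily n (k - j) u v ∧
          ∀ᵐ x ∂(volume : Measure (Euc n)), ∀ I,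
            MemT n j ((n : ℝ) / ((n : ℝ) - (j : ℝ))) (v I) x) ↔
      (IsElliptic n k A ∧ IsCanceling n k A) := by
  refine ⟨fun h => ?_, fun h u hu => exists_weakDeriv_memT hj1 hjk hjn h.1 h.2 hu⟩
  have hj : (0 : ℝ) < j := by exact_mod_cast hj1
  have hn : (j : ℝ) < n := by exact_mod_cast hjn
  have hp : 1 < (n : ℝ) / ((n : ℝ) - (j : ℝ)) := by
    rw [one_lt_div (sub_pos.2 hn)]
    linarith
  have hpq : ((n : ℝ) / ((n : ℝ) - (j : ℝ))).HolderConjugate ((n : ℝ) / j) := by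
    rw [Real.holderConjugate_iff, inv_div, inv_div, ← add_div, sub_add_cancel]
    exact ⟨hp, div_self (hj.trans hn).ne'⟩
  have hreg := locRegular_of_forall hp.le h
  exact ⟨(ell_symbolMatrix_iff A).1 (ell_of_locRegular (symbolMatrix_homog A) hpq hreg),
    (canc_symbolMatrix_iff A).1 (canc_of_locRegular (by omega) (by omega) (by omega)
      (symbolMatrix_homog A) hpq (div_mul_cancel₀ _ hj.ne') hreg)⟩
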